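/- Let Ω ⊂ ℂ^N be a bounded strongly pseudoconvex domain with C^{2,α}-smooth boundary, α ∈ (0,1]. There exist constants 0 < c < C depending only on Ω such that for every complex geodesic φ : Δ → Ω and all distinct points z, w ∈ φ(Δ): c·d_e(φ(Δ)) ≤ ‖(z−w)_z‖/‖z−w‖ + δ_Ω(z)^{1/2} + ‖z−w‖ ≤ C·d_e(φ(Δ)). -/

import Mathlib

open Metric Set Filter Topology MeasureTheory

noncomputable section

namespace InvDist

/-- Complex Euclidean `N`-space. -/
abbrev E (N : ℕ) := EuclideanSpace ℂ (Fin N)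

variable {N : ℕ}

/-- The paper's Hermitian product `⟨a,b⟩ = ∑ a_j * conj (b_j)`. -/
def herm (a b : E N) : ℂ := ∑ j, a j * (starRingEnd ℂ) (b j)

/-- Euclidean distance to the boundary of `Ω`. -/
def bdist (Ω : Set (E N)) (x : E N) : ℝ := Metric.infDist x (frontier Ω)

/-- `π` selects, for each point of `Ω`, a closest point on the boundary. -/
def IsClosestPointSelection (Ω : Set (E N)) (π : E N → E N) : Prop :=
  ∀ z ∈ Ω, π z ∈ frontier Ω ∧ dist z (π z) = bdist Ω z

/-- `‖v_z‖`: modulus of the complex normal component of `v` with respect to the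
closest boundary point `π z`; the outer unit normal at `π z` is `(π z - z)/‖π z - z‖`. -/
def ncomp (Ω : Set (E N)) (π : E N → E N) (z v : E N) : ℝ :=
  ‖herm v (π z - z)‖ / bdist Ω z

/-- `‖v_z^ℝ‖`: modulus of the real normal component of `v` at `π z`. -/
def ncompR (Ω : Set (E N)) (π : E N → E N) (z v : E N) : ℝ :=
  |(herm v (π z - z)).re| / bdist Ω z

/-- The quantity `A_Ω(z,w)`. -/
def Afun (Ω : Set (E N)) (π : E N → E N) (z w : E N) : ℝ :=
  (ncomp Ω π z (z - w) + ‖z - w‖ ^ 2 + ‖z - w‖ * Real.sqrt (bdist Ω z)) /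
    (Real.sqrt (bdist Ω z) * Real.sqrt (bdist Ω w))

/-- `h_Ω(z,w) = ‖(z-w)_z‖ + ‖z-w‖ δ_Ω(z)^{1/2}`. -/
def hfun (Ω : Set (E N)) (π : E N → E N) (z w : E N) : ℝ :=
  ncomp Ω π z (z - w) + ‖z - w‖ * Real.sqrt (bdist Ω z)

/-- real analogue of `h_Ω`. -/
def hfunR (Ω : Set (E N)) (π : E N → E N) (z w : E N) : ℝ :=
  ncompR Ω π z (z - w) + ‖z - w‖ * Real.sqrt (bdist Ω z)

/-- inverse hyperbolic tangent -/
def artanh (x : ℝ) : ℝ := Real.log ((1 + x) / (1 - x)) / 2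

/-- The Lempert function of `Ω`. -/
def lempert (Ω : Set (E N)) (z w : E N) : ℝ :=
  artanh (sInf { r : ℝ | ∃ φ : ℂ → E N, DifferentiableOn ℂ φ (ball 0 1) ∧
    MapsTo φ (ball (0:ℂ) 1) Ω ∧ φ 0 = z ∧ ∃ a ∈ ball (0:ℂ) 1, φ a = w ∧ r = ‖a‖ })

/-- The Carathéodory distance of `Ω`. -/
def caratheodory (Ω : Set (E N)) (z w : E N) : ℝ :=
  artanh (sSup { r : ℝ | ∃ f : E N → ℂ, DifferentiableOn ℂ f Ω ∧
    MapsTo f Ω (ball (0:ℂ) 1) ∧ f z = 0 ∧ r = ‖f w‖ })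

/-- The Kobayashi distance: the largest pseudodistance not exceeding the Lempert
function, given as an infimum over chains. -/
def kobayashi (Ω : Set (E N)) (z w : E N) : ℝ :=
  sInf { r : ℝ | ∃ (n : ℕ) (p : Fin (n + 1) → E N), p 0 = z ∧ p (Fin.last n) = w ∧
    (∀ i, p i ∈ Ω) ∧ r = ∑ i : Fin n, lempert Ω (p i.castSucc) (p i.succ) }

/-- The Poincaré distance on the unit disc. -/
def poincare (ζ ξ : ℂ) : ℝ := artanh ‖(ζ - ξ) / (1 - (starRingEnd ℂ) ζ * ξ)‖

/-- A complex geodesic of `Ω`. -/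
def IsComplexGeodesic (Ω : Set (E N)) (φ : ℂ → E N) : Prop :=
  DifferentiableOn ℂ φ (ball 0 1) ∧ MapsTo φ (ball (0:ℂ) 1) Ω ∧
    ∀ ζ ∈ ball (0:ℂ) 1, ∀ ξ ∈ ball (0:ℂ) 1, kobayashi Ω (φ ζ) (φ ξ) = poincare ζ ξ

/-- `ρ` is `C^k` on `U` with `α`-Hölder `k`-th derivative. -/
def IsCkHolderOn (k : ℕ) (α : ℝ) (ρ : E N → ℝ) (U : Set (E N)) : Prop :=
  ContDiffOn ℝ k ρ U ∧ ∃ M : ℝ, ∀ x ∈ U, ∀ y ∈ U,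
    ‖iteratedFDeriv ℝ k ρ x - iteratedFDeriv ℝ k ρ y‖ ≤ M * ‖x - y‖ ^ α

/-- The Levi form of `ρ` at `p` evaluated at `v`. -/
def levi (ρ : E N → ℝ) (p v : E N) : ℝ :=
  (iteratedFDeriv ℝ 2 ρ p ![v, v] +
    iteratedFDeriv ℝ 2 ρ p ![(Complex.I : ℂ) • v, (Complex.I : ℂ) • v]) / 4

/-- Bounded strongly pseudoconvex domain with `C^{k,α}`-smooth boundary. -/
def IsStronglyPseudoconvexDomain (k : ℕ) (α : ℝ) (Ω : Set (E N)) : Prop :=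
  IsOpen Ω ∧ IsConnected Ω ∧ Bornology.IsBounded Ω ∧
  ∃ (U : Set (E N)) (ρ : E N → ℝ), IsOpen U ∧ closure Ω ⊆ U ∧
    IsCkHolderOn k α ρ U ∧ Ω = {x ∈ U | ρ x < 0} ∧
    (∀ p ∈ frontier Ω, fderiv ℝ ρ p ≠ 0) ∧
    ∀ p ∈ frontier Ω, ∀ v : E N, v ≠ 0 → fderiv ℝ ρ p v = 0 →
      fderiv ℝ ρ p ((Complex.I : ℂ) • v) = 0 → 0 < levi ρ p v

/-- `η` is the outer unit normal of `Ω` at the boundary point `p`. -/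
def IsOuterUnitNormalAt (Ω : Set (E N)) (p η : E N) : Prop :=
  ‖η‖ = 1 ∧ p ∈ frontier Ω ∧ ∃ ε > 0, ∀ t : ℝ, 0 < t → t < ε →
    p - t • η ∈ Ω ∧ bdist Ω (p - t • η) = t

open Classical in
/-- signed boundary distance -/
def signedDist (Ω : Set (E N)) (x : E N) : ℝ :=
  if x ∈ closure Ω then -(bdist Ω x) else bdist Ω x

/-- Hessian quadratic form of the signed boundary distance. -/
def hessSD (Ω : Set (E N)) (p v : E N) : ℝ :=
  iteratedFDeriv ℝ 2 (signedDist Ω) p ![v, v]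

/-- strict linear convexity at `p` (with outer unit normal `η`). -/
def StrictlyLinearlyConvexAt (Ω : Set (E N)) (p η : E N) : Prop :=
  ∀ v : E N, v ≠ 0 → herm v η = 0 → 0 < hessSD Ω p v

/-- strong convexity at `p` (with outer unit normal `η`). -/
def StronglyConvexAt (Ω : Set (E N)) (p η : E N) : Prop :=
  ∀ v : E N, v ≠ 0 → (herm v η).re = 0 → 0 < hessSD Ω p v

/-- `p` is a `C^k`-smooth boundary point of `Ω`. -/
def IsCkBoundaryPoint (k : ℕ) (Ω : Set (E N)) (p : E N) : Prop :=
  p ∈ frontier Ω ∧ ∃ (U : Set (E N)) (ρ : E N → ℝ), IsOpen U ∧ p ∈ U ∧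
    ContDiffOn ℝ k ρ U ∧ (∀ x ∈ U, (x ∈ Ω ↔ ρ x < 0)) ∧
    ∀ x ∈ U ∩ frontier Ω, fderiv ℝ ρ x ≠ 0

/-- bounded domain with `C^k`-smooth boundary. -/
def IsCkDomain (k : ℕ) (Ω : Set (E N)) : Prop :=
  IsOpen Ω ∧ IsConnected Ω ∧ Bornology.IsBounded Ω ∧
    ∀ p ∈ frontier Ω, IsCkBoundaryPoint k Ω p

/-- bounded domain with `C^{1,1}`-smooth boundary. -/
def IsC11Domain (Ω : Set (E N)) : Prop :=
  IsOpen Ω ∧ IsConnected Ω ∧ Bornology.IsBounded Ω ∧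
  ∀ p ∈ frontier Ω, ∃ (U : Set (E N)) (ρ : E N → ℝ), IsOpen U ∧ p ∈ U ∧
    IsCkHolderOn 1 1 ρ U ∧ (∀ x ∈ U, (x ∈ Ω ↔ ρ x < 0)) ∧
    ∀ x ∈ U ∩ frontier Ω, fderiv ℝ ρ x ≠ 0

/-- `p` is a `C^{2,α}`-smooth strongly pseudoconvex boundary point of `Ω`. -/
def IsSPSCBoundaryPoint (α : ℝ) (Ω : Set (E N)) (p : E N) : Prop :=
  p ∈ frontier Ω ∧ ∃ (U : Set (E N)) (ρ : E N → ℝ), IsOpen U ∧ p ∈ U ∧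
    IsCkHolderOn 2 α ρ U ∧ (∀ x ∈ U, (x ∈ Ω ↔ ρ x < 0)) ∧
    (∀ x ∈ U ∩ frontier Ω, fderiv ℝ ρ x ≠ 0) ∧
    ∀ x ∈ U ∩ frontier Ω, ∀ v : E N, v ≠ 0 → fderiv ℝ ρ x v = 0 →
      fderiv ℝ ρ x ((Complex.I : ℂ) • v) = 0 → 0 < levi ρ x v

instance (N : ℕ) : MeasurableSpace (E N) := borel _

instance (N : ℕ) : BorelSpace (E N) := ⟨rfl⟩

/-- Lebesgue measure on `E N`. -/
def vol (N : ℕ) : Measure (E N) :=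
  letI : InnerProductSpace ℝ (E N) := InnerProductSpace.rclikeToReal ℂ (E N)
  letI : MeasureSpace (E N) := measureSpaceOfInnerProductSpace
  volume

/-- Bergman kernel on the diagonal. -/
def bergmanKernelDiag (Ω : Set (E N)) (z : E N) : ℝ :=
  sSup { r : ℝ | ∃ f : E N → ℂ, DifferentiableOn ℂ f Ω ∧
    (∫ x in Ω, ‖f x‖ ^ 2 ∂(vol N)) ≤ 1 ∧ r = ‖f z‖ ^ 2 }

/-- `M_Ω(z;v)`. -/
def bergmanM (Ω : Set (E N)) (z v : E N) : ℝ :=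
  sSup { r : ℝ | ∃ f : E N → ℂ, DifferentiableOn ℂ f Ω ∧
    (∫ x in Ω, ‖f x‖ ^ 2 ∂(vol N)) ≤ 1 ∧ f z = 0 ∧ r = ‖fderiv ℂ f z v‖ }

/-- The Bergman metric. -/
def bergmanMetric (Ω : Set (E N)) (z v : E N) : ℝ :=
  bergmanM Ω z v / Real.sqrt (bergmanKernelDiag Ω z)

/-- The Bergman distance: inner distance of the Bergman metric. -/
def bergmanDist (Ω : Set (E N)) (z w : E N) : ℝ :=
  sInf { r : ℝ | ∃ γ : ℝ → E N, ContDiffOn ℝ 1 γ (Icc 0 1) ∧ γ 0 = z ∧ γ 1 = w ∧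
    (∀ t ∈ Icc (0:ℝ) 1, γ t ∈ Ω) ∧
    r = ∫ t in (0:ℝ)..(1:ℝ), bergmanMetric Ω (γ t) (derivWithin γ (Icc 0 1) t) }

open Complex (I norm_real re_ofReal_mul normSq_eq_norm_sq sub_re add_re re_le_norm normSq_apply
  neg_re abs_re_le_norm ofReal_re mul_conj ofReal_sub ofReal_mul coe_smul norm_exp norm_I sq_norm
  zero_re ofReal_one conj_conj continuous_re continuous_ofReal)
open Real (norm_of_nonneg cos rpow_le_rpow rpow_one zero_rpow rpow_natCast sqrt_eq_rpow sq_sqrt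
  rpow_mul mul_rpow sqrt_mul sqrt_sq rpow_add_one norm_eq_abs sqrt_le_sqrt rpow_sub_one sqrt_pos
  rpow_zero sqrt_nonneg log rpow_le_rpow_of_exponent_le rpow_add log_mul)
open ContinuousLinearMap (le_opNorm opNorm_le_bound)

local notation "𝔻" => ball (0:ℂ) 1
local notation "conj" => starRingEnd ℂ

section Analysis

variable {V : Type*} [NormedAddCommGroup V] [NormedSpace ℂ V]

theorem norm_sub_le_of_deriv_rpow_bound {W : Type*} [NormedAddCommGroup W] [NormedSpace ℝ W]
    {G G' : ℝ → W} {K β s0 s1 : ℝ} (hβ : β ≠ 0)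
    (h01 : s0 ≤ s1) (h1 : s1 < 1 ∨ (s1 ≤ 1 ∧ 0 < β)) (hc : ContinuousOn G (Icc s0 s1))
    (hd : ∀ s ∈ Ico s0 s1, HasDerivAt G (G' s) s)
    (hb : ∀ s ∈ Ico s0 s1, ‖G' s‖ ≤ K * (1 - s) ^ (β - 1)) :
    ‖G s1 - G s0‖ ≤ K / β * ((1 - s0) ^ β - (1 - s1) ^ β) := by
  have hs1 : s1 ≤ 1 := by rcases h1 with h | h <;> [exact h.le; exact h.1]
  have key := image_norm_le_of_norm_deriv_right_le_deriv_boundary' (f := fun s => G s - G s0)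
    (f' := G') (a := s0) (b := s1) (B := fun s => K / β * ((1 - s0) ^ β - (1 - s) ^ β))
    (B' := fun s => K * (1 - s) ^ (β - 1)) (hc.sub continuousOn_const)
    (fun s hs => ((hd s hs).sub_const _).hasDerivWithinAt) (by simp) ?_ ?_ hb
  · exact key ⟨h01, le_rfl⟩
  · refine ContinuousOn.mul continuousOn_const (continuousOn_const.sub ?_)
    refine ContinuousOn.rpow_const (by fun_prop) ?_
    intro s hs
    rcases h1 with h | h
    · left; have := hs.2; linarith
    · right; exact h.2.le
  · intro s hs
    have h2 : (0:ℝ) < 1 - s := by have := hs.2; linarith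
    have h3 : HasDerivAt (fun s : ℝ => 1 - s) (-1) s := by
      simpa using (hasDerivAt_id s).const_sub 1
    have := ((h3.rpow_const (p := β) (Or.inl h2.ne')).const_sub ((1 - s0) ^ β)).const_mul (K / β)
    refine (this.congr_deriv ?_).hasDerivWithinAt
    field_simp

theorem norm_lt_one_of_mem_ball {a : ℂ} (ha : a ∈ 𝔻) : ‖a‖ < 1 := by simpa using ha

theorem smul_mem_ball {a : ℂ} {s : ℝ} (hs : 0 ≤ s) (h : s * ‖a‖ < 1) :
    ((s : ℂ) * a) ∈ 𝔻 := by
  simpa [abs_of_nonneg hs] using h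

theorem hasDerivAt_ray {F : ℂ → V} (hF : DifferentiableOn ℂ F 𝔻) {a : ℂ} {s : ℝ}
    (hs : ((s : ℂ) * a) ∈ 𝔻) :
    HasDerivAt (fun s : ℝ => F ((s : ℂ) * a)) (a • deriv F ((s : ℂ) * a)) s := by
  have h1 : HasDerivAt F (deriv F ((s : ℂ) * a)) ((s : ℂ) * a) :=
    (hF.differentiableAt (isOpen_ball.mem_nhds hs)).hasDerivAt
  have h2 : HasDerivAt (fun s : ℝ => (s : ℂ) * a) a s := by
    simpa using (Complex.ofRealCLM.hasDerivAt (x := s)).mul_const a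
  exact h1.scomp s h2

theorem norm_sub_zero_le_of_deriv_bound {F : ℂ → V} (hF : DifferentiableOn ℂ F 𝔻)
    {K γ : ℝ} (hγ : 1 < γ) (hK : 0 ≤ K)
    (hb : ∀ a ∈ 𝔻, ‖deriv F a‖ ≤ K * (1 - ‖a‖) ^ (-γ)) {a : ℂ}
    (ha : a ∈ 𝔻) :
    ‖F a - F 0‖ ≤ K / (γ - 1) * (1 - ‖a‖) ^ (1 - γ) := by
  have ha1 := norm_lt_one_of_mem_ball ha
  by_cases h0 : a = 0
  · subst h0
    simp only [sub_self, norm_zero]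
    have : 0 < γ - 1 := by linarith
    positivity
  obtain ⟨u, hu1, hua⟩ : ∃ u : ℂ, ‖u‖ = 1 ∧ ((‖a‖ : ℝ) : ℂ) * u = a := by
    have : ((‖a‖ : ℝ) : ℂ) ≠ 0 := by exact_mod_cast norm_ne_zero_iff.mpr h0
    refine ⟨a / ‖a‖, ?_, ?_⟩
    · simp [h0]
    · field_simp
  have hmem : ∀ s ∈ Icc (0:ℝ) ‖a‖, ((s : ℂ) * u) ∈ 𝔻 := by
    intro s hs
    refine smul_mem_ball hs.1 ?_
    rw [hu1]; linarith [hs.2]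
  have := norm_sub_le_of_deriv_rpow_bound (G := fun s : ℝ => F ((s : ℂ) * u))
    (G' := fun s : ℝ => u • deriv F ((s : ℂ) * u)) (K := K) (β := 1 - γ) (s0 := 0) (s1 := ‖a‖)
    (by linarith) (norm_nonneg _) (Or.inl ha1) ?_ ?_ ?_
  · simp only [hua] at this
    simp only [Complex.ofReal_zero, zero_mul, sub_zero, Real.one_rpow] at this
    refine this.trans ?_
    have e : K / (1 - γ) * (1 - (1 - ‖a‖) ^ (1 - γ)) =
        K / (γ - 1) * (1 - ‖a‖) ^ (1 - γ) - K / (γ - 1) := by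
      have : 1 - γ ≠ 0 := by linarith
      have : γ - 1 ≠ 0 := by linarith
      rw [show 1 - γ = -(γ - 1) by ring, div_neg]; ring
    rw [e]
    have : 0 ≤ K / (γ - 1) := div_nonneg hK (by linarith)
    linarith
  · intro s hs
    exact (hasDerivAt_ray hF (hmem s hs)).continuousAt.continuousWithinAt
  · intro s hs
    exact hasDerivAt_ray hF (hmem s ⟨hs.1, hs.2.le⟩)
  · intro s hs
    rw [norm_smul, hu1, one_mul]
    refine (hb _ (hmem s ⟨hs.1, hs.2.le⟩)).trans (le_of_eq ?_)
    rw [norm_mul, hu1, mul_one, norm_real, norm_of_nonneg hs.1]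
    ring_nf

/-- Hardy–Littlewood: growth of the derivative gives Hölder continuity. -/
theorem norm_sub_le_of_hardy_littlewood {F : ℂ → V} (hF : DifferentiableOn ℂ F 𝔻)
    {K β : ℝ} (hβ : 0 < β) (hβ1 : β ≤ 1) (hK : 0 ≤ K)
    (hb : ∀ a ∈ 𝔻, ‖deriv F a‖ ≤ K * (1 - ‖a‖) ^ (β - 1)) {a b : ℂ}
    (ha : a ∈ 𝔻) (hb' : b ∈ 𝔻) :
    ‖F a - F b‖ ≤ 4 / β * K * ‖a - b‖ ^ β := by
  have ha1 := norm_lt_one_of_mem_ball ha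
  have hb1 := norm_lt_one_of_mem_ball hb'
  rcases eq_or_ne a b with rfl | hab
  · simp [zero_rpow hβ.ne']
  set h := ‖a - b‖ / 2 with hh
  have hpos : 0 < h := by have := norm_pos_iff.mpr (sub_ne_zero.mpr hab); positivity
  have hle : h ≤ 1 := by
    have := norm_sub_le a b; rw [hh]; linarith
  have hab2 : ‖a - b‖ = 2 * h := by rw [hh]; ring
  have ray : ∀ c : ℂ, ‖c‖ < 1 → ‖F c - F (((1 - h : ℝ) : ℂ) * c)‖ ≤ K / β * h ^ β := by
    intro c hc
    have hmem : ∀ s ∈ Icc (1 - h) 1, ((s : ℂ) * c) ∈ 𝔻 := by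
      intro s hs
      refine smul_mem_ball (by linarith [hs.1]) ?_
      have := hs.1; have := hs.2; nlinarith [norm_nonneg c]
    have := norm_sub_le_of_deriv_rpow_bound (G := fun s : ℝ => F ((s : ℂ) * c))
      (G' := fun s : ℝ => c • deriv F ((s : ℂ) * c)) (K := K) (β := β) (s0 := 1 - h) (s1 := 1)
      hβ.ne' (by linarith) (Or.inr ⟨le_rfl, hβ⟩) ?_ ?_ ?_
    · simpa [zero_rpow hβ.ne'] using this
    · intro s hs
      exact (hasDerivAt_ray hF (hmem s hs)).continuousAt.continuousWithinAt
    · intro s hs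
      exact hasDerivAt_ray hF (hmem s ⟨hs.1, hs.2.le⟩)
    · intro s hs
      have hs0 : 0 ≤ s := by linarith [hs.1]
      rw [norm_smul]
      have h1 := hb _ (hmem s ⟨hs.1, hs.2.le⟩)
      have h2 : (1 - ‖(s : ℂ) * c‖) ^ (β - 1) ≤ (1 - s) ^ (β - 1) := by
        refine Real.rpow_le_rpow_of_nonpos (by linarith [hs.2]) ?_ (by linarith)
        rw [norm_mul, norm_real, norm_of_nonneg hs0]
        nlinarith
      calc ‖c‖ * ‖deriv F (s * c)‖ ≤ 1 * ‖deriv F (s * c)‖ := by gcongr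
        _ ≤ K * (1 - ‖(s : ℂ) * c‖) ^ (β - 1) := by rw [one_mul]; exact h1
        _ ≤ _ := by gcongr
  have hball : ∀ c : ℂ, ‖c‖ ≤ 1 - h → ‖deriv F c‖ ≤ K * h ^ (β - 1) := by
    intro c hc
    refine (hb c (by simpa using by linarith)).trans ?_
    have : (1 - ‖c‖) ^ (β - 1) ≤ h ^ (β - 1) :=
      Real.rpow_le_rpow_of_nonpos hpos (by linarith) (by linarith)
    gcongr
  have sc : ∀ c : ℂ, ‖c‖ < 1 → ‖((1 - h : ℝ) : ℂ) * c‖ ≤ 1 - h := by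
    intro c hc
    rw [norm_mul, norm_real, norm_of_nonneg (by linarith)]
    nlinarith
  have mid : ‖F (((1 - h : ℝ) : ℂ) * a) - F (((1 - h : ℝ) : ℂ) * b)‖ ≤ 2 * K * h ^ β := by
    have := (convex_closedBall (0:ℂ) (1 - h)).norm_image_sub_le_of_norm_deriv_le
      (𝕜 := ℂ) (f := F) (C := K * h ^ (β - 1)) (x := ((1 - h : ℝ) : ℂ) * b)
      (y := ((1 - h : ℝ) : ℂ) * a) ?_ ?_ ?_ ?_
    · refine this.trans ?_
      rw [← mul_sub, norm_mul, norm_real, norm_of_nonneg (by linarith), hab2]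
      have e : h ^ β = h ^ (β - 1) * h := by
        rw [← rpow_add_one hpos.ne']; congr 1; ring
      rw [e]
      have : 0 ≤ K * h ^ (β - 1) * h := by positivity
      nlinarith
    · intro x hx
      refine hF.differentiableAt (isOpen_ball.mem_nhds ?_)
      simp only [mem_closedBall, dist_zero_right] at hx
      simp only [mem_ball, dist_zero_right]; linarith
    · intro x hx; exact hball x (by simpa using hx)
    · simpa using sc b hb1
    · simpa using sc a ha1
  have e2 : h ^ β ≤ ‖a - b‖ ^ β := by
    apply rpow_le_rpow hpos.le _ hβ.le; linarith
  have r1 := ray a ha1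
  have r2 := ray b hb1
  have tri : ‖F a - F b‖ ≤ ‖F a - F (((1 - h : ℝ) : ℂ) * a)‖ +
      ‖F (((1 - h : ℝ) : ℂ) * a) - F (((1 - h : ℝ) : ℂ) * b)‖ +
      ‖F b - F (((1 - h : ℝ) : ℂ) * b)‖ := by
    rw [norm_sub_rev (F b)]
    have := norm_add₃_le (a := F a - F (((1 - h : ℝ) : ℂ) * a))
      (b := F (((1 - h : ℝ) : ℂ) * a) - F (((1 - h : ℝ) : ℂ) * b))
      (c := F (((1 - h : ℝ) : ℂ) * b) - F b)
    simpa using this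
  have hib : K ≤ K / β := by rw [le_div_iff₀ hβ]; nlinarith
  calc ‖F a - F b‖ ≤ 4 / β * K * h ^ β := by
        have : 0 ≤ h ^ β := by positivity
        have e : 4 / β * K = 4 * (K / β) := by ring
        rw [e]; nlinarith
    _ ≤ _ := by gcongr

/-- Cayley transform of a function with positive real part. -/
theorem exists_cayley {g : ℂ → ℂ} {c : ℂ} {R : ℝ} (hR : 0 < R)
    (hg : DifferentiableOn ℂ g (ball c R)) (hpos : ∀ x ∈ ball c R, 0 < (g x).re) {x : ℂ}
    (hx : x ∈ ball c R) :
    ‖g x - g c‖ * R ≤ dist x c * ‖g x + conj (g c)‖ := by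
  have hc : 0 < (g c).re := hpos c (mem_ball_self hR)
  have hne : ∀ y ∈ ball c R, g y + conj (g c) ≠ 0 := by
    intro y hy h
    have := congrArg Complex.re h
    simp at this
    have := hpos y hy
    linarith
  have key := Complex.dist_le_div_mul_dist_of_mapsTo_ball (R₂ := 1)
    (f := fun y => (g y - g c) / (g y + conj (g c)))
    (c := c) (R₁ := R) ?_ ?_ hx
  · simp only [sub_self, zero_div, dist_zero_right, norm_div] at key
    have hp : 0 < ‖g x + conj (g c)‖ := norm_pos_iff.mpr (hne x hx)
    rw [div_le_iff₀ hp] at key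
    calc _ ≤ (1 / R * dist x c * ‖g x + conj (g c)‖) * R := by gcongr
      _ = _ := by field_simp
  · exact (hg.sub_const _).div (hg.add_const _) hne
  · intro y hy
    simp only [sub_self, zero_div, mem_closedBall, dist_zero_right, norm_div]
    rw [div_le_one (norm_pos_iff.mpr (hne y hy))]
    have hy' := hpos y hy
    rw [← sq_le_sq₀ (norm_nonneg _) (norm_nonneg _), ← normSq_eq_norm_sq,
      ← normSq_eq_norm_sq, normSq_apply, normSq_apply]
    simp
    nlinarith

/-- Borel–Carathéodory. -/
theorem norm_sub_le_of_re_pos {g : ℂ → ℂ} {c : ℂ} {R : ℝ} (hR : 0 < R)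
    (hg : DifferentiableOn ℂ g (ball c R)) (hpos : ∀ x ∈ ball c R, 0 < (g x).re) {x : ℂ}
    (hx : x ∈ ball c R) :
    ‖g x - g c‖ ≤ 2 * (g c).re * dist x c / (R - dist x c) := by
  have h := exists_cayley hR hg hpos hx
  have hd : dist x c < R := hx
  have hc : 0 < (g c).re := hpos c (mem_ball_self hR)
  rw [le_div_iff₀ (by linarith)]
  have h2 : ‖g x + conj (g c)‖ ≤ ‖g x - g c‖ + 2 * (g c).re := by
    have e : g x + conj (g c) = (g x - g c) + ((2 * (g c).re : ℝ) : ℂ) := by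
      rw [← Complex.add_conj]; ring
    rw [e]
    refine (norm_add_le _ _).trans ?_
    rw [norm_real, norm_of_nonneg (by linarith)]
  have := mul_le_mul_of_nonneg_left h2 (dist_nonneg (x := x) (y := c))
  nlinarith

theorem re_le_of_harnack {g : ℂ → ℂ} {c : ℂ} {R : ℝ} (hR : 0 < R)
    (hg : DifferentiableOn ℂ g (ball c R)) (hpos : ∀ x ∈ ball c R, 0 < (g x).re) {x : ℂ}
    (hx : x ∈ ball c R) :
    (g c).re * (R - dist x c) ≤ (g x).re * (R + dist x c) := by
  have h := exists_cayley hR hg hpos hx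
  have hd : dist x c < R := hx
  have hd0 : 0 ≤ dist x c := dist_nonneg
  have hc : 0 < (g c).re := hpos c (mem_ball_self hR)
  have hx' : 0 < (g x).re := hpos x hx
  set t := dist x c
  have h2 : (‖g x - g c‖ * R) ^ 2 ≤ (t * ‖g x + conj (g c)‖) ^ 2 := by gcongr
  rw [mul_pow, mul_pow, ← normSq_eq_norm_sq,
      ← normSq_eq_norm_sq, normSq_apply, normSq_apply] at h2
  simp at h2
  set p := (g x).re
  set q := (g c).re
  set y := (g x).im - (g c).im
  have h2' : (p - q) ^ 2 * R ^ 2 + y ^ 2 * (R ^ 2 - t ^ 2) ≤ t ^ 2 * (p + q) ^ 2 := by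
    have : (g x).im + -(g c).im = y := by ring
    rw [this] at h2
    nlinarith
  have h3 : (p - q) ^ 2 * R ^ 2 ≤ t ^ 2 * (p + q) ^ 2 := by
    have : 0 ≤ y ^ 2 * (R ^ 2 - t ^ 2) := by
      apply mul_nonneg (sq_nonneg _); nlinarith
    linarith
  by_contra hcon
  push Not at hcon
  have h4 : t * (p + q) < (q - p) * R := by nlinarith
  have h5 : 0 ≤ t * (p + q) := by positivity
  nlinarith

theorem norm_deriv_le_of_re_pos {g : ℂ → ℂ} {c : ℂ} {R : ℝ} (hR : 0 < R)
    (hg : DifferentiableOn ℂ g (ball c R)) (hpos : ∀ x ∈ ball c R, 0 < (g x).re) :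
    ‖deriv g c‖ ≤ 8 * (g c).re / R := by
  have hc : 0 < (g c).re := hpos c (mem_ball_self hR)
  have key := Complex.norm_deriv_le_div_of_mapsTo_ball (f := g) (c := c) (R₁ := R / 2)
    (R₂ := 4 * (g c).re) ?_ ?_ (by positivity)
  · refine key.trans (le_of_eq ?_); field_simp; norm_num
  · exact hg.mono (ball_subset_ball (by linarith))
  · intro x hx
    have hx' : dist x c < R / 2 := hx
    have := norm_sub_le_of_re_pos hR hg hpos (x := x) (by simp; linarith)
    simp only [mem_closedBall, dist_eq_norm]
    refine this.trans ?_
    rw [div_le_iff₀ (by linarith)]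
    nlinarith

end Analysis

section Analysis

theorem norm_deriv_le_of_abs_re_le {G : ℂ → ℂ} {c : ℂ} {R m : ℝ} (hR : 0 < R)
    (hG : DifferentiableOn ℂ G (ball c R)) (hb : ∀ x ∈ ball c R, |(G x).re| ≤ m) :
    ‖deriv G c‖ ≤ 16 * m / R := by
  have hm : 0 ≤ m := (abs_nonneg _).trans (hb c (mem_ball_self hR))
  refine le_of_forall_pos_le_add fun δ hδ => ?_
  have key := norm_deriv_le_of_re_pos (g := fun x => G x + ((m + δ * R / 8 : ℝ) : ℂ)) (c := c) hR
    (hG.add_const _) ?_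
  · rw [deriv_add_const] at key
    refine key.trans ?_
    have h1 := (abs_le.mp (hb c (mem_ball_self hR))).2
    simp only [add_re, ofReal_re]
    rw [div_le_iff₀ hR]
    have : (16 * m / R + δ) * R = 16 * m + δ * R := by field_simp
    rw [this]; linarith
  · intro x hx
    have h1 := (abs_le.mp (hb x hx)).1
    simp only [add_re, ofReal_re]
    have : 0 < δ * R := by positivity
    linarith

theorem re_one_sub_pos {a : ℂ} (ha : a ∈ 𝔻) : 0 < (1 - a).re := by
  have := norm_lt_one_of_mem_ball ha
  have := re_le_norm a
  simp; linarith

theorem cpow_re_eq (w : ℂ) (γ : ℝ) :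
    (w ^ (γ : ℂ)).re = ‖w‖ ^ γ * cos (γ * Complex.arg w) := by
  rw [Complex.cpow_ofReal_re, mul_comm (Complex.arg w)]

theorem exists_barrier {γ : ℝ} (h0 : 0 < γ) (h2 : γ < 2) (h1 : γ ≠ 1) :
    ∃ C : ℝ, 1 ≤ C ∧ ∃ Φ : ℂ → ℂ, DifferentiableOn ℂ Φ 𝔻 ∧
      ∀ a ∈ 𝔻, ‖1 - a‖ ^ γ ≤ (Φ a).re ∧ (Φ a).re ≤ C * ‖1 - a‖ ^ (min γ 1) := by
  have hdiff : DifferentiableOn ℂ (fun a : ℂ => (1 - a) ^ (γ : ℂ)) 𝔻 := by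
    intro a ha
    apply DifferentiableAt.differentiableWithinAt
    refine DifferentiableAt.cpow (by fun_prop) (by fun_prop) ?_
    left; exact re_one_sub_pos ha
  rcases lt_or_gt_of_ne h1 with hlt | hgt
  · have hc : 0 < cos (γ * (Real.pi / 2)) := by
      apply Real.cos_pos_of_mem_Ioo
      constructor <;> nlinarith [Real.pi_pos]
    refine ⟨max 1 (1 / cos (γ * (Real.pi / 2))), le_max_left _ _,
      fun a => (((1 / cos (γ * (Real.pi / 2)) : ℝ)) : ℂ) * (1 - a) ^ (γ : ℂ),
      hdiff.const_mul _, ?_⟩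
    intro a ha
    have hre := re_one_sub_pos ha
    have hne : (1 - a) ≠ 0 := by intro h; rw [h] at hre; simp at hre
    rw [re_ofReal_mul, cpow_re_eq _ _, min_eq_left hlt.le]
    have harg : |Complex.arg (1 - a)| ≤ Real.pi / 2 := Complex.abs_arg_le_pi_div_two_iff.mpr hre.le
    have hcos : cos (γ * (Real.pi / 2)) ≤ cos (γ * Complex.arg (1 - a)) := by
      rw [← Real.cos_abs (γ * Complex.arg (1 - a)), abs_mul, abs_of_pos h0]
      apply Real.cos_le_cos_of_nonneg_of_le_pi
      · positivity
      · nlinarith [Real.pi_pos]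
      · gcongr
    have hp : 0 ≤ ‖1 - a‖ ^ γ := by positivity
    constructor
    · rw [div_mul_eq_mul_div, one_mul, le_div_iff₀ hc]
      gcongr
    · calc _ ≤ 1 / cos (γ * (Real.pi / 2)) * (‖1 - a‖ ^ γ * 1) := by
            gcongr; exact Real.cos_le_one _
        _ ≤ _ := by rw [mul_one]; gcongr; exact le_max_right _ _
  · -- choose an angle `θ0 < π/2` with `γ θ0 > π/2`
    set θ0 := (Real.pi / 2) * ((1 + 1 / γ) / 2) with hθ0
    have hπ := Real.pi_pos
    have hi : 1 / γ < 1 := by rw [div_lt_one h0]; exact hgt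
    have hi0 : 0 < 1 / γ := by positivity
    have hθlt : θ0 < Real.pi / 2 := by rw [hθ0]; nlinarith
    have hθpos : 0 < θ0 := by rw [hθ0]; positivity
    have hγθ : Real.pi / 2 < γ * θ0 := by
      have : γ * θ0 = (Real.pi / 2) * ((γ + 1) / 2) := by rw [hθ0]; field_simp
      rw [this]; nlinarith
    have hγπ : γ * (Real.pi / 2) < Real.pi + Real.pi / 2 := by nlinarith
    set c := min (-cos (γ * θ0)) (-cos (γ * (Real.pi / 2))) with hcdef
    have hneg : ∀ x, Real.pi / 2 < x → x < Real.pi + Real.pi / 2 → cos x < 0 :=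
      fun x h h' => Real.cos_neg_of_pi_div_two_lt_of_lt h h'
    have hγpi : γ * (Real.pi / 2) ≤ Real.pi := by nlinarith
    have hc' : 0 < -cos (γ * θ0) := by
      have := hneg (γ * θ0) hγθ (by nlinarith); linarith
    set δ := cos θ0 with hδ
    have hδpos : 0 < δ := Real.cos_pos_of_mem_Ioo ⟨by linarith, hθlt⟩
    set B := 1 / (-cos (γ * θ0)) with hB
    have hBpos : 0 < B := by positivity
    set A := 2 * (1 + B) / δ with hA
    have hApos : 0 < A := by positivity
    refine ⟨max 1 (A + 2 * B), le_max_left _ _,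
      fun a => ((A : ℝ) : ℂ) * (1 - a) - ((B : ℝ) : ℂ) * (1 - a) ^ (γ : ℂ),
      (by fun_prop : DifferentiableOn ℂ (fun a => ((A : ℝ) : ℂ) * (1 - a)) 𝔻).sub
        (hdiff.const_mul _), ?_⟩
    intro a ha
    have hre := re_one_sub_pos ha
    have hne : (1 - a) ≠ 0 := by intro h; rw [h] at hre; simp at hre
    have hnp : 0 < ‖1 - a‖ := norm_pos_iff.mpr hne
    have hn2 : ‖1 - a‖ ≤ 2 := by
      have := norm_sub_le (1:ℂ) a; have := norm_lt_one_of_mem_ball ha; simp at *; linarith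
    have hpw : ‖1 - a‖ ^ γ ≤ 2 * ‖1 - a‖ := by
      have e : ‖1 - a‖ ^ γ = ‖1 - a‖ ^ (γ - 1) * ‖1 - a‖ := by
        rw [← rpow_add_one hnp.ne']; congr 1; ring
      rw [e]
      have : ‖1 - a‖ ^ (γ - 1) ≤ 2 := by
        calc ‖1 - a‖ ^ (γ - 1) ≤ 2 ^ (γ - 1) :=
              rpow_le_rpow hnp.le hn2 (by linarith)
          _ ≤ 2 ^ (1:ℝ) := rpow_le_rpow_of_exponent_le (by norm_num) (by linarith)
          _ = 2 := by norm_num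
      gcongr
    have hpp : 0 < ‖1 - a‖ ^ γ := by positivity
    rw [sub_re, re_ofReal_mul, re_ofReal_mul, cpow_re_eq _ _,
      min_eq_right hgt.le, rpow_one]
    have harg : |Complex.arg (1 - a)| ≤ Real.pi / 2 := Complex.abs_arg_le_pi_div_two_iff.mpr hre.le
    have hcosarg : (1 - a).re = ‖1 - a‖ * cos (Complex.arg (1 - a)) := by
      rw [Complex.norm_mul_cos_arg]
    constructor
    · rcases le_or_gt |Complex.arg (1 - a)| θ0 with hle | hgt'
      · have h3 : δ ≤ cos (Complex.arg (1 - a)) := by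
          rw [← Real.cos_abs (Complex.arg (1 - a))]
          exact Real.cos_le_cos_of_nonneg_of_le_pi (abs_nonneg _) (by linarith) hle
        have h4 : 2 * (1 + B) * ‖1 - a‖ ≤ A * (1 - a).re := by
          rw [hcosarg, hA]
          have : 2 * (1 + B) / δ * (‖1 - a‖ * cos (Complex.arg (1 - a))) =
            2 * (1 + B) * ‖1 - a‖ * (cos (Complex.arg (1 - a)) / δ) := by ring
          rw [this]
          have h5 : 1 ≤ cos (Complex.arg (1 - a)) / δ := by rw [le_div_iff₀ hδpos]; linarith
          have : 0 ≤ 2 * (1 + B) * ‖1 - a‖ := by positivity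
          nlinarith
        have h6 : B * (‖1 - a‖ ^ γ * cos (γ * Complex.arg (1 - a))) ≤ B * (‖1 - a‖ ^ γ * 1) := by
          gcongr; exact Real.cos_le_one _
        nlinarith
      · have h3 : cos (γ * Complex.arg (1 - a)) ≤ cos (γ * θ0) := by
          rw [← Real.cos_abs (γ * Complex.arg (1 - a)), abs_mul, abs_of_pos h0]
          apply Real.cos_le_cos_of_nonneg_of_le_pi
          · positivity
          · exact (mul_le_mul_of_nonneg_left harg h0.le).trans hγpi
          · gcongr
        have h4 : B * (‖1 - a‖ ^ γ * cos (γ * Complex.arg (1 - a))) ≤ - ‖1 - a‖ ^ γ := by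
          have : B * (‖1 - a‖ ^ γ * cos (γ * Complex.arg (1 - a))) ≤
              B * (‖1 - a‖ ^ γ * cos (γ * θ0)) := by gcongr
          refine this.trans (le_of_eq ?_)
          rw [hB]
          have : cos (γ * θ0) ≠ 0 := by linarith
          field_simp
        have : 0 ≤ A * (1 - a).re := by positivity
        linarith
    · have h3 : (1 - a).re ≤ ‖1 - a‖ := re_le_norm _
      have h4 : -(B * ‖1 - a‖ ^ γ) ≤ B * (‖1 - a‖ ^ γ * cos (γ * Complex.arg (1 - a))) := by
        have := Real.neg_one_le_cos (γ * Complex.arg (1 - a))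
        have : 0 ≤ B * ‖1 - a‖ ^ γ := by positivity
        nlinarith
      calc _ ≤ A * ‖1 - a‖ + B * ‖1 - a‖ ^ γ := by nlinarith
        _ ≤ (A + 2 * B) * ‖1 - a‖ := by nlinarith
        _ ≤ _ := by gcongr; exact le_max_right _ _

/-- Maximum principle for the real part with control near the unit circle. -/
theorem re_le_of_control {f : ℂ → ℂ} {η : ℝ} (hη : 0 < η)
    (hf : DifferentiableOn ℂ f (𝔻 ∩ ball 1 η))
    (hb : ∀ a ∈ 𝔻 ∩ ball 1 η, η / 2 ≤ ‖1 - a‖ → (f a).re ≤ 0)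
    (hc : ∀ ε > 0, ∃ s < 1, ∀ a ∈ 𝔻 ∩ ball 1 η, s ≤ ‖a‖ → (f a).re ≤ ε)
    {a : ℂ} (ha : a ∈ 𝔻 ∩ ball 1 η) : (f a).re ≤ 0 := by
  refine le_of_forall_pos_le_add fun ε hε => ?_
  rw [zero_add]
  obtain ⟨s, hs, H⟩ := hc ε hε
  by_cases h1 : s ≤ ‖a‖
  · exact H a ha h1
  by_cases h2 : η / 2 ≤ ‖1 - a‖
  · exact (hb a ha h2).trans hε.le
  push Not at h1 h2
  set G : Set ℂ := ball 0 s ∩ ball 1 (η / 2) with hG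
  have hsub : closure G ⊆ 𝔻 ∩ ball 1 η := by
    refine (closure_inter_subset_inter_closure _ _).trans ?_
    refine inter_subset_inter (closure_ball_subset_closedBall.trans (closedBall_subset_ball hs))
      (closure_ball_subset_closedBall.trans (closedBall_subset_ball (by linarith)))
  have key := Complex.norm_le_of_forall_mem_frontier_norm_le (f := fun x => Complex.exp (f x))
    (U := G) (C := Real.exp ε) (isBounded_ball.subset inter_subset_left) ?_ ?_ (z := a) ?_
  · rw [norm_exp] at key
    exact Real.exp_le_exp.mp key
  · refine DifferentiableOn.diffContOnCl ?_
    exact (hf.mono hsub).cexp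
  · intro x hx
    rw [norm_exp, Real.exp_le_exp]
    have hxS := hsub (frontier_subset_closure hx)
    have hxn : x ∉ G := by
      rw [(isOpen_ball.inter isOpen_ball).frontier_eq] at hx; exact hx.2
    by_cases h3 : s ≤ ‖x‖
    · exact H x hxS h3
    · refine (hb x hxS ?_).trans hε.le
      by_contra h4
      refine hxn ⟨by simpa using h3, ?_⟩
      rw [mem_ball, dist_comm, dist_eq_norm]; push Not at h4; exact h4
  · refine subset_closure ⟨by simpa using h1, ?_⟩
    rw [mem_ball, dist_comm, dist_eq_norm]; exact h2

theorem exists_reg_one {γ : ℝ} (h0 : 0 < γ) (h2 : γ < 2) (h1 : γ ≠ 1) {η : ℝ} (hη : 0 < η) :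
    ∃ C : ℝ, 0 < C ∧ ∀ (k b : ℂ → ℂ) (K : ℝ), 0 ≤ K →
      DifferentiableOn ℂ k (𝔻 ∩ ball 1 η) → DifferentiableOn ℂ b (𝔻 ∩ ball 1 η) →
      (∀ a ∈ 𝔻 ∩ ball 1 η, η / 2 ≤ ‖1 - a‖ → ‖k a‖ ≤ K ∧ ‖b a‖ ≤ K) →
      (∀ ε > 0, ∃ s < 1, ∀ a ∈ 𝔻 ∩ ball 1 η, s ≤ ‖a‖ →
        ‖k a - conj (b a)‖ ≤ K * ‖1 - a‖ ^ γ + ε) →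
      ∀ t : ℝ, 0 ≤ t → t < 1 → 1 - t < η / 4 →
        ‖deriv b t‖ ≤ C * K * (1 - t) ^ (min γ 1 - 1) := by
  obtain ⟨C0, hC0, Φ, hΦ, hΦb⟩ := exists_barrier h0 h2 h1
  set C1 := max 1 (2 * (2 / η) ^ γ) with hC1
  have hC1p : 1 ≤ C1 := le_max_left _ _
  refine ⟨64 * (C1 * C0), by positivity, ?_⟩
  intro k b K hK hk hb hKb hctrl t ht0 ht1 htη
  set m := min γ 1 with hm
  have hm0 : 0 < m := lt_min h0 one_pos
  -- any holomorphic `G` with controlled real part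
  have main : ∀ G : ℂ → ℂ, DifferentiableOn ℂ G (𝔻 ∩ ball 1 η) →
      (∀ a ∈ 𝔻 ∩ ball 1 η, η / 2 ≤ ‖1 - a‖ → ‖G a‖ ≤ 2 * K) →
      (∀ ε > 0, ∃ s < 1, ∀ a ∈ 𝔻 ∩ ball 1 η, s ≤ ‖a‖ →
        |(G a).re| ≤ K * ‖1 - a‖ ^ γ + ε) →
      ‖deriv G t‖ ≤ 64 * (C1 * C0) * K * (1 - t) ^ (m - 1) := by
    intro G hG hGb hGc
    have upper : ∀ G : ℂ → ℂ, DifferentiableOn ℂ G (𝔻 ∩ ball 1 η) →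
      (∀ a ∈ 𝔻 ∩ ball 1 η, η / 2 ≤ ‖1 - a‖ → ‖G a‖ ≤ 2 * K) →
      (∀ ε > 0, ∃ s < 1, ∀ a ∈ 𝔻 ∩ ball 1 η, s ≤ ‖a‖ →
        |(G a).re| ≤ K * ‖1 - a‖ ^ γ + ε) →
      ∀ a ∈ 𝔻 ∩ ball 1 η, (G a).re ≤ C1 * K * (C0 * ‖1 - a‖ ^ m) := by
      intro G hG hGb hGc a ha
      have := re_le_of_control (f := fun a => G a - ((C1 * K : ℝ) : ℂ) * Φ a) hη
        (hG.sub ((hΦ.mono inter_subset_left).const_mul _)) ?_ ?_ ha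
      · rw [sub_re, re_ofReal_mul] at this
        have h3 := (hΦb a ha.1).2
        have : C1 * K * (Φ a).re ≤ C1 * K * (C0 * ‖1 - a‖ ^ m) := by gcongr
        linarith
      · intro a ha h
        rw [sub_re, re_ofReal_mul]
        have h3 := (hΦb a ha.1).1
        have h4 := (re_le_norm _).trans (hGb a ha h)
        have h5 : (η / 2) ^ γ ≤ ‖1 - a‖ ^ γ := by gcongr
        have h6 : 2 ≤ C1 * (η / 2) ^ γ := by
          have : 2 * (2 / η) ^ γ * (η / 2) ^ γ = 2 := by
            rw [mul_assoc, ← mul_rpow (by positivity) (by positivity)]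
            have : 2 / η * (η / 2) = 1 := by field_simp
            rw [this]; simp
          calc (2:ℝ) = 2 * (2 / η) ^ γ * (η / 2) ^ γ := this.symm
            _ ≤ _ := by gcongr; exact le_max_right _ _
        have h7 : C1 * (η / 2) ^ γ ≤ C1 * (Φ a).re := by
          gcongr; linarith
        nlinarith
      · intro ε hε
        obtain ⟨s, hs, H⟩ := hGc ε hε
        refine ⟨s, hs, fun a ha hsa => ?_⟩
        rw [sub_re, re_ofReal_mul]
        have h3 := (hΦb a ha.1).1
        have h4 := (le_abs_self _).trans (H a ha hsa)
        have h5 : 0 ≤ ‖1 - a‖ ^ γ := by positivity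
        have h6 : K * ‖1 - a‖ ^ γ ≤ C1 * K * (Φ a).re := by
          calc K * ‖1 - a‖ ^ γ ≤ K * (Φ a).re := by gcongr
            _ ≤ C1 * K * (Φ a).re := by
              have : 0 ≤ K * (Φ a).re := mul_nonneg hK (h5.trans h3)
              nlinarith
        linarith
    have hR : 0 < (1 - t) / 2 := by linarith
    have hsub : ball (t : ℂ) ((1 - t) / 2) ⊆ 𝔻 ∩ ball 1 η := by
      intro x hx
      have hx' : ‖x - t‖ < (1 - t) / 2 := by simpa [dist_eq_norm] using hx
      constructor
      · rw [mem_ball, dist_zero_right]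
        calc ‖x‖ = ‖(x - t) + t‖ := by ring_nf
          _ ≤ ‖x - t‖ + ‖(t:ℂ)‖ := norm_add_le _ _
          _ < 1 := by rw [norm_real, norm_of_nonneg ht0]; linarith
      · rw [mem_ball, dist_eq_norm]
        calc ‖x - 1‖ = ‖(x - t) + ((t - 1 : ℝ) : ℂ)‖ := by push_cast; ring_nf
          _ ≤ ‖x - t‖ + ‖((t - 1 : ℝ):ℂ)‖ := norm_add_le _ _
          _ < η := by
            rw [norm_real, Real.norm_of_nonpos (by linarith)]; linarith
    have hnorm : ∀ x ∈ ball (t : ℂ) ((1 - t) / 2), ‖1 - x‖ ^ m ≤ 2 * (1 - t) ^ m := by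
      intro x hx
      have hx' : ‖x - t‖ < (1 - t) / 2 := by simpa [dist_eq_norm] using hx
      have h3 : ‖1 - x‖ ≤ 2 * (1 - t) := by
        calc ‖1 - x‖ = ‖((1 - t : ℝ) : ℂ) - (x - t)‖ := by push_cast; ring_nf
          _ ≤ ‖((1 - t : ℝ):ℂ)‖ + ‖x - t‖ := norm_sub_le _ _
          _ ≤ _ := by
            rw [norm_real, norm_of_nonneg (by linarith)]; linarith
      calc ‖1 - x‖ ^ m ≤ (2 * (1 - t)) ^ m := by gcongr
        _ = 2 ^ m * (1 - t) ^ m := by rw [mul_rpow (by norm_num) (by linarith)]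
        _ ≤ 2 ^ (1:ℝ) * (1 - t) ^ m := by
          gcongr
          · norm_num
          · exact min_le_right _ _
        _ = _ := by norm_num
    have key := norm_deriv_le_of_abs_re_le (G := G) (c := t) (m := 2 * (C1 * C0) * K * (1 - t) ^ m) hR
      (hG.mono hsub) ?_
    · refine key.trans (le_of_eq ?_)
      rw [rpow_sub_one (by linarith)]
      have : 1 - t ≠ 0 := by linarith
      field_simp; ring
    · intro x hx
      have hxS := hsub hx
      have e : C1 * K * (C0 * ‖1 - x‖ ^ m) ≤ 2 * (C1 * C0) * K * (1 - t) ^ m := by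
        calc C1 * K * (C0 * ‖1 - x‖ ^ m) ≤ C1 * K * (C0 * (2 * (1 - t) ^ m)) := by
              gcongr; exact hnorm x hx
          _ = _ := by ring
      rw [abs_le]
      constructor
      · have := upper (fun a => - G a) hG.neg (by simpa using hGb) (by simpa using hGc) x hxS
        simp only [neg_re] at this
        linarith
      · exact (upper G hG hGb hGc x hxS).trans e
  have htS : (t : ℂ) ∈ 𝔻 ∩ ball 1 η := by
    constructor
    · simpa [abs_of_nonneg ht0] using ht1
    · rw [mem_ball, dist_comm, dist_eq_norm, ← ofReal_one, ← ofReal_sub,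
        norm_real, norm_of_nonneg (by linarith)]; linarith
  have hopen : IsOpen (𝔻 ∩ ball 1 η) := isOpen_ball.inter isOpen_ball
  have hkd : DifferentiableAt ℂ k t := hk.differentiableAt (hopen.mem_nhds htS)
  have hbd : DifferentiableAt ℂ b t := hb.differentiableAt (hopen.mem_nhds htS)
  have m1 := main (fun a => k a - b a) (hk.sub hb) ?_ ?_
  · have m2 := main (fun a => -I * (k a + b a)) ((hk.add hb).const_mul _) ?_ ?_
    · have e1 : deriv (fun a => k a - b a) t = deriv k t - deriv b t :=
        deriv_fun_sub hkd hbd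
      have e2 : deriv (fun a => -I * (k a + b a)) t =
          -I * (deriv k t + deriv b t) := by
        exact ((hkd.hasDerivAt.add hbd.hasDerivAt).const_mul _).deriv
      rw [e1] at m1
      rw [e2, norm_mul, norm_neg, norm_I, one_mul] at m2
      have e3 : deriv b t = (1 / 2 : ℂ) * ((deriv k t + deriv b t) - (deriv k t - deriv b t)) := by
        ring
      rw [e3, norm_mul]
      have h5 := norm_sub_le (deriv k t + deriv b t) (deriv k t - deriv b t)
      have : ‖(1 / 2 : ℂ)‖ = 1 / 2 := by norm_num
      rw [this]
      linarith
    · intro a ha h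
      rw [norm_mul, norm_neg, norm_I, one_mul]
      have := hKb a ha h
      have := norm_add_le (k a) (b a)
      linarith
    · intro ε hε
      obtain ⟨s, hs, H⟩ := hctrl ε hε
      refine ⟨s, hs, fun a ha hsa => ?_⟩
      refine le_trans ?_ (H a ha hsa)
      have : (-I * (k a + b a)).re = (k a - conj (b a)).im := by
        simp
      rw [this]
      exact Complex.abs_im_le_norm _
  · intro a ha h
    have := hKb a ha h
    have := norm_sub_le (k a) (b a)
    linarith
  · intro ε hε
    obtain ⟨s, hs, H⟩ := hctrl ε hε
    refine ⟨s, hs, fun a ha hsa => ?_⟩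
    refine le_trans ?_ (H a ha hsa)
    have : (k a - b a).re = (k a - conj (b a)).re := by simp
    rw [this]
    exact abs_re_le_norm _

/-- Regularity at an arbitrary point `ω` of the circle. -/
theorem exists_reg {γ : ℝ} (h0 : 0 < γ) (h2 : γ < 2) (h1 : γ ≠ 1) {η : ℝ} (hη : 0 < η) :
    ∃ C : ℝ, 0 < C ∧ ∀ (ω : ℂ) (k b : ℂ → ℂ) (K : ℝ), ‖ω‖ = 1 → 0 ≤ K →
      DifferentiableOn ℂ k (𝔻 ∩ ball ω η) → DifferentiableOn ℂ b (𝔻 ∩ ball ω η) →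
      (∀ a ∈ 𝔻 ∩ ball ω η, η / 2 ≤ ‖a - ω‖ → ‖k a‖ ≤ K ∧ ‖b a‖ ≤ K) →
      (∀ ε > 0, ∃ s < 1, ∀ a ∈ 𝔻 ∩ ball ω η, s ≤ ‖a‖ →
        ‖k a - conj (b a)‖ ≤ K * ‖a - ω‖ ^ γ + ε) →
      ∀ t : ℝ, 0 ≤ t → t < 1 → 1 - t < η / 4 →
        ‖deriv b (t * ω)‖ ≤ C * K * (1 - t) ^ (min γ 1 - 1) := by
  obtain ⟨C, hC, H⟩ := exists_reg_one h0 h2 h1 hη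
  refine ⟨C, hC, ?_⟩
  intro ω k b K hω hK hk hb hKb hctrl t ht0 ht1 htη
  have hn : ∀ a : ℂ, ‖a * ω - ω‖ = ‖1 - a‖ := by
    intro a
    have : a * ω - ω = (a - 1) * ω := by ring
    rw [this, norm_mul, hω, mul_one, norm_sub_rev]
  have hn2 : ∀ a : ℂ, ‖a * ω‖ = ‖a‖ := by intro a; rw [norm_mul, hω, mul_one]
  have hmem : ∀ a, a ∈ 𝔻 ∩ ball 1 η → a * ω ∈ 𝔻 ∩ ball ω η := by
    intro a ha
    refine ⟨?_, ?_⟩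
    · have := ha.1; simp only [mem_ball, dist_zero_right] at this ⊢; rwa [hn2]
    · have := ha.2; rw [mem_ball, dist_eq_norm] at this ⊢; rwa [hn, norm_sub_rev]
  have hmt : MapsTo (fun a : ℂ => a * ω) (𝔻 ∩ ball 1 η) (𝔻 ∩ ball ω η) :=
    fun a ha => hmem a ha
  have hd : DifferentiableOn ℂ (fun a : ℂ => a * ω) (𝔻 ∩ ball 1 η) := by fun_prop
  have := H (fun a => k (a * ω)) (fun a => b (a * ω)) K hK (hk.comp hd hmt) (hb.comp hd hmt)
    ?_ ?_ t ht0 ht1 htη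
  · have htS : (t : ℂ) ∈ 𝔻 ∩ ball 1 η := by
      constructor
      · simpa [abs_of_nonneg ht0] using ht1
      · rw [mem_ball, dist_comm, dist_eq_norm, ← ofReal_one, ← ofReal_sub,
          norm_real, norm_of_nonneg (by linarith)]; linarith
    have hbd : DifferentiableAt ℂ b (t * ω) := hb.differentiableAt
      ((isOpen_ball.inter isOpen_ball).mem_nhds (hmem _ htS))
    have e : deriv (fun a => b (a * ω)) t = deriv b (t * ω) * ω := by
      have h6 : HasDerivAt (fun a : ℂ => a * ω) ω (t : ℂ) := by
        simpa using (hasDerivAt_id (t : ℂ)).mul_const ω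
      exact (hbd.hasDerivAt.comp (t : ℂ) h6).deriv
    rw [e, norm_mul, hω, mul_one] at this
    exact this
  · intro a ha h
    exact hKb _ (hmem a ha) (by rwa [hn])
  · intro ε hε
    obtain ⟨s, hs, H'⟩ := hctrl ε hε
    refine ⟨s, hs, fun a ha hsa => ?_⟩
    have := H' _ (hmem a ha) (by rwa [hn2])
    rwa [hn] at this

end Analysis

theorem artanh_le_artanh {x y : ℝ} (hx : 0 ≤ x) (hxy : x ≤ y) (hy : y < 1) :
    artanh x ≤ artanh y := by
  unfold artanh
  have h1 : 0 < 1 - y := by linarith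
  have h2 : 0 < 1 - x := by linarith
  gcongr
  linarith

theorem artanh_zero : artanh 0 = 0 := by simp [artanh]

theorem artanh_nonneg {x : ℝ} (hx : 0 ≤ x) (h1 : x < 1) : 0 ≤ artanh x := by
  rw [← artanh_zero]; exact artanh_le_artanh le_rfl hx h1

theorem lempert_set_bddBelow (Ω : Set (E N)) (z w : E N) :
    BddBelow { r : ℝ | ∃ φ : ℂ → E N, DifferentiableOn ℂ φ 𝔻 ∧
    MapsTo φ 𝔻 Ω ∧ φ 0 = z ∧ ∃ a ∈ 𝔻, φ a = w ∧ r = ‖a‖ } := by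
  refine ⟨0, ?_⟩
  rintro r ⟨φ, _, _, _, a, _, _, rfl⟩
  exact norm_nonneg _

theorem sInf_lempert_nonneg (Ω : Set (E N)) (z w : E N) :
    0 ≤ sInf { r : ℝ | ∃ φ : ℂ → E N, DifferentiableOn ℂ φ 𝔻 ∧
    MapsTo φ 𝔻 Ω ∧ φ 0 = z ∧ ∃ a ∈ 𝔻, φ a = w ∧ r = ‖a‖ } := by
  refine Real.sInf_nonneg ?_
  rintro r ⟨φ, _, _, _, a, _, _, rfl⟩
  exact norm_nonneg _

theorem lempert_le {Ω : Set (E N)} {z w : E N} {φ : ℂ → E N} {a : ℂ}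
    (h1 : DifferentiableOn ℂ φ 𝔻) (h2 : MapsTo φ 𝔻 Ω) (h3 : φ 0 = z)
    (ha : a ∈ 𝔻) (h4 : φ a = w) : lempert Ω z w ≤ artanh ‖a‖ := by
  refine artanh_le_artanh (sInf_lempert_nonneg Ω z w) ?_ (norm_lt_one_of_mem_ball ha)
  exact csInf_le (lempert_set_bddBelow Ω z w) ⟨φ, h1, h2, h3, a, ha, h4, rfl⟩

theorem lempert_nonneg (Ω : Set (E N)) (z w : E N) : 0 ≤ lempert Ω z w := by
  unfold lempert
  set S := { r : ℝ | ∃ φ : ℂ → E N, DifferentiableOn ℂ φ 𝔻 ∧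
    MapsTo φ 𝔻 Ω ∧ φ 0 = z ∧ ∃ a ∈ 𝔻, φ a = w ∧ r = ‖a‖ } with hS
  rcases S.eq_empty_or_nonempty with h | h
  · rw [h, Real.sInf_empty, artanh_zero]
  · refine artanh_nonneg (sInf_lempert_nonneg Ω z w) ?_
    obtain ⟨r, hr⟩ := h
    refine (csInf_le (lempert_set_bddBelow Ω z w) hr).trans_lt ?_
    obtain ⟨φ, _, _, _, a, ha, _, rfl⟩ := hr
    exact norm_lt_one_of_mem_ball ha

/-- `r` is the length of some chain from `z` to `w` in `Ω`. -/
def IsChain (Ω : Set (E N)) (z w : E N) (r : ℝ) : Prop :=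
  ∃ (n : ℕ) (p : Fin (n + 1) → E N), p 0 = z ∧ p (Fin.last n) = w ∧
    (∀ i, p i ∈ Ω) ∧ r = ∑ i : Fin n, lempert Ω (p i.castSucc) (p i.succ)

theorem IsChain.cons {Ω : Set (E N)} {z w v : E N} {r : ℝ} (hz : z ∈ Ω) (h : IsChain Ω w v r) :
    IsChain Ω z v (lempert Ω z w + r) := by
  obtain ⟨n, p, h0, hl, hΩ, rfl⟩ := h
  refine ⟨n + 1, Fin.cons z p, rfl, ?_, ?_, ?_⟩
  · rw [← hl]; simp [← Fin.succ_last]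
  · intro i; refine Fin.cases ?_ ?_ i
    · simpa using hz
    · intro j; simpa using hΩ j
  · rw [Fin.sum_univ_succ]
    congr 1
    simp [h0]

theorem IsChain.trans {Ω : Set (E N)} {z w v : E N} {r s : ℝ} (h : IsChain Ω z w r)
    (h' : IsChain Ω w v s) : IsChain Ω z v (r + s) := by
  obtain ⟨n, p, h0, hl, hΩ, rfl⟩ := h
  induction n generalizing z with
  | zero =>
    have : z = w := by rw [← h0, ← hl]; rfl
    subst this
    simpa using h'
  | succ n ih =>
    have := ih (z := p 1) (fun i => p i.succ) rfl (by simpa using hl) (fun i => hΩ _)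
    have h2 := this.cons (z := z) (by rw [← h0]; exact hΩ 0)
    rw [Fin.sum_univ_succ]
    simp only [Fin.castSucc_zero, h0, Fin.succ_zero_eq_one]
    convert h2 using 1
    rw [add_assoc]
    congr 1

/-- There is a chain of length at most `r`. -/
def KLe (Ω : Set (E N)) (z w : E N) (r : ℝ) : Prop := ∃ s ≤ r, IsChain Ω z w s

theorem KLe.trans {Ω : Set (E N)} {z w v : E N} {r s : ℝ} (h : KLe Ω z w r)
    (h' : KLe Ω w v s) : KLe Ω z v (r + s) := by
  obtain ⟨a, ha, h⟩ := h
  obtain ⟨b, hb, h'⟩ := h'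
  exact ⟨a + b, by linarith, h.trans h'⟩

theorem KLe.mono {Ω : Set (E N)} {z w : E N} {r s : ℝ} (h : KLe Ω z w r) (hrs : r ≤ s) :
    KLe Ω z w s := by
  obtain ⟨a, ha, h⟩ := h
  exact ⟨a, ha.trans hrs, h⟩

theorem KLe.refl {Ω : Set (E N)} {z : E N} (hz : z ∈ Ω) : KLe Ω z z 0 :=
  ⟨0, le_rfl, 0, fun _ => z, rfl, rfl, fun _ => hz, by simp⟩

theorem KLe.kobayashi_le {Ω : Set (E N)} {z w : E N} {r : ℝ} (h : KLe Ω z w r) :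
    kobayashi Ω z w ≤ r := by
  obtain ⟨s, hs, h⟩ := h
  refine le_trans (csInf_le ⟨0, ?_⟩ h) hs
  rintro r ⟨n, p, _, _, _, rfl⟩
  exact Finset.sum_nonneg fun i _ => lempert_nonneg _ _ _

theorem KLe.of_disc {Ω : Set (E N)} {ψ : ℂ → E N} (h1 : DifferentiableOn ℂ ψ 𝔻)
    (h2 : MapsTo ψ 𝔻 Ω) {a : ℂ} (ha : a ∈ 𝔻) :
    KLe Ω (ψ 0) (ψ a) (artanh ‖a‖) := by
  refine ⟨lempert Ω (ψ 0) (ψ a), lempert_le h1 h2 rfl ha rfl, 1, ![ψ 0, ψ a], rfl, rfl, ?_, ?_⟩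
  · intro i
    fin_cases i
    · exact h2 (mem_ball_self one_pos)
    · exact h2 ha
  · simp

/-- Pseudohyperbolic distance. -/
def phd (s t : ℂ) : ℝ := ‖(s - t) / (1 - conj s * t)‖

/-- The disc automorphism `ζ ↦ (ζ + s) / (1 + conj s ζ)`. -/
def mob (s ζ : ℂ) : ℂ := (ζ + s) / (1 + conj s * ζ)

theorem one_add_conj_mul_ne_zero {s ζ : ℂ} (hs : ‖s‖ < 1) (hζ : ‖ζ‖ ≤ 1) :
    1 + conj s * ζ ≠ 0 := by
  intro h
  have h1 : ‖conj s * ζ‖ = 1 := by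
    rw [show conj s * ζ = -1 by linear_combination h]; simp
  rw [norm_mul, RCLike.norm_conj] at h1
  nlinarith [norm_nonneg s, norm_nonneg ζ]

theorem one_sub_conj_mul_ne_zero {s ζ : ℂ} (hs : ‖s‖ < 1) (hζ : ‖ζ‖ ≤ 1) :
    1 - conj s * ζ ≠ 0 := by
  have := one_add_conj_mul_ne_zero (s := -s) (ζ := ζ) (by simpa using hs) hζ
  simpa [sub_eq_add_neg] using this

/-- The basic identity for the pseudohyperbolic distance. -/
theorem one_sub_phd_sq {s t : ℂ} (hs : ‖s‖ < 1) (ht : ‖t‖ ≤ 1) :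
    1 - phd s t ^ 2 = (1 - ‖s‖ ^ 2) * (1 - ‖t‖ ^ 2) / ‖1 - conj s * t‖ ^ 2 := by
  have h := one_sub_conj_mul_ne_zero hs ht
  have hp : 0 < ‖1 - conj s * t‖ := norm_pos_iff.mpr h
  unfold phd
  rw [norm_div, div_pow, eq_div_iff (by positivity), sub_mul, div_mul_cancel₀ _ (by positivity)]
  simp only [← normSq_eq_norm_sq, normSq_apply]
  simp
  ring

theorem phd_lt_one {s t : ℂ} (hs : ‖s‖ < 1) (ht : ‖t‖ < 1) : phd s t < 1 := by
  have h := one_sub_phd_sq hs ht.le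
  have hp : 0 < ‖1 - conj s * t‖ :=
    norm_pos_iff.mpr (one_sub_conj_mul_ne_zero hs ht.le)
  have h1 : 0 < 1 - ‖s‖ ^ 2 := by nlinarith [norm_nonneg s]
  have h2 : 0 < 1 - ‖t‖ ^ 2 := by nlinarith [norm_nonneg t]
  have : 0 < 1 - phd s t ^ 2 := by rw [h]; positivity
  have h0 : 0 ≤ phd s t := norm_nonneg _
  nlinarith

theorem phd_nonneg (s t : ℂ) : 0 ≤ phd s t := norm_nonneg _

theorem norm_mob_lt_one {s ζ : ℂ} (hs : ‖s‖ < 1) (hζ : ‖ζ‖ < 1) : ‖mob s ζ‖ < 1 := by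
  have := phd_lt_one (s := -s) (t := ζ) (by simpa using hs) hζ
  unfold phd at this
  unfold mob
  rw [norm_div] at this ⊢
  simp only [map_neg, neg_mul, sub_neg_eq_add] at this
  rwa [show -s - ζ = -(ζ + s) by ring, norm_neg] at this

theorem differentiableOn_mob {s : ℂ} (hs : ‖s‖ < 1) : DifferentiableOn ℂ (mob s) 𝔻 := by
  intro ζ hζ
  apply DifferentiableAt.differentiableWithinAt
  unfold mob
  exact DifferentiableAt.div (by fun_prop) (by fun_prop)
    (one_add_conj_mul_ne_zero hs (norm_lt_one_of_mem_ball hζ).le)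

theorem mapsTo_mob {s : ℂ} (hs : ‖s‖ < 1) : MapsTo (mob s) 𝔻 𝔻 := by
  intro ζ hζ
  simpa using norm_mob_lt_one hs (norm_lt_one_of_mem_ball hζ)

theorem mob_zero (s : ℂ) : mob s 0 = s := by simp [mob]

theorem mob_neg_mob {s ζ : ℂ} (hs : ‖s‖ < 1) (hζ : ‖ζ‖ < 1) : mob s (mob (-s) ζ) = ζ := by
  have h1 : 1 - conj s * ζ ≠ 0 := one_sub_conj_mul_ne_zero hs hζ.le
  have h2 : 1 - conj s * s ≠ 0 := one_sub_conj_mul_ne_zero hs hs.le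
  have h3 : 1 + conj s * (ζ - s) / (1 - conj s * ζ) =
    (1 - conj s * s) / (1 - conj s * ζ) := by
    rw [eq_div_iff h1, add_mul, div_mul_cancel₀ _ h1]; ring
  unfold mob
  simp only [map_neg, neg_mul, ← sub_eq_add_neg]
  rw [← mul_div_assoc, h3, div_eq_iff (div_ne_zero h2 h1), div_add' _ _ _ h1, mul_div_assoc']
  congr 1; ring

theorem norm_mob_neg (s t : ℂ) : ‖mob (-s) t‖ = phd s t := by
  unfold phd mob
  rw [norm_div, norm_div]
  simp only [map_neg, neg_mul, ← sub_eq_add_neg]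
  rw [norm_sub_rev]

theorem KLe.of_disc₂ {Ω : Set (E N)} {ψ : ℂ → E N} (h1 : DifferentiableOn ℂ ψ 𝔻)
    (h2 : MapsTo ψ 𝔻 Ω) {s t : ℂ} (hs : s ∈ 𝔻) (ht : t ∈ 𝔻) :
    KLe Ω (ψ s) (ψ t) (artanh (phd s t)) := by
  have hs' := norm_lt_one_of_mem_ball hs
  have ht' := norm_lt_one_of_mem_ball ht
  have := KLe.of_disc (ψ := fun ζ => ψ (mob s ζ)) (h1.comp (differentiableOn_mob hs') (mapsTo_mob hs'))
    (h2.comp (mapsTo_mob hs')) (a := mob (-s) t)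
    (mapsTo_mob (s := -s) (by simpa using hs') ht)
  simp only [mob_zero, mob_neg_mob hs' ht', norm_mob_neg] at this
  exact this

theorem IsComplexGeodesic.artanh_le {Ω : Set (E N)} {φ : ℂ → E N} (h : IsComplexGeodesic Ω φ)
    {s t : ℂ} (hs : s ∈ 𝔻) (ht : t ∈ 𝔻) {r : ℝ}
    (hr : KLe Ω (φ s) (φ t) r) : artanh (phd s t) ≤ r := by
  have := h.2.2 s hs t ht
  have h2 := hr.kobayashi_le
  rw [this] at h2
  exact h2

theorem phd_mob {c s t : ℂ} (hc : ‖c‖ < 1) (hs : ‖s‖ < 1) (ht : ‖t‖ < 1) :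
    phd (mob c s) (mob c t) = phd s t := by
  have h1 := one_add_conj_mul_ne_zero hc hs.le
  have h2 := one_add_conj_mul_ne_zero hc ht.le
  have h3 := one_sub_conj_mul_ne_zero hc hc.le
  have h4 := one_sub_conj_mul_ne_zero hs ht.le
  have h1' : 1 + c * conj s ≠ 0 := by
    intro h; apply h1; have := congrArg conj h; simpa using this
  have e1 : mob c s - mob c t = (1 - conj c * c) * (s - t) /
      ((1 + conj c * s) * (1 + conj c * t)) := by
    unfold mob; rw [div_sub_div _ _ h1 h2]; congr 1; ring
  have e2 : 1 - conj (mob c s) * mob c t =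
      (1 - conj c * c) * (1 - conj s * t) /
      ((1 + c * conj s) * (1 + conj c * t)) := by
    unfold mob
    simp only [map_div₀, map_add, map_mul, map_one, conj_conj]
    rw [div_mul_div_comm, eq_div_iff (mul_ne_zero h1' h2), sub_mul,
      div_mul_cancel₀ _ (mul_ne_zero h1' h2)]
    ring
  have e3 : ‖1 + c * conj s‖ = ‖1 + conj c * s‖ := by
    rw [← RCLike.norm_conj]; simp
  unfold phd
  rw [e1, e2]
  simp only [norm_div, norm_mul]
  rw [e3]
  have n1 := norm_ne_zero_iff.mpr h1
  have n2 := norm_ne_zero_iff.mpr h2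
  have n3 := norm_ne_zero_iff.mpr h3
  have n4 := norm_ne_zero_iff.mpr h4
  field_simp

theorem IsComplexGeodesic.comp_mob {Ω : Set (E N)} {φ : ℂ → E N} (h : IsComplexGeodesic Ω φ)
    {c : ℂ} (hc : ‖c‖ < 1) : IsComplexGeodesic Ω (fun ζ => φ (mob c ζ)) := by
  refine ⟨h.1.comp (differentiableOn_mob hc) (mapsTo_mob hc), h.2.1.comp (mapsTo_mob hc), ?_⟩
  intro s hs t ht
  rw [h.2.2 _ (mapsTo_mob hc hs) _ (mapsTo_mob hc ht)]
  exact congrArg artanh (phd_mob hc (norm_lt_one_of_mem_ball hs) (norm_lt_one_of_mem_ball ht))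

theorem image_comp_mob (φ : ℂ → E N) {c : ℂ} (hc : ‖c‖ < 1) :
    (fun ζ => φ (mob c ζ)) '' 𝔻 = φ '' 𝔻 := by
  ext x
  constructor
  · rintro ⟨ζ, hζ, rfl⟩
    exact ⟨_, mapsTo_mob hc hζ, rfl⟩
  · rintro ⟨ζ, hζ, rfl⟩
    have hc' : ‖-c‖ < 1 := by simpa using hc
    refine ⟨mob (-c) ζ, mapsTo_mob hc' hζ, ?_⟩
    simp only [mob_neg_mob hc (norm_lt_one_of_mem_ball hζ)]

/-- Quantitative data attached to a strongly pseudoconvex domain: `L z` is the complex linear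
form whose real part is the differential of `ρ`, and `ell z` its real derivative. -/
structure Dom (Ω : Set (E N)) (α : ℝ) where
  ρ : E N → ℝ
  L : E N → (E N →L[ℂ] ℂ)
  ell : E N → (E N →L[ℝ] (E N →L[ℂ] ℂ))
  M : ℝ
  ε : ℝ
  α_pos : 0 < α
  α_le : α ≤ 1
  one_le_M : 1 ≤ M
  ε_pos : 0 < ε
  ε_le : ε ≤ 1
  isOpen : IsOpen Ω
  isBounded : Bornology.IsBounded Ω
  isConnected : IsConnected Ω
  diam_le : ∀ z ∈ closure Ω, ∀ w ∈ closure Ω, ‖w - z‖ ≤ M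
  neg : ∀ z ∈ Ω, ρ z < 0
  zero : ∀ z ∈ frontier Ω, ρ z = 0
  abs_le : ∀ z ∈ closure Ω, |ρ z| ≤ M
  mem : ∀ z ∈ closure Ω, ∀ x, ‖x‖ < ε → ρ (z + x) < 0 → z + x ∈ Ω
  d1_ball : ∀ z ∈ closure Ω, ∀ x, ‖x‖ < ε → |ρ (z + x) - ρ z - (L z x).re| ≤ M * ‖x‖ ^ 2
  d1 : ∀ z ∈ closure Ω, ∀ w ∈ closure Ω, |ρ w - ρ z - (L z (w - z)).re| ≤ M * ‖w - z‖ ^ 2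
  d2 : ∀ z ∈ closure Ω, ∀ w ∈ closure Ω, ‖L w - L z‖ ≤ M * ‖w - z‖
  norm_L : ∀ z ∈ closure Ω, ‖L z‖ ≤ M
  d3 : ∀ z ∈ closure Ω, ∀ w ∈ closure Ω, ‖L w - L z - ell z (w - z)‖ ≤ M * ‖w - z‖ ^ (1 + α)
  d4 : ∀ z ∈ closure Ω, ∀ w ∈ closure Ω, ‖ell w - ell z‖ ≤ M * ‖w - z‖ ^ α
  norm_ell : ∀ z ∈ closure Ω, ‖ell z‖ ≤ M
  taylor : ∀ z ∈ closure Ω, ∀ x, ‖x‖ < ε →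
    |ρ (z + x) - ρ z - (L z x).re - (ell z x x).re / 2| ≤ M * ‖x‖ ^ (2 + α)
  L_ne : ∀ p ∈ frontier Ω, L p ≠ 0
  levi_pos : ∀ p ∈ frontier Ω, ∀ v : E N, v ≠ 0 → L p v = 0 →
    0 < (ell p v v).re + (ell p (I • v) (I • v)).re

/-- complexification of a real linear form, as a real-linear isometry -/
def cplx : StrongDual ℝ (E N) ≃ₗᵢ[ℝ] StrongDual ℂ (E N) := StrongDual.extendRCLikeₗᵢ

theorem cplx_re (f : StrongDual ℝ (E N)) (x : E N) : (cplx f x).re = f x :=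
  Module.Dual.re_extendRCLike_apply (𝕜 := ℂ) (f : E N →ₗ[ℝ] ℝ) x

theorem cplx_im (f : StrongDual ℝ (E N)) (x : E N) : (cplx f x).im = - f (I • x) :=
  Module.Dual.im_extendRCLike_apply (𝕜 := ℂ) (f : E N →ₗ[ℝ] ℝ) x

theorem rpow_ge_sq {ε t s : ℝ} (hε : 0 < ε) (hε1 : ε ≤ 1) (ht : ε ≤ t) (hs : 0 ≤ s) (hs2 : s ≤ 2) :
    ε ^ 2 ≤ t ^ s := by
  calc ε ^ 2 = ε ^ (2:ℝ) := by norm_num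
    _ ≤ ε ^ s := Real.rpow_le_rpow_of_exponent_ge hε hε1 hs2
    _ ≤ t ^ s := by gcongr

set_option maxHeartbeats 2000000 in
theorem exists_dom {α : ℝ} (hα : α ∈ Set.Ioc (0:ℝ) 1) {Ω : Set (E N)}
    (hΩ : IsStronglyPseudoconvexDomain 2 α Ω) : Nonempty (Dom Ω α) := by
  obtain ⟨hopen, hconn, hbdd, U, ρ, hU, hKU, ⟨hρ, M0, hM0⟩, hΩe, hdne, hlevi⟩ := hΩ
  set Kc := closure Ω with hKc
  have hcomp : IsCompact Kc := hbdd.isCompact_closure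
  obtain ⟨ε0, hε0, hT⟩ := hcomp.exists_cthickening_subset_open hU hKU
  set T := cthickening ε0 Kc with hTdef
  have hTc : IsCompact T := hcomp.cthickening
  set R := fderiv ℝ ρ with hR
  set R2 := fderiv ℝ R with hR2
  have hR1 : ContDiffOn ℝ 1 R U := hρ.fderiv_of_isOpen hU (by norm_num)
  have hρd : ∀ y ∈ U, HasFDerivAt ρ (R y) y := fun y hy =>
    ((hρ.differentiableOn (by norm_num)).differentiableAt (hU.mem_nhds hy)).hasFDerivAt
  have hRd : ∀ y ∈ U, HasFDerivAt R (R2 y) y := fun y hy =>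
    ((hR1.differentiableOn (by norm_num)).differentiableAt (hU.mem_nhds hy)).hasFDerivAt
  obtain ⟨m0, hm0⟩ := hTc.exists_bound_of_continuousOn (hρ.continuousOn.mono hT)
  obtain ⟨m1, hm1⟩ := hTc.exists_bound_of_continuousOn (hR1.continuousOn.mono hT)
  obtain ⟨m3, hm3⟩ := isBounded_iff.mp hcomp.isBounded
  have hholder : ∀ x ∈ U, ∀ y ∈ U, ‖R2 x - R2 y‖ ≤ |M0| * ‖x - y‖ ^ α := by
    intro x hx y hy
    have h1 := hM0 x hx y hy
    have h2 : M0 * ‖x - y‖ ^ α ≤ |M0| * ‖x - y‖ ^ α := by gcongr; exact le_abs_self _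
    refine ContinuousLinearMap.opNorm_le_bound₂ _ (by positivity) fun v w => ?_
    have h3 := (iteratedFDeriv ℝ 2 ρ x - iteratedFDeriv ℝ 2 ρ y).le_opNorm ![v, w]
    rw [sub_apply, iteratedFDeriv_two_apply,
      iteratedFDeriv_two_apply] at h3
    simp only [Fin.prod_univ_two, Matrix.cons_val_zero, Matrix.cons_val_one] at h3
    refine le_trans h3 ?_
    rw [mul_assoc]
    gcongr
    linarith
  obtain ⟨m2, hm2⟩ : ∃ C, ∀ x ∈ T, ‖R2 x‖ ≤ C := by
    obtain ⟨x0, hx0⟩ := hconn.nonempty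
    have hx0T : x0 ∈ T := self_subset_cthickening _ (subset_closure hx0)
    obtain ⟨d, hd⟩ := isBounded_iff.mp hTc.isBounded
    refine ⟨‖R2 x0‖ + |M0| * d ^ α, fun x hx => ?_⟩
    have h1 := hholder x (hT hx) x0 (hT hx0T)
    have h2 : ‖x - x0‖ ^ α ≤ d ^ α := by
      have := hα.1.le
      have h3 := hd hx hx0T
      rw [dist_eq_norm] at h3
      gcongr
    have h4 := norm_sub_norm_le (R2 x) (R2 x0)
    nlinarith [abs_nonneg M0]
  set ε := min ε0 1 with hε
  have hεp : 0 < ε := lt_min hε0 one_pos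
  have hε1 : ε ≤ 1 := min_le_right _ _
  set m := 1 + |m0| + |m1| + |m2| + |m3| + |M0| with hm
  have hm1' : 1 ≤ m := by
    rw [hm]; linarith [abs_nonneg m0, abs_nonneg m1, abs_nonneg m2, abs_nonneg m3, abs_nonneg M0]
  have le0 : m0 ≤ m := by
    rw [hm]; linarith [le_abs_self m0, abs_nonneg m1, abs_nonneg m2, abs_nonneg m3, abs_nonneg M0]
  have le1 : m1 ≤ m := by
    rw [hm]; linarith [le_abs_self m1, abs_nonneg m0, abs_nonneg m2, abs_nonneg m3, abs_nonneg M0]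
  have le2 : m2 ≤ m := by
    rw [hm]; linarith [le_abs_self m2, abs_nonneg m1, abs_nonneg m0, abs_nonneg m3, abs_nonneg M0]
  have le3 : m3 ≤ m := by
    rw [hm]; linarith [le_abs_self m3, abs_nonneg m1, abs_nonneg m2, abs_nonneg m0, abs_nonneg M0]
  have le4 : |M0| ≤ m := by
    rw [hm]; linarith [abs_nonneg m1, abs_nonneg m2, abs_nonneg m3, abs_nonneg m0]
  set M := 4 * m ^ 2 / ε ^ 2 with hM
  have hε2 : ε ^ 2 ≤ 1 := by nlinarith
  have hmM : 4 * m ^ 2 ≤ M := by rw [hM, le_div_iff₀ (by positivity)]; nlinarith [sq_nonneg m]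
  have hmM' : m ≤ M := by nlinarith
  have hM1 : 1 ≤ M := by nlinarith
  have hMp : 0 ≤ M := by linarith
  have hfar : ∀ {t s b : ℝ}, ε ≤ t → 0 ≤ s → s ≤ 2 → b ≤ 4 * m ^ 2 → b ≤ M * t ^ s := by
    intro t s b ht hs hs2 hb
    calc b ≤ 4 * m ^ 2 := hb
      _ = M * ε ^ 2 := by rw [hM]; field_simp
      _ ≤ M * t ^ s := by gcongr; exact rpow_ge_sq hεp hε1 ht hs hs2
  have hballT : ∀ z ∈ Kc, ball z ε ⊆ T := by
    intro z hz y hy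
    refine mem_cthickening_of_dist_le y z ε0 _ hz ?_
    exact (le_of_lt hy).trans (min_le_left _ _)
  have hballU : ∀ z ∈ Kc, ball z ε ⊆ U := fun z hz => (hballT z hz).trans hT
  have hKT : Kc ⊆ T := self_subset_cthickening _
  have b0 : ∀ z ∈ Kc, |ρ z| ≤ m := fun z hz => (hm0 z (hKT hz)).trans le0
  have b1 : ∀ z ∈ Kc, ‖R z‖ ≤ m := fun z hz => (hm1 z (hKT hz)).trans le1
  have b2 : ∀ z ∈ Kc, ‖R2 z‖ ≤ m := fun z hz => (hm2 z (hKT hz)).trans le2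
  have b3 : ∀ z ∈ Kc, ∀ w ∈ Kc, ‖w - z‖ ≤ m := fun z hz w hw => by
    rw [← dist_eq_norm]; exact (hm3 hw hz).trans le3
  -- local versions
  have l2 : ∀ z ∈ Kc, ∀ y ∈ ball z ε, ‖R y - R z‖ ≤ m * ‖y - z‖ := by
    intro z hz y hy
    refine (convex_ball z ε).norm_image_sub_le_of_norm_hasFDerivWithin_le (f' := R2)
      (fun x hx => (hRd x (hballU z hz hx)).hasFDerivWithinAt)
      (fun x hx => (hm2 x (hballT z hz hx)).trans le2) (mem_ball_self hεp) hy
  have l1 : ∀ z ∈ Kc, ∀ y ∈ ball z ε, ‖ρ y - ρ z - R z (y - z)‖ ≤ m * ‖y - z‖ ^ 2 := by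
    intro z hz y hy
    have hy' : ‖y - z‖ < ε := by rwa [← dist_eq_norm]
    have hsub : closedBall z ‖y - z‖ ⊆ ball z ε := closedBall_subset_ball hy'
    have := (convex_closedBall z ‖y - z‖).norm_image_sub_le_of_norm_hasFDerivWithin_le'
      (f' := R) (φ := R z) (C := m * ‖y - z‖) (x := z) (y := y)
      (fun x hx => (hρd x (hballU z hz (hsub hx))).hasFDerivWithinAt) ?_
      (mem_closedBall_self (norm_nonneg _)) (by rw [mem_closedBall, dist_eq_norm])
    · refine this.trans (le_of_eq (by ring))
    · intro x hx
      refine (l2 z hz x (hsub hx)).trans ?_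
      rw [mem_closedBall, dist_eq_norm] at hx
      gcongr
  have l3 : ∀ z ∈ Kc, ∀ y ∈ ball z ε, ‖R y - R z - R2 z (y - z)‖ ≤ m * ‖y - z‖ ^ (1 + α) := by
    intro z hz y hy
    have hy' : ‖y - z‖ < ε := by rwa [← dist_eq_norm]
    have hsub : closedBall z ‖y - z‖ ⊆ ball z ε := closedBall_subset_ball hy'
    have := (convex_closedBall z ‖y - z‖).norm_image_sub_le_of_norm_hasFDerivWithin_le'
      (f' := R2) (φ := R2 z) (C := m * ‖y - z‖ ^ α) (x := z) (y := y)
      (fun x hx => (hRd x (hballU z hz (hsub hx))).hasFDerivWithinAt) ?_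
      (mem_closedBall_self (norm_nonneg _)) (by rw [mem_closedBall, dist_eq_norm])
    · refine this.trans (le_of_eq ?_)
      rw [Real.rpow_add_of_nonneg (norm_nonneg _) (by norm_num) hα.1.le, rpow_one]; ring
    · intro x hx
      refine (hholder x (hballU z hz (hsub hx)) z (hKU hz)).trans ?_
      rw [mem_closedBall, dist_eq_norm] at hx
      have := hα.1.le
      gcongr
  have ltay : ∀ z ∈ Kc, ∀ x, ‖x‖ < ε →
      ‖ρ (z + x) - ρ z - R z x - (R2 z x x) / 2‖ ≤ m * ‖x‖ ^ (2 + α) := by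
    intro z hz x hx
    have hmem : ∀ t ∈ Icc (0:ℝ) 1, z + t • x ∈ ball z ε := by
      intro t ht
      rw [mem_ball, dist_eq_norm, add_sub_cancel_left, norm_smul, norm_of_nonneg ht.1]
      nlinarith [ht.2, norm_nonneg x]
    have key := norm_image_sub_le_of_norm_deriv_le_segment_01'
      (f := fun t : ℝ => ρ (z + t • x) - t * R z x - t ^ 2 / 2 * (R2 z x x))
      (f' := fun t : ℝ => R (z + t • x) x - R z x - t * (R2 z x x))
      (C := m * ‖x‖ ^ (2 + α)) ?_ ?_
    · simp only [one_smul, zero_smul, add_zero] at key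
      refine le_trans (le_of_eq ?_) key
      congr 1; ring
    · intro t ht
      have h1 : HasDerivAt (fun t : ℝ => z + t • x) x t := by
        simpa using ((hasDerivAt_id t).smul_const x).const_add z
      have h2 := (hρd _ (hballU z hz (hmem t ht))).comp_hasDerivAt t h1
      have h3 : HasDerivAt (fun t : ℝ => t * R z x) (R z x) t := by
        simpa using (hasDerivAt_id t).mul_const (R z x)
      have h4 : HasDerivAt (fun t : ℝ => t ^ 2 / 2 * (R2 z x x)) (t * (R2 z x x)) t := by
        have := ((hasDerivAt_pow 2 t).div_const 2).mul_const (R2 z x x)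
        refine this.congr_deriv ?_
        simp
      exact ((h2.sub h3).sub h4).hasDerivWithinAt
    · intro t ht
      have h1 := l3 z hz _ (hmem t ⟨ht.1, ht.2.le⟩)
      rw [add_sub_cancel_left] at h1
      have h2 : R (z + t • x) x - R z x - t * (R2 z x x) =
          (R (z + t • x) - R z - R2 z (t • x)) x := by simp
      rw [h2]
      refine (le_opNorm _ _).trans ?_
      have h3 : ‖t • x‖ ≤ ‖x‖ := by
        rw [norm_smul, norm_of_nonneg ht.1]; nlinarith [ht.2, norm_nonneg x]
      have h4 : ‖t • x‖ ^ (1 + α) ≤ ‖x‖ ^ (1 + α) := by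
        have := hα.1
        gcongr
      have h5 : ‖x‖ ^ (2 + α) = ‖x‖ ^ (1 + α) * ‖x‖ := by
        rw [show 2 + α = (1 + α) + 1 by ring,
          Real.rpow_add_of_nonneg (norm_nonneg _) (by linarith [hα.1]) (by norm_num), rpow_one]
      rw [h5, ← mul_assoc]
      gcongr
      exact h1.trans (by gcongr)
  have hΩneg : ∀ z ∈ Ω, ρ z < 0 := fun z hz => by rw [hΩe] at hz; exact hz.2
  have hzero : ∀ p ∈ frontier Ω, ρ p = 0 := by
    intro p hp
    have hpK : p ∈ Kc := frontier_subset_closure hp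
    have hcont : ContinuousWithinAt ρ Ω p :=
      ((hρ.continuousOn p (hKU hpK)).mono (subset_closure.trans hKU))
    have hle : ρ p ≤ 0 := by
      have : (𝓝[Ω] p).NeBot := mem_closure_iff_nhdsWithin_neBot.mp hpK
      exact le_of_tendsto hcont (eventually_nhdsWithin_of_forall fun z hz => (hΩneg z hz).le)
    refine le_antisymm hle (not_lt.mp fun h => ?_)
    have : p ∈ Ω := by rw [hΩe]; exact ⟨hKU hpK, h⟩
    rw [hopen.frontier_eq] at hp
    exact hp.2 this
  have hmM2 : ∀ {t : ℝ}, 0 ≤ t → m * t ≤ M * t := fun ht => by gcongr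
  refine ⟨⟨ρ, fun w => cplx (R w), fun z => (cplx (N := N)).toContinuousLinearEquiv.toContinuousLinearMap.comp (R2 z),
    M, ε, hα.1, hα.2, hM1, hεp, hε1, hopen, hbdd, hconn, fun z hz w hw => (b3 z hz w hw).trans hmM',
    hΩneg, hzero, fun z hz => (b0 z hz).trans hmM', ?_, ?_, ?_, ?_, ?_, ?_, ?_, ?_, ?_, ?_, ?_⟩⟩
  · intro z hz x hx h
    have : z + x ∈ ball z ε := by rwa [mem_ball, dist_eq_norm, add_sub_cancel_left]
    rw [hΩe]
    exact ⟨hballU z hz this, h⟩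
  · intro z hz x hx
    have h1 : z + x ∈ ball z ε := by rwa [mem_ball, dist_eq_norm, add_sub_cancel_left]
    have h2 := l1 z hz _ h1
    rw [add_sub_cancel_left] at h2
    rw [cplx_re]
    exact h2.trans (hmM2 (by positivity))
  · intro z hz w hw
    rw [cplx_re]
    by_cases h : ‖w - z‖ < ε
    · exact (l1 z hz w (by rwa [mem_ball, dist_eq_norm])).trans (hmM2 (by positivity))
    · push Not at h
      rw [← rpow_natCast]
      refine hfar h (by norm_num) (by norm_num) ?_
      have h1 := b0 z hz
      have h2 := b0 w hw
      have h3 : |R z (w - z)| ≤ m * m := ((R z).le_opNorm _).trans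
        (mul_le_mul (b1 z hz) (b3 z hz w hw) (norm_nonneg _) (by linarith))
      have h4 := abs_sub (ρ w - ρ z) (R z (w - z))
      have h5 := abs_sub (ρ w) (ρ z)
      nlinarith
  · intro z hz w hw
    rw [← map_sub, LinearIsometryEquiv.norm_map]
    by_cases h : ‖w - z‖ < ε
    · exact (l2 z hz w (by rwa [mem_ball, dist_eq_norm])).trans (hmM2 (by positivity))
    · push Not at h
      rw [← rpow_one ‖w - z‖]
      refine hfar h (by norm_num) (by norm_num) ?_
      have h1 := b1 z hz
      have h2 := b1 w hw
      have h5 := norm_sub_le (R w) (R z)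
      nlinarith
  · intro z hz
    rw [LinearIsometryEquiv.norm_map]
    exact (b1 z hz).trans hmM'
  · intro z hz w hw
    have e : cplx (R w) - cplx (R z) - ((cplx (N := N)).toContinuousLinearEquiv.toContinuousLinearMap.comp (R2 z)) (w - z)
        = cplx (R w - R z - R2 z (w - z)) := by
      rw [map_sub cplx, map_sub cplx]; rfl
    rw [e, LinearIsometryEquiv.norm_map]
    by_cases h : ‖w - z‖ < ε
    · exact (l3 z hz w (by rwa [mem_ball, dist_eq_norm])).trans (hmM2 (by positivity))
    · push Not at h
      refine hfar h (by linarith [hα.1]) (by linarith [hα.2]) ?_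
      have h1 := b1 z hz
      have h2 := b1 w hw
      have h3 : ‖R2 z (w - z)‖ ≤ m * m := ((R2 z).le_opNorm _).trans
        (mul_le_mul (b2 z hz) (b3 z hz w hw) (norm_nonneg _) (by linarith))
      have h4 := norm_sub_le (R w - R z) (R2 z (w - z))
      have h5 := norm_sub_le (R w) (R z)
      nlinarith
  · intro z hz w hw
    rw [← ContinuousLinearMap.comp_sub]
    have h1 : ‖R2 w - R2 z‖ ≤ M * ‖w - z‖ ^ α :=
      (hholder w (hKU hw) z (hKU hz)).trans (by gcongr; exact le4.trans hmM')
    refine (opNorm_le_bound _ (norm_nonneg (R2 w - R2 z)) fun x => ?_).trans h1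
    refine le_trans (le_of_eq ?_) ((R2 w - R2 z).le_opNorm x)
    exact LinearIsometryEquiv.norm_map cplx _
  · intro z hz
    refine (opNorm_le_bound _ (norm_nonneg (R2 z)) fun x => ?_).trans
      ((b2 z hz).trans hmM')
    refine le_trans (le_of_eq ?_) ((R2 z).le_opNorm x)
    exact LinearIsometryEquiv.norm_map cplx _
  · intro z hz x hx
    have e : (((cplx (N := N)).toContinuousLinearEquiv.toContinuousLinearMap.comp (R2 z)) x x).re
        = R2 z x x := cplx_re _ _
    rw [e, cplx_re]
    exact (ltay z hz x hx).trans (hmM2 (by positivity))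
  · intro p hp h
    apply hdne p hp
    exact (cplx (N := N)).injective (by rw [map_zero]; exact h)
  · intro p hp v hv hLv
    have e : ∀ u, (((cplx (N := N)).toContinuousLinearEquiv.toContinuousLinearMap.comp (R2 p)) u u).re
        = R2 p u u := fun u => cplx_re _ _
    rw [e, e]
    have h1 : R p v = 0 := by rw [← cplx_re, hLv]; rfl
    have h2 : R p (I • v) = 0 := by
      have := cplx_im (R p) v; rw [hLv] at this; simpa using this
    have := hlevi p hp v hv h1 h2
    unfold levi at this
    rw [iteratedFDeriv_two_apply, iteratedFDeriv_two_apply] at this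
    simp only [Matrix.cons_val_zero, Matrix.cons_val_one] at this
    linarith

theorem exists_add_mul_ge {X : Type*} [MetricSpace X] {K : Set X} (hK : IsCompact K)
    {f g : X → ℝ} (hf : ContinuousOn f K) (hg : ContinuousOn g K) (hg0 : ∀ x ∈ K, 0 ≤ g x)
    (hpos : ∀ x ∈ K, g x = 0 → 0 < f x) :
    ∃ κ c : ℝ, 0 ≤ κ ∧ 0 < c ∧ ∀ x ∈ K, c ≤ f x + κ * g x := by
  by_contra! H
  have h1 : ∀ n : ℕ, ∃ x ∈ K, f x + n * g x < 1 / (n + 1 : ℝ) := fun n =>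
    H n (1 / (n + 1 : ℝ)) (Nat.cast_nonneg n) (by positivity)
  choose x hx hlt using h1
  obtain ⟨a, ha, φ, hφ, hlim⟩ := hK.tendsto_subseq hx
  have hw : Tendsto (x ∘ φ) atTop (𝓝[K] a) :=
    tendsto_nhdsWithin_iff.mpr ⟨hlim, Eventually.of_forall fun n => hx _⟩
  have hfl : Tendsto (fun n => f (x (φ n))) atTop (𝓝 (f a)) := (hf a ha).tendsto.comp hw
  have hgl : Tendsto (fun n => g (x (φ n))) atTop (𝓝 (g a)) := (hg a ha).tendsto.comp hw
  have hφt : Tendsto φ atTop atTop := hφ.tendsto_atTop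
  have hone : Tendsto (fun n => 1 / ((φ n : ℝ) + 1)) atTop (𝓝 0) :=
    (tendsto_one_div_add_atTop_nhds_zero_nat (𝕜 := ℝ)).comp hφt
  have hfa : f a ≤ 0 := by
    refine le_of_tendsto_of_tendsto' hfl hone fun n => ?_
    have := hlt (φ n)
    have h2 := mul_nonneg (Nat.cast_nonneg (α := ℝ) (φ n)) (hg0 _ (hx (φ n)))
    linarith
  have hga : g a = 0 := by
    refine le_antisymm (not_lt.mp fun hgp => ?_) (hg0 a ha)
    have h3 : Tendsto (fun n => (φ n : ℝ) * g (x (φ n))) atTop atTop :=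
      (tendsto_natCast_atTop_atTop.comp hφt).atTop_mul_pos hgp hgl
    have h4 : Tendsto (fun n => 1 / ((φ n : ℝ) + 1) - f (x (φ n))) atTop (𝓝 (0 - f a)) :=
      hone.sub hfl
    have h5 := h4.eventually_lt_const (show 0 - f a < -f a + 1 by linarith)
    have h6 := h3.eventually_ge_atTop (-f a + 1)
    obtain ⟨n, hn1, hn2⟩ := (h5.and h6).exists
    have := hlt (φ n)
    linarith
  exact absurd (hpos a ha hga) (not_lt.mpr hfa)

section Lin
variable {F : Type*} [NormedAddCommGroup F] [NormedSpace ℂ F] {G : Type*} [NormedAddCommGroup G]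
  [NormedSpace ℂ G]

/-- The complex linear part of a real linear map. -/
def lin (f : G →L[ℝ] F) : G →L[ℂ] F :=
  LinearMap.mkContinuous
    { toFun := fun x => (2:ℂ)⁻¹ • (f x - I • f (I • x))
      map_add' := fun x y => by simp only [smul_add, map_add]; module
      map_smul' := fun c x => by
        have h : ∀ (c : ℂ) (x : G), f (c • x) = c.re • f x + c.im • f (I • x) := by
          intro c x
          conv_lhs => rw [← Complex.re_add_im c]
          rw [add_smul, mul_smul, map_add]
          congr 1
          · rw [coe_smul, map_smul]
          · rw [coe_smul, map_smul]
        have h2 : f (I • c • x) = c.re • f (I • x) - c.im • f x := by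
          rw [smul_comm, h, smul_smul I I, Complex.I_mul_I, neg_one_smul, map_neg]
          module
        rw [h c x, h2]
        simp only [RingHom.id_apply]
        conv_rhs => rw [← Complex.re_add_im c]
        simp only [← coe_smul]
        match_scalars
        · ring_nf
        · ring_nf; simp; try ring }
    ‖f‖ (fun x => by
      simp only [LinearMap.coe_mk, AddHom.coe_mk]
      rw [norm_smul]
      have h1 := norm_sub_le (f x) (I • f (I • x))
      have h2 : ‖I • f (I • x)‖ ≤ ‖f‖ * ‖x‖ := by
        rw [norm_smul, norm_I, one_mul]
        refine (f.le_opNorm _).trans ?_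
        rw [norm_smul, norm_I, one_mul]
      have h3 := f.le_opNorm x
      norm_num
      linarith)

theorem lin_apply (f : G →L[ℝ] F) (x : G) :
    lin f x = (2:ℂ)⁻¹ • (f x - I • f (I • x)) := rfl

theorem norm_lin_le (f : G →L[ℝ] F) : ‖lin f‖ ≤ ‖f‖ :=
  LinearMap.mkContinuous_norm_le _ (norm_nonneg _) _

theorem lin_sub (f g : G →L[ℝ] F) : lin f - lin g = lin (f - g) := by
  ext x
  simp only [sub_apply, lin_apply, smul_sub]
  module

end Lin

namespace Dom

variable {Ω : Set (E N)} {α : ℝ} (D : Dom Ω α)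

/-- The defining function, with positive values inside. -/
def r (z : E N) : ℝ := - D.ρ z

theorem r_pos {z : E N} (hz : z ∈ Ω) : 0 < D.r z := neg_pos.mpr (D.neg z hz)

theorem r_frontier {z : E N} (hz : z ∈ frontier Ω) : D.r z = 0 := by simp [r, D.zero z hz]

theorem mem_or {z : E N} (hz : z ∈ closure Ω) : z ∈ Ω ∨ z ∈ frontier Ω := by
  rw [closure_eq_self_union_frontier] at hz; exact hz

theorem r_nonneg {z : E N} (hz : z ∈ closure Ω) : 0 ≤ D.r z := by
  rcases mem_or hz with h | h
  · exact (D.r_pos h).le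
  · exact (D.r_frontier h).ge

theorem mem_of_pos {z : E N} (hz : z ∈ closure Ω) (h : 0 < D.r z) : z ∈ Ω := by
  rcases mem_or hz with h' | h'
  · exact h'
  · exact absurd (D.r_frontier h') h.ne'

theorem M_pos : 0 < D.M := by linarith [D.one_le_M]

theorem isCompact_closure (D : Dom Ω α) : IsCompact (closure Ω) := D.isBounded.isCompact_closure

theorem r_le {z : E N} (hz : z ∈ closure Ω) : D.r z ≤ D.M :=
  (neg_le_abs _).trans (D.abs_le z hz)

theorem abs_r_sub_le {z w : E N} (hz : z ∈ closure Ω) (hw : w ∈ closure Ω) :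
    |D.r w - D.r z| ≤ 2 * D.M ^ 2 * ‖w - z‖ := by
  have h1 := _root_.abs_le.mp (D.d1 z hz w hw)
  have h2 := D.diam_le z hz w hw
  have h3 : |(D.L z (w - z)).re| ≤ D.M * ‖w - z‖ := (abs_re_le_norm _).trans
    (((D.L z).le_opNorm _).trans (by gcongr; exact D.norm_L z hz))
  have h4 := _root_.abs_le.mp h3
  have h5 := D.one_le_M
  have h6 : ‖w - z‖ ^ 2 ≤ D.M * ‖w - z‖ := by
    rw [sq]; gcongr
  have h7 : D.M * ‖w - z‖ ≤ D.M ^ 2 * ‖w - z‖ := by gcongr; nlinarith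
  have h8 : D.M * ‖w - z‖ ^ 2 ≤ D.M ^ 2 * ‖w - z‖ := by
    calc D.M * ‖w - z‖ ^ 2 ≤ D.M * (D.M * ‖w - z‖) := by gcongr
      _ = _ := by ring
  rw [_root_.abs_le, r, r]
  constructor <;> linarith

theorem continuousOn_r : ContinuousOn D.r (closure Ω) := by
  have : LipschitzOnWith (2 * D.M ^ 2).toNNReal D.r (closure Ω) :=
    LipschitzOnWith.of_dist_le_mul fun w hw z hz => by
      rw [Real.dist_eq, dist_eq_norm, Real.coe_toNNReal _ (by positivity)]
      exact D.abs_r_sub_le hz hw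
  exact this.continuousOn

theorem continuousOn_L : ContinuousOn D.L (closure Ω) := by
  have : LipschitzOnWith D.M.toNNReal D.L (closure Ω) :=
    LipschitzOnWith.of_dist_le_mul fun w hw z hz => by
      rw [dist_eq_norm, dist_eq_norm, Real.coe_toNNReal _ D.M_pos.le]
      exact D.d2 z hz w hw
  exact this.continuousOn

theorem continuousOn_ell : ContinuousOn D.ell (closure Ω) := by
  intro z hz
  have h0 : Tendsto (fun w => D.M * ‖w - z‖ ^ α) (𝓝[closure Ω] z) (𝓝 0) := by
    have h1 : ContinuousAt (fun w : E N => D.M * ‖w - z‖ ^ α) z := by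
      have h2 : ContinuousAt (fun w : E N => ‖w - z‖ ^ α) z :=
        ContinuousAt.rpow_const (by fun_prop) (Or.inr D.α_pos.le)
      exact continuousAt_const.mul h2
    have h3 := h1.tendsto.mono_left (nhdsWithin_le_nhds (s := closure Ω))
    simpa [zero_rpow D.α_pos.ne'] using h3
  refine (tendsto_iff_norm_sub_tendsto_zero (E := E N →L[ℝ] (E N →L[ℂ] ℂ))).mpr ?_
  exact squeeze_zero' (Eventually.of_forall fun w => norm_nonneg (D.ell w - D.ell z))
    (eventually_nhdsWithin_of_forall fun w hw => D.d4 z hz w hw) h0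

/-- `L` is bounded below near the boundary. -/
theorem exists_norm_L_ge : ∃ c ε : ℝ, 0 < c ∧ 0 < ε ∧ ∀ z ∈ closure Ω, D.r z ≤ ε → c ≤ ‖D.L z‖ := by
  obtain ⟨κ, c, hκ, hc, h⟩ := exists_add_mul_ge (f := fun z => ‖D.L z‖) (g := D.r)
    D.isCompact_closure D.continuousOn_L.norm D.continuousOn_r (fun z hz => D.r_nonneg hz) (by
      intro z hz h0
      rcases mem_or hz with h | h
      · exact absurd h0 (D.r_pos h).ne'
      · exact norm_pos_iff.mpr (D.L_ne z h))
  refine ⟨c / 2, c / (2 * (κ + 1)), by positivity, by positivity, fun z hz hr => ?_⟩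
  have h1 := h z hz
  have h2 : κ * D.r z ≤ c / 2 := by
    calc κ * D.r z ≤ (κ + 1) * (c / (2 * (κ + 1))) := by
          gcongr
          · exact D.r_nonneg hz
          · linarith
      _ = c / 2 := by field_simp
  linarith

/-- Existence of bounded transversal vectors near the boundary. -/
theorem exists_normal : ∃ C ε : ℝ, 0 < C ∧ 0 < ε ∧ ∀ z ∈ closure Ω, D.r z ≤ ε →
    ∃ e : E N, D.L z e = 1 ∧ ‖e‖ ≤ C := by
  obtain ⟨c, ε, hc, hε, h⟩ := D.exists_norm_L_ge
  refine ⟨2 / c, ε, by positivity, hε, fun z hz hr => ?_⟩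
  obtain ⟨v, hv, hv2⟩ := (D.L z).exists_lt_apply_of_lt_opNorm
    (show c / 2 < ‖D.L z‖ by linarith [h z hz hr])
  have hne : D.L z v ≠ 0 := by
    intro h0; rw [h0, norm_zero] at hv2; linarith
  refine ⟨(D.L z v)⁻¹ • v, by rw [map_smul, smul_eq_mul, inv_mul_cancel₀ hne], ?_⟩
  rw [norm_smul, norm_inv]
  have hp : 0 < ‖D.L z v‖ := norm_pos_iff.mpr hne
  rw [inv_mul_le_iff₀ hp]
  have : 1 ≤ 2 / c * ‖D.L z v‖ := by
    rw [div_mul_eq_mul_div, le_div_iff₀ hc]; linarith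
  nlinarith

/-- The hermitian part of the second derivative. -/
def herml (z x : E N) : ℝ :=
  ((D.ell z x x).re + (D.ell z (I • x) (I • x)).re) / 2

theorem re_lin_ell (z x : E N) : (D.ell z x x).re = (lin (D.ell z) x x).re + D.herml z x := by
  have h : lin (D.ell z) x x = (2:ℂ)⁻¹ * (D.ell z x x - I * D.ell z (I • x) x) := by
    rw [lin_apply]; rfl
  have h2 : D.ell z (I • x) (I • x) = I * D.ell z (I • x) x := by
    rw [map_smul]; rfl
  have h3 : ((2:ℂ)⁻¹ * (D.ell z x x - I * D.ell z (I • x) x)).re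
      = ((D.ell z x x).re - (I * D.ell z (I • x) x).re) / 2 := by
    rw [show (2:ℂ)⁻¹ = ((2⁻¹ : ℝ) : ℂ) by norm_num, re_ofReal_mul, sub_re]; ring
  rw [h, h3, herml, h2]; ring

theorem continuousOn_apply_ell {f g : E N × E N → E N} (hf : Continuous f) (hg : Continuous g) :
    ContinuousOn (fun p : E N × E N => (D.ell p.1 (f p) (g p)).re) (closure Ω ×ˢ univ) := by
  have h1 : ContinuousOn (fun p : E N × E N => D.ell p.1) (closure Ω ×ˢ univ) :=
    D.continuousOn_ell.comp continuousOn_fst (fun p hp => hp.1)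
  have h2 := h1.clm_apply hf.continuousOn
  have h3 := h2.clm_apply hg.continuousOn
  exact continuous_re.comp_continuousOn h3

/-- Strong positivity of the Levi form in the complex tangential directions. -/
theorem exists_herml_ge : ∃ κ c : ℝ, 0 ≤ κ ∧ 0 < c ∧ ∀ z ∈ closure Ω, ∀ x : E N,
    c * ‖x‖ ^ 2 ≤ D.herml z x + κ * (‖D.L z x‖ ^ 2 + D.r z * ‖x‖ ^ 2) := by
  have hsub : closure Ω ×ˢ sphere (0 : E N) 1 ⊆ closure Ω ×ˢ univ := prod_mono_right (subset_univ _)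
  obtain ⟨κ, c, hκ, hc, h⟩ := exists_add_mul_ge
    (K := closure Ω ×ˢ sphere (0 : E N) 1) (D.isCompact_closure.prod (isCompact_sphere _ _))
    (f := fun p => D.herml p.1 p.2) (g := fun p => ‖D.L p.1 p.2‖ ^ 2 + D.r p.1)
    (((D.continuousOn_apply_ell continuous_snd continuous_snd).add
      (D.continuousOn_apply_ell (continuous_snd.const_smul I)
        (continuous_snd.const_smul I))).div_const 2 |>.mono hsub)
    (by
      refine ContinuousOn.add ?_ (D.continuousOn_r.comp continuousOn_fst fun p hp => hp.1)
      refine ContinuousOn.pow (ContinuousOn.norm ?_) 2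
      have h1 : ContinuousOn (fun p : E N × E N => D.L p.1) (closure Ω ×ˢ sphere (0 : E N) 1) :=
        D.continuousOn_L.comp continuousOn_fst (fun p hp => hp.1)
      exact h1.clm_apply continuousOn_snd)
    (fun p hp => add_nonneg (by positivity) (D.r_nonneg hp.1))
    (by
      rintro ⟨z, x⟩ ⟨hz, hx⟩ h0
      have hz' : z ∈ closure Ω := hz
      have hr := D.r_nonneg hz'
      simp only at h0 ⊢
      have h1 : ‖D.L z x‖ ^ 2 = 0 := by nlinarith [sq_nonneg ‖D.L z x‖]
      have h2 : D.r z = 0 := by nlinarith [sq_nonneg ‖D.L z x‖]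
      have hzf : z ∈ frontier Ω := by
        rcases mem_or hz' with h | h
        · exact absurd h2 (D.r_pos h).ne'
        · exact h
      have hx0 : x ≠ 0 := by
        rintro rfl; simp at hx
      have := D.levi_pos z hzf x hx0 (by simpa using h1)
      rw [herml]; linarith)
  refine ⟨κ, c, hκ, hc, fun z hz x => ?_⟩
  rcases eq_or_ne x 0 with rfl | hx
  · simp [herml]
  have hn : 0 < ‖x‖ := norm_pos_iff.mpr hx
  set y : E N := (‖x‖⁻¹ : ℝ) • x with hy
  have hxy : x = (‖x‖ : ℝ) • y := by rw [hy, smul_smul, mul_inv_cancel₀ hn.ne', one_smul]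
  have hy1 : y ∈ sphere (0 : E N) 1 := by
    rw [mem_sphere_zero_iff_norm, hy, norm_smul, norm_inv, norm_norm, inv_mul_cancel₀ hn.ne']
  have h1 := h (z, y) ⟨hz, hy1⟩
  simp only at h1
  have h2 : D.herml z x = ‖x‖ ^ 2 * D.herml z y := by
    have e : ∀ (t : ℝ) (u : E N), (D.ell z (t • u) (t • u)).re = t ^ 2 * (D.ell z u u).re := by
      intro t u
      have h1 : D.ell z (t • u) = t • D.ell z u := map_smul _ _ _
      have h2 : D.ell z u (t • u) = t • D.ell z u u := by
        rw [← coe_smul t u, map_smul, ← coe_smul]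
      rw [h1, smul_apply, h2, smul_smul, Complex.smul_re, smul_eq_mul]; ring
    have e2 : I • x = (‖x‖ : ℝ) • (I • y) := by
      rw [smul_comm, ← hxy]
    have e3 : (D.ell z x x).re = ‖x‖ ^ 2 * (D.ell z y y).re := by
      rw [← e, ← hxy]
    rw [herml, herml, e2, e, e3]; ring
  have h3 : ‖D.L z x‖ = ‖x‖ * ‖D.L z y‖ := by
    conv_lhs => rw [hxy]
    rw [← coe_smul, map_smul, norm_smul]; simp
  rw [h2, h3]
  nlinarith [mul_le_mul_of_nonneg_left h1 (sq_nonneg ‖x‖)]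

set_option maxHeartbeats 1000000 in
/-- Holomorphic support polynomials. -/
theorem exists_levi_poly : ∃ (Q : E N → E N → ℂ) (C c ε : ℝ), 0 < C ∧ 0 < c ∧ 0 < ε ∧
    (∀ z, Differentiable ℂ (Q z)) ∧
    (∀ z ∈ closure Ω, ∀ x, ‖Q z x‖ ≤ C * ‖x‖ ^ 2) ∧
    (∀ p ∈ closure Ω, ∀ q ∈ closure Ω, ∀ x, ‖Q p x - Q q x‖ ≤ C * ‖p - q‖ ^ α * ‖x‖ ^ 2) ∧
    (∀ z ∈ closure Ω, ∀ x, D.r z ≤ ε → ‖x‖ ≤ ε → z + x ∈ closure Ω →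
      (D.L z x + Q z x / 2).re ≤ 3 / 2 * D.r z - D.r (z + x) / 2 - c * ‖x‖ ^ 2) := by
  obtain ⟨κ, c, hκ, hc, hB⟩ := D.exists_herml_ge
  have hM := D.M_pos
  have hM1 := D.one_le_M
  obtain ⟨ε, hε, hεb⟩ : ∃ ε > 0, ε ≤ D.ε / 2 ∧ κ * ε ≤ c / 2 ∧ 4 * κ * ε ≤ 1 ∧
      2 * κ * (2 * D.M ^ 2 * ε) ≤ 1 / 4 ∧ D.M * ε ^ α ≤ c / 16 ∧ 2 * κ * D.M ^ 2 * ε ^ 2 ≤ c / 16 := by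
    have hcont : ∀ f : ℝ → ℝ, Continuous f → f 0 = 0 → ∀ b > 0, ∀ᶠ t in 𝓝[>] (0:ℝ), f t ≤ b := by
      intro f hf h0 b hb
      have : ∀ᶠ t in 𝓝 (0:ℝ), f t < b := by
        refine (hf.tendsto 0).eventually_lt_const (by rw [h0]; exact hb)
      exact (this.filter_mono nhdsWithin_le_nhds).mono fun t ht => ht.le
    have e1 := hcont (fun t => t) continuous_id rfl (D.ε / 2) (by linarith [D.ε_pos])
    have e2 := hcont (fun t => κ * t) (by fun_prop) (by simp) (c / 2) (by linarith)
    have e3 := hcont (fun t => 4 * κ * t) (by fun_prop) (by simp) 1 (by norm_num)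
    have e4 := hcont (fun t => 2 * κ * (2 * D.M ^ 2 * t)) (by fun_prop) (by simp) (1/4) (by norm_num)
    have e5 := hcont (fun t => D.M * t ^ α)
      (continuous_const.mul (Real.continuous_rpow_const D.α_pos.le))
      (by simp [zero_rpow D.α_pos.ne']) (c / 16) (by linarith)
    have e6 := hcont (fun t => 2 * κ * D.M ^ 2 * t ^ 2) (by fun_prop) (by simp) (c / 16) (by linarith)
    have e0 : ∀ᶠ t in 𝓝[>] (0:ℝ), 0 < t := self_mem_nhdsWithin
    obtain ⟨t, ht, h⟩ := (e0.and (e1.and (e2.and (e3.and (e4.and (e5.and e6)))))).exists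
    exact ⟨t, ht, h⟩
  obtain ⟨b1, b2, b3, b4, b5, b6⟩ := hεb
  refine ⟨fun z x => lin (D.ell z) x x + κ * (D.L z x) ^ 2, D.M + 2 * κ * D.M ^ 2 + 2 * κ * D.M ^ 3,
    c / 16, ε, by positivity, by positivity, hε, ?_, ?_, ?_, ?_⟩
  · intro z; fun_prop
  · intro z hz x
    have h1 : ‖lin (D.ell z) x x‖ ≤ D.M * ‖x‖ ^ 2 := by
      calc ‖lin (D.ell z) x x‖ ≤ ‖lin (D.ell z)‖ * ‖x‖ * ‖x‖ := (lin (D.ell z)).le_opNorm₂ x x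
        _ ≤ D.M * ‖x‖ * ‖x‖ := by gcongr; exact (norm_lin_le _).trans (D.norm_ell z hz)
        _ = _ := by ring
    have h2 : ‖(κ : ℂ) * (D.L z x) ^ 2‖ ≤ κ * D.M ^ 2 * ‖x‖ ^ 2 := by
      rw [norm_mul, norm_pow, norm_real, norm_of_nonneg hκ, mul_assoc, ← mul_pow]
      gcongr
      exact ((D.L z).le_opNorm x).trans (by gcongr; exact D.norm_L z hz)
    refine (norm_add_le _ _).trans ?_
    have : 0 ≤ (κ * D.M ^ 2 + 2 * κ * D.M ^ 3) * ‖x‖ ^ 2 := by positivity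
    linarith
  · intro p hp q hq x
    have hn : ‖p - q‖ ≤ D.M * ‖p - q‖ ^ α := by
      have h1 := D.diam_le q hq p hp
      rcases le_total ‖p - q‖ 1 with h | h
      · calc ‖p - q‖ = ‖p - q‖ ^ (1:ℝ) := (rpow_one _).symm
          _ ≤ ‖p - q‖ ^ α := Real.rpow_le_rpow_of_exponent_ge' (norm_nonneg _) h D.α_pos.le D.α_le
          _ ≤ D.M * ‖p - q‖ ^ α := le_mul_of_one_le_left (by positivity) hM1
      · calc ‖p - q‖ ≤ D.M * 1 := by linarith
          _ ≤ D.M * ‖p - q‖ ^ α := by gcongr; exact Real.one_le_rpow h D.α_pos.le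
    have e : lin (D.ell p) x x + κ * (D.L p x) ^ 2 - (lin (D.ell q) x x + κ * (D.L q x) ^ 2)
        = lin (D.ell p - D.ell q) x x + κ * ((D.L p - D.L q) x * ((D.L p + D.L q) x)) := by
      rw [← lin_sub]; simp only [sub_apply, add_apply]; ring
    rw [e]
    have h1 : ‖lin (D.ell p - D.ell q) x x‖ ≤ D.M * ‖p - q‖ ^ α * ‖x‖ ^ 2 := by
      calc ‖lin (D.ell p - D.ell q) x x‖ ≤ ‖lin (D.ell p - D.ell q)‖ * ‖x‖ * ‖x‖ :=
            (lin (D.ell p - D.ell q)).le_opNorm₂ x x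
        _ ≤ D.M * ‖p - q‖ ^ α * ‖x‖ * ‖x‖ := by
            gcongr; exact (norm_lin_le _).trans (D.d4 q hq p hp)
        _ = _ := by ring
    have h2 : ‖(D.L p - D.L q) x‖ ≤ D.M * (D.M * ‖p - q‖ ^ α) * ‖x‖ := by
      refine ((D.L p - D.L q).le_opNorm x).trans ?_
      gcongr
      exact (D.d2 q hq p hp).trans (by gcongr)
    have h3 : ‖(D.L p + D.L q) x‖ ≤ (2 * D.M) * ‖x‖ := by
      refine ((D.L p + D.L q).le_opNorm x).trans ?_
      gcongr
      exact (norm_add_le _ _).trans (by linarith [D.norm_L p hp, D.norm_L q hq])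
    refine (norm_add_le _ _).trans ?_
    rw [norm_mul, norm_mul, norm_real, norm_of_nonneg hκ]
    have h4 : κ * (‖(D.L p - D.L q) x‖ * ‖(D.L p + D.L q) x‖) ≤
        κ * ((D.M * (D.M * ‖p - q‖ ^ α) * ‖x‖) * ((2 * D.M) * ‖x‖)) := by gcongr
    have : 0 ≤ 2 * κ * D.M ^ 2 * ‖p - q‖ ^ α * ‖x‖ ^ 2 := by positivity
    nlinarith
  · intro z hz x hr hx hzx
    have hεx : ‖x‖ < D.ε := by linarith [D.ε_pos]
    have hrz := D.r_nonneg hz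
    have hrw := D.r_nonneg hzx
    have t1 := _root_.abs_le.mp (D.taylor z hz x hεx)
    have t2 := _root_.abs_le.mp (D.d1_ball z hz x hεx)
    have t3 := hB z hz x
    have t4 := D.re_lin_ell z x
    have t5 := _root_.abs_le.mp (D.abs_r_sub_le hz hzx)
    rw [add_sub_cancel_left] at t5
    set a := (D.L z x).re with ha
    set Δ := D.r z - D.r (z + x) with hΔ
    have eΔ : D.ρ (z + x) - D.ρ z = Δ := by rw [hΔ, r, r]; ring
    rw [eΔ] at t1 t2
    have hx2 : ‖x‖ ^ (2 + α) ≤ ε ^ α * ‖x‖ ^ 2 := by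
      rw [Real.rpow_add_of_nonneg (norm_nonneg _) (by norm_num) D.α_pos.le, mul_comm]
      norm_cast
      gcongr
      exact D.α_pos.le
    have hx3 : D.M * ‖x‖ ^ (2 + α) ≤ c / 16 * ‖x‖ ^ 2 := by
      calc D.M * ‖x‖ ^ (2 + α) ≤ (D.M * ε ^ α) * ‖x‖ ^ 2 := by rw [mul_assoc]; gcongr
        _ ≤ _ := by gcongr
    have hx4 : ‖x‖ ^ 2 ≤ ε ^ 2 := by gcongr
    have hX : 0 ≤ ‖x‖ ^ 2 := by positivity
    have hre : (D.L z x + (lin (D.ell z) x x + κ * (D.L z x) ^ 2) / 2).re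
        = a + (lin (D.ell z) x x).re / 2 + κ * (a ^ 2 - ‖D.L z x‖ ^ 2 / 2) := by
      rw [sq_norm, normSq_apply, ha, add_re]
      rw [show (lin (D.ell z) x x + κ * (D.L z x) ^ 2) / 2 =
        ((2⁻¹ : ℝ) : ℂ) * lin (D.ell z) x x + ((κ / 2 : ℝ) : ℂ) * (D.L z x * D.L z x) by
          push_cast; ring]
      rw [add_re, re_ofReal_mul, re_ofReal_mul, Complex.mul_re]
      ring
    rw [hre]
    -- bound on `a ^ 2`
    have ha2 : a ^ 2 ≤ 2 * Δ ^ 2 + 2 * (D.M * ‖x‖ ^ 2) ^ 2 := by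
      have h1 : |a| ≤ |Δ| + D.M * ‖x‖ ^ 2 := by
        rw [_root_.abs_le]
        constructor <;> linarith [le_abs_self Δ, neg_abs_le Δ]
      have h2 : a ^ 2 ≤ (|Δ| + D.M * ‖x‖ ^ 2) ^ 2 := by
        rw [← sq_abs a]; gcongr
      nlinarith [sq_nonneg (|Δ| - D.M * ‖x‖ ^ 2), sq_abs Δ]
    have hκΔ : κ * (2 * Δ ^ 2) ≤ |Δ| / 2 := by
      have h1 : |Δ| ≤ 2 * D.M ^ 2 * ε := by
        have : |Δ| ≤ 2 * D.M ^ 2 * ‖x‖ := by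
          rw [_root_.abs_le]; constructor <;> linarith
        exact this.trans (by gcongr)
      have h2 : κ * (2 * Δ ^ 2) = (2 * κ * |Δ|) * |Δ| := by rw [← sq_abs Δ]; ring
      rw [h2]
      have h3 : 2 * κ * |Δ| ≤ 1 / 2 := by
        have : 2 * κ * |Δ| ≤ 2 * κ * (2 * D.M ^ 2 * ε) := by gcongr
        linarith
      nlinarith [abs_nonneg Δ]
    have hκx : κ * (2 * (D.M * ‖x‖ ^ 2) ^ 2) ≤ c / 16 * ‖x‖ ^ 2 := by
      have : κ * (2 * (D.M * ‖x‖ ^ 2) ^ 2) = (2 * κ * D.M ^ 2 * ‖x‖ ^ 2) * ‖x‖ ^ 2 := by ring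
      rw [this]
      gcongr
      exact le_trans (by gcongr) b6
    have hκr : κ * (D.r z * ‖x‖ ^ 2) ≤ c / 2 * ‖x‖ ^ 2 := by
      rw [← mul_assoc]
      gcongr
      exact le_trans (by gcongr) b2
    have hκa : κ * a ^ 2 ≤ |Δ| / 2 + c / 16 * ‖x‖ ^ 2 := by
      have := mul_le_mul_of_nonneg_left ha2 hκ
      linarith
    have hΔ3 : Δ + |Δ| / 2 ≤ 3 / 2 * D.r z - D.r (z + x) / 2 := by
      rcases abs_cases Δ with ⟨h, _⟩ | ⟨h, _⟩ <;> rw [h] <;> linarith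
    linarith

end Dom

theorem herm_eq_inner (a b : E N) : herm a b = inner ℂ b a := by
  simp [herm, PiLp.inner_apply]

theorem norm_herm_le (a b : E N) : ‖herm a b‖ ≤ ‖a‖ * ‖b‖ := by
  rw [herm_eq_inner, mul_comm]; exact norm_inner_le_norm _ _

theorem herm_self (a : E N) : herm a a = (‖a‖ : ℂ) ^ 2 := by
  rw [herm_eq_inner, inner_self_eq_norm_sq_to_K]; rfl

theorem bdist_le_of_notMem {Ω : Set (E N)} {z y : E N} (hz : z ∈ Ω) (hy : y ∉ Ω) :
    bdist Ω z ≤ ‖y - z‖ := by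
  obtain ⟨q, hq, h⟩ := exists_mem_frontier_infDist_compl_eq_dist hz
    (fun h : Ω = univ => hy (h ▸ mem_univ y))
  calc bdist Ω z ≤ dist z q := infDist_le_dist_of_mem hq
    _ = infDist z Ωᶜ := h.symm
    _ ≤ dist z y := infDist_le_dist_of_mem hy
    _ = ‖y - z‖ := by rw [dist_comm, dist_eq_norm]

namespace Dom

variable {Ω : Set (E N)} {α : ℝ} (D : Dom Ω α)

theorem exists_bdist_le : ∃ C > 0, ∀ z ∈ Ω, bdist Ω z ≤ C * D.r z := by
  obtain ⟨C, ε, hC, hε, h⟩ := D.exists_normal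
  have hM := D.M_pos
  set ε' := min ε (min (1 / (8 * D.M * C ^ 2)) (D.ε / (4 * C))) with hε'
  have hε0 : 0 < ε' := by
    have := D.ε_pos
    rw [hε']; positivity
  refine ⟨max (2 * C) (D.M / ε'), by positivity, fun z hz => ?_⟩
  have hzc := subset_closure hz
  have hr := D.r_pos hz
  rcases le_total (D.r z) ε' with hle | hge
  · obtain ⟨e, he, heC⟩ := h z hzc (hle.trans (min_le_left _ _))
    have h1 : D.r z ≤ 1 / (8 * D.M * C ^ 2) := hle.trans ((min_le_right _ _).trans (min_le_left _ _))
    have h2 : D.r z ≤ D.ε / (4 * C) := hle.trans ((min_le_right _ _).trans (min_le_right _ _))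
    rw [le_div_iff₀ (by positivity)] at h1 h2
    set x : E N := ((2 * D.r z : ℝ) : ℂ) • e with hx
    have hxn : ‖x‖ ≤ 2 * C * D.r z := by
      rw [hx, norm_smul, norm_real, norm_of_nonneg (by positivity)]
      nlinarith
    have hxε : ‖x‖ < D.ε := by nlinarith [D.ε_pos]
    have h3 := _root_.abs_le.mp (D.d1_ball z hzc x hxε)
    have h4 : (D.L z x).re = 2 * D.r z := by
      rw [hx, map_smul, he, smul_eq_mul, mul_one, ofReal_re]
    have h5 : D.M * ‖x‖ ^ 2 ≤ D.M * (2 * C * D.r z) ^ 2 := by gcongr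
    have h6 : D.ρ z = - D.r z := by rw [r, neg_neg]
    have h7 : 0 < D.ρ (z + x) := by nlinarith
    have h8 : z + x ∉ Ω := fun hm => by linarith [D.neg _ hm]
    have := bdist_le_of_notMem hz h8
    rw [add_sub_cancel_left] at this
    refine (this.trans hxn).trans ?_
    gcongr
    exact le_max_left _ _
  · by_cases hne : (frontier Ω).Nonempty
    · obtain ⟨p, hp⟩ := hne
      calc bdist Ω z ≤ dist z p := infDist_le_dist_of_mem hp
        _ ≤ D.M := by rw [dist_comm, dist_eq_norm]; exact D.diam_le z hzc p (frontier_subset_closure hp)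
        _ = D.M / ε' * ε' := by field_simp
        _ ≤ max (2 * C) (D.M / ε') * D.r z := by gcongr; exact le_max_right _ _
    · rw [not_nonempty_iff_eq_empty] at hne
      rw [bdist, hne, infDist_empty]; positivity

theorem r_le_bdist {π : E N → E N} (hπ : IsClosestPointSelection Ω π) {z : E N} (hz : z ∈ Ω) :
    D.r z ≤ 2 * D.M ^ 2 * bdist Ω z := by
  obtain ⟨h1, h2⟩ := hπ z hz
  have := D.abs_r_sub_le (subset_closure hz) (frontier_subset_closure h1)
  rw [D.r_frontier h1, zero_sub, abs_neg, abs_of_pos (D.r_pos hz), ← dist_eq_norm, dist_comm, h2] at this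
  exact this

theorem L_eq_herm {π : E N → E N} (hπ : IsClosestPointSelection Ω π) {z : E N} (hz : z ∈ Ω)
    (v : E N) : ‖D.L (π z) v‖ = ncomp Ω π z v * ‖D.L (π z)‖ := by
  obtain ⟨h1, h2⟩ := hπ z hz
  set p := π z with hp
  set w := p - z with hw
  have hpc : p ∈ closure Ω := frontier_subset_closure h1
  have hδ : ‖w‖ = bdist Ω z := by rw [← h2, dist_comm, dist_eq_norm]
  have hwpos : 0 < ‖w‖ := by
    rw [norm_pos_iff, hw, sub_ne_zero]
    rintro h
    rw [D.isOpen.frontier_eq] at h1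
    exact h1.2 (h ▸ hz)
  have hball : ∀ y, ‖y - z‖ < ‖w‖ → y ∈ Ω := fun y hy => by
    by_contra hc
    have := bdist_le_of_notMem hz hc
    linarith
  -- directions pointing into the ball
  have key : ∀ u : E N, (herm u w).re < 0 → (D.L p u).re ≤ 0 := by
    intro u hu
    by_contra! hc
    have hcont : Tendsto (fun t : ℝ => (D.L p u).re - t * (D.M * ‖u‖ ^ 2)) (𝓝[>] 0)
        (𝓝 ((D.L p u).re)) := by
      have : ContinuousAt (fun t : ℝ => (D.L p u).re - t * (D.M * ‖u‖ ^ 2)) 0 := by fun_prop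
      simpa using this.tendsto.mono_left nhdsWithin_le_nhds
    have hcont2 : Tendsto (fun t : ℝ => 2 * (herm u w).re + t * ‖u‖ ^ 2) (𝓝[>] 0)
        (𝓝 (2 * (herm u w).re)) := by
      have : ContinuousAt (fun t : ℝ => 2 * (herm u w).re + t * ‖u‖ ^ 2) 0 := by fun_prop
      simpa using this.tendsto.mono_left nhdsWithin_le_nhds
    have hcont3 : Tendsto (fun t : ℝ => t * ‖u‖) (𝓝[>] 0) (𝓝 0) := by
      have : ContinuousAt (fun t : ℝ => t * ‖u‖) 0 := by fun_prop
      simpa using this.tendsto.mono_left nhdsWithin_le_nhds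
    have e0 : ∀ᶠ t in 𝓝[>] (0:ℝ), 0 < t := self_mem_nhdsWithin
    obtain ⟨t, ht, a1, a2, a3⟩ := (e0.and ((hcont.eventually_const_lt hc).and
      ((hcont2.eventually_lt_const (show 2 * (herm u w).re < 0 by linarith)).and
      (hcont3.eventually_lt_const D.ε_pos)))).exists
    have hn : ‖(t : ℂ) • u‖ = t * ‖u‖ := by
      rw [norm_smul, norm_real, norm_of_nonneg ht.le]
    have hmem : p + (t : ℂ) • u ∈ Ω := by
      refine hball _ ?_
      have e : p + (t : ℂ) • u - z = w + (t : ℂ) • u := by rw [hw]; abel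
      rw [e]
      have hsq : ‖w + (t : ℂ) • u‖ ^ 2 = ‖w‖ ^ 2 + 2 * (t * (herm u w).re) + (t * ‖u‖) ^ 2 := by
        rw [norm_add_sq (𝕜 := ℂ), hn, inner_smul_right, ← herm_eq_inner]
        congr 3
        exact re_ofReal_mul _ _
      refine lt_of_pow_lt_pow_left₀ 2 hwpos.le ?_
      rw [hsq]
      nlinarith
    have h3 := _root_.abs_le.mp (D.d1_ball p hpc ((t : ℂ) • u) (by rw [hn]; exact a3))
    rw [map_smul, smul_eq_mul, re_ofReal_mul, hn, D.zero p h1] at h3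
    have h4 := D.neg _ hmem
    nlinarith
  have key2 : ∀ u : E N, (herm u w).re = 0 → (D.L p u).re ≤ 0 := by
    intro u hu
    by_contra! hc
    have hcont : Tendsto (fun t : ℝ => (D.L p u).re - t * (D.L p w).re) (𝓝[>] 0)
        (𝓝 ((D.L p u).re)) := by
      have : ContinuousAt (fun t : ℝ => (D.L p u).re - t * (D.L p w).re) 0 := by fun_prop
      simpa using this.tendsto.mono_left nhdsWithin_le_nhds
    have e0 : ∀ᶠ t in 𝓝[>] (0:ℝ), 0 < t := self_mem_nhdsWithin
    obtain ⟨t, ht, a1⟩ := (e0.and (hcont.eventually_const_lt hc)).exists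
    have h1 := key (u - (t : ℂ) • w) (by
      have e : herm (u - (t : ℂ) • w) w = herm u w - t * herm w w := by
        simp only [herm_eq_inner, inner_sub_right, inner_smul_right]
      rw [e, herm_self, sub_re, hu]
      have : ((t : ℂ) * (‖w‖ : ℂ) ^ 2).re = t * ‖w‖ ^ 2 := by
        rw [← Complex.ofReal_pow, ← ofReal_mul, ofReal_re]
      rw [this]
      have : 0 < t * ‖w‖ ^ 2 := by positivity
      linarith)
    rw [map_sub, map_smul, smul_eq_mul, sub_re, re_ofReal_mul] at h1
    linarith
  have key3 : ∀ u : E N, herm u w = 0 → D.L p u = 0 := by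
    have hs : ∀ (c : ℂ) (u : E N), herm u w = 0 → (D.L p (c • u)).re ≤ 0 := fun c u hu =>
      key2 _ (by rw [herm_eq_inner, inner_smul_right, ← herm_eq_inner, hu]; simp)
    intro u hu
    have a1 := hs 1 u hu
    have a2 := hs (-1) u hu
    have a3 := hs I u hu
    have a4 := hs (-I) u hu
    simp only [map_smul, smul_eq_mul, neg_mul, one_mul, neg_re, Complex.mul_re,
      Complex.I_re, Complex.I_im, zero_mul] at a1 a2 a3 a4
    apply Complex.ext
    · simp; linarith
    · simp; linarith
  have hw2 : (‖w‖ : ℂ) ^ 2 ≠ 0 := by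
    exact_mod_cast (pow_pos hwpos 2).ne'
  have key4 : ∀ v, D.L p v = herm v w / (‖w‖ : ℂ) ^ 2 * D.L p w := by
    intro v
    have := key3 (v - (herm v w / (‖w‖ : ℂ) ^ 2) • w) (by
      rw [herm_eq_inner, inner_sub_right, inner_smul_right, ← herm_eq_inner, ← herm_eq_inner,
        herm_self, div_mul_cancel₀ _ hw2, sub_self])
    rw [map_sub, map_smul, smul_eq_mul, sub_eq_zero] at this
    exact this
  have key5 : ∀ v, ‖D.L p v‖ = ‖herm v w‖ / ‖w‖ * (‖D.L p w‖ / ‖w‖) := by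
    intro v
    rw [key4 v, norm_mul, norm_div, norm_pow, norm_real, norm_norm]
    field_simp
  have hnorm : ‖D.L p‖ = ‖D.L p w‖ / ‖w‖ := by
    apply le_antisymm
    · refine opNorm_le_bound _ (by positivity) fun v => ?_
      rw [key5 v, mul_comm]
      gcongr
      exact div_le_of_le_mul₀ (norm_nonneg _) (norm_nonneg _) (norm_herm_le _ _)
    · exact (D.L p).ratio_le_opNorm w
  rw [key5, hnorm, ncomp, ← hδ]

/-- The complex normal component is comparable with `L`. -/
theorem exists_ncomp_comparison {π : E N → E N} (hπ : IsClosestPointSelection Ω π) :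
    ∃ C > 0, ∀ z ∈ Ω, ∀ v, ncomp Ω π z v ≤ C * (‖D.L z v‖ + bdist Ω z * ‖v‖) ∧
      ‖D.L z v‖ ≤ C * (ncomp Ω π z v + bdist Ω z * ‖v‖) := by
  obtain ⟨c, ε, hc, hε, h⟩ := D.exists_norm_L_ge
  have hM := D.M_pos
  refine ⟨max ((1 + D.M) / c) D.M, by positivity, fun z hz v => ?_⟩
  obtain ⟨h1, h2⟩ := hπ z hz
  have hpc := frontier_subset_closure h1
  have hzc := subset_closure hz
  have e := D.L_eq_herm hπ hz v
  have hd : ‖D.L (π z) v - D.L z v‖ ≤ D.M * (bdist Ω z * ‖v‖) := by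
    have := (D.L (π z) - D.L z).le_opNorm v
    rw [sub_apply] at this
    refine this.trans ?_
    rw [← mul_assoc]
    gcongr
    have := D.d2 z hzc _ hpc
    rwa [← dist_eq_norm (π z), dist_comm, h2] at this
  have hδ : 0 ≤ bdist Ω z := infDist_nonneg
  have hn : 0 ≤ ncomp Ω π z v := div_nonneg (norm_nonneg _) hδ
  have hL1 : c ≤ ‖D.L (π z)‖ := h _ hpc (by rw [D.r_frontier h1]; exact hε.le)
  have hL2 := D.norm_L _ hpc
  have t1 := norm_sub_norm_le (D.L (π z) v) (D.L z v)
  have t2 := norm_sub_norm_le (D.L z v) (D.L (π z) v)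
  rw [norm_sub_rev] at t2
  have hδv : 0 ≤ bdist Ω z * ‖v‖ := by positivity
  have hLz := norm_nonneg (D.L z v)
  constructor
  · calc ncomp Ω π z v ≤ (1 + D.M) / c * (‖D.L z v‖ + bdist Ω z * ‖v‖) := by
          rw [div_mul_eq_mul_div, le_div_iff₀ hc]
          nlinarith
      _ ≤ _ := by gcongr; exact le_max_left _ _
  · calc ‖D.L z v‖ ≤ D.M * (ncomp Ω π z v + bdist Ω z * ‖v‖) := by nlinarith
      _ ≤ _ := by gcongr; exact le_max_right _ _

end Dom

theorem phd_comm (s t : ℂ) : phd s t = phd t s := by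
  unfold phd
  rw [norm_div, norm_div, norm_sub_rev]
  congr 1
  rw [← Complex.norm_conj]
  congr 1
  simp [mul_comm]

theorem artanh_phd_real {s t : ℝ} (hs : -1 < s) (hst : s ≤ t) (ht : t < 1) :
    artanh (phd s t) = log ((1 + t) * (1 - s) / ((1 - t) * (1 + s))) / 2 := by
  have h1 : 0 < 1 - s * t := by nlinarith
  have h2 : phd s t = (t - s) / (1 - s * t) := by
    unfold phd
    rw [Complex.conj_ofReal, norm_div, ← ofReal_sub, ← ofReal_mul,
      ← ofReal_one, ← ofReal_sub, norm_real, norm_real,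
      norm_of_nonneg h1.le, norm_eq_abs, abs_sub_comm, abs_of_nonneg (by linarith)]
  have h3 : 0 < (1 - t) * (1 + s) := mul_pos (by linarith) (by linarith)
  rw [artanh, h2]
  congr 2
  have h4 : 1 + (t - s) / (1 - s * t) = (1 + t) * (1 - s) / (1 - s * t) := by
    rw [eq_div_iff h1.ne', add_mul, div_mul_cancel₀ _ h1.ne']; ring
  have h5 : 1 - (t - s) / (1 - s * t) = (1 - t) * (1 + s) / (1 - s * t) := by
    rw [eq_div_iff h1.ne', sub_mul, div_mul_cancel₀ _ h1.ne']; ring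
  rw [h4, h5, div_div_div_cancel_right₀ h1.ne']

theorem KLe.of_disc₂_symm {Ω : Set (E N)} {ψ : ℂ → E N} (h1 : DifferentiableOn ℂ ψ 𝔻)
    (h2 : MapsTo ψ 𝔻 Ω) {s t : ℂ} (hs : s ∈ 𝔻) (ht : t ∈ 𝔻)
    {r : ℝ} (hr : artanh (phd s t) ≤ r) : KLe Ω (ψ s) (ψ t) r ∧ KLe Ω (ψ t) (ψ s) r :=
  ⟨(KLe.of_disc₂ h1 h2 hs ht).mono hr, (KLe.of_disc₂ h1 h2 ht hs).mono (by rwa [phd_comm])⟩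

namespace Dom

variable {Ω : Set (E N)} {α : ℝ} (D : Dom Ω α)

/-- Affine discs through a point, of size adapted to the geometry. -/
theorem exists_affine_disc : ∃ c > 0, ∀ z ∈ Ω, ∀ x : E N, ∀ θ : ℝ, 0 < θ → θ < 1 →
    ‖D.L z x‖ ≤ θ * D.r z / 4 → ‖x‖ ≤ θ * c * √(D.r z) →
    z + x ∈ Ω ∧ KLe Ω z (z + x) (artanh θ) ∧ KLe Ω (z + x) z (artanh θ) := by
  have hM := D.M_pos
  have hε := D.ε_pos
  refine ⟨min (1 / (2 * √D.M)) (D.ε / (2 * √D.M)), by positivity, fun z hz x θ hθ hθ1 hL hx => ?_⟩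
  set c := min (1 / (2 * √D.M)) (D.ε / (2 * √D.M)) with hc
  have hcp : 0 < c := by positivity
  have hr := D.r_pos hz
  have hzc := subset_closure hz
  have hsM : 0 < √D.M := sqrt_pos.mpr hM
  have hc1 : D.M * c ^ 2 ≤ 1 / 4 := by
    have : c ≤ 1 / (2 * √D.M) := min_le_left _ _
    rw [le_div_iff₀ (by positivity)] at this
    have h2 : (c * (2 * √D.M)) ^ 2 ≤ 1 ^ 2 := by gcongr
    nlinarith [sq_sqrt hM.le]
  have hc2 : c * √D.M ≤ D.ε / 2 := by
    have : c ≤ D.ε / (2 * √D.M) := min_le_right _ _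
    rw [le_div_iff₀ (by positivity)] at this
    linarith
  set ψ : ℂ → E N := fun ζ => z + (ζ * (θ⁻¹ : ℝ)) • x with hψ
  have hmaps : MapsTo ψ 𝔻 Ω := by
    intro ζ hζ
    have hζ1 := norm_lt_one_of_mem_ball hζ
    have hn : ‖(ζ * (θ⁻¹ : ℝ)) • x‖ ≤ c * √(D.r z) := by
      rw [norm_smul, norm_mul, norm_real, norm_of_nonneg (by positivity)]
      calc ‖ζ‖ * θ⁻¹ * ‖x‖ ≤ 1 * θ⁻¹ * (θ * c * √(D.r z)) := by gcongr
        _ = c * √(D.r z) := by field_simp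
    have hnε : ‖(ζ * (θ⁻¹ : ℝ)) • x‖ < D.ε := by
      have : c * √(D.r z) ≤ c * √D.M := by gcongr; exact D.r_le hzc
      linarith
    refine D.mem z hzc _ hnε ?_
    have h1 := _root_.abs_le.mp (D.d1_ball z hzc _ hnε)
    have h2 : (D.L z ((ζ * (θ⁻¹ : ℝ)) • x)).re ≤ D.r z / 4 := by
      refine (re_le_norm _).trans ?_
      rw [map_smul, norm_smul, norm_mul, norm_real, norm_of_nonneg (by positivity)]
      calc ‖ζ‖ * θ⁻¹ * ‖D.L z x‖ ≤ 1 * θ⁻¹ * (θ * D.r z / 4) := by gcongr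
        _ = D.r z / 4 := by field_simp
    have h3 : D.M * ‖(ζ * (θ⁻¹ : ℝ)) • x‖ ^ 2 ≤ D.r z / 4 := by
      calc D.M * ‖(ζ * (θ⁻¹ : ℝ)) • x‖ ^ 2 ≤ D.M * (c * √(D.r z)) ^ 2 := by gcongr
        _ = D.M * c ^ 2 * D.r z := by rw [mul_pow, sq_sqrt hr.le]; ring
        _ ≤ 1 / 4 * D.r z := by gcongr
        _ = _ := by ring
    have h4 : D.ρ z = - D.r z := by rw [r, neg_neg]
    linarith
  have hdiff : DifferentiableOn ℂ ψ 𝔻 := by rw [hψ]; fun_prop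
  have hθb : (θ : ℂ) ∈ 𝔻 := by
    rw [mem_ball_zero_iff, norm_real, norm_of_nonneg hθ.le]; exact hθ1
  have e0 : ψ 0 = z := by simp [hψ]
  have e1 : ψ θ = z + x := by
    simp only [hψ]
    rw [← ofReal_mul, mul_inv_cancel₀ hθ.ne', ofReal_one, one_smul]
  have hp : artanh (phd 0 θ) ≤ artanh θ := by
    have : phd 0 θ = θ := by
      simp [phd, abs_of_pos hθ]
    rw [this]
  have := KLe.of_disc₂_symm hdiff hmaps (mem_ball_self one_pos) hθb hp
  rw [e0, e1] at this
  exact ⟨e1 ▸ hmaps hθb, this⟩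

set_option maxHeartbeats 1000000 in
/-- Pushing a point inside along a transversal direction. -/
theorem exists_push {C : ℝ} (hC : 0 < C) : ∃ R > 0, ∀ z ∈ Ω, ∀ ν : E N, D.L z ν = -1 → ‖ν‖ ≤ C →
    ∀ T : ℝ, D.r z ≤ T → T ≤ R → z + (T : ℂ) • ν ∈ Ω ∧ T / 2 ≤ D.r (z + (T : ℂ) • ν) ∧
      KLe Ω z (z + (T : ℂ) • ν) (log (8 * T / D.r z) / 2) ∧
      KLe Ω (z + (T : ℂ) • ν) z (log (8 * T / D.r z) / 2) := by
  have hM := D.M_pos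
  have hε := D.ε_pos
  set R := min (1 / (4 * D.M * C ^ 2)) (D.ε / (4 * C)) with hR
  have hRp : 0 < R := by positivity
  have hR1 : 4 * (D.M * C ^ 2) * R ≤ 1 := by
    have : R ≤ 1 / (4 * D.M * C ^ 2) := min_le_left _ _
    rw [le_div_iff₀ (by positivity)] at this
    linarith
  have hR2 : 4 * C * R ≤ D.ε := by
    have : R ≤ D.ε / (4 * C) := min_le_right _ _
    rw [le_div_iff₀ (by positivity)] at this
    linarith
  refine ⟨R / 2, by positivity, fun z hz ν hν hνC T hrT hTR => ?_⟩
  have hr := D.r_pos hz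
  have hzc := subset_closure hz
  have hρ : D.ρ z = - D.r z := by rw [r, neg_neg]
  have hd1 : ∀ t : ℂ, ‖t‖ ≤ 2 * R → D.ρ (z + t • ν) ≤ - D.r z - t.re + D.M * C ^ 2 * ‖t‖ ^ 2 ∧
      (D.ρ (z + t • ν) < 0 → z + t • ν ∈ Ω) := by
    intro t ht
    have hn : ‖t • ν‖ ≤ ‖t‖ * C := by rw [norm_smul]; gcongr
    have hnε : ‖t • ν‖ < D.ε := by
      have : ‖t‖ * C ≤ 2 * R * C := by gcongr
      have : 0 < R * C := by positivity
      linarith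
    refine ⟨?_, D.mem z hzc _ hnε⟩
    have h1 := _root_.abs_le.mp (D.d1_ball z hzc _ hnε)
    have h2 : (D.L z (t • ν)).re = - t.re := by rw [map_smul, hν]; simp
    have h3 : D.M * ‖t • ν‖ ^ 2 ≤ D.M * (‖t‖ * C) ^ 2 := by gcongr
    rw [mul_pow] at h3
    linarith
  set ψ : ℂ → E N := fun ζ => z + (((R - D.r z / 2 : ℝ) : ℂ) + R * ζ) • ν with hψ
  have hdiff : DifferentiableOn ℂ ψ 𝔻 := by rw [hψ]; fun_prop
  have hmaps : MapsTo ψ 𝔻 Ω := by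
    intro ζ hζ
    have hζ1 := norm_lt_one_of_mem_ball hζ
    set t : ℂ := ((R - D.r z / 2 : ℝ) : ℂ) + R * ζ with ht
    have htn : ‖t‖ ≤ 2 * R := by
      refine (norm_add_le _ _).trans ?_
      rw [norm_mul, norm_real, norm_real, norm_of_nonneg (by linarith),
        norm_of_nonneg hRp.le]
      nlinarith
    obtain ⟨h1, h2⟩ := hd1 t htn
    refine h2 (lt_of_le_of_lt h1 ?_)
    have h3 : t.re = R + R * ζ.re - D.r z / 2 := by
      rw [ht, add_re, ofReal_re, re_ofReal_mul]; ring
    have h4 : t.im = R * ζ.im := by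
      rw [ht, Complex.add_im, Complex.ofReal_im, Complex.im_ofReal_mul]; ring
    have h5 : ‖t‖ ^ 2 = t.re ^ 2 + t.im ^ 2 := by rw [sq_norm, normSq_apply]; ring
    have h6 : ζ.re ^ 2 + ζ.im ^ 2 ≤ 1 := by
      have : ‖ζ‖ ^ 2 = ζ.re ^ 2 + ζ.im ^ 2 := by rw [sq_norm, normSq_apply]; ring
      rw [← this]; nlinarith [norm_nonneg ζ]
    have h7 : ‖t‖ ^ 2 ≤ 4 * R * (R + R * ζ.re) + D.r z ^ 2 / 2 := by
      rw [h5, h3, h4]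
      nlinarith [sq_nonneg (R + R * ζ.re + D.r z / 2), sq_nonneg R, mul_le_mul_of_nonneg_left h6 (sq_nonneg R), sq_nonneg (R * ζ.im)]
    have h8 : D.M * C ^ 2 * ‖t‖ ^ 2 ≤
        D.M * C ^ 2 * (4 * R * (R + R * ζ.re) + D.r z ^ 2 / 2) := by gcongr
    have h9 : 0 ≤ R + R * ζ.re := by
      have := abs_re_le_norm ζ
      have := _root_.abs_le.mp this
      nlinarith
    have h10 : D.M * C ^ 2 * (4 * R * (R + R * ζ.re)) ≤ R + R * ζ.re := by
      calc _ = (4 * (D.M * C ^ 2) * R) * (R + R * ζ.re) := by ring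
        _ ≤ 1 * (R + R * ζ.re) := by gcongr
        _ = _ := one_mul _
    have h11 : D.M * C ^ 2 * (D.r z ^ 2 / 2) ≤ D.r z / 8 := by
      have : 4 * (D.M * C ^ 2) * D.r z ≤ 1 := by
        refine le_trans ?_ hR1
        gcongr; linarith
      nlinarith
    rw [h3]
    linarith
  set s : ℝ := -(1 - D.r z / (2 * R)) with hs
  set t : ℝ := (T + D.r z / 2 - R) / R with ht
  have hrR : D.r z / (2 * R) ≤ 1 / 4 := by
    rw [div_le_iff₀ (by positivity)]; linarith
  have hrRp : 0 < D.r z / (2 * R) := by positivity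
  have e1t : 1 + t = (T + D.r z / 2) / R := by rw [ht]; field_simp; ring
  have ht0 : t ≤ 0 := by
    rw [ht]; exact div_nonpos_of_nonpos_of_nonneg (by linarith) hRp.le
  have hst : s ≤ t := by
    have : D.r z / (2 * R) ≤ (T + D.r z / 2) / R := by
      rw [div_le_div_iff₀ (by positivity) hRp]; nlinarith
    rw [← e1t] at this
    rw [hs]; linarith
  have hs1 : -1 < s := by rw [hs]; linarith
  have hart : artanh (phd s t) ≤ log (8 * T / D.r z) / 2 := by
    rw [artanh_phd_real hs1 hst (by linarith)]
    have hpos : 0 < (1 + t) * (1 - s) / ((1 - t) * (1 + s)) := by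
      apply div_pos <;> apply mul_pos <;> linarith
    suffices hle : (1 + t) * (1 - s) / ((1 - t) * (1 + s)) ≤ 8 * T / D.r z by
      have := Real.log_le_log hpos hle
      linarith
    rw [div_le_div_iff₀ (mul_pos (by linarith) (by linarith)) hr]
    have e2 : 1 + s = D.r z / (2 * R) := by rw [hs]; ring
    have e3 : 1 - s ≤ 2 := by linarith
    rw [e2, e1t]
    have hT : 0 < T := hr.trans_le hrT
    have e4 : (T + D.r z / 2) / R * (1 - s) * D.r z ≤ (3 / 2 * T) / R * 2 * D.r z := by
      have : (T + D.r z / 2) / R ≤ (3 / 2 * T) / R := by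
        apply div_le_div_of_nonneg_right _ hRp.le
        linarith
      have h3 : 0 ≤ (3 / 2 * T) / R := by positivity
      have : (T + D.r z / 2) / R * (1 - s) ≤ (3 / 2 * T) / R * 2 :=
        mul_le_mul this e3 (by linarith) h3
      exact mul_le_mul_of_nonneg_right this hr.le
    have e5 : 8 * T * (1 * (D.r z / (2 * R))) ≤ 8 * T * ((1 - t) * (D.r z / (2 * R))) := by
      have : 0 < T := hr.trans_le hrT
      gcongr; linarith
    refine e4.trans (le_trans ?_ e5)
    have : 3 / 2 * T / R * 2 * D.r z = 3 * (T * D.r z / R) := by ring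
    rw [this]
    have : 8 * T * (1 * (D.r z / (2 * R))) = 4 * (T * D.r z / R) := by field_simp; ring
    rw [this]
    have : 0 ≤ T * D.r z / R := by
      have : 0 < T := hr.trans_le hrT
      positivity
    linarith
  have hsb : (s : ℂ) ∈ 𝔻 := by
    rw [mem_ball_zero_iff, norm_real, norm_eq_abs, abs_lt]; constructor <;> linarith
  have htb : (t : ℂ) ∈ 𝔻 := by
    rw [mem_ball_zero_iff, norm_real, norm_eq_abs, abs_lt]; constructor <;> linarith
  have es : ψ s = z := by
    simp only [hψ]
    rw [← ofReal_mul, ← Complex.ofReal_add]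
    have : R - D.r z / 2 + R * s = 0 := by rw [hs]; field_simp; ring
    rw [this]; simp
  have et : ψ t = z + (T : ℂ) • ν := by
    simp only [hψ]
    rw [← ofReal_mul, ← Complex.ofReal_add]
    have : R - D.r z / 2 + R * t = T := by rw [ht]; field_simp; ring
    rw [this]
  have hk := KLe.of_disc₂_symm hdiff hmaps hsb htb hart
  rw [es, et] at hk
  refine ⟨et ▸ hmaps htb, ?_, hk⟩
  have hT : 0 < T := hr.trans_le hrT
  have hTn : ‖(T : ℂ)‖ = T := by rw [norm_real, norm_of_nonneg hT.le]
  have h1 := (hd1 T (by rw [hTn]; linarith)).1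
  rw [hTn, ofReal_re] at h1
  have h2 : D.M * C ^ 2 * T ^ 2 ≤ T / 4 := by
    have : 4 * (D.M * C ^ 2) * T ≤ 1 := by
      refine le_trans ?_ hR1
      gcongr; linarith
    nlinarith
  change T / 2 ≤ -D.ρ (z + (T : ℂ) • ν)
  linarith

end Dom

/-- Two-sided upper bound for the Kobayashi distance. -/
def KLe₂ (Ω : Set (E N)) (z w : E N) (r : ℝ) : Prop := KLe Ω z w r ∧ KLe Ω w z r

theorem KLe₂.symm {Ω : Set (E N)} {z w : E N} {r : ℝ} (h : KLe₂ Ω z w r) : KLe₂ Ω w z r :=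
  ⟨h.2, h.1⟩

theorem KLe₂.mono {Ω : Set (E N)} {z w : E N} {r s : ℝ} (h : KLe₂ Ω z w r) (hrs : r ≤ s) :
    KLe₂ Ω z w s := ⟨h.1.mono hrs, h.2.mono hrs⟩

theorem KLe₂.trans {Ω : Set (E N)} {z w v : E N} {r s : ℝ} (h : KLe₂ Ω z w r)
    (h' : KLe₂ Ω w v s) : KLe₂ Ω z v (r + s) :=
  ⟨h.1.trans h'.1, by rw [add_comm]; exact h'.2.trans h.2⟩

theorem KLe₂.refl {Ω : Set (E N)} {z : E N} (hz : z ∈ Ω) : KLe₂ Ω z z 0 :=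
  ⟨KLe.refl hz, KLe.refl hz⟩

theorem artanh_half : artanh (1 / 2) = log 3 / 2 := by
  unfold artanh; norm_num

namespace Dom

variable {Ω : Set (E N)} {α : ℝ} (D : Dom Ω α)

theorem eventually_KLe₂ (D : Dom Ω α) {z : E N} (hz : z ∈ Ω) : ∀ᶠ w in 𝓝 z, KLe₂ Ω z w (artanh (1 / 2)) := by
  obtain ⟨c, hc, h⟩ := D.exists_affine_disc
  have hr := D.r_pos hz
  have h1 : ∀ᶠ w in 𝓝 z, ‖D.L z (w - z)‖ < 1 / 2 * D.r z / 4 := by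
    have : ContinuousAt (fun w => ‖D.L z (w - z)‖) z := by fun_prop
    apply this.eventually_lt_const
    simp; linarith
  have h2 : ∀ᶠ w in 𝓝 z, ‖w - z‖ < 1 / 2 * c * √(D.r z) := by
    have : ContinuousAt (fun w => ‖w - z‖) z := by fun_prop
    apply this.eventually_lt_const
    simp; positivity
  filter_upwards [h1, h2] with w hw1 hw2
  have := h z hz (w - z) (1 / 2) (by norm_num) (by norm_num) hw1.le hw2.le
  rw [add_sub_cancel] at this
  exact this.2

theorem exists_KLe₂ (D : Dom Ω α) {z w : E N} (hz : z ∈ Ω) (hw : w ∈ Ω) : ∃ C, KLe₂ Ω z w C := by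
  refine D.isConnected.isPreconnected.induction₂ (fun z w => ∃ C, KLe₂ Ω z w C) ?_ ?_ ?_ hz hw
  · intro x hx
    filter_upwards [nhdsWithin_le_nhds (D.eventually_KLe₂ hx)] with y hy
    exact ⟨_, hy⟩
  · rintro x y z - - - ⟨C, hC⟩ ⟨C', hC'⟩
    exact ⟨_, hC.trans hC'⟩
  · rintro x y - - ⟨C, hC⟩
    exact ⟨C, hC.symm⟩

theorem exists_KLe₂_compact (D : Dom Ω α) {K : Set (E N)} (hK : IsCompact K) (hKΩ : K ⊆ Ω) :
    ∃ C, ∀ z ∈ K, ∀ w ∈ K, KLe₂ Ω z w C := by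
  obtain ⟨p, hp⟩ := D.isConnected.nonempty
  have : ∃ C, ∀ z ∈ K, KLe₂ Ω p z C := by
    refine hK.induction_on (p := fun s => ∃ C, ∀ z ∈ s, KLe₂ Ω p z C) ⟨0, by simp⟩ ?_ ?_ ?_
    · rintro s t hst ⟨C, hC⟩
      exact ⟨C, fun z hz => hC z (hst hz)⟩
    · rintro s t ⟨C, hC⟩ ⟨C', hC'⟩
      refine ⟨max C C', fun z hz => ?_⟩
      rcases hz with hz | hz
      · exact (hC z hz).mono (le_max_left _ _)
      · exact (hC' z hz).mono (le_max_right _ _)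
    · intro x hx
      obtain ⟨C, hC⟩ := D.exists_KLe₂ hp (hKΩ hx)
      exact ⟨_, nhdsWithin_le_nhds (D.eventually_KLe₂ (hKΩ hx)), C + artanh (1 / 2),
        fun z hz => hC.trans hz⟩
  obtain ⟨C, hC⟩ := this
  exact ⟨C + C, fun z hz w hw => (hC z hz).symm.trans (hC w hw)⟩

theorem exists_KLe₂_deep {ε : ℝ} (hε : 0 < ε) :
    ∃ C, ∀ z ∈ Ω, ∀ w ∈ Ω, ε ≤ D.r z → ε ≤ D.r w → KLe₂ Ω z w C := by
  have hK : IsCompact (closure Ω ∩ D.r ⁻¹' Ici ε) :=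
    D.isCompact_closure.of_isClosed_subset
      (D.continuousOn_r.preimage_isClosed_of_isClosed isClosed_closure isClosed_Ici)
      inter_subset_left
  obtain ⟨C, hC⟩ := D.exists_KLe₂_compact hK
    (fun z hz => D.mem_of_pos hz.1 (hε.trans_le hz.2))
  exact ⟨C, fun z hz w hw h1 h2 => hC z ⟨subset_closure hz, h1⟩ w ⟨subset_closure hw, h2⟩⟩

theorem exists_KLe₂_global : ∃ C > 0, ∀ z ∈ Ω, ∀ w ∈ Ω,
    KLe₂ Ω z w (log (C / (D.r z * D.r w)) / 2) := by
  obtain ⟨Cn, εn, hCn, hεn, hn⟩ := D.exists_normal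
  obtain ⟨R, hR, hpush⟩ := D.exists_push hCn
  set ε := min εn R with hε
  have hεp : 0 < ε := lt_min hεn hR
  have hM := D.M_pos
  obtain ⟨C, hC⟩ := D.exists_KLe₂_deep (half_pos hεp)
  set B := max D.M (8 * ε) with hB
  have hBp : 0 < B := lt_max_of_lt_left hM
  have key : ∀ z ∈ Ω, ∃ z1 ∈ Ω, ε / 2 ≤ D.r z1 ∧ KLe₂ Ω z z1 (log (B / D.r z) / 2) := by
    intro z hz
    have hr := D.r_pos hz
    rcases le_total (D.r z) ε with h | h
    · obtain ⟨e, he, heC⟩ := hn z (subset_closure hz) (h.trans (min_le_left _ _))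
      obtain ⟨h1, h2, h3⟩ := hpush z hz (-e) (by simp [he]) (by simpa using heC) ε h
        (min_le_right _ _)
      refine ⟨_, h1, h2, KLe₂.mono h3 ?_⟩
      have : 8 * ε / D.r z ≤ B / D.r z := by gcongr; exact le_max_right _ _
      have := Real.log_le_log (by positivity) this
      linarith
    · refine ⟨z, hz, by linarith, (KLe₂.refl hz).mono ?_⟩
      have : 1 ≤ B / D.r z := by
        rw [le_div_iff₀ hr, one_mul]
        exact (D.r_le (subset_closure hz)).trans (le_max_left _ _)
      have := Real.log_nonneg this
      linarith
  refine ⟨B * B * Real.exp (2 * C), by positivity, fun z hz w hw => ?_⟩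
  obtain ⟨z1, hz1, h1, h2⟩ := key z hz
  obtain ⟨w1, hw1, h3, h4⟩ := key w hw
  have hr := D.r_pos hz
  have hr' := D.r_pos hw
  refine ((h2.trans (hC z1 hz1 w1 hw1 h1 h3)).trans h4.symm).mono (le_of_eq ?_)
  have : B * B * Real.exp (2 * C) / (D.r z * D.r w) =
      (B / D.r z) * Real.exp (2 * C) * (B / D.r w) := by field_simp
  rw [this, log_mul (by positivity) (by positivity), log_mul (by positivity)
    (by positivity), Real.log_exp]
  ring

set_option maxHeartbeats 1000000 in
/-- Upper bound for the Kobayashi distance. -/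
theorem exists_kobayashi_upper : ∃ C > 0, ∀ z ∈ Ω, ∀ w ∈ Ω, ∀ H > 0, D.r z ≤ H → D.r w ≤ H →
    ‖D.L z (w - z)‖ ≤ H → ‖w - z‖ ^ 2 ≤ H →
    KLe₂ Ω z w (log (C * H ^ 2 / (D.r z * D.r w)) / 2) := by
  obtain ⟨Cn, εn, hCn, hεn, hn⟩ := D.exists_normal
  obtain ⟨c, hc, haff⟩ := D.exists_affine_disc
  obtain ⟨R, hR, hpush⟩ := D.exists_push (C := 2 * Cn) (by positivity)
  obtain ⟨B, hB, hglob⟩ := D.exists_KLe₂_global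
  have hM := D.M_pos
  have hM1 := D.one_le_M
  set K := max 32 (32 / c ^ 2) with hK
  have hK32 : 32 ≤ K := le_max_left _ _
  have hKc : 32 ≤ K * c ^ 2 := by
    have : 32 / c ^ 2 ≤ K := le_max_right _ _
    rwa [div_le_iff₀ (by positivity)] at this
  have hKp : 0 < K := by linarith
  -- smallness condition on `√H`
  set σ := min (min (1 / (K * (D.M * Cn + 2 * D.M ^ 2 * Cn ^ 2))) (1 / (2 * D.M * Cn)))
    (min (min εn 1) (R / K)) with hσ
  have hσp : 0 < σ := by positivity
  have hσ1 : σ * (K * (D.M * Cn + 2 * D.M ^ 2 * Cn ^ 2)) ≤ 1 := by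
    rw [← le_div_iff₀ (by positivity)]
    exact (min_le_left _ _).trans (min_le_left _ _)
  have hσ2 : σ * (2 * D.M * Cn) ≤ 1 := by
    rw [← le_div_iff₀ (by positivity)]
    exact (min_le_left _ _).trans (min_le_right _ _)
  have hσ3 : σ ≤ εn := (min_le_right _ _).trans ((min_le_left _ _).trans (min_le_left _ _))
  have hσ4 : σ ≤ 1 := (min_le_right _ _).trans ((min_le_left _ _).trans (min_le_right _ _))
  have hσ5 : σ * K ≤ R := by
    rw [← le_div_iff₀ (by positivity)]
    exact (min_le_right _ _).trans (min_le_right _ _)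
  refine ⟨max (B / (σ ^ 2) ^ 2) (192 * K ^ 2), by positivity,
    fun z hz w hw H hH hzH hwH hL hx => ?_⟩
  have hr := D.r_pos hz
  have hr' := D.r_pos hw
  have hrr := mul_pos hr hr'
  rcases le_total H (σ ^ 2) with hHσ | hHσ
  swap
  · refine (hglob z hz w hw).mono ?_
    have : B / (D.r z * D.r w) ≤ max (B / (σ ^ 2) ^ 2) (192 * K ^ 2) * H ^ 2 / (D.r z * D.r w) := by
      gcongr
      calc B = B / (σ ^ 2) ^ 2 * (σ ^ 2) ^ 2 := by field_simp
        _ ≤ _ := by gcongr; exact le_max_left _ _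
    have := Real.log_le_log (by positivity) this
    linarith
  have hs : √H ≤ σ := by
    rw [Real.sqrt_le_left hσp.le]; exact hHσ
  have hHsq : √H * √H = H := Real.mul_self_sqrt hH.le
  have hs0 : 0 < √H := sqrt_pos.mpr hH
  have hHr : H ≤ √H := by
    calc H = √H * √H := hHsq.symm
      _ ≤ √H * 1 := by gcongr; exact hs.trans hσ4
      _ = √H := mul_one _
  have hHle : H ≤ σ := hHr.trans hs
  have hxs : ‖w - z‖ ≤ √H := Real.le_sqrt_of_sq_le hx
  have hzc := subset_closure hz
  have hwc := subset_closure hw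
  obtain ⟨e, he, heC⟩ := hn z hzc (by linarith)
  set T := K * H with hT
  have hTp : 0 < T := by positivity
  have hTR : T ≤ R := by
    calc T = H * K := mul_comm _ _
      _ ≤ σ * K := by gcongr
      _ ≤ R := hσ5
  have hHT : H ≤ T := le_mul_of_one_le_left hH.le (by linarith)
  have hLw : ‖D.L w e - 1‖ ≤ D.M * Cn * √H := by
    rw [← he, ← sub_apply]
    calc _ ≤ ‖D.L w - D.L z‖ * ‖e‖ := le_opNorm _ _
      _ ≤ (D.M * √H) * Cn := by
        gcongr
        exact (D.d2 z hzc w hwc).trans (by gcongr)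
      _ = _ := by ring
  have hLw2 : ‖D.L w e - 1‖ ≤ 1 / 2 := by
    have : √H * (2 * D.M * Cn) ≤ σ * (2 * D.M * Cn) := by gcongr
    linarith
  have hLw3 : 1 / 2 ≤ ‖D.L w e‖ := by
    have := norm_sub_norm_le (1:ℂ) (1 - D.L w e)
    rw [sub_sub_cancel, norm_one, norm_sub_rev] at this
    linarith
  have hLw0 : D.L w e ≠ 0 := by
    intro h; rw [h, norm_zero] at hLw3; linarith
  set ν : E N := -e with hν
  set ν' : E N := -((D.L w e)⁻¹ • e) with hν'
  have hν1 : D.L w ν' = -1 := by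
    rw [hν', map_neg, map_smul, smul_eq_mul, inv_mul_cancel₀ hLw0]
  have hinv : ‖(D.L w e)⁻¹‖ ≤ 2 := by
    rw [norm_inv]
    calc ‖D.L w e‖⁻¹ ≤ (1 / 2)⁻¹ := by gcongr
      _ = 2 := by norm_num
  have hνn : ‖ν'‖ ≤ 2 * Cn := by
    rw [hν', norm_neg, norm_smul]; gcongr
  have hνd : ‖ν' - ν‖ ≤ 2 * D.M * Cn ^ 2 * √H := by
    have : ν' - ν = ((D.L w e)⁻¹ * (D.L w e - 1)) • e := by
      rw [mul_sub, inv_mul_cancel₀ hLw0, hν, hν']; module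
    rw [this, norm_smul, norm_mul]
    calc _ ≤ 2 * (D.M * Cn * √H) * Cn := by gcongr
      _ = _ := by ring
  obtain ⟨hz1, hrz1, hkz⟩ := hpush z hz ν (by rw [hν, map_neg, he])
    (by rw [hν, norm_neg]; linarith) T (hzH.trans hHT) hTR
  obtain ⟨hw1, -, hkw⟩ := hpush w hw ν' hν1 hνn T (hwH.trans hHT) hTR
  set z1 := z + (T : ℂ) • ν with hz1d
  set w1 := w + (T : ℂ) • ν' with hw1d
  have hTn : ‖(T : ℂ)‖ = T := by rw [norm_real, norm_of_nonneg hTp.le]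
  have hx1 : w1 - z1 = (w - z) + (T : ℂ) • (ν' - ν) := by rw [hw1d, hz1d, smul_sub]; abel
  have hsm1 : √H * (K * (D.M * Cn + 2 * D.M ^ 2 * Cn ^ 2)) ≤ 1 :=
    le_trans (by gcongr) hσ1
  have hx1n : ‖w1 - z1‖ ≤ 2 * √H := by
    rw [hx1]
    refine (norm_add_le _ _).trans ?_
    rw [norm_smul, hTn]
    have h1 : T * ‖ν' - ν‖ ≤ T * (2 * D.M * Cn ^ 2 * √H) := by gcongr
    have h2 : T * (2 * D.M * Cn ^ 2) ≤ 1 := by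
      calc T * (2 * D.M * Cn ^ 2) = H * (K * (2 * D.M * Cn ^ 2)) := by rw [hT]; ring
        _ ≤ √H * (K * (D.M * Cn + 2 * D.M ^ 2 * Cn ^ 2)) := by
          have h4 : 2 * D.M * Cn ^ 2 ≤ D.M * Cn + 2 * D.M ^ 2 * Cn ^ 2 := by
            have : D.M ≤ D.M ^ 2 := le_self_pow₀ D.one_le_M two_ne_zero
            have : 0 ≤ (D.M ^ 2 - D.M) * Cn ^ 2 := by
              exact mul_nonneg (by linarith) (sq_nonneg _)
            linarith [mul_pos hM hCn, mul_nonneg (sq_nonneg D.M) (sq_nonneg Cn)]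
          gcongr
        _ ≤ 1 := hsm1
    have h5 : T * (2 * D.M * Cn ^ 2 * √H) ≤ 1 * √H := by
      rw [← mul_assoc]; gcongr
    linarith
  have hz1c := subset_closure hz1
  have hLx1 : ‖D.L z1 (w1 - z1)‖ ≤ 2 * H := by
    have e1 : D.L z1 (w1 - z1) = D.L z (w - z) + ((D.L z1 - D.L z) (w - z) +
        (T : ℂ) * D.L z1 (ν' - ν)) := by
      rw [hx1, map_add, map_smul, smul_eq_mul, sub_apply]; ring
    have h1 : ‖(D.L z1 - D.L z) (w - z)‖ ≤ D.M * (T * Cn) * √H := by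
      refine (le_opNorm _ _).trans ?_
      gcongr
      refine (D.d2 z hzc z1 hz1c).trans ?_
      gcongr
      rw [hz1d, add_sub_cancel_left, norm_smul, hTn, hν, norm_neg]
      gcongr
    have h2 : ‖(T : ℂ) * D.L z1 (ν' - ν)‖ ≤ T * (D.M * (2 * D.M * Cn ^ 2 * √H)) := by
      rw [norm_mul, hTn]
      gcongr
      refine (le_opNorm _ _).trans ?_
      gcongr
      exact D.norm_L z1 hz1c
    have h3 : D.M * (T * Cn) * √H + T * (D.M * (2 * D.M * Cn ^ 2 * √H)) ≤ H := by
      calc _ = H * (√H * (K * (D.M * Cn + 2 * D.M ^ 2 * Cn ^ 2))) := by rw [hT]; ring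
        _ ≤ H * 1 := by gcongr
        _ = H := mul_one _
    rw [e1]
    have := norm_add_le (D.L z (w - z)) ((D.L z1 - D.L z) (w - z) + (T : ℂ) * D.L z1 (ν' - ν))
    have := norm_add_le ((D.L z1 - D.L z) (w - z)) ((T : ℂ) * D.L z1 (ν' - ν))
    linarith
  have hfin := haff z1 hz1 (w1 - z1) (1 / 2) (by norm_num) (by norm_num)
    (by
      have : 32 * H ≤ K * H := by gcongr
      linarith) (by
      refine hx1n.trans ?_
      have h1 : √(K * H / 2) ≤ √(D.r z1) := sqrt_le_sqrt (by linarith)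
      have h2 : 4 * √H ≤ c * √(K * H / 2) := by
        refine abs_le_of_sq_le_sq' ?_ (by positivity) |>.2
        rw [mul_pow, mul_pow, sq_sqrt hH.le, sq_sqrt (by positivity)]
        have : 32 * H ≤ K * c ^ 2 * H := by gcongr
        linarith
      have h3 : c * √(K * H / 2) ≤ c * √(D.r z1) := by gcongr
      linarith)
  rw [add_sub_cancel] at hfin
  have hk := (KLe₂.trans (KLe₂.trans hkz hfin.2) (KLe₂.symm hkw))
  refine hk.mono ?_
  have e1 : 192 * K ^ 2 * H ^ 2 / (D.r z * D.r w) = (8 * T / D.r z) * 3 * (8 * T / D.r w) := by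
    rw [hT]; field_simp; ring
  have h1 : 192 * K ^ 2 * H ^ 2 / (D.r z * D.r w) ≤
      max (B / (σ ^ 2) ^ 2) (192 * K ^ 2) * H ^ 2 / (D.r z * D.r w) := by
    gcongr; exact le_max_right _ _
  have h2 := Real.log_le_log (by positivity) h1
  have h3 : log (8 * T / D.r z * 3 * (8 * T / D.r w)) =
      log (8 * T / D.r z) + log 3 + log (8 * T / D.r w) := by
    rw [log_mul (by positivity) (by positivity), log_mul (by positivity) (by norm_num)]
  rw [e1, h3] at h2
  rw [artanh_half]
  linarith

/-- The Poincaré distance of the parameters of a complex geodesic is controlled. -/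
theorem exists_geodesic_le : ∃ C > 0, ∀ φ : ℂ → E N, IsComplexGeodesic Ω φ →
    ∀ a ∈ 𝔻, ∀ b ∈ 𝔻, ∀ H > 0, D.r (φ a) ≤ H → D.r (φ b) ≤ H →
    ‖D.L (φ a) (φ b - φ a)‖ ≤ H → ‖φ b - φ a‖ ^ 2 ≤ H →
    D.r (φ a) * D.r (φ b) ≤ C * H ^ 2 * (1 - phd a b) := by
  obtain ⟨C, hC, h⟩ := D.exists_kobayashi_upper
  refine ⟨C, hC, fun φ hφ a ha b hb H hH h1 h2 h3 h4 => ?_⟩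
  have hk := hφ.artanh_le ha hb (h _ (hφ.2.1 ha) _ (hφ.2.1 hb) H hH h1 h2 h3 h4).1
  have hra := D.r_pos (hφ.2.1 ha)
  have hrb := D.r_pos (hφ.2.1 hb)
  have hp := phd_lt_one (norm_lt_one_of_mem_ball ha) (norm_lt_one_of_mem_ball hb)
  have hp0 := phd_nonneg a b
  unfold artanh at hk
  have h5 : (1 + phd a b) / (1 - phd a b) ≤ C * H ^ 2 / (D.r (φ a) * D.r (φ b)) := by
    rw [← Real.log_le_log_iff (div_pos (by linarith) (by linarith)) (by positivity)]
    linarith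
  rw [div_le_div_iff₀ (by linarith) (by positivity)] at h5
  have := mul_nonneg (mul_pos hra hrb).le hp0
  linarith

end Dom

theorem re_ge_of_sphere {f : ℂ → ℂ} {s m : ℝ} (hs : 0 < s)
    (hf : DifferentiableOn ℂ f (closedBall 0 s)) (h : ∀ ζ, ‖ζ‖ = s → m ≤ (f ζ).re) {a : ℂ}
    (ha : ‖a‖ ≤ s) : m ≤ (f a).re := by
  have hd : DiffContOnCl ℂ (fun ζ => Complex.exp (-f ζ)) (ball 0 s) := by
    apply DifferentiableOn.diffContOnCl
    rw [closure_ball _ hs.ne']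
    exact hf.neg.cexp
  have := Complex.norm_le_of_forall_mem_frontier_norm_le isBounded_ball hd (C := Real.exp (-m))
    (fun z hz => by
      rw [frontier_ball _ hs.ne', mem_sphere_zero_iff_norm] at hz
      rw [norm_exp, neg_re]
      exact Real.exp_le_exp.mpr (by linarith [h z hz]))
    (z := a) (by rw [closure_ball _ hs.ne']; simpa using ha)
  rw [norm_exp, neg_re, Real.exp_le_exp] at this
  linarith

namespace Dom

variable {Ω : Set (E N)} {α : ℝ} (D : Dom Ω α)

/-- Local holomorphic support functions. -/
theorem exists_peak : ∃ (G : E N → E N → ℂ) (C c ε : ℝ), 0 < C ∧ 0 < c ∧ 0 < ε ∧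
    (∀ z, Differentiable ℂ (G z)) ∧ (∀ z ∈ closure Ω, G z z = 2 * D.r z) ∧
    (∀ z ∈ closure Ω, HasFDerivAt (G z) (-(D.L z)) z) ∧
    (∀ z ∈ closure Ω, ∀ w, ‖G z w - (2 * D.r z - D.L z (w - z))‖ ≤ C * ‖w - z‖ ^ 2) ∧
    (∀ z ∈ closure Ω, ∀ w ∈ closure Ω, D.r z ≤ ε → ‖w - z‖ ≤ ε →
      D.r w / 2 + c * ‖w - z‖ ^ 2 ≤ (G z w).re) := by
  obtain ⟨Q, C, c, ε, hC, hc, hε, hQd, hQ, -, hlp⟩ := D.exists_levi_poly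
  have hb : ∀ z ∈ closure Ω, ∀ w, ‖(2 * D.r z - D.L z (w - z) - Q z (w - z) / 2) -
      (2 * D.r z - D.L z (w - z))‖ ≤ C * ‖w - z‖ ^ 2 := by
    intro z hz w
    rw [sub_right_comm, sub_self, zero_sub, norm_neg, norm_div]
    have := hQ z hz (w - z)
    have := norm_nonneg (Q z (w - z))
    simp only [Complex.norm_ofNat]
    linarith
  have hdiff : ∀ z, Differentiable ℂ (fun w => 2 * (D.r z : ℂ) - D.L z (w - z) -
      Q z (w - z) / 2) := by
    intro z
    have h1 : Differentiable ℂ (fun w => Q z (w - z)) :=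
      (hQd z).comp (differentiable_id.sub_const z)
    have h2 : Differentiable ℂ (fun w => D.L z (w - z)) :=
      (D.L z).differentiable.comp (differentiable_id.sub_const z)
    have h3 : Differentiable ℂ (fun w => Q z (w - z) / 2) := by
      simpa only [div_eq_mul_inv] using h1.mul_const (2:ℂ)⁻¹
    exact (h2.const_sub _).sub h3
  refine ⟨fun z w => 2 * D.r z - D.L z (w - z) - Q z (w - z) / 2, C, c, ε, hC, hc, hε, hdiff,
    ?_, ?_, hb, ?_⟩
  · intro z hz
    have := hb z hz z
    simp only [sub_self, norm_zero, map_zero, sub_zero] at this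
    rw [zero_pow two_ne_zero, mul_zero] at this
    have := norm_le_zero_iff.mp this
    simp only [sub_self, map_zero, sub_zero]
    linear_combination this
  · intro z hz
    have h1 : HasFDerivAt (fun w => (2 * D.r z - D.L z (w - z) - Q z (w - z) / 2) -
      (2 * D.r z - D.L z (w - z))) (0 : E N →L[ℂ] ℂ) z := by
      refine Asymptotics.IsBigO.hasFDerivAt (n := 2) ?_ (by norm_num)
      refine Asymptotics.IsBigO.of_bound C (Eventually.of_forall fun w => ?_)
      rw [norm_pow, norm_norm]
      exact hb z hz w
    have h2 : HasFDerivAt (fun w => 2 * (D.r z : ℂ) - D.L z (w - z)) (-(D.L z)) z := by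
      have h4 : HasFDerivAt (fun w => D.L z w - D.L z z) (D.L z) z :=
        (D.L z).hasFDerivAt.sub_const _
      simp only [map_sub]
      exact h4.const_sub _
    have h3 := h1.add h2
    rw [zero_add] at h3
    refine h3.congr_of_eventuallyEq (Eventually.of_forall fun w => ?_)
    simp only [Pi.add_apply]
    ring
  · intro z hz w hw h1 h2
    have := hlp z hz (w - z) h1 h2 (by rwa [add_sub_cancel])
    rw [add_sub_cancel, add_re] at this
    have e : (2 * (D.r z : ℂ) - D.L z (w - z) - Q z (w - z) / 2).re =
        2 * D.r z - (D.L z (w - z)).re - (Q z (w - z) / 2).re := by simp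
    rw [e]
    linarith [D.r_nonneg hz]

theorem norm_disc_sub_le {ψ : ℂ → E N} (h1 : DifferentiableOn ℂ ψ 𝔻)
    (h2 : MapsTo ψ 𝔻 Ω) {ζ : ℂ} (hζ : ζ ∈ 𝔻) :
    ‖ψ ζ - ψ 0‖ ≤ D.M * ‖ζ‖ := by
  have h0 : (0:ℂ) ∈ 𝔻 := mem_ball_self one_pos
  have := Complex.dist_le_div_mul_dist_of_mapsTo_ball (R₂ := D.M) h1 (fun x hx => by
    rw [mem_closedBall, dist_eq_norm]
    exact D.diam_le _ (subset_closure (h2 h0)) _ (subset_closure (h2 hx))) hζ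
  rwa [dist_eq_norm, div_one, dist_zero_right] at this

/-- Infinitesimal Kobayashi estimates. -/
theorem exists_disc_bounds : ∃ C > 0, ∀ ψ : ℂ → E N, DifferentiableOn ℂ ψ 𝔻 →
    MapsTo ψ 𝔻 Ω → ‖deriv ψ 0‖ ≤ C * √(D.r (ψ 0)) ∧
      ‖D.L (ψ 0) (deriv ψ 0)‖ ≤ C * D.r (ψ 0) := by
  obtain ⟨G, C, c, ε, hC, hc, hε, hGd, hG0, hGf, -, hG⟩ := D.exists_peak
  have hM := D.M_pos
  set η := min (ε / D.M) 1 with hη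
  have hηp : 0 < η := by positivity
  have hη1 : η ≤ 1 := min_le_right _ _
  have hηM : D.M * η ≤ ε := by
    have : η ≤ ε / D.M := min_le_left _ _
    rw [le_div_iff₀ hM] at this
    linarith
  have h0 : (0:ℂ) ∈ 𝔻 := mem_ball_self one_pos
  refine ⟨max (max (16 / η) (2 * √(6 / c) / η)) (max (2 * D.M / √ε) (2 * D.M ^ 2 / ε)),
    by positivity, fun ψ h1 h2 => ?_⟩
  set K := max (max (16 / η) (2 * √(6 / c) / η)) (max (2 * D.M / √ε) (2 * D.M ^ 2 / ε)) with hK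
  have hK1 : 16 / η ≤ K := (le_max_left _ _).trans (le_max_left _ _)
  have hK2 : 2 * √(6 / c) / η ≤ K := (le_max_right _ _).trans (le_max_left _ _)
  have hK3 : 2 * D.M / √ε ≤ K := (le_max_left _ _).trans (le_max_right _ _)
  have hK4 : 2 * D.M ^ 2 / ε ≤ K := (le_max_right _ _).trans (le_max_right _ _)
  have hz := h2 h0
  set z := ψ 0 with hzd
  have hzc := subset_closure hz
  have hr := D.r_pos hz
  have hcauchy : ∀ s B : ℝ, 0 < s → s < 1 → (∀ ζ : ℂ, ‖ζ‖ ≤ s → ‖ψ ζ - z‖ ≤ B) →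
      ‖deriv ψ 0‖ ≤ B / s := by
    intro s B hs hs1 hB
    have hdc : DiffContOnCl ℂ (fun ζ => ψ ζ - z) (ball 0 s) := by
      apply DifferentiableOn.diffContOnCl
      rw [closure_ball _ hs.ne']
      exact (h1.mono (closedBall_subset_ball hs1)).sub_const _
    have := Complex.norm_deriv_le_of_forall_mem_sphere_norm_le hs hdc (C := B)
      (fun ζ hζ => hB ζ (by simpa using (mem_sphere_zero_iff_norm.mp hζ).le))
    rwa [deriv_sub_const] at this
  rcases le_total (D.r z) ε with hrε | hrε
  · have hηsub : ball (0:ℂ) η ⊆ 𝔻 := ball_subset_ball hη1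
    have hψd : HasDerivAt ψ (deriv ψ 0) 0 :=
      (h1.differentiableAt (isOpen_ball.mem_nhds h0)).hasDerivAt
    set g : ℂ → ℂ := fun ζ => G z (ψ ζ) with hg
    have hgd : DifferentiableOn ℂ g (ball 0 η) :=
      (hGd z).comp_differentiableOn (h1.mono hηsub)
    have hgre : ∀ ζ ∈ ball (0:ℂ) η, D.r (ψ ζ) / 2 + c * ‖ψ ζ - z‖ ^ 2 ≤ (g ζ).re := by
      intro ζ hζ
      refine hG z hzc _ (subset_closure (h2 (hηsub hζ))) hrε ?_
      refine (D.norm_disc_sub_le h1 h2 (hηsub hζ)).trans ?_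
      rw [mem_ball_zero_iff] at hζ
      calc D.M * ‖ζ‖ ≤ D.M * η := by gcongr
        _ ≤ ε := hηM
    have hgpos : ∀ ζ ∈ ball (0:ℂ) η, 0 < (g ζ).re := by
      intro ζ hζ
      refine lt_of_lt_of_le ?_ (hgre ζ hζ)
      have := D.r_pos (h2 (hηsub hζ))
      positivity
    have hg0 : g 0 = 2 * D.r z := hG0 z hzc
    have hg0r : (g 0).re = 2 * D.r z := by rw [hg0]; simp
    have hgder : HasDerivAt g (-(D.L z (deriv ψ 0))) 0 := by
      exact (hGf z hzc).comp_hasDerivAt (0:ℂ) hψd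
    constructor
    · have hs : ∀ ζ : ℂ, ‖ζ‖ ≤ η / 2 → ‖ψ ζ - z‖ ≤ √(6 / c) * √(D.r z) := by
        intro ζ hζ
        have hζη : ζ ∈ ball (0:ℂ) η := by rw [mem_ball_zero_iff]; linarith
        have h3 := norm_sub_le_of_re_pos hηp hgd hgpos hζη
        rw [hg0r, dist_zero_right] at h3
        have h4 : 2 * (2 * D.r z) * ‖ζ‖ / (η - ‖ζ‖) ≤ 4 * D.r z := by
          rw [div_le_iff₀ (by linarith)]
          nlinarith
        have h5 : (g ζ).re ≤ 6 * D.r z := by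
          have := abs_re_le_norm (g ζ - g 0)
          rw [sub_re, hg0r] at this
          have := le_abs_self ((g ζ).re - 2 * D.r z)
          linarith
        have h6 := hgre ζ hζη
        have h7 := D.r_pos (h2 (hηsub hζη))
        rw [← sqrt_mul (by positivity)]
        apply Real.le_sqrt_of_sq_le
        rw [div_mul_eq_mul_div, le_div_iff₀ hc]
        linarith
      have := hcauchy (η / 2) _ (by linarith) (by linarith) hs
      calc _ ≤ _ := this
        _ = 2 * √(6 / c) / η * √(D.r z) := by field_simp
        _ ≤ _ := by gcongr
    · have := norm_deriv_le_of_re_pos hηp hgd hgpos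
      rw [hgder.deriv, norm_neg, hg0r] at this
      calc _ ≤ _ := this
        _ = 16 / η * D.r z := by ring
        _ ≤ _ := by gcongr
  · have hb := hcauchy (1 / 2) (D.M) (by norm_num) (by norm_num) (fun ζ hζ =>
      D.diam_le _ hzc _ (subset_closure (h2 (by rw [mem_ball_zero_iff]; linarith))))
    have hb' : ‖deriv ψ 0‖ ≤ 2 * D.M := by linarith
    constructor
    · have hsq : √ε ≤ √(D.r z) := sqrt_le_sqrt hrε
      calc _ ≤ 2 * D.M := hb'
        _ = 2 * D.M / √ε * √ε := by field_simp
        _ ≤ K * √(D.r z) := by gcongr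
    · calc _ ≤ ‖D.L z‖ * ‖deriv ψ 0‖ := le_opNorm _ _
        _ ≤ D.M * (2 * D.M) := by gcongr; exact D.norm_L z hzc
        _ = 2 * D.M ^ 2 / ε * ε := by field_simp
        _ ≤ K * D.r z := by gcongr

theorem exists_disc_deriv_bounds : ∃ C > 0, ∀ ψ : ℂ → E N, DifferentiableOn ℂ ψ 𝔻 →
    MapsTo ψ 𝔻 Ω → ∀ a ∈ 𝔻,
      ‖deriv ψ a‖ * (1 - ‖a‖) ≤ C * √(D.r (ψ a)) ∧
      ‖D.L (ψ a) (deriv ψ a)‖ * (1 - ‖a‖) ≤ C * D.r (ψ a) := by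
  obtain ⟨C, hC, h⟩ := D.exists_disc_bounds
  refine ⟨C, hC, fun ψ h1 h2 a ha => ?_⟩
  have ha1 := norm_lt_one_of_mem_ball ha
  have hmaps : MapsTo (fun ζ : ℂ => a + ((1 - ‖a‖ : ℝ) : ℂ) * ζ) 𝔻 𝔻 := by
    intro ζ hζ
    have := norm_lt_one_of_mem_ball hζ
    rw [mem_ball_zero_iff]
    refine (norm_add_le _ _).trans_lt ?_
    rw [norm_mul, norm_real, norm_of_nonneg (by linarith)]
    nlinarith
  have hder : HasDerivAt (fun ζ : ℂ => ψ (a + ((1 - ‖a‖ : ℝ) : ℂ) * ζ))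
      (((1 - ‖a‖ : ℝ) : ℂ) • deriv ψ a) 0 := by
    have e1 : HasDerivAt (fun ζ : ℂ => a + ((1 - ‖a‖ : ℝ) : ℂ) * ζ) ((1 - ‖a‖ : ℝ) : ℂ) 0 := by
      simpa using ((hasDerivAt_id (0:ℂ)).const_mul ((1 - ‖a‖ : ℝ) : ℂ)).const_add a
    have e2 : HasDerivAt ψ (deriv ψ a) (a + ((1 - ‖a‖ : ℝ) : ℂ) * 0) := by
      rw [mul_zero, add_zero]
      exact (h1.differentiableAt (isOpen_ball.mem_nhds ha)).hasDerivAt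
    exact e2.scomp (0:ℂ) e1
  have := h (fun ζ : ℂ => ψ (a + ((1 - ‖a‖ : ℝ) : ℂ) * ζ))
    (h1.comp (by fun_prop) hmaps) (h2.comp hmaps)
  rw [hder.deriv] at this
  simp only [mul_zero, add_zero, map_smul, norm_smul, norm_real] at this
  rw [norm_of_nonneg (by linarith), mul_comm, mul_comm (1 - ‖a‖)] at this
  exact this

theorem exists_geodesic_r_le {φ : ℂ → E N} (hφ : IsComplexGeodesic Ω φ) :
    ∃ C > 0, ∀ a ∈ 𝔻, D.r (φ a) ≤ C * (1 - ‖a‖) := by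
  obtain ⟨C, hC, h⟩ := D.exists_geodesic_le
  have h0 : (0:ℂ) ∈ 𝔻 := mem_ball_self one_pos
  have hM := D.M_pos
  have hM1 := D.one_le_M
  have hr0 := D.r_pos (hφ.2.1 h0)
  refine ⟨C * (D.M ^ 2) ^ 2 / D.r (φ 0), by positivity, fun a ha => ?_⟩
  have hz := subset_closure (hφ.2.1 h0)
  have hw := subset_closure (hφ.2.1 ha)
  have hMM : D.M ≤ D.M ^ 2 := by nlinarith
  have hd := D.diam_le _ hz _ hw
  have := h φ hφ 0 h0 a ha (D.M ^ 2) (by positivity) ((D.r_le hz).trans hMM)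
    ((D.r_le hw).trans hMM) (by
      calc _ ≤ ‖D.L (φ 0)‖ * ‖φ a - φ 0‖ := le_opNorm _ _
        _ ≤ D.M * D.M := by gcongr; exact D.norm_L _ hz
        _ = _ := by ring) (by gcongr)
  have hphd : phd 0 a = ‖a‖ := by simp [phd]
  rw [hphd] at this
  rw [div_mul_eq_mul_div, le_div_iff₀ hr0]
  linarith

/-- A geodesic whose value at the origin is the deepest point of its image. -/
structure _root_.InvDist.Dom.Centered (φ : ℂ → E N) : Prop where
  geod : IsComplexGeodesic Ω φ
  max : ∀ a ∈ 𝔻, D.r (φ a) ≤ D.r (φ 0)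

theorem exists_centered {φ : ℂ → E N} (hφ : IsComplexGeodesic Ω φ) :
    ∃ c : ℂ, ‖c‖ < 1 ∧ D.Centered (fun ζ => φ (mob c ζ)) := by
  obtain ⟨C, hC, h⟩ := D.exists_geodesic_r_le hφ
  have h0 : (0:ℂ) ∈ 𝔻 := mem_ball_self one_pos
  have hr0 := D.r_pos (hφ.2.1 h0)
  set s := max 0 (1 - D.r (φ 0) / C) with hs
  have hs1 : s < 1 := by
    rw [hs, max_lt_iff]
    have : 0 < D.r (φ 0) / C := by positivity
    constructor <;> linarith
  have hs0 : 0 ≤ s := le_max_left _ _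
  have hsub : closedBall (0:ℂ) s ⊆ 𝔻 := closedBall_subset_ball hs1
  have hcont : ContinuousOn (fun a => D.r (φ a)) (closedBall 0 s) :=
    D.continuousOn_r.comp (hφ.1.continuousOn.mono hsub)
      (fun a ha => subset_closure (hφ.2.1 (hsub ha)))
  obtain ⟨c, hc, hmax⟩ := (isCompact_closedBall (0:ℂ) s).exists_isMaxOn
    ⟨0, mem_closedBall_self hs0⟩ hcont
  have hc1 : ‖c‖ < 1 := norm_lt_one_of_mem_ball (hsub hc)
  refine ⟨c, hc1, hφ.comp_mob hc1, fun a ha => ?_⟩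
  rw [mob_zero]
  have hb := mapsTo_mob hc1 ha
  set b := mob c a
  rcases le_or_gt ‖b‖ s with hbs | hbs
  · exact hmax (by simpa using hbs)
  · have h1 := h b hb
    have h2 : D.r (φ 0) ≤ D.r (φ c) := hmax (mem_closedBall_self hs0)
    have h3 : 1 - D.r (φ 0) / C ≤ ‖b‖ := (le_max_right _ _).trans hbs.le
    have h4 : C * (1 - ‖b‖) ≤ C * (D.r (φ 0) / C) := by gcongr; linarith
    rw [mul_div_cancel₀ _ hC.ne'] at h4
    linarith

theorem r_le_diam_sq {φ : ℂ → E N} (hφ : IsComplexGeodesic Ω φ) {d : ℝ}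
    (hd : ∀ a ∈ 𝔻, ‖φ a - φ 0‖ ≤ d) : D.r (φ 0) ≤ D.M * d ^ 2 := by
  obtain ⟨C, hC, h⟩ := D.exists_geodesic_r_le hφ
  have h0 : (0:ℂ) ∈ 𝔻 := mem_ball_self one_pos
  have hM := D.M_pos
  by_contra! hlt
  set κ := D.r (φ 0) - D.M * d ^ 2 with hκ
  have hκp : 0 < κ := by linarith
  set s := max (1 / 2) (1 - κ / (2 * C)) with hs
  have hs1 : s < 1 := by
    rw [hs, max_lt_iff]
    have : 0 < κ / (2 * C) := by positivity
    constructor <;> linarith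
  have hs0 : 0 < s := lt_of_lt_of_le (by norm_num) (le_max_left _ _)
  have hsub : closedBall (0:ℂ) s ⊆ 𝔻 := closedBall_subset_ball hs1
  have := re_ge_of_sphere (f := fun ζ => D.L (φ 0) (φ ζ - φ 0)) (m := κ / 2) (a := 0) hs0
    ((D.L (φ 0)).differentiable.comp_differentiableOn ((hφ.1.mono hsub).sub_const _))
    (fun ζ hζ => by
      have hζb : ζ ∈ 𝔻 := by rw [mem_ball_zero_iff, hζ]; exact hs1
      have h1 := h ζ hζb
      have h2 := D.d1 _ (subset_closure (hφ.2.1 h0)) _ (subset_closure (hφ.2.1 hζb))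
      have h3 := (_root_.abs_le.mp h2).2
      have h4 : D.M * ‖φ ζ - φ 0‖ ^ 2 ≤ D.M * d ^ 2 := by gcongr; exact hd ζ hζb
      have h5 : 1 - κ / (2 * C) ≤ ‖ζ‖ := by rw [hζ]; exact le_max_right _ _
      have h6 : C * (1 - ‖ζ‖) ≤ C * (κ / (2 * C)) := by gcongr; linarith
      have h7 : C * (κ / (2 * C)) = κ / 2 := by field_simp
      unfold r at *
      linarith) (by simpa using hs0.le)
  simp at this
  linarith

/-- The size of a centered geodesic. -/
def sz (φ : ℂ → E N) : ℝ := √(D.r (φ 0))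

namespace Centered

variable {D} {φ : ℂ → E N}

theorem diff (h : D.Centered φ) : DifferentiableOn ℂ φ 𝔻 := h.geod.1

theorem mem (h : D.Centered φ) {a : ℂ} (ha : a ∈ 𝔻) : φ a ∈ Ω := h.geod.2.1 ha

theorem memc (h : D.Centered φ) {a : ℂ} (ha : a ∈ 𝔻) : φ a ∈ closure Ω := subset_closure (h.mem ha)

theorem r_pos (h : D.Centered φ) : 0 < D.r (φ 0) := D.r_pos (h.mem (mem_ball_self one_pos))

theorem sz_pos (h : D.Centered φ) : 0 < D.sz φ := sqrt_pos.mpr h.r_pos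

theorem sz_sq (h : D.Centered φ) : D.sz φ ^ 2 = D.r (φ 0) := sq_sqrt h.r_pos.le

theorem sz_le (h : D.Centered φ) : D.sz φ ≤ D.M := by
  have h1 := D.r_le (h.memc (mem_ball_self one_pos))
  have h2 := D.one_le_M
  have h3 := h.sz_pos
  rw [← h.sz_sq] at h1
  nlinarith

theorem hasDerivAt (h : D.Centered φ) {a : ℂ} (ha : a ∈ 𝔻) : HasDerivAt φ (deriv φ a) a :=
  (h.diff.differentiableAt (isOpen_ball.mem_nhds ha)).hasDerivAt

theorem norm_deriv_apply_le (h : D.Centered φ) {a : ℂ} (ha : a ∈ 𝔻) {z : E N} (hz : z ∈ closure Ω) :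
    ‖deriv (fun ζ => D.L z (φ ζ)) a‖ ≤
      ‖D.L (φ a) (deriv φ a)‖ + D.M * ‖φ a - z‖ * ‖deriv φ a‖ := by
  have h1 : HasDerivAt (fun ζ => D.L z (φ ζ)) (D.L z (deriv φ a)) a :=
    (D.L z).hasFDerivAt.comp_hasDerivAt a (h.hasDerivAt ha)
  rw [h1.deriv]
  have e : D.L z (deriv φ a) = D.L (φ a) (deriv φ a) - (D.L (φ a) - D.L z) (deriv φ a) := by
    rw [sub_apply]; ring
  rw [e]
  refine (norm_sub_le _ _).trans ?_
  gcongr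
  refine (le_opNorm _ _).trans ?_
  gcongr
  exact D.d2 z hz _ (h.memc ha)

end Centered

theorem rpow_le_of_le_one {u p q : ℝ} (hu : 0 < u) (hu1 : u ≤ 1) (h : p ≤ q) : u ^ q ≤ u ^ p :=
  Real.rpow_le_rpow_of_exponent_ge hu hu1 h

set_option maxHeartbeats 1000000 in
theorem exists_r_le_sqrt : ∃ C > 0, ∀ φ : ℂ → E N, D.Centered φ → ∀ a ∈ 𝔻,
    D.r (φ a) ≤ C * D.sz φ ^ 2 * (1 - ‖a‖) ^ (1 / 2 : ℝ) := by
  obtain ⟨C0, hC0, hk⟩ := D.exists_geodesic_le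
  obtain ⟨C1, hC1, hd⟩ := D.exists_disc_deriv_bounds
  have hM := D.M_pos
  set K := 1 + 8 * (C1 + 8 * D.M * C1 ^ 2) + 64 * C1 ^ 2 with hK
  have hKp : 0 < K := by positivity
  refine ⟨C0 * K ^ 2, by positivity, fun φ h a ha => ?_⟩
  have h0 : (0:ℂ) ∈ 𝔻 := mem_ball_self one_pos
  have hs := h.sz_pos
  have hsq := h.sz_sq
  set s := D.sz φ with hsd
  have hder : ∀ a ∈ 𝔻, ‖deriv φ a‖ ≤ C1 * s * (1 - ‖a‖) ^ (-1 : ℝ) := by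
    intro a ha
    have ha1 := norm_lt_one_of_mem_ball ha
    rw [Real.rpow_neg_one, ← div_eq_mul_inv, le_div_iff₀ (by linarith)]
    refine ((hd φ h.diff h.geod.2.1 a ha).1).trans ?_
    rw [hsd, sz]
    gcongr
    exact h.max a ha
  have hder2 : ∀ a ∈ 𝔻, ‖deriv φ a‖ ≤ C1 * s * (1 - ‖a‖) ^ (-(9 / 8) : ℝ) := by
    intro a ha
    have ha1 := norm_lt_one_of_mem_ball ha
    refine (hder a ha).trans ?_
    gcongr C1 * s * ?_
    exact rpow_le_of_le_one (by linarith) (by linarith [norm_nonneg a]) (by norm_num)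
  have hx : ∀ a ∈ 𝔻, ‖φ a - φ 0‖ ≤ 8 * C1 * s * (1 - ‖a‖) ^ (-(1 / 8) : ℝ) := by
    intro a ha
    have := norm_sub_zero_le_of_deriv_bound h.diff (by norm_num) (by positivity) hder2 ha
    convert this using 2
    · ring
    · norm_num
  have hL : ∀ a ∈ 𝔻, ‖deriv (fun ζ => D.L (φ 0) (φ ζ)) a‖ ≤
      (C1 + 8 * D.M * C1 ^ 2) * s ^ 2 * (1 - ‖a‖) ^ (-(9 / 8) : ℝ) := by
    intro a ha
    have ha1 := norm_lt_one_of_mem_ball ha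
    have hu : 0 < 1 - ‖a‖ := by linarith
    have hu1 : 1 - ‖a‖ ≤ 1 := by linarith [norm_nonneg a]
    refine (h.norm_deriv_apply_le ha (h.memc h0)).trans ?_
    have e1 : ‖D.L (φ a) (deriv φ a)‖ ≤ C1 * s ^ 2 * (1 - ‖a‖) ^ (-(9 / 8) : ℝ) := by
      have : ‖D.L (φ a) (deriv φ a)‖ ≤ C1 * s ^ 2 * (1 - ‖a‖) ^ (-1 : ℝ) := by
        rw [Real.rpow_neg_one, ← div_eq_mul_inv, le_div_iff₀ hu]
        refine ((hd φ h.diff h.geod.2.1 a ha).2).trans ?_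
        rw [hsq]
        gcongr
        exact h.max a ha
      refine this.trans ?_
      gcongr C1 * s ^ 2 * ?_
      exact rpow_le_of_le_one hu hu1 (by norm_num)
    have e2 : D.M * ‖φ a - φ 0‖ * ‖deriv φ a‖ ≤ D.M * (8 * C1 * s * (1 - ‖a‖) ^ (-(1 / 8) : ℝ)) *
        (C1 * s * (1 - ‖a‖) ^ (-1 : ℝ)) := by
      gcongr
      · exact hx a ha
      · exact hder a ha
    have e3 : (1 - ‖a‖) ^ (-(1 / 8) : ℝ) * (1 - ‖a‖) ^ (-1 : ℝ) = (1 - ‖a‖) ^ (-(9 / 8) : ℝ) := by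
      rw [← rpow_add hu]; norm_num
    calc _ ≤ C1 * s ^ 2 * (1 - ‖a‖) ^ (-(9 / 8) : ℝ) +
          D.M * (8 * C1 * s * (1 - ‖a‖) ^ (-(1 / 8) : ℝ)) * (C1 * s * (1 - ‖a‖) ^ (-1 : ℝ)) :=
        add_le_add e1 e2
      _ = _ := by rw [← e3]; ring
  have hLx : ‖D.L (φ 0) (φ a - φ 0)‖ ≤
      8 * (C1 + 8 * D.M * C1 ^ 2) * s ^ 2 * (1 - ‖a‖) ^ (-(1 / 8) : ℝ) := by
    have := norm_sub_zero_le_of_deriv_bound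
      ((D.L (φ 0)).differentiable.comp_differentiableOn h.diff) (by norm_num) (by positivity) hL ha
    have e : (1:ℝ) - 9 / 8 = -(1 / 8) := by norm_num
    rw [e] at this
    rw [map_sub]
    refine this.trans (le_of_eq ?_)
    ring
  have ha1 := norm_lt_one_of_mem_ball ha
  have hu : 0 < 1 - ‖a‖ := by linarith
  have hu1 : 1 - ‖a‖ ≤ 1 := by linarith [norm_nonneg a]
  set v := (1 - ‖a‖) ^ (-(1 / 4) : ℝ) with hv
  have hv1 : 1 ≤ v := by
    have := rpow_le_of_le_one hu hu1 (show -(1 / 4 : ℝ) ≤ 0 by norm_num)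
    rwa [rpow_zero] at this
  have hvv : ((1 - ‖a‖) ^ (-(1 / 8) : ℝ)) ^ 2 = v := by
    rw [← rpow_natCast, ← rpow_mul hu.le]; norm_num [hv]
  have hv8 : (1 - ‖a‖) ^ (-(1 / 8) : ℝ) ≤ v := rpow_le_of_le_one hu hu1 (by norm_num)
  have hs2 : 0 < s ^ 2 * v := by positivity
  have hH : s ^ 2 ≤ K * s ^ 2 * v := by
    have : 1 ≤ K := by rw [hK]; nlinarith [mul_pos hM (pow_pos hC1 2), sq_nonneg C1]
    calc s ^ 2 = 1 * s ^ 2 * 1 := by ring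
      _ ≤ K * s ^ 2 * v := by gcongr
  have := hk φ h.geod 0 h0 a ha (K * s ^ 2 * v) (by positivity) (by rwa [← hsq])
    ((h.max a ha).trans (by rwa [← hsq])) (hLx.trans (by
      gcongr
      rw [hK]; nlinarith [sq_nonneg C1])) (by
      calc ‖φ a - φ 0‖ ^ 2 ≤ (8 * C1 * s * (1 - ‖a‖) ^ (-(1 / 8) : ℝ)) ^ 2 := by
            gcongr; exact hx a ha
        _ = 64 * C1 ^ 2 * s ^ 2 * v := by rw [← hvv]; ring
        _ ≤ K * s ^ 2 * v := by
          gcongr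
          rw [hK]
          have : 0 < 8 * (C1 + 8 * D.M * C1 ^ 2) := by positivity
          linarith)
  have hphd : phd 0 a = ‖a‖ := by simp [phd]
  rw [hphd, ← hsq] at this
  have hv2 : v ^ 2 * (1 - ‖a‖) = (1 - ‖a‖) ^ (1 / 2 : ℝ) := by
    rw [hv, ← rpow_natCast, ← rpow_mul hu.le, ← rpow_add_one hu.ne']; norm_num
  have e : C0 * (K * s ^ 2 * v) ^ 2 * (1 - ‖a‖) =
      s ^ 2 * (C0 * K ^ 2 * s ^ 2 * (1 - ‖a‖) ^ (1 / 2 : ℝ)) := by rw [← hv2]; ring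
  rw [e] at this
  exact le_of_mul_le_mul_left this (by positivity)

set_option maxHeartbeats 1000000 in
theorem exists_basic : ∃ C > 0, ∀ φ : ℂ → E N, D.Centered φ → ∀ a ∈ 𝔻,
    D.r (φ a) ≤ C * D.sz φ ^ 2 * (1 - ‖a‖) ∧
    ‖deriv φ a‖ ≤ C * D.sz φ * (1 - ‖a‖) ^ (1 / 2 - 1 : ℝ) ∧
    ‖D.L (φ a) (deriv φ a)‖ ≤ C * D.sz φ ^ 2 := by
  obtain ⟨C0, hC0, hk⟩ := D.exists_geodesic_le
  obtain ⟨C1, hC1, hd⟩ := D.exists_disc_deriv_bounds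
  obtain ⟨K2, hK2, hr2⟩ := D.exists_r_le_sqrt
  have hM := D.M_pos
  set K3 := 16 * (C1 * √K2) with hK3
  set K4 := C1 * K2 + D.M * K3 * (C1 * √K2) with hK4
  set K5 := 1 + 16 * K4 + K3 ^ 2 with hK5
  set K6 := C0 * K5 ^ 2 with hK6
  have hK3p : 0 < K3 := by positivity
  have hK4p : 0 < K4 := by positivity
  have hK5p : 0 < K5 := by positivity
  have hK6p : 0 < K6 := by positivity
  have h0 : (0:ℂ) ∈ 𝔻 := mem_ball_self one_pos
  have key : ∀ φ : ℂ → E N, D.Centered φ → ∀ a ∈ 𝔻,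
      D.r (φ a) ≤ K6 * D.sz φ ^ 2 * (1 - ‖a‖) := by
    intro φ h a ha
    have hs := h.sz_pos
    have hsq := h.sz_sq
    set s := D.sz φ with hsd
    have hder : ∀ a ∈ 𝔻, ‖deriv φ a‖ ≤ C1 * √K2 * s * (1 - ‖a‖) ^ (1 / 4 - 1 : ℝ) := by
      intro a ha
      have ha1 := norm_lt_one_of_mem_ball ha
      have hu : 0 < 1 - ‖a‖ := by linarith
      rw [rpow_sub_one hu.ne', ← mul_div_assoc, le_div_iff₀ hu]
      refine ((hd φ h.diff h.geod.2.1 a ha).1).trans ?_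
      have e1 : √(D.r (φ a)) ≤ √(K2 * s ^ 2 * (1 - ‖a‖) ^ (1 / 2 : ℝ)) :=
        sqrt_le_sqrt (hr2 φ h a ha)
      have e2 : √(K2 * s ^ 2 * (1 - ‖a‖) ^ (1 / 2 : ℝ)) = √K2 * s * (1 - ‖a‖) ^ (1 / 4 : ℝ) := by
        rw [sqrt_mul (by positivity), sqrt_mul hK2.le, sqrt_sq hs.le,
          sqrt_eq_rpow ((1 - ‖a‖) ^ (1 / 2 : ℝ)), ← rpow_mul hu.le]
        norm_num
      rw [e2] at e1
      calc C1 * √(D.r (φ a)) ≤ C1 * (√K2 * s * (1 - ‖a‖) ^ (1 / 4 : ℝ)) := by gcongr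
        _ = _ := by ring
    have hx : ∀ a ∈ 𝔻, ‖φ a - φ 0‖ ≤ K3 * s := by
      intro a ha
      have := norm_sub_le_of_hardy_littlewood h.diff (by norm_num) (by norm_num)
        (by positivity) hder ha h0
      refine this.trans ?_
      have h1 : ‖a - 0‖ ^ (1 / 4 : ℝ) ≤ 1 :=
        Real.rpow_le_one (norm_nonneg _) (by simpa using (norm_lt_one_of_mem_ball ha).le)
          (by norm_num)
      calc 4 / (1 / 4) * (C1 * √K2 * s) * ‖a - 0‖ ^ (1 / 4 : ℝ)
          ≤ 4 / (1 / 4) * (C1 * √K2 * s) * 1 := by gcongr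
        _ = K3 * s := by rw [hK3]; ring
    have hL : ∀ a ∈ 𝔻, ‖deriv (fun ζ => D.L (φ 0) (φ ζ)) a‖ ≤
        K4 * s ^ 2 * (1 - ‖a‖) ^ (1 / 4 - 1 : ℝ) := by
      intro a ha
      have ha1 := norm_lt_one_of_mem_ball ha
      have hu : 0 < 1 - ‖a‖ := by linarith
      have hu1 : 1 - ‖a‖ ≤ 1 := by linarith [norm_nonneg a]
      refine (h.norm_deriv_apply_le ha (h.memc h0)).trans ?_
      have e1 : ‖D.L (φ a) (deriv φ a)‖ ≤ C1 * K2 * s ^ 2 * (1 - ‖a‖) ^ (1 / 4 - 1 : ℝ) := by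
        have : ‖D.L (φ a) (deriv φ a)‖ ≤ C1 * K2 * s ^ 2 * (1 - ‖a‖) ^ (1 / 2 - 1 : ℝ) := by
          rw [rpow_sub_one hu.ne', ← mul_div_assoc, le_div_iff₀ hu]
          refine ((hd φ h.diff h.geod.2.1 a ha).2).trans ?_
          calc C1 * D.r (φ a) ≤ C1 * (K2 * s ^ 2 * (1 - ‖a‖) ^ (1 / 2 : ℝ)) := by
                gcongr; exact hr2 φ h a ha
            _ = _ := by ring
        refine this.trans ?_
        gcongr C1 * K2 * s ^ 2 * ?_
        exact rpow_le_of_le_one hu hu1 (by norm_num)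
      have e2 : D.M * ‖φ a - φ 0‖ * ‖deriv φ a‖ ≤ D.M * (K3 * s) *
          (C1 * √K2 * s * (1 - ‖a‖) ^ (1 / 4 - 1 : ℝ)) := by
        gcongr
        · exact hx a ha
        · exact hder a ha
      calc _ ≤ C1 * K2 * s ^ 2 * (1 - ‖a‖) ^ (1 / 4 - 1 : ℝ) + D.M * (K3 * s) *
          (C1 * √K2 * s * (1 - ‖a‖) ^ (1 / 4 - 1 : ℝ)) := add_le_add e1 e2
        _ = _ := by rw [hK4]; ring
    have hLx : ‖D.L (φ 0) (φ a - φ 0)‖ ≤ 16 * K4 * s ^ 2 := by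
      have := norm_sub_le_of_hardy_littlewood
        ((D.L (φ 0)).differentiable.comp_differentiableOn h.diff) (by norm_num) (by norm_num)
        (by positivity) hL ha h0
      rw [map_sub]
      refine this.trans ?_
      have h1 : ‖a - 0‖ ^ (1 / 4 : ℝ) ≤ 1 :=
        Real.rpow_le_one (norm_nonneg _) (by simpa using (norm_lt_one_of_mem_ball ha).le)
          (by norm_num)
      calc 4 / (1 / 4) * (K4 * s ^ 2) * ‖a - 0‖ ^ (1 / 4 : ℝ)
          ≤ 4 / (1 / 4) * (K4 * s ^ 2) * 1 := by gcongr
        _ = _ := by ring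
    have hs2 : 0 < s ^ 2 := by positivity
    have hH : s ^ 2 ≤ K5 * s ^ 2 := by
      have : 1 ≤ K5 := by rw [hK5]; nlinarith
      nlinarith
    have := hk φ h.geod 0 h0 a ha (K5 * s ^ 2) (by positivity) (by rwa [← hsq])
      ((h.max a ha).trans (by rwa [← hsq])) (hLx.trans (by
        gcongr
        rw [hK5]; nlinarith)) (by
        calc ‖φ a - φ 0‖ ^ 2 ≤ (K3 * s) ^ 2 := by
              gcongr; exact hx a ha
          _ = K3 ^ 2 * s ^ 2 := by ring
          _ ≤ K5 * s ^ 2 := by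
            gcongr
            rw [hK5]
            linarith)
    have hphd : phd 0 a = ‖a‖ := by simp [phd]
    rw [hphd, ← hsq] at this
    have e : C0 * (K5 * s ^ 2) ^ 2 * (1 - ‖a‖) = s ^ 2 * (K6 * s ^ 2 * (1 - ‖a‖)) := by
      rw [hK6]; ring
    rw [e] at this
    exact le_of_mul_le_mul_left this (by positivity)
  refine ⟨max K6 (max (C1 * √K6) (C1 * K6)), by positivity, fun φ h a ha => ?_⟩
  have ha1 := norm_lt_one_of_mem_ball ha
  have hu : 0 < 1 - ‖a‖ := by linarith
  have hs := h.sz_pos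
  have hr := key φ h a ha
  have h1 := hd φ h.diff h.geod.2.1 a ha
  refine ⟨hr.trans ?_, ?_, ?_⟩
  · gcongr; exact le_max_left _ _
  · have e1 : √(D.r (φ a)) ≤ √(K6 * D.sz φ ^ 2 * (1 - ‖a‖)) := sqrt_le_sqrt hr
    have e2 : √(K6 * D.sz φ ^ 2 * (1 - ‖a‖)) = √K6 * D.sz φ * (1 - ‖a‖) ^ (1 / 2 : ℝ) := by
      rw [sqrt_mul (by positivity), sqrt_mul hK6p.le, sqrt_sq hs.le,
        sqrt_eq_rpow (1 - ‖a‖)]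
    rw [e2] at e1
    have : ‖deriv φ a‖ ≤ C1 * √K6 * D.sz φ * (1 - ‖a‖) ^ (1 / 2 - 1 : ℝ) := by
      rw [rpow_sub_one hu.ne', ← mul_div_assoc, le_div_iff₀ hu]
      calc _ ≤ _ := h1.1
        _ ≤ C1 * (√K6 * D.sz φ * (1 - ‖a‖) ^ (1 / 2 : ℝ)) := by gcongr
        _ = _ := by ring
    refine this.trans ?_
    gcongr
    exact (le_max_left _ _).trans (le_max_right _ _)
  · have : ‖D.L (φ a) (deriv φ a)‖ * (1 - ‖a‖) ≤ C1 * K6 * D.sz φ ^ 2 * (1 - ‖a‖) := by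
      calc _ ≤ _ := h1.2
        _ ≤ C1 * (K6 * D.sz φ ^ 2 * (1 - ‖a‖)) := by gcongr
        _ = _ := by ring
    refine (le_of_mul_le_mul_right this hu).trans ?_
    gcongr
    exact (le_max_right _ _).trans (le_max_right _ _)

theorem exists_holder : ∃ C > 0, ∀ φ : ℂ → E N, D.Centered φ → ∀ a ∈ 𝔻,
    ∀ b ∈ 𝔻, ‖φ a - φ b‖ ≤ C * D.sz φ * ‖a - b‖ ^ (1 / 2 : ℝ) := by
  obtain ⟨C, hC, h⟩ := D.exists_basic
  refine ⟨8 * C, by positivity, fun φ hφ a ha b hb => ?_⟩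
  have hs := hφ.sz_pos
  have := norm_sub_le_of_hardy_littlewood hφ.diff (by norm_num) (by norm_num)
    (by positivity) (fun a ha => (h φ hφ a ha).2.1) ha hb
  convert this using 2
  ring

end Dom

theorem le_of_artanh_le {x y : ℝ} (hx : 0 ≤ x) (hx1 : x < 1) (hy : 0 ≤ y) (hy1 : y < 1)
    (h : artanh x ≤ artanh y) : x ≤ y := by
  unfold artanh at h
  have h1 : log ((1 + x) / (1 - x)) ≤ log ((1 + y) / (1 - y)) := by linarith
  have hx' : 0 < 1 - x := by linarith
  have hy' : 0 < 1 - y := by linarith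
  rw [Real.log_le_log_iff (by positivity) (by positivity), div_le_div_iff₀ hx' hy'] at h1
  nlinarith

namespace Dom

variable {Ω : Set (E N)} {α : ℝ} (D : Dom Ω α)

theorem hasDerivAt_r_comp {γ : ℝ → E N} {v : E N} {s : ℝ} (hγ : HasDerivAt γ v s)
    (hs : γ s ∈ closure Ω) (hmem : ∀ᶠ t in 𝓝 s, γ t ∈ closure Ω) :
    HasDerivAt (fun t => D.r (γ t)) (-(D.L (γ s) v).re) s := by
  have hL : HasDerivAt (fun t => -(D.L (γ s) (γ t)).re) (-(D.L (γ s) v).re) s := by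
    have h1 : HasDerivAt (fun t => D.L (γ s) (γ t)) (D.L (γ s) v) s :=
      ((D.L (γ s)).restrictScalars ℝ).hasFDerivAt.comp_hasDerivAt s hγ
    exact (Complex.reCLM.hasFDerivAt.comp_hasDerivAt s h1).neg
  have hO : (fun t => D.r (γ t) - (D.r (γ s) + (-(D.L (γ s) (γ t)).re + (D.L (γ s) (γ s)).re)))
      =o[𝓝 s] fun t => t - s := by
    have h1 : (fun t => D.r (γ t) - (D.r (γ s) + (-(D.L (γ s) (γ t)).re + (D.L (γ s) (γ s)).re)))
        =O[𝓝 s] fun t => ‖γ t - γ s‖ ^ 2 := by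
      refine Asymptotics.IsBigO.of_bound D.M ?_
      filter_upwards [hmem] with t ht
      have := D.d1 _ hs _ ht
      rw [map_sub, sub_re] at this
      rw [norm_eq_abs, norm_of_nonneg (by positivity), ← abs_neg]
      convert this using 2
      simp only [r]; ring
    have h2 : (fun t => ‖γ t - γ s‖ ^ 2) =O[𝓝 s] fun t => ‖t - s‖ ^ 2 :=
      hγ.isBigO_sub.norm_norm.pow 2
    refine (h1.trans h2).trans_isLittleO ?_
    have h3 : (fun t : ℝ => ‖t - s‖ ^ 2) =o[𝓝 s] fun t => t - s := by
      have := Asymptotics.isLittleO_pow_sub_sub (E' := ℝ) s (m := 2) (by norm_num)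
      refine (Asymptotics.isLittleO_norm_left.mp ?_)
      refine this.congr_left fun x => ?_
      simp
    exact h3
  rw [hasDerivAt_iff_isLittleO] at hL ⊢
  refine (hO.add hL).congr_left fun t => ?_
  simp only [smul_eq_mul]
  ring

/-- Along a radius the defining function of a disc decays at most polynomially. -/
theorem exists_radial_lower : ∃ C : ℝ, 0 < C ∧ ∀ φ : ℂ → E N, DifferentiableOn ℂ φ 𝔻 →
    MapsTo φ 𝔻 Ω → ∀ a ∈ 𝔻,
      D.r (φ 0) * (1 - ‖a‖) ^ C ≤ D.r (φ a) := by
  obtain ⟨C, hC, hd⟩ := D.exists_disc_deriv_bounds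
  refine ⟨C, hC, fun φ h1 h2 a ha => ?_⟩
  have ha1 := norm_lt_one_of_mem_ball ha
  rcases eq_or_ne a 0 with rfl | hne
  · simp
  set u : ℂ := a / ‖a‖ with hu
  have hna : (‖a‖ : ℂ) ≠ 0 := by simpa using hne
  have hu1 : ‖u‖ = 1 := by simp [hu, hne]
  have hau : (‖a‖ : ℂ) * u = a := by rw [hu]; field_simp
  have hsn : ∀ s ∈ Icc 0 ‖a‖, ‖(s : ℂ) * u‖ = s := fun s hs => by
    rw [norm_mul, hu1, mul_one, norm_real, norm_of_nonneg hs.1]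
  have hsu : ∀ s ∈ Icc 0 ‖a‖, (s : ℂ) * u ∈ 𝔻 := fun s hs => by
    rw [mem_ball_zero_iff, hsn s hs]; linarith [hs.2]
  have hder : ∀ s ∈ Icc 0 ‖a‖, HasDerivAt (fun t : ℝ => D.r (φ (t * u)))
      (-(D.L (φ (s * u)) (u • deriv φ (s * u))).re) s := by
    intro s hs
    have hm := hsu s hs
    have e0 : HasDerivAt (fun t : ℝ => (t : ℂ) * u) u s := by
      simpa using (HasDerivAt.ofReal_comp (hasDerivAt_id s)).mul_const u
    have e1 : HasDerivAt φ (deriv φ (s * u)) (s * u) :=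
      (h1.differentiableAt (isOpen_ball.mem_nhds hm)).hasDerivAt
    have e2 : HasDerivAt (fun t : ℝ => φ (t * u)) (u • deriv φ (s * u)) s :=
      HasDerivAt.scomp s (h := fun t : ℝ => (t : ℂ) * u) e1 e0
    refine D.hasDerivAt_r_comp e2 (subset_closure (h2 hm)) ?_
    have : ∀ᶠ t : ℝ in 𝓝 s, (t : ℂ) * u ∈ 𝔻 :=
      (e0.continuousAt.eventually (isOpen_ball.mem_nhds hm))
    filter_upwards [this] with t ht using subset_closure (h2 ht)
  have hpow : ∀ s ∈ Icc 0 ‖a‖, HasDerivAt (fun t : ℝ => (1 - t) ^ (-C))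
      (C * (1 - s) ^ (-C - 1)) s := by
    intro s hs
    have : HasDerivAt (fun t : ℝ => 1 - t) (-1) s := by
      exact (hasDerivAt_id s).const_sub 1
    convert this.rpow_const (p := -C) (Or.inl (by linarith [hs.2])) using 1
    ring
  have hmono : MonotoneOn (fun t : ℝ => D.r (φ (t * u)) * (1 - t) ^ (-C)) (Icc 0 ‖a‖) := by
    refine monotoneOn_of_deriv_nonneg (convex_Icc _ _)
      (fun s hs => ((hder s hs).mul (hpow s hs)).continuousAt.continuousWithinAt)
      (fun s hs => ?_) (fun s hs => ?_)
    · exact ((hder s (interior_subset hs)).mul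
        (hpow s (interior_subset hs))).differentiableAt.differentiableWithinAt
    · have hs' := interior_subset hs
      have hp : 0 < 1 - s := by linarith [hs'.2]
      have hdv : deriv (fun t : ℝ => D.r (φ (t * u)) * (1 - t) ^ (-C)) s = _ :=
        ((hder s hs').mul (hpow s hs')).deriv
      rw [hdv, rpow_sub_one hp.ne']
      have hb := (hd φ h1 h2 _ (hsu s hs')).2
      rw [hsn s hs'] at hb
      have hre : (D.L (φ (s * u)) (u • deriv φ (s * u))).re ≤
          ‖D.L (φ (s * u)) (deriv φ (s * u))‖ := by
        refine (re_le_norm _).trans ?_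
        rw [map_smul, norm_smul, hu1, one_mul]
      have hq : (D.L (φ (s * u)) (u • deriv φ (s * u))).re ≤ C * D.r (φ (s * u)) / (1 - s) := by
        rw [le_div_iff₀ hp]
        exact (mul_le_mul_of_nonneg_right hre hp.le).trans hb
      have hpp : 0 < (1 - s) ^ (-C) := by positivity
      have e : -(D.L (φ (s * u)) (u • deriv φ (s * u))).re * (1 - s) ^ (-C) +
          D.r (φ (s * u)) * (C * ((1 - s) ^ (-C) / (1 - s))) =
          (1 - s) ^ (-C) * (C * D.r (φ (s * u)) / (1 - s) -
            (D.L (φ (s * u)) (u • deriv φ (s * u))).re) := by ring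
      rw [e]
      exact mul_nonneg hpp.le (by linarith)
  have := hmono (left_mem_Icc.mpr (norm_nonneg a)) (right_mem_Icc.mpr (norm_nonneg a))
    (norm_nonneg a)
  simp only [Complex.ofReal_zero, zero_mul, sub_zero, Real.one_rpow, mul_one, hau] at this
  have hp : 0 < 1 - ‖a‖ := by linarith
  rw [Real.rpow_neg hp.le, ← div_eq_mul_inv, le_div_iff₀ (by positivity)] at this
  exact this

set_option maxHeartbeats 1000000 in
/-- Hopf lemma for centered geodesics. -/
theorem exists_hopf : ∃ c > 0, ∀ φ : ℂ → E N, D.Centered φ → ∀ a ∈ 𝔻,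
    c * D.sz φ ^ 2 * (1 - ‖a‖) ≤ D.r (φ a) := by
  obtain ⟨C0, hC0, hrad⟩ := D.exists_radial_lower
  obtain ⟨G, C, c, ε, hC, hc, hε, hGd, hGz, -, -, hG⟩ := D.exists_peak
  obtain ⟨C2, hC2, hhol⟩ := D.exists_holder
  have hM := D.M_pos
  set η := min (1 / 2) ((ε / (C2 * D.M)) ^ 2 / 2) with hη
  have hηp : 0 < η := by positivity
  have hη2 : η ≤ 1 / 2 := min_le_left _ _
  have hηε : C2 * D.M * √(2 * η) ≤ ε := by
    have : √(2 * η) ≤ ε / (C2 * D.M) := by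
      rw [Real.sqrt_le_left (by positivity)]
      linarith [min_le_right (1 / 2) ((ε / (C2 * D.M)) ^ 2 / 2)]
    rw [le_div_iff₀ (by positivity)] at this
    linarith
  have hηC : 0 < η ^ C0 := by positivity
  refine ⟨min (η ^ C0) (min (ε / D.M ^ 2) (η ^ C0 / (8 * η))), by positivity,
    fun φ h a ha => ?_⟩
  have ha1 := norm_lt_one_of_mem_ball ha
  have hs := h.sz_pos
  have hsq := h.sz_sq
  have hu : 0 < 1 - ‖a‖ := by linarith
  have hu1 : 1 - ‖a‖ ≤ 1 := by linarith [norm_nonneg a]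
  set κ := min (η ^ C0) (min (ε / D.M ^ 2) (η ^ C0 / (8 * η))) with hκ
  have hκp : 0 < κ := by positivity
  rcases lt_or_ge (‖a‖) (1 - η) with hcase | hcase
  · calc κ * D.sz φ ^ 2 * (1 - ‖a‖) ≤ η ^ C0 * D.sz φ ^ 2 * 1 := by
          gcongr; exact min_le_left _ _
      _ = D.r (φ 0) * η ^ C0 := by rw [hsq]; ring
      _ ≤ D.r (φ 0) * (1 - ‖a‖) ^ C0 := by
          have := h.r_pos
          gcongr; linarith
      _ ≤ _ := hrad φ h.diff h.geod.2.1 a ha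
  rcases lt_or_ge ε (D.r (φ a)) with hbig | hsmall
  · calc κ * D.sz φ ^ 2 * (1 - ‖a‖) ≤ ε / D.M ^ 2 * D.M ^ 2 * 1 := by
          gcongr
          · exact (min_le_right _ _).trans (min_le_left _ _)
          · exact h.sz_le
      _ = ε := by field_simp
      _ ≤ _ := hbig.le
  have hane : a ≠ 0 := by
    rintro rfl
    simp at hcase; linarith
  set s' : ℂ := ((1 - η : ℝ) : ℂ) * (a / ‖a‖) with hs'
  have hna : (‖a‖ : ℂ) ≠ 0 := by simpa using hane
  have hnap : 0 < ‖a‖ := norm_pos_iff.mpr hane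
  have hs'n : ‖s'‖ = 1 - η := by
    rw [hs', norm_mul, norm_real, norm_div, norm_real, norm_norm, div_self hnap.ne',
      mul_one, norm_of_nonneg (by linarith)]
  have hdist : dist a s' = ‖a‖ - (1 - η) := by
    have : a - s' = ((‖a‖ - (1 - η) : ℝ) : ℂ) * (a / ‖a‖) := by
      rw [hs']; push_cast; field_simp
    rw [dist_eq_norm, this, norm_mul, norm_real, norm_div, norm_real, norm_norm,
      div_self hnap.ne', mul_one, norm_of_nonneg (by linarith)]
  have hsub : ball s' η ⊆ 𝔻 := by
    intro x hx
    rw [mem_ball, dist_eq_norm] at hx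
    rw [mem_ball_zero_iff]
    calc ‖x‖ ≤ ‖x - s'‖ + ‖s'‖ := by simpa using norm_add_le (x - s') s'
      _ < 1 := by rw [hs'n]; linarith
  have has' : a ∈ ball s' η := by rw [mem_ball, hdist]; linarith
  have hclose : ∀ x ∈ ball s' η, ‖φ x - φ a‖ ≤ ε := by
    intro x hx
    refine (hhol φ h x (hsub hx) a ha).trans ?_
    have hxa : ‖x - a‖ ≤ 2 * η := by
      rw [← dist_eq_norm]
      have h1 := dist_triangle_right x a s'
      have h2 : dist x s' < η := hx
      have h3 : dist a s' < η := has'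
      linarith
    calc C2 * D.sz φ * ‖x - a‖ ^ (1 / 2 : ℝ) ≤ C2 * D.M * (2 * η) ^ (1 / 2 : ℝ) := by
          gcongr; exact h.sz_le
      _ ≤ ε := by rw [← sqrt_eq_rpow]; exact hηε
  have hlow : ∀ x ∈ ball s' η, D.r (φ x) / 2 ≤ (G (φ a) (φ x)).re := by
    intro x hx
    have := hG _ (h.memc ha) _ (h.memc (hsub hx)) hsmall (hclose x hx)
    have := mul_nonneg hc.le (sq_nonneg ‖φ x - φ a‖)
    linarith
  have hsm : s' ∈ ball s' η := mem_ball_self hηp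
  have hH := re_le_of_harnack hηp (g := fun ζ => G (φ a) (φ ζ))
    ((hGd (φ a)).comp_differentiableOn (h.diff.mono hsub)) (fun x hx => by
      have := D.r_pos (h.mem (hsub hx))
      exact lt_of_lt_of_le (by positivity) (hlow x hx)) has'
  have e1 : η - dist a s' = 1 - ‖a‖ := by rw [hdist]; ring
  rw [e1, hdist, hGz _ (h.memc ha)] at hH
  have e2 : (2 * (D.r (φ a) : ℂ)).re = 2 * D.r (φ a) := by simp
  rw [e2] at hH
  have h3 : D.r (φ 0) * η ^ C0 / 2 ≤ (G (φ a) (φ s')).re := by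
    have := hrad φ h.diff h.geod.2.1 s' (hsub hsm)
    rw [hs'n, show 1 - (1 - η) = η by ring] at this
    linarith [hlow s' hsm]
  have hra := D.r_pos (h.mem ha)
  have h4 : D.r (φ 0) * η ^ C0 / 2 * (1 - ‖a‖) ≤ 2 * D.r (φ a) * (2 * η) := by
    refine ((mul_le_mul_of_nonneg_right h3 hu.le).trans hH).trans ?_
    gcongr; linarith
  calc κ * D.sz φ ^ 2 * (1 - ‖a‖) ≤ η ^ C0 / (8 * η) * D.sz φ ^ 2 * (1 - ‖a‖) := by
        gcongr; exact (min_le_right _ _).trans (min_le_right _ _)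
    _ = (D.r (φ 0) * η ^ C0 / 2 * (1 - ‖a‖)) / (4 * η) := by rw [hsq]; field_simp; ring
    _ ≤ (2 * D.r (φ a) * (2 * η)) / (4 * η) := div_le_div_of_nonneg_right h4 (by positivity)
    _ = D.r (φ a) := by field_simp; norm_num

set_option maxHeartbeats 1000000 in
/-- Parameter distances are controlled by the anisotropic displacement. -/
theorem exists_parameter_le : ∃ C > 0, ∀ φ : ℂ → E N, D.Centered φ → ∀ a ∈ 𝔻,
    ∀ b ∈ 𝔻, D.sz φ ^ 2 * ‖a - b‖ ≤ C * (‖D.L (φ a) (φ b - φ a)‖ +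
      ‖φ b - φ a‖ ^ 2 + ‖φ b - φ a‖ * √(D.r (φ a))) := by
  obtain ⟨C0, hC0, hk⟩ := D.exists_geodesic_le
  obtain ⟨c0, hc0, haff⟩ := D.exists_affine_disc
  set c1 := min c0 1 with hc1d
  have hc1 : 0 < c1 := by positivity
  have hc11 : c1 ≤ 1 := min_le_right _ _
  have hc10 : c1 ≤ c0 := min_le_left _ _
  obtain ⟨c2, hc2, hopf⟩ := D.exists_hopf
  have hM := D.M_pos
  have hM1 := D.one_le_M
  set C1 := 2 * √C0 * D.M / c2 with hC1
  have hC1p : 0 < C1 := by positivity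
  set g := 1 / c1 with hg
  have hg1 : 1 ≤ g := by rw [hg, le_div_iff₀ hc1]; linarith
  set K := 16 * g ^ 2 + 2 with hK
  have hKp : 0 < K := by positivity
  refine ⟨3 * C1 * K, by positivity, fun φ h a ha b hb => ?_⟩
  have ha1 := norm_lt_one_of_mem_ball ha
  have hb1 := norm_lt_one_of_mem_ball hb
  have hs := h.sz_pos
  have hra := D.r_pos (h.mem ha)
  have hrb := D.r_pos (h.mem hb)
  set x := φ b - φ a with hx
  set l := ‖D.L (φ a) x‖ with hl
  have hl0 : 0 ≤ l := norm_nonneg _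
  have hx0 : 0 ≤ ‖x‖ := norm_nonneg _
  set H := D.r (φ a) + l + ‖x‖ ^ 2 with hH
  have hHp : 0 < H := by positivity
  set w := ‖1 - conj a * b‖ with hw
  have hwp : 0 < w := norm_pos_iff.mpr (one_sub_conj_mul_ne_zero ha1 hb1.le)
  have hphd : phd a b * w = ‖a - b‖ := by
    rw [phd, norm_div, div_mul_cancel₀ _ hwp.ne']
  have hp1 := phd_lt_one ha1 hb1
  have hp0 := phd_nonneg a b
  have hw1 : D.sz φ ^ 2 * w ≤ C1 * H := by
    have hHM : H ≤ D.M * H := le_mul_of_one_le_left hHp.le hM1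
    have hx2 : 0 ≤ ‖x‖ ^ 2 := by positivity
    have h1 := hk φ h.geod a ha b hb (D.M * H) (by positivity) (by linarith)
      (by
        have := _root_.abs_le.mp (D.d1 _ (h.memc ha) _ (h.memc hb))
        have h2 := (_root_.abs_le.mp (abs_re_le_norm (D.L (φ a) (φ b - φ a)))).1
        simp only [← hx, ← hl] at this h2
        have : D.r (φ b) ≤ D.r (φ a) + l + D.M * ‖x‖ ^ 2 := by simp only [r]; linarith
        have h3 : D.r (φ a) + l ≤ D.M * (D.r (φ a) + l) :=
          le_mul_of_one_le_left (by positivity) hM1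
        rw [hH, mul_add]
        linarith)
      (by rw [← hx, ← hl]; linarith)
      (by rw [← hx]; linarith)
    have h2 : 1 - phd a b ≤ 4 * (1 - ‖a‖) * (1 - ‖b‖) / w ^ 2 := by
      have e := one_sub_phd_sq ha1 hb1.le
      have : phd a b ^ 2 ≤ phd a b := pow_le_of_le_one hp0 hp1.le two_ne_zero
      replace this : 1 - phd a b ≤ 1 - phd a b ^ 2 := by linarith
      refine this.trans (e.le.trans ?_)
      refine div_le_div_of_nonneg_right ?_ (by positivity)
      have g1 : 1 - ‖a‖ ^ 2 ≤ 2 * (1 - ‖a‖) := by linarith [sq_nonneg (1 - ‖a‖)]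
      have g2 : 1 - ‖b‖ ^ 2 ≤ 2 * (1 - ‖b‖) := by linarith [sq_nonneg (1 - ‖b‖)]
      calc (1 - ‖a‖ ^ 2) * (1 - ‖b‖ ^ 2) ≤ (2 * (1 - ‖a‖)) * (2 * (1 - ‖b‖)) := by
            gcongr
            exact sub_nonneg.mpr (pow_le_one₀ (norm_nonneg b) hb1.le)
        _ = _ := by ring
    have hu : 0 < 1 - ‖a‖ := by linarith
    have hv : 0 < 1 - ‖b‖ := by linarith
    have h3 : (c2 * D.sz φ ^ 2 * (1 - ‖a‖)) * (c2 * D.sz φ ^ 2 * (1 - ‖b‖)) ≤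
        C0 * (D.M * H) ^ 2 * (4 * (1 - ‖a‖) * (1 - ‖b‖) / w ^ 2) := by
      refine (mul_le_mul (hopf φ h a ha) (hopf φ h b hb) (by positivity) hra.le).trans
        (h1.trans ?_)
      gcongr
    rw [mul_div_assoc', le_div_iff₀ (by positivity)] at h3
    have h4 : (c2 * (D.sz φ ^ 2 * w)) ^ 2 ≤ (2 * √C0 * D.M * H) ^ 2 := by
      have e : (2 * √C0 * D.M * H) ^ 2 = 4 * C0 * D.M ^ 2 * H ^ 2 := by
        rw [mul_pow, mul_pow, mul_pow, sq_sqrt hC0.le]; ring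
      rw [e]
      refine le_of_mul_le_mul_right (a := (1 - ‖a‖) * (1 - ‖b‖)) ?_ (by positivity)
      linarith
    have h5 := (pow_le_pow_iff_left₀ (by positivity) (by positivity) two_ne_zero).mp h4
    rw [hC1, div_mul_eq_mul_div, le_div_iff₀ hc2]
    linarith
  rw [← hphd]
  set q := √(D.r (φ a)) with hq
  have hq2 : q ^ 2 = D.r (φ a) := sq_sqrt hra.le
  have hqp : 0 < q := sqrt_pos.mpr hra
  set X := l + ‖x‖ ^ 2 + ‖x‖ * q with hX
  have hX0 : 0 ≤ X := by positivity
  set θ := 4 * l / D.r (φ a) + ‖x‖ / (c1 * q) with hθ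
  have hθ0 : 0 ≤ θ := by positivity
  have hθr : θ * D.r (φ a) = 4 * l + ‖x‖ * q / c1 := by
    rw [hθ, ← hq2]; field_simp
  have hgg : g ≤ g ^ 2 := le_self_pow₀ hg1 two_ne_zero
  have hK' : 4 * l + ‖x‖ * q / c1 ≤ K * X := by
    have e : ‖x‖ * q / c1 = g * (‖x‖ * q) := by rw [hg]; ring
    have h1 : 4 * l ≤ K * l := by gcongr; linarith
    have h2 : g * (‖x‖ * q) ≤ K * (‖x‖ * q) := by gcongr; linarith
    have h3 : 0 ≤ K * ‖x‖ ^ 2 := by positivity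
    rw [e, hX]
    linarith
  rcases lt_or_ge θ (1 / 2) with hsmall | hbig
  · have hple : phd a b ≤ θ := by
      rcases hθ0.eq_or_lt with h0 | hθp
      · have hx0' : x = 0 := by
          have h1 : 0 ≤ 4 * l / D.r (φ a) := by positivity
          have h2 : 0 ≤ ‖x‖ / (c1 * q) := by positivity
          have h3 : ‖x‖ / (c1 * q) = 0 := by linarith
          rw [div_eq_zero_iff] at h3
          rcases h3 with h3 | h3
          · exact norm_eq_zero.mp h3
          · exact absurd h3 (by positivity)
        have heq : φ b = φ a := sub_eq_zero.mp hx0'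
        have h4 := h.geod.artanh_le ha hb (r := 0) (by rw [heq]; exact KLe.refl (h.mem ha))
        rw [← h0]
        exact le_of_artanh_le hp0 hp1 le_rfl one_pos (by rwa [artanh_zero])
      · have := haff (φ a) (h.mem ha) x θ hθp (by linarith) (by
          rw [hθr]
          have : 0 ≤ ‖x‖ * q / c1 := by positivity
          linarith) (by
          have e : ‖x‖ = ‖x‖ / (c1 * q) * c1 * q := by field_simp
          have h1 : ‖x‖ / (c1 * q) ≤ θ := by
            have : 0 ≤ 4 * l / D.r (φ a) := by positivity
            linarith
          calc ‖x‖ = ‖x‖ / (c1 * q) * c1 * q := e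
            _ ≤ θ * c0 * q := by gcongr)
        have hk1 := this.2.1
        rw [hx, add_sub_cancel] at hk1
        exact le_of_artanh_le hp0 hp1 hθp.le (by linarith) (h.geod.artanh_le ha hb hk1)
    have hHr : H ≤ 3 * D.r (φ a) := by
      have h1 : 4 * l / D.r (φ a) ≤ 1 := by
        have : 0 ≤ ‖x‖ / (c1 * q) := by positivity
        linarith
      have h2 : ‖x‖ / (c1 * q) ≤ 1 := by
        have : 0 ≤ 4 * l / D.r (φ a) := by positivity
        linarith
      rw [div_le_one (by positivity)] at h1 h2
      have : ‖x‖ ^ 2 ≤ (c1 * q) ^ 2 := by gcongr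
      rw [mul_pow, hq2] at this
      have h3 : c1 ^ 2 * D.r (φ a) ≤ 1 * D.r (φ a) := by gcongr; exact pow_le_one₀ hc1.le hc11
      rw [hH]; linarith
    calc D.sz φ ^ 2 * (phd a b * w) = phd a b * (D.sz φ ^ 2 * w) := by ring
      _ ≤ θ * (C1 * (3 * D.r (φ a))) := mul_le_mul hple
          (hw1.trans (mul_le_mul_of_nonneg_left hHr hC1p.le)) (by positivity) hθ0
      _ = 3 * C1 * (θ * D.r (φ a)) := by ring
      _ ≤ 3 * C1 * (K * X) := by rw [hθr]; gcongr
      _ = _ := by ring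
  · have hr : D.r (φ a) ≤ 16 * g ^ 2 * (l + ‖x‖ ^ 2) := by
      have hx2 : 0 ≤ ‖x‖ ^ 2 := by positivity
      have hg2 : 1 ≤ g ^ 2 := by linarith
      rcases le_or_gt (1 / 4) (4 * l / D.r (φ a)) with h1 | h1
      · rw [le_div_iff₀ hra] at h1
        linarith [mul_nonneg hl0 (sub_nonneg.mpr hg2), mul_nonneg hx2 (sq_nonneg g)]
      · have h2 : 1 / 4 ≤ ‖x‖ / (c1 * q) := by linarith
        rw [le_div_iff₀ (by positivity)] at h2
        have h3 : q ≤ 4 * g * ‖x‖ := by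
          rw [hg]
          have : 4 * (1 / c1) * ‖x‖ = 4 * ‖x‖ / c1 := by ring
          rw [this, le_div_iff₀ hc1]; linarith
        have h4 : q ^ 2 ≤ (4 * g * ‖x‖) ^ 2 := by gcongr
        rw [hq2] at h4
        linarith [mul_nonneg hl0 (sq_nonneg g)]
    have hHX : H ≤ K * X := by
      have h1 : 0 ≤ K * (‖x‖ * q) := by positivity
      have h3 : H ≤ K * (l + ‖x‖ ^ 2) := by
        have h2 : 0 ≤ ‖x‖ ^ 2 := by positivity
        rw [hH, hK]; linarith
      rw [hX]; linarith
    calc D.sz φ ^ 2 * (phd a b * w) = phd a b * (D.sz φ ^ 2 * w) := by ring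
      _ ≤ 1 * (C1 * H) := by gcongr
      _ ≤ 1 * (C1 * (K * X)) := by gcongr
      _ ≤ 3 * (C1 * (K * X)) := by gcongr; norm_num
      _ = _ := by ring

end Dom

theorem closure_unitBall : closure 𝔻 = closedBall 0 1 := closure_ball _ one_ne_zero

theorem le_on_closedBall {f g : ℂ → ℝ} (h : ∀ a ∈ 𝔻, f a ≤ g a)
    (hf : ContinuousOn f (closedBall 0 1)) (hg : ContinuousOn g (closedBall 0 1)) {a : ℂ}
    (ha : a ∈ closedBall (0:ℂ) 1) : f a ≤ g a := by
  rw [← closure_unitBall] at *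
  exact le_on_closure h hf hg ha

theorem mem_closedBall_of_norm_eq {a : ℂ} (h : ‖a‖ = 1) : a ∈ closedBall (0:ℂ) 1 := by
  simp [h]

namespace Dom

variable {Ω : Set (E N)} {α : ℝ} (D : Dom Ω α)

/-- A centered geodesic, extended continuously to the closed disc. -/
structure Reg (φ : ℂ → E N) : Prop where
  cen : D.Centered φ
  cont : ContinuousOn φ (closedBall 0 1)

namespace Reg

variable {D} {φ : ℂ → E N}

theorem dcc (h : D.Reg φ) : DiffContOnCl ℂ φ 𝔻 :=
  ⟨h.cen.diff, by rw [closure_unitBall]; exact h.cont⟩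

theorem memc (h : D.Reg φ) {a : ℂ} (ha : a ∈ closedBall (0:ℂ) 1) : φ a ∈ closure Ω := by
  have h1 : MapsTo φ (closure 𝔻) (closure Ω) :=
    MapsTo.closure_of_continuousOn (fun x hx => h.cen.mem hx)
      (by rw [closure_unitBall]; exact h.cont)
  exact h1 (by rwa [closure_unitBall])

theorem mem_frontier (h : D.Reg φ) {a : ℂ} (ha : ‖a‖ = 1) : φ a ∈ frontier Ω := by
  obtain ⟨C, hC, hb⟩ := D.exists_basic
  have hac := mem_closedBall_of_norm_eq ha
  have h1 : D.r (φ a) ≤ C * D.sz φ ^ 2 * (1 - ‖a‖) :=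
    le_on_closedBall (f := fun a => D.r (φ a)) (g := fun a => C * D.sz φ ^ 2 * (1 - ‖a‖))
      (fun a ha => (hb φ h.cen a ha).1)
      (D.continuousOn_r.comp h.cont fun x hx => h.memc hx) (by fun_prop) hac
  rw [ha, sub_self, mul_zero] at h1
  rcases mem_or (h.memc hac) with h2 | h2
  · exact absurd (D.r_pos h2) (not_lt.mpr h1)
  · exact h2

end Reg

theorem Centered.exists_reg {D : Dom Ω α} {φ : ℂ → E N} (h : D.Centered φ) :
    ∃ Φ, D.Reg Φ ∧ EqOn Φ φ 𝔻 := by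
  obtain ⟨C, hC, hh⟩ := D.exists_holder
  have hs := h.sz_pos
  have huc : UniformContinuousOn φ 𝔻 := by
    rw [Metric.uniformContinuousOn_iff]
    intro ε hε
    refine ⟨(ε / (C * D.sz φ)) ^ 2, by positivity, fun a ha b hb hab => ?_⟩
    rw [dist_eq_norm] at *
    refine (hh φ h a ha b hb).trans_lt ?_
    rw [← sqrt_eq_rpow, ← lt_div_iff₀' (by positivity)]
    exact (Real.sqrt_lt_sqrt (norm_nonneg _) hab).trans_eq (sqrt_sq (by positivity))
  have hlim : ∀ x ∈ closedBall (0:ℂ) 1, ∃ y, Tendsto φ (𝓝[𝔻] x) (𝓝 y) := by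
    intro x hx
    have : (𝓝[𝔻] x).NeBot := by
      rw [← mem_closure_iff_nhdsWithin_neBot, closure_unitBall]; exact hx
    have hc : Cauchy (map φ (𝓝[𝔻] x)) :=
      ((cauchy_nhds.mono' this nhdsWithin_le_nhds).map_of_le huc
        (le_principal_iff.mpr self_mem_nhdsWithin))
    exact cauchy_map_iff_exists_tendsto.mp hc
  have hcont : ContinuousOn (extendFrom 𝔻 φ) (closedBall 0 1) :=
    continuousOn_extendFrom closure_unitBall.ge hlim
  have heq : EqOn (extendFrom 𝔻 φ) φ 𝔻 :=
    fun x hx => extendFrom_eq (subset_closure hx)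
      (h.diff.continuousOn x hx)
  have h0 : (0:ℂ) ∈ 𝔻 := mem_ball_self one_pos
  refine ⟨extendFrom 𝔻 φ, ⟨⟨⟨?_, ?_, ?_⟩, ?_⟩, hcont⟩, heq⟩
  · exact h.diff.congr heq
  · exact fun x hx => by rw [heq hx]; exact h.mem hx
  · intro a ha b hb; rw [heq ha, heq hb]; exact h.geod.2.2 a ha b hb
  · intro a ha; rw [heq ha, heq h0]; exact h.max a ha

theorem exists_reg_holder : ∃ C > 0, ∀ φ, D.Reg φ → ∀ a ∈ closedBall (0:ℂ) 1,
    ∀ b ∈ closedBall (0:ℂ) 1, ‖φ a - φ b‖ ≤ C * D.sz φ * ‖a - b‖ ^ (1 / 2 : ℝ) := by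
  obtain ⟨C, hC, h⟩ := D.exists_holder
  refine ⟨C, hC, fun φ hφ => ?_⟩
  have h1 : ∀ a ∈ closedBall (0:ℂ) 1, ∀ b ∈ 𝔻,
      ‖φ a - φ b‖ ≤ C * D.sz φ * ‖a - b‖ ^ (1 / 2 : ℝ) := by
    intro a ha b hb
    refine le_on_closedBall (f := fun a => ‖φ a - φ b‖)
      (g := fun a => C * D.sz φ * ‖a - b‖ ^ (1 / 2 : ℝ)) (fun a ha => h φ hφ.cen a ha b hb)
      (hφ.cont.sub continuousOn_const).norm ?_ ha
    exact (continuous_const.mul ((continuous_id.sub continuous_const).norm.rpow_const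
      fun _ => Or.inr (by norm_num))).continuousOn
  intro a ha b hb
  refine le_on_closedBall (f := fun b => ‖φ a - φ b‖)
    (g := fun b => C * D.sz φ * ‖a - b‖ ^ (1 / 2 : ℝ)) (fun b hb => h1 a ha b hb)
    (continuousOn_const.sub hφ.cont).norm ?_ hb
  exact (continuous_const.mul ((continuous_const.sub continuous_id).norm.rpow_const
    fun _ => Or.inr (by norm_num))).continuousOn

theorem exists_norm_sub_le : ∃ C > 0, ∀ φ, D.Reg φ → ∀ a ∈ closedBall (0:ℂ) 1,
    ∀ b ∈ closedBall (0:ℂ) 1, ‖φ a - φ b‖ ≤ C * D.sz φ := by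
  obtain ⟨C, hC, h⟩ := D.exists_reg_holder
  refine ⟨C * 2 ^ (1 / 2 : ℝ), by positivity, fun φ hφ a ha b hb => (h φ hφ a ha b hb).trans ?_⟩
  have hs := hφ.cen.sz_pos
  have h1 : ‖a - b‖ ≤ 2 := by
    rw [mem_closedBall_zero_iff] at ha hb
    linarith [norm_sub_le a b]
  calc C * D.sz φ * ‖a - b‖ ^ (1 / 2 : ℝ) ≤ C * D.sz φ * 2 ^ (1 / 2 : ℝ) := by gcongr
    _ = _ := by ring

/-- Displacements along a centered geodesic are nearly complex tangential. -/
theorem exists_norm_L_sub_le : ∃ C > 0, ∀ φ, D.Reg φ → ∀ c ∈ closedBall (0:ℂ) 1,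
    ∀ a ∈ closedBall (0:ℂ) 1, ∀ b ∈ closedBall (0:ℂ) 1,
      ‖D.L (φ c) (φ a - φ b)‖ ≤ C * D.sz φ ^ 2 := by
  obtain ⟨C1, hC1, h1⟩ := D.exists_basic
  obtain ⟨C2, hC2, h2⟩ := D.exists_norm_sub_le
  have hM := D.M_pos
  refine ⟨8 * ((C1 + D.M * C2 * C1)) * 2 , by positivity, fun φ hφ c hc => ?_⟩
  have hs := hφ.cen.sz_pos
  set s := D.sz φ with hsd
  have hder : ∀ a ∈ 𝔻, ‖deriv (fun ζ => D.L (φ c) (φ ζ)) a‖ ≤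
      (C1 + D.M * C2 * C1) * s ^ 2 * (1 - ‖a‖) ^ (1 / 2 - 1 : ℝ) := by
    intro a ha
    have ha1 := norm_lt_one_of_mem_ball ha
    have hu : 0 < 1 - ‖a‖ := by linarith
    have hb := h1 φ hφ.cen a ha
    have hp : 1 ≤ (1 - ‖a‖) ^ (1 / 2 - 1 : ℝ) := by
      have := rpow_le_of_le_one hu (by linarith [norm_nonneg a])
        (show (1 / 2 - 1 : ℝ) ≤ 0 by norm_num)
      rwa [rpow_zero] at this
    refine (hφ.cen.norm_deriv_apply_le ha (hφ.memc hc)).trans ?_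
    have e1 : ‖D.L (φ a) (deriv φ a)‖ ≤ C1 * s ^ 2 * (1 - ‖a‖) ^ (1 / 2 - 1 : ℝ) :=
      hb.2.2.trans (le_mul_of_one_le_right (by positivity) hp)
    have e2 : D.M * ‖φ a - φ c‖ * ‖deriv φ a‖ ≤
        D.M * (C2 * s) * (C1 * s * (1 - ‖a‖) ^ (1 / 2 - 1 : ℝ)) := by
      gcongr
      · exact h2 φ hφ a (ball_subset_closedBall ha) c hc
      · exact hb.2.1
    calc _ ≤ _ := add_le_add e1 e2
      _ = _ := by ring
  have hball : ∀ a ∈ 𝔻, ∀ b ∈ 𝔻, ‖D.L (φ c) (φ a - φ b)‖ ≤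
      8 * ((C1 + D.M * C2 * C1)) * 2 * s ^ 2 := by
    intro a ha b hb
    have := norm_sub_le_of_hardy_littlewood
      ((D.L (φ c)).differentiable.comp_differentiableOn hφ.cen.diff) (by norm_num) (by norm_num)
      (by positivity) hder ha hb
    rw [map_sub]
    refine this.trans ?_
    have hab : ‖a - b‖ ≤ 2 := by
      rw [mem_ball_zero_iff] at ha hb
      linarith [norm_sub_le a b]
    have h3 : ‖a - b‖ ^ (1 / 2 : ℝ) ≤ 2 := by
      calc ‖a - b‖ ^ (1 / 2 : ℝ) ≤ 2 ^ (1 / 2 : ℝ) := by gcongr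
        _ ≤ 2 ^ (1 : ℝ) := rpow_le_rpow_of_exponent_le (by norm_num) (by norm_num)
        _ = 2 := rpow_one 2
    calc 4 / (1 / 2) * ((C1 + D.M * C2 * C1) * s ^ 2) * ‖a - b‖ ^ (1 / 2 : ℝ)
        ≤ 4 / (1 / 2) * ((C1 + D.M * C2 * C1) * s ^ 2) * 2 := by gcongr
      _ = _ := by ring
  have hstep : ∀ a ∈ closedBall (0:ℂ) 1, ∀ b ∈ 𝔻, ‖D.L (φ c) (φ a - φ b)‖ ≤
      8 * ((C1 + D.M * C2 * C1)) * 2 * s ^ 2 := fun a ha b hb =>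
    le_on_closedBall (f := fun a => ‖D.L (φ c) (φ a - φ b)‖)
      (g := fun _ => 8 * ((C1 + D.M * C2 * C1)) * 2 * s ^ 2) (fun a ha => hball a ha b hb)
      ((D.L (φ c)).continuous.comp_continuousOn (hφ.cont.sub continuousOn_const)).norm
      continuousOn_const ha
  exact fun a ha b hb =>
    le_on_closedBall (f := fun b => ‖D.L (φ c) (φ a - φ b)‖)
      (g := fun _ => 8 * ((C1 + D.M * C2 * C1)) * 2 * s ^ 2) (fun b hb => hstep a ha b hb)
      ((D.L (φ c)).continuous.comp_continuousOn (continuousOn_const.sub hφ.cont)).norm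
      continuousOn_const hb

end Dom

open CompactlySupported in
/-- A subspace of continuous functions on a compact space containing no negative function
is annihilated by a probability measure. -/
theorem exists_annihilating_measure {X : Type*} [TopologicalSpace X] [T2Space X] [CompactSpace X]
    [Nonempty X] [MeasurableSpace X] [BorelSpace X] (V : Submodule ℝ C(X, ℝ))
    (hV : ∀ f ∈ V, ¬ ∀ x, f x < 0) :
    ∃ μ : Measure X, IsProbabilityMeasure μ ∧ ∀ f ∈ V, ∫ x, f x ∂μ = 0 := by
  have hopen : IsOpen {f : C(X, ℝ) | MapsTo f univ (Iio 0)} :=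
    ContinuousMap.isOpen_setOfPred_mapsTo isCompact_univ isOpen_Iio
  have hconv : Convex ℝ {f : C(X, ℝ) | MapsTo f univ (Iio 0)} := by
    intro f hf g hg a b ha hb hab x _
    exact (convex_Iio (0:ℝ)) (hf (mem_univ x)) (hg (mem_univ x)) ha hb hab
  obtain ⟨Λ, u, h1, h2⟩ := geometric_hahn_banach_open hconv hopen V.convex (by
    rw [Set.disjoint_left]
    exact fun f hf hfV => hV f hfV fun x => hf (mem_univ x))
  have hu0 : u ≤ 0 := by simpa using h2 0 V.zero_mem
  have hzero : ∀ f ∈ V, Λ f = 0 := by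
    intro f hf
    by_contra hne
    have := h2 (((u - 1) / Λ f) • f) (V.smul_mem _ hf)
    rw [map_smul, smul_eq_mul, div_mul_cancel₀ _ hne] at this
    linarith
  have hone : 0 < Λ 1 := by
    have := h1 (-1) fun x _ => by simp
    rw [map_neg] at this
    linarith
  have hpos : ∀ f : C(X, ℝ), (∀ x, 0 ≤ f x) → 0 ≤ Λ f := by
    intro f hf
    by_contra! hlt
    have := h1 (-f + (Λ f / (2 * Λ 1)) • 1) fun x _ => by
      have h3 : Λ f / (2 * Λ 1) < 0 := div_neg_of_neg_of_pos hlt (by positivity)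
      simp only [ContinuousMap.add_apply, ContinuousMap.neg_apply, ContinuousMap.smul_apply,
        ContinuousMap.one_apply, smul_eq_mul, mul_one, mem_Iio]
      linarith [hf x]
    rw [map_add, map_neg, map_smul, smul_eq_mul] at this
    have h4 : Λ f / (2 * Λ 1) * Λ 1 = Λ f / 2 := by field_simp
    linarith
  let T : C_c(X, ℝ) →ₗ[ℝ] ℝ :=
    { toFun := fun f => (Λ 1)⁻¹ * Λ f.toContinuousMap
      map_add' := fun f g => by
        rw [← mul_add, ← map_add]; rfl
      map_smul' := fun c f => by
        have : (c • f).toContinuousMap = c • f.toContinuousMap := rfl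
        rw [this, map_smul, RingHom.id_apply, smul_eq_mul, smul_eq_mul]
        ring }
  let P : C_c(X, ℝ) →ₚ[ℝ] ℝ := PositiveLinearMap.mk₀ T fun f hf =>
    mul_nonneg (by positivity) (hpos _ hf)
  have hint : ∀ f : C(X, ℝ), ∫ x, f x ∂(RealRMK.rieszMeasure P) = (Λ 1)⁻¹ * Λ f := fun f =>
    RealRMK.integral_rieszMeasure P (CompactlySupportedContinuousMap.continuousMapEquiv f)
  refine ⟨RealRMK.rieszMeasure P, ⟨?_⟩, fun f hf => by rw [hint, hzero f hf, mul_zero]⟩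
  have := hint 1
  rw [inv_mul_cancel₀ hone.ne'] at this
  simp only [ContinuousMap.one_apply, integral_const, smul_eq_mul, mul_one] at this
  rw [measureReal_def] at this
  exact (ENNReal.toReal_eq_one_iff _).mp this

namespace Dom

variable {Ω : Set (E N)} {α : ℝ} {D : Dom Ω α}

theorem Reg.continuousOn_L_apply {φ : ℂ → E N} (h : D.Reg φ) {u : ℂ → E N}
    (hu : ContinuousOn u (closedBall 0 1)) :
    ContinuousOn (fun ζ => D.L (φ ζ) (u ζ)) (closedBall 0 1) :=
  (D.continuousOn_L.comp h.cont fun _ hx => h.memc hx).clm_apply hu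

/-- Small descent perturbations map the closed disc into the domain. -/
theorem Reg.exists_perturb {φ : ℂ → E N} (h : D.Reg φ) {u : ℂ → E N}
    (hu : ContinuousOn u (closedBall 0 1))
    (hneg : ∀ ζ, ‖ζ‖ = 1 → (D.L (φ ζ) (u ζ)).re < 0) :
    ∃ t : ℝ, 0 < t ∧ MapsTo (fun ζ => φ ζ + (t:ℂ) • u ζ) (closedBall 0 1) Ω := by
  have hM := D.M_pos
  have hF : ContinuousOn (fun ζ => (D.L (φ ζ) (u ζ)).re) (closedBall 0 1) :=
    continuous_re.comp_continuousOn (h.continuousOn_L_apply hu)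
  obtain ⟨κ, hκ, hκb⟩ : ∃ κ > 0, ∀ ζ ∈ sphere (0:ℂ) 1, (D.L (φ ζ) (u ζ)).re < -κ := by
    obtain ⟨x, hx, hmax⟩ := (isCompact_sphere (0:ℂ) 1).exists_isMaxOn
      (NormedSpace.sphere_nonempty.mpr zero_le_one) (hF.mono sphere_subset_closedBall)
    have hx' := hneg x (by simpa using hx)
    exact ⟨-(D.L (φ x) (u x)).re / 2, by linarith, fun ζ hζ => by
      have := hmax hζ
      simp only [mem_ofPred_eq] at this
      linarith⟩
  set K0 : Set ℂ := {a ∈ closedBall (0:ℂ) 1 | -κ ≤ (D.L (φ a) (u a)).re} with hK0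
  have hK0c : IsCompact K0 :=
    (isCompact_closedBall (0:ℂ) 1).of_isClosed_subset
      (hF.preimage_isClosed_of_isClosed isClosed_closedBall isClosed_Ici) fun x hx => hx.1
  have hK0b : K0 ⊆ 𝔻 := by
    intro a ha
    rw [mem_ball_zero_iff]
    refine lt_of_le_of_ne (mem_closedBall_zero_iff.mp ha.1) fun h1 => ?_
    exact absurd ha.2 (not_le.mpr (hκb a (mem_sphere_zero_iff_norm.mpr h1)))
  obtain ⟨δ, hδ, hδΩ⟩ := (hK0c.image_of_continuousOn
    (h.cont.mono fun x hx => hx.1)).exists_thickening_subset_open D.isOpen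
    (image_subset_iff.mpr fun x hx => h.cen.mem (hK0b hx))
  obtain ⟨U, hU⟩ := (isCompact_closedBall (0:ℂ) 1).exists_bound_of_continuousOn hu
  set U' := max U 1 with hU'
  have hU1 : 1 ≤ U' := le_max_right _ _
  obtain ⟨t, ht, ht1, ht2, ht3⟩ : ∃ t : ℝ, 0 < t ∧ t * U' < D.ε ∧ t * U' < δ ∧
      D.M * (t * U') ^ 2 ≤ t * κ := by
    have hε := D.ε_pos
    refine ⟨min (min (D.ε / (2 * U')) (δ / (2 * U'))) (κ / (D.M * U' ^ 2)), by positivity, ?_, ?_, ?_⟩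
    · have : min (min (D.ε / (2 * U')) (δ / (2 * U'))) (κ / (D.M * U' ^ 2)) ≤ D.ε / (2 * U') :=
        (min_le_left _ _).trans (min_le_left _ _)
      calc _ ≤ D.ε / (2 * U') * U' := by gcongr
        _ = D.ε / 2 := by field_simp
        _ < _ := by linarith
    · have : min (min (D.ε / (2 * U')) (δ / (2 * U'))) (κ / (D.M * U' ^ 2)) ≤ δ / (2 * U') :=
        (min_le_left _ _).trans (min_le_right _ _)
      calc _ ≤ δ / (2 * U') * U' := by gcongr
        _ = δ / 2 := by field_simp
        _ < _ := by linarith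
    · set t := min (min (D.ε / (2 * U')) (δ / (2 * U'))) (κ / (D.M * U' ^ 2))
      have h3 : t ≤ κ / (D.M * U' ^ 2) := min_le_right _ _
      have h4 : 0 ≤ t := by positivity
      rw [le_div_iff₀ (by positivity)] at h3
      calc D.M * (t * U') ^ 2 = t * (t * (D.M * U' ^ 2)) := by ring
        _ ≤ t * κ := by gcongr
  refine ⟨t, ht, fun a ha => ?_⟩
  have hn : ‖(t:ℂ) • u a‖ ≤ t * U' := by
    rw [norm_smul, norm_real, norm_of_nonneg ht.le]
    exact mul_le_mul_of_nonneg_left ((hU a ha).trans (le_max_left _ _)) ht.le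
  by_cases hK : a ∈ K0
  · refine hδΩ (mem_thickening_iff.mpr ⟨φ a, mem_image_of_mem _ hK, ?_⟩)
    rw [dist_eq_norm, add_sub_cancel_left]
    exact hn.trans_lt ht2
  · have hlt : (D.L (φ a) (u a)).re < -κ := by
      by_contra! h1
      exact hK ⟨ha, h1⟩
    have hac := h.memc ha
    refine D.mem _ hac _ (hn.trans_lt ht1) ?_
    have h1 := (_root_.abs_le.mp (D.d1_ball _ hac _ (hn.trans_lt ht1))).2
    have h2 : (D.L (φ a) ((t:ℂ) • u a)).re = t * (D.L (φ a) (u a)).re := by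
      rw [map_smul, smul_eq_mul, re_ofReal_mul]
    have h3 : D.M * ‖(t:ℂ) • u a‖ ^ 2 ≤ t * κ := le_trans (by gcongr) ht3
    have h4 : 0 ≤ D.r (φ a) := D.r_nonneg hac
    have h5 : t * (D.L (φ a) (u a)).re < t * (-κ) := mul_lt_mul_of_pos_left hlt ht
    have h6 : D.r (φ a) = - D.ρ (φ a) := rfl
    linarith

/-- A geodesic has no descent direction vanishing to second order at the origin. -/
theorem Reg.not_descent {φ : ℂ → E N} (h : D.Reg φ) {u : ℂ → E N}
    (hu : DiffContOnCl ℂ u 𝔻) (hu0 : u 0 = 0) (hu1 : HasDerivAt u 0 0) :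
    ¬ ∀ ζ, ‖ζ‖ = 1 → (D.L (φ ζ) (u ζ)).re < 0 := by
  intro hneg
  have huc : ContinuousOn u (closedBall 0 1) := by
    rw [← closure_unitBall]; exact hu.continuousOn
  obtain ⟨t, ht, hmap⟩ := h.exists_perturb huc hneg
  set ψ : ℂ → E N := fun ζ => φ ζ + (t:ℂ) • u ζ with hψ
  have hψc : ContinuousOn ψ (closedBall 0 1) := by
    have h1 : ContinuousOn (fun ζ => (t:ℂ) • u ζ) (closedBall 0 1) := huc.const_smul (t:ℂ)
    exact h.cont.add h1
  have h0 : (0:ℂ) ∈ 𝔻 := mem_ball_self one_pos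
  obtain ⟨κ, hκ, hκΩ⟩ := ((isCompact_closedBall (0:ℂ) 1).image_of_continuousOn
    hψc).exists_thickening_subset_open D.isOpen (image_subset_iff.mpr hmap)
  have hφd := h.cen.hasDerivAt h0
  set d := deriv φ 0 with hd
  obtain ⟨s, hs, hs1, hsd⟩ : ∃ s : ℝ, 0 < s ∧ s < 1 ∧ s * ‖d‖ < κ / 2 * (1 - s) := by
    have : ∀ᶠ s in 𝓝[>] (0:ℝ), s * ‖d‖ < κ / 2 * (1 - s) := by
      have hc1 : Tendsto (fun s : ℝ => κ / 2 * (1 - s) - s * ‖d‖) (𝓝 0) (𝓝 (κ / 2 * (1 - 0) - 0 * ‖d‖)) :=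
        Continuous.tendsto (by fun_prop) 0
      have := hc1.eventually_const_lt (show (0:ℝ) < κ / 2 * (1 - 0) - 0 * ‖d‖ by linarith)
      filter_upwards [nhdsWithin_le_nhds this] with s hs
      linarith
    obtain ⟨s, h1, h2, h3⟩ := (this.and ((eventually_lt_nhds (one_pos)).filter_mono
      nhdsWithin_le_nhds |>.and self_mem_nhdsWithin)).exists
    exact ⟨s, h3, h2, h1⟩
  have hG : HasDerivAt (fun ζ : ℂ => φ ζ - ψ ((1 - s : ℂ) * ζ)) ((s:ℂ) • d) 0 := by
    have hm : HasDerivAt (fun ζ : ℂ => (1 - s : ℂ) * ζ) (1 - s : ℂ) 0 := by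
      simpa using (hasDerivAt_id (0:ℂ)).const_mul (1 - s : ℂ)
    have hψd : HasDerivAt ψ d ((1 - s : ℂ) * 0) := by
      rw [mul_zero]
      have h2 : HasDerivAt ψ (d + (t:ℂ) • (0:E N)) 0 := hφd.add (hu1.const_smul (t:ℂ))
      rwa [smul_zero, add_zero] at h2
    have := hφd.sub (hψd.scomp (0:ℂ) hm)
    refine this.congr_deriv ?_
    module
  have hG0 : φ 0 - ψ ((1 - s : ℂ) * 0) = 0 := by simp [hψ, hu0]
  have hev := hG.isLittleO.def (show 0 < κ / 4 * (1 - s) by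
    have : 0 < 1 - s := by linarith
    positivity)
  simp only [hG0, sub_zero] at hev
  obtain ⟨ξ, hξ0, hξ1, hξ⟩ : ∃ ξ : ℝ, 0 < ξ ∧ ξ < 1 ∧
      ‖φ ξ - ψ ((1 - s : ℂ) * ξ) - (ξ:ℂ) • (s:ℂ) • d‖ ≤ κ / 4 * (1 - s) * ‖(ξ:ℂ)‖ := by
    have ht : Tendsto (fun ξ : ℝ => (ξ:ℂ)) (𝓝[>] 0) (𝓝 0) :=
      (continuous_ofReal.tendsto' 0 0 (by simp)).mono_left nhdsWithin_le_nhds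
    obtain ⟨ξ, h1, h2, h3⟩ := ((ht.eventually hev).and ((eventually_lt_nhds
      (one_pos)).filter_mono nhdsWithin_le_nhds |>.and self_mem_nhdsWithin)).exists
    exact ⟨ξ, h3, h2, h1⟩
  have hs' : 0 < 1 - s := by linarith
  set a : ℂ := (1 - s : ℂ) * ξ with ha
  have haR : a = (((1 - s) * ξ : ℝ) : ℂ) := by rw [ha]; push_cast; ring
  have hna : ‖a‖ = (1 - s) * ξ := by
    rw [haR, norm_real, norm_of_nonneg (by positivity)]
  have ha0 : a ≠ 0 := by rw [← norm_pos_iff, hna]; positivity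
  have haξ : ‖a‖ < ξ := by
    rw [hna]
    have := mul_pos hs hξ0
    linarith
  have hab : a ∈ 𝔻 := by rw [mem_ball_zero_iff]; linarith
  set v : E N := a⁻¹ • (φ ξ - ψ a) with hv
  have hvn : ‖v‖ < κ := by
    have h1 : ‖φ ξ - ψ a‖ ≤ κ / 4 * (1 - s) * ξ + ξ * (s * ‖d‖) := by
      have h2 := norm_le_norm_add_norm_sub' (φ ξ - ψ a) ((ξ:ℂ) • (s:ℂ) • d)
      rw [norm_smul, norm_smul, norm_real, norm_real, norm_of_nonneg hξ0.le,
        norm_of_nonneg hs.le] at h2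
      rw [norm_real, norm_of_nonneg hξ0.le] at hξ
      linarith
    rw [hv, norm_smul, norm_inv, hna, inv_mul_lt_iff₀ (by positivity)]
    have h3 : ξ * (s * ‖d‖) < ξ * (κ / 2 * (1 - s)) := mul_lt_mul_of_pos_left hsd hξ0
    have h4 : 0 < κ * ((1 - s) * ξ) := by positivity
    linarith
  have hχ : MapsTo (fun ζ => ψ ζ + ζ • v) 𝔻 Ω := by
    intro ζ hζ
    refine hκΩ (mem_thickening_iff.mpr ⟨ψ ζ, mem_image_of_mem _ (ball_subset_closedBall hζ), ?_⟩)
    rw [dist_eq_norm, add_sub_cancel_left, norm_smul]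
    have := norm_lt_one_of_mem_ball hζ
    exact (mul_le_of_le_one_left (norm_nonneg _) this.le).trans_lt hvn
  have hχd : DifferentiableOn ℂ (fun ζ => ψ ζ + ζ • v) 𝔻 := by
    have h1 : DifferentiableOn ℂ (fun ζ => (t:ℂ) • u ζ) 𝔻 :=
      hu.differentiableOn.const_smul (t:ℂ)
    have h2 : DifferentiableOn ℂ (fun ζ : ℂ => ζ • v) 𝔻 := by fun_prop
    have h3 : DifferentiableOn ℂ ψ 𝔻 := h.cen.diff.add h1
    exact h3.add h2
  have hk := KLe.of_disc hχd hχ hab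
  have e1 : ψ 0 + (0:ℂ) • v = φ 0 := by simp [hψ, hu0]
  have e2 : ψ a + a • v = φ ξ := by rw [hv, smul_inv_smul₀ ha0]; abel
  simp only [e1, e2] at hk
  have hξb : (ξ:ℂ) ∈ 𝔻 := by
    rw [mem_ball_zero_iff, norm_real, norm_of_nonneg hξ0.le]; exact hξ1
  have h1 := h.cen.geod.artanh_le h0 hξb hk
  have h2 : phd 0 (ξ:ℂ) = ξ := by
    simp [phd, abs_of_pos hξ0]
  rw [h2] at h1
  have := le_of_artanh_le hξ0.le hξ1 (norm_nonneg _) (by linarith) h1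
  linarith

/-- The measure dual to a geodesic. -/
structure Dual (D : Dom Ω α) (φ : ℂ → E N) (μ : Measure (sphere (0:ℂ) 1)) : Prop where
  prob : IsProbabilityMeasure μ
  annih : ∀ u : ℂ → E N, DiffContOnCl ℂ u 𝔻 → u 0 = 0 → HasDerivAt u 0 0 →
    ∫ ζ, D.L (φ ζ) (u ζ) ∂μ = 0

theorem continuous_sphere {F : Type*} [TopologicalSpace F] {f : ℂ → F}
    (hf : ContinuousOn f (closedBall 0 1)) : Continuous fun ζ : sphere (0:ℂ) 1 => f ζ :=
  hf.comp_continuous continuous_subtype_val fun x => sphere_subset_closedBall x.2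

theorem Reg.exists_dual {φ : ℂ → E N} (h : D.Reg φ) : ∃ μ, D.Dual φ μ := by
  have hc : ∀ u : ℂ → E N, DiffContOnCl ℂ u 𝔻 →
      Continuous fun ζ : sphere (0:ℂ) 1 => D.L (φ ζ) (u ζ) := fun u hu =>
    continuous_sphere (h.continuousOn_L_apply (by rw [← closure_unitBall]; exact hu.continuousOn))
  let W : Submodule ℝ C(sphere (0:ℂ) 1, ℝ) :=
    { carrier := {f | ∃ u : ℂ → E N, DiffContOnCl ℂ u 𝔻 ∧ u 0 = 0 ∧ HasDerivAt u 0 0 ∧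
        ∀ ζ : sphere (0:ℂ) 1, f ζ = (D.L (φ ζ) (u ζ)).re}
      add_mem' := by
        rintro f g ⟨u, h1, h2, h3, h4⟩ ⟨v, h1', h2', h3', h4'⟩
        refine ⟨u + v, h1.add h1', by simp [h2, h2'], by simpa using h3.add h3', fun ζ => ?_⟩
        simp [h4, h4']
      zero_mem' := ⟨0, diffContOnCl_const, rfl, hasDerivAt_const (0:ℂ) (0:E N),
        fun ζ => by simp⟩
      smul_mem' := by
        rintro c f ⟨u, h1, h2, h3, h4⟩
        refine ⟨(c:ℂ) • u, h1.const_smul _, by simp [h2], by simpa using h3.const_smul (c:ℂ),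
          fun ζ => ?_⟩
        simp [h4] }
  have : Nonempty (sphere (0:ℂ) 1) := ⟨⟨1, by simp⟩⟩
  obtain ⟨μ, hμ, hW⟩ := exists_annihilating_measure W (by
    rintro f ⟨u, h1, h2, h3, h4⟩ hneg
    refine h.not_descent h1 h2 h3 fun ζ hζ => ?_
    have := hneg ⟨ζ, by simpa using hζ⟩
    rwa [h4] at this)
  refine ⟨μ, hμ, fun u h1 h2 h3 => ?_⟩
  have hint : Integrable (fun ζ : sphere (0:ℂ) 1 => D.L (φ ζ) (u ζ)) μ :=
    (hc u h1).integrable_of_hasCompactSupport (HasCompactSupport.of_compactSpace _)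
  have hre : ∀ v : ℂ → E N, DiffContOnCl ℂ v 𝔻 → v 0 = 0 → HasDerivAt v 0 0 →
      ∫ ζ : sphere (0:ℂ) 1, (D.L (φ ζ) (v ζ)).re ∂μ = 0 := fun v h1 h2 h3 =>
    hW ⟨fun ζ => (D.L (φ ζ) (v ζ)).re, continuous_re.comp (hc v h1)⟩
      ⟨v, h1, h2, h3, fun ζ => rfl⟩
  apply Complex.ext
  · rw [zero_re, ← hre u h1 h2 h3]
    exact (integral_re hint).symm
  · have h5 := hre (I • u) (h1.const_smul _) (by simp [h2]) (by
      simpa using h3.const_smul I)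
    simp only [Pi.smul_apply, map_smul, smul_eq_mul, Complex.I_mul_re, integral_neg,
      neg_eq_zero] at h5
    rw [Complex.zero_im, ← h5]
    exact (integral_im hint).symm

end Dom

/-- The Poisson kernel of the unit disc. -/
def pk (a ζ : ℂ) : ℝ := (1 - ‖a‖ ^ 2) / ‖ζ - a‖ ^ 2

theorem sphere_sub_ne_zero {a ζ : ℂ} (ha : a ∈ 𝔻) (hζ : ‖ζ‖ = 1) : ζ - a ≠ 0 := by
  intro h
  rw [sub_eq_zero.mp h] at hζ
  exact absurd (norm_lt_one_of_mem_ball ha) (by rw [hζ]; exact lt_irrefl _)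

theorem one_sub_norm_sq_pos {a : ℂ} (ha : a ∈ 𝔻) : 0 < 1 - ‖a‖ ^ 2 := by
  have := norm_lt_one_of_mem_ball ha
  have h2 : ‖a‖ ^ 2 < 1 := pow_lt_one₀ (norm_nonneg _) this two_ne_zero
  linarith

theorem pk_pos {a ζ : ℂ} (ha : a ∈ 𝔻) (hζ : ‖ζ‖ = 1) : 0 < pk a ζ := by
  have h1 := one_sub_norm_sq_pos ha
  have h2 := norm_pos_iff.mpr (sphere_sub_ne_zero ha hζ)
  unfold pk
  positivity

theorem pk_mul_norm_sq {a ζ : ℂ} (ha : a ∈ 𝔻) (hζ : ‖ζ‖ = 1) :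
    pk a ζ * ‖ζ - a‖ ^ 2 = 1 - ‖a‖ ^ 2 := by
  have h2 := norm_pos_iff.mpr (sphere_sub_ne_zero ha hζ)
  unfold pk
  field_simp

theorem pk_zero {ζ : ℂ} (hζ : ‖ζ‖ = 1) : pk 0 ζ = 1 := by simp [pk, hζ]

theorem one_sub_conj_mul_eq {a ζ : ℂ} (hζ : ‖ζ‖ = 1) :
    1 - conj a * ζ = ζ * conj (ζ - a) := by
  have : ζ * conj ζ = 1 := by
    rw [mul_conj, normSq_eq_norm_sq, hζ]; norm_num
  rw [map_sub, mul_sub, this]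
  ring

theorem mul_pk_eq {a ζ : ℂ} (ha : a ∈ 𝔻) (hζ : ‖ζ‖ = 1) :
    (pk a ζ : ℂ) * ((ζ - a) * (1 - conj a * ζ)) = (1 - ‖a‖ ^ 2 : ℝ) * ζ := by
  have h1 : (ζ - a) * (1 - conj a * ζ) = ζ * ((‖ζ - a‖ ^ 2 : ℝ) : ℂ) := by
    rw [one_sub_conj_mul_eq hζ, ← mul_assoc, mul_comm (ζ - a) ζ, mul_assoc, mul_conj,
      normSq_eq_norm_sq]
  rw [h1, ← pk_mul_norm_sq ha hζ]
  push_cast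
  ring

theorem mul_pk_eq_add {a ζ : ℂ} (ha : a ∈ 𝔻) (hζ : ‖ζ‖ = 1) :
    ζ * (pk a ζ : ℂ) = ζ ^ 2 * (ζ - a)⁻¹ +
      ζ ^ 2 * (conj a / (1 - conj a * ζ)) := by
  have h1 := sphere_sub_ne_zero ha hζ
  have h2 := one_sub_conj_mul_ne_zero (norm_lt_one_of_mem_ball ha) hζ.le
  have h3 := mul_pk_eq ha hζ
  have h4 : ((1 - ‖a‖ ^ 2 : ℝ) : ℂ) = 1 - conj a * a := by
    rw [mul_comm, mul_conj, normSq_eq_norm_sq]; push_cast; ring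
  rw [h4] at h3
  apply mul_right_cancel₀ (mul_ne_zero h1 h2)
  have e1 : (ζ ^ 2 * (ζ - a)⁻¹ + ζ ^ 2 * (conj a / (1 - conj a * ζ))) *
      ((ζ - a) * (1 - conj a * ζ)) =
      ζ ^ 2 * (1 - conj a * ζ) + ζ ^ 2 * conj a * (ζ - a) := by
    rw [← mul_assoc, add_mul, add_mul, mul_assoc (ζ ^ 2), inv_mul_cancel₀ h1, mul_one]
    congr 1
    rw [div_eq_mul_inv]
    linear_combination (ζ ^ 2 * conj a * (ζ - a)) * inv_mul_cancel₀ h2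
  rw [e1, mul_assoc, h3]
  ring

theorem pk_eq_re {a ζ : ℂ} (ha : a ∈ 𝔻) (hζ : ‖ζ‖ = 1) :
    pk a ζ = ((ζ + a) * (ζ - a)⁻¹).re := by
  have h1 := sphere_sub_ne_zero ha hζ
  have h2 : (ζ + a) * (ζ - a)⁻¹ =
      ((ζ + a) * conj (ζ - a)) * ((‖ζ - a‖ ^ 2 : ℝ) : ℂ)⁻¹ := by
    rw [← normSq_eq_norm_sq, ← mul_conj]
    have h3 : conj (ζ - a) ≠ 0 := (map_ne_zero _).mpr h1
    field_simp
  rw [h2, ← Complex.ofReal_inv, Complex.re_mul_ofReal, pk, div_eq_mul_inv]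
  congr 1
  have h3 : ‖ζ‖ ^ 2 = 1 := by rw [hζ]; norm_num
  rw [sq_norm, normSq_apply] at *
  simp only [Complex.mul_re, map_sub, add_re, sub_re, Complex.conj_re,
    Complex.add_im, Complex.sub_im, Complex.conj_im]
  linarith

theorem norm_sub_mul_pk_le {a ζ : ℂ} (ha : a ∈ 𝔻) (hζ : ‖ζ‖ = 1) :
    ‖ζ - a‖ * pk a ζ ≤ 2 := by
  have h2 := norm_pos_iff.mpr (sphere_sub_ne_zero ha hζ)
  have h3 := pk_mul_norm_sq ha hζ
  have h4 : 1 - ‖a‖ ≤ ‖ζ - a‖ := by rw [← hζ]; exact norm_sub_norm_le _ _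
  have h5 := norm_lt_one_of_mem_ball ha
  have h6 : (1 - ‖a‖) * (1 + ‖a‖) ≤ ‖ζ - a‖ * 2 :=
    mul_le_mul h4 (by linarith) (by positivity) h2.le
  refine le_of_mul_le_mul_right ?_ h2
  linarith [show ‖ζ - a‖ * pk a ζ * ‖ζ - a‖ = pk a ζ * ‖ζ - a‖ ^ 2 by ring,
    show (1 - ‖a‖) * (1 + ‖a‖) = 1 - ‖a‖ ^ 2 by ring]

theorem continuous_pk {a : ℂ} (ha : a ∈ 𝔻) :
    Continuous fun ζ : sphere (0:ℂ) 1 => pk a ζ := by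
  unfold pk
  refine Continuous.div continuous_const (by fun_prop) fun ζ => ?_
  have := norm_pos_iff.mpr (sphere_sub_ne_zero ha (mem_sphere_zero_iff_norm.mp ζ.2))
  positivity

theorem integrable_sphere {F : Type*} [NormedAddCommGroup F] [SecondCountableTopology F]
    {μ : Measure (sphere (0:ℂ) 1)} [IsFiniteMeasure μ] {f : sphere (0:ℂ) 1 → F}
    (hf : Continuous f) : Integrable f μ :=
  hf.integrable_of_hasCompactSupport (HasCompactSupport.of_compactSpace _)

/-- Cauchy integrals are holomorphic in the disc. -/
theorem differentiableOn_cauchy {F : Type*} [NormedAddCommGroup F] [NormedSpace ℂ F]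
    [CompleteSpace F] [SecondCountableTopology F] {μ : Measure (sphere (0:ℂ) 1)} [IsFiniteMeasure μ]
    {f : sphere (0:ℂ) 1 → F} (hf : Continuous f) :
    DifferentiableOn ℂ (fun a => ∫ ζ, ((ζ:ℂ) - a)⁻¹ • f ζ ∂μ) 𝔻 := by
  intro a₀ ha₀
  have h0 := norm_lt_one_of_mem_ball ha₀
  set δ := (1 - ‖a₀‖) / 2 with hδ
  have hδ0 : 0 < δ := by linarith
  have hsub : ∀ a ∈ ball a₀ δ, ∀ ζ : sphere (0:ℂ) 1, δ ≤ ‖(ζ:ℂ) - a‖ := by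
    intro a ha ζ
    have h1 := mem_ball_iff_norm.mp ha
    have h2 : ‖(ζ:ℂ)‖ = 1 := mem_sphere_zero_iff_norm.mp ζ.2
    have h3 : ‖(ζ:ℂ)‖ - ‖a‖ ≤ ‖(ζ:ℂ) - a‖ := norm_sub_norm_le _ _
    have h4 : ‖a‖ - ‖a₀‖ ≤ ‖a - a₀‖ := norm_sub_norm_le _ _
    linarith
  have hne : ∀ a ∈ ball a₀ δ, ∀ ζ : sphere (0:ℂ) 1, (ζ:ℂ) - a ≠ 0 := fun a ha ζ =>
    norm_pos_iff.mp (hδ0.trans_le (hsub a ha ζ))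
  have hcont : ∀ a ∈ ball a₀ δ, Continuous fun ζ : sphere (0:ℂ) 1 => ((ζ:ℂ) - a)⁻¹ • f ζ :=
    fun a ha => (Continuous.inv₀ (by fun_prop) (hne a ha)).smul hf
  have hmem := ball_mem_nhds a₀ hδ0
  have := (hasDerivAt_integral_of_dominated_loc_of_deriv_le (μ := μ) (𝕜 := ℂ)
    (F := fun a ζ => ((ζ:ℂ) - a)⁻¹ • f ζ) (F' := fun a ζ => (((ζ:ℂ) - a) ^ 2)⁻¹ • f ζ)
    (x₀ := a₀) (s := ball a₀ δ) (bound := fun ζ => (δ ^ 2)⁻¹ * ‖f ζ‖) hmem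
    (by filter_upwards [hmem] with a ha using (hcont a ha).aestronglyMeasurable)
    (integrable_sphere (hcont a₀ (mem_ball_self hδ0)))
    (Continuous.aestronglyMeasurable ((Continuous.inv₀ (by fun_prop)
      fun ζ => pow_ne_zero 2 (hne a₀ (mem_ball_self hδ0) ζ)).smul hf))
    (by
      refine Eventually.of_forall fun ζ a ha => ?_
      rw [norm_smul, norm_inv, norm_pow]
      have := hsub a ha ζ
      gcongr)
    ((integrable_sphere (hf.norm)).const_mul _)
    (by
      refine Eventually.of_forall fun ζ a ha => ?_
      have h1 : HasDerivAt (fun a : ℂ => (ζ:ℂ) - a) (-1) a := by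
        simpa using (hasDerivAt_id a).const_sub (ζ:ℂ)
      have h2 := (h1.inv (hne a ha ζ)).smul_const (f ζ)
      refine h2.congr_deriv ?_
      rw [neg_neg, one_div])).2
  exact this.differentiableAt.differentiableWithinAt

/-- The Cauchy transform of the dual measure. -/
def dualH {Ω : Set (E N)} {α : ℝ} (D : Dom Ω α) (φ : ℂ → E N) (μ : Measure (sphere (0:ℂ) 1))
    (a : ℂ) : E N →L[ℂ] ℂ := ∫ ζ, ((ζ:ℂ) - a)⁻¹ • ((ζ:ℂ) ^ 2 • D.L (φ ζ)) ∂μ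

/-- The Poisson integral of the dual measure. -/
def dualM (μ : Measure (sphere (0:ℂ) 1)) (a : ℂ) : ℝ := ∫ ζ, pk a ζ ∂μ

theorem re_dual_integral {μ : Measure (sphere (0:ℂ) 1)} {f : sphere (0:ℂ) 1 → ℂ}
    {p : sphere (0:ℂ) 1 → ℝ} (h : Integrable (fun ζ => (p ζ : ℂ) * f ζ) μ) :
    (∫ ζ, (p ζ : ℂ) * f ζ ∂μ).re = ∫ ζ, p ζ * (f ζ).re ∂μ := by
  have := integral_re h
  simp only [RCLike.re_to_complex, re_ofReal_mul] at this
  exact this.symm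

theorem diffContOnCl_dslope {F : Type*} [NormedAddCommGroup F] [NormedSpace ℂ F] [CompleteSpace F]
    {g : ℂ → F} (hg : DiffContOnCl ℂ g 𝔻) {a : ℂ}
    (ha : a ∈ 𝔻) : DiffContOnCl ℂ (dslope g a) 𝔻 := by
  have hn := isOpen_ball.mem_nhds ha
  refine ⟨(Complex.differentiableOn_dslope hn).mpr hg.differentiableOn, ?_⟩
  exact (continuousOn_dslope (mem_of_superset hn subset_closure)).mpr
    ⟨hg.continuousOn, hg.differentiableOn.differentiableAt hn⟩

theorem diffContOnCl_div_one_sub {a c : ℂ} (ha : a ∈ 𝔻) :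
    DiffContOnCl ℂ (fun ζ => c / (1 - conj a * ζ)) 𝔻 := by
  have h : ∀ ζ ∈ closedBall (0:ℂ) 1, 1 - conj a * ζ ≠ 0 := fun ζ hζ =>
    one_sub_conj_mul_ne_zero (norm_lt_one_of_mem_ball ha) (mem_closedBall_zero_iff.mp hζ)
  refine ⟨fun ζ hζ => DifferentiableAt.differentiableWithinAt
    ((differentiableAt_const _).div (by fun_prop) (h ζ (ball_subset_closedBall hζ))), ?_⟩
  rw [closure_unitBall]
  exact continuousOn_const.div (by fun_prop) h

namespace Dom

variable {Ω : Set (E N)} {α : ℝ} {D : Dom Ω α} {φ : ℂ → E N} {μ : Measure (sphere (0:ℂ) 1)}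

namespace Dual

theorem annih_sq (hμ : D.Dual φ μ) {w : ℂ → E N} (hw : DiffContOnCl ℂ w 𝔻) :
    ∫ ζ : sphere (0:ℂ) 1, (ζ:ℂ) ^ 2 * D.L (φ ζ) (w ζ) ∂μ = 0 := by
  have h0 : (0:ℂ) ∈ 𝔻 := mem_ball_self one_pos
  have hd : Differentiable ℂ fun ζ : ℂ => ζ ^ 2 := by fun_prop
  have h1 : DiffContOnCl ℂ (fun ζ : ℂ => ζ ^ 2 • w ζ) 𝔻 := hd.diffContOnCl.smul hw
  have h2 : HasDerivAt (fun ζ : ℂ => ζ ^ 2 • w ζ) 0 0 := by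
    have h3 : HasDerivAt (fun ζ : ℂ => ζ ^ 2) 0 0 := by simpa using hasDerivAt_pow 2 (0:ℂ)
    refine (h3.smul (hw.differentiableOn.differentiableAt (isOpen_ball.mem_nhds h0)).hasDerivAt).congr_deriv ?_
    simp
  have := hμ.annih _ h1 (by simp) h2
  simpa using this

theorem continuous_apply (hφ : D.Reg φ) {u : ℂ → E N} (hu : DiffContOnCl ℂ u 𝔻) :
    Continuous fun ζ : sphere (0:ℂ) 1 => D.L (φ ζ) (u ζ) :=
  continuous_sphere (hφ.continuousOn_L_apply (by rw [← closure_unitBall]; exact hu.continuousOn))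

theorem continuous_L (hφ : D.Reg φ) : Continuous fun ζ : sphere (0:ℂ) 1 => D.L (φ ζ) :=
  continuous_sphere (D.continuousOn_L.comp hφ.cont fun _ hx => hφ.memc hx)

theorem differentiableOn_h (hφ : D.Reg φ) (hμ : D.Dual φ μ) :
    DifferentiableOn ℂ (dualH D φ μ) 𝔻 := by
  have := hμ.prob
  exact differentiableOn_cauchy ((continuous_subtype_val.pow 2).smul (continuous_L hφ))

theorem h_apply (hφ : D.Reg φ) (hμ : D.Dual φ μ) {a : ℂ} (ha : a ∈ 𝔻) (y : E N) :
    dualH D φ μ a y = ∫ ζ : sphere (0:ℂ) 1, (ζ:ℂ) ^ 2 * ((ζ:ℂ) - a)⁻¹ * D.L (φ ζ) y ∂μ := by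
  have := hμ.prob
  have hc : Continuous fun ζ : sphere (0:ℂ) 1 =>
      ((ζ:ℂ) - a)⁻¹ • ((ζ:ℂ) ^ 2 • D.L (φ ζ)) :=
    (Continuous.inv₀ (by fun_prop)
      fun ζ => sphere_sub_ne_zero ha (mem_sphere_zero_iff_norm.mp ζ.2)).smul
      ((continuous_subtype_val.pow 2).smul (continuous_L hφ))
  rw [dualH, ContinuousLinearMap.integral_apply (integrable_sphere hc)]
  congr 1
  ext ζ
  simp only [smul_apply, smul_eq_mul]
  ring

/-- Poisson pairing of the dual measure with a holomorphic map. -/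
theorem integral_mul_pk (hφ : D.Reg φ) (hμ : D.Dual φ μ) {a : ℂ} (ha : a ∈ 𝔻)
    {g : ℂ → E N} (hg : DiffContOnCl ℂ g 𝔻) :
    ∫ ζ : sphere (0:ℂ) 1, (pk a ζ : ℂ) * ((ζ:ℂ) * D.L (φ ζ) (g ζ)) ∂μ = dualH D φ μ a (g a) := by
  have := hμ.prob
  have hw : DiffContOnCl ℂ (fun ζ => dslope g a ζ +
      (conj a / (1 - conj a * ζ)) • g ζ) 𝔻 :=
    (diffContOnCl_dslope hg ha).add ((diffContOnCl_div_one_sub ha).smul hg)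
  have hpc : Continuous fun ζ : sphere (0:ℂ) 1 => (pk a ζ : ℂ) :=
    continuous_ofReal.comp (continuous_pk ha)
  have hic : Continuous fun ζ : sphere (0:ℂ) 1 => ((ζ:ℂ) - a)⁻¹ :=
    Continuous.inv₀ (by fun_prop)
      fun ζ => sphere_sub_ne_zero ha (mem_sphere_zero_iff_norm.mp ζ.2)
  have hgc := continuous_apply hφ hg
  have hyc : Continuous fun ζ : sphere (0:ℂ) 1 => D.L (φ ζ) (g a) :=
    (continuous_L hφ).clm_apply continuous_const
  rw [h_apply hφ hμ ha, ← sub_eq_zero, ← integral_sub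
    (integrable_sphere (by fun_prop)) (integrable_sphere (by fun_prop))]
  refine Eq.trans ?_ (hμ.annih_sq hw)
  congr 1
  ext ζ
  have hζ : ‖(ζ:ℂ)‖ = 1 := mem_sphere_zero_iff_norm.mp ζ.2
  have hne := sphere_sub_ne_zero ha hζ
  rw [← mul_assoc, mul_comm (pk a ζ : ℂ), mul_pk_eq_add ha hζ, dslope_of_ne _ (sub_ne_zero.mp hne),
    slope_def_module]
  simp only [map_add, map_smul, map_sub, smul_eq_mul]
  ring

theorem integral_pk_sq (hφ : D.Reg φ) (hμ : D.Dual φ μ) {a : ℂ} (ha : a ∈ 𝔻)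
    {u : ℂ → E N} (hu : DiffContOnCl ℂ u 𝔻) (hua : u a = 0) :
    ∫ ζ : sphere (0:ℂ) 1, ((pk a ζ ^ 2 : ℝ) : ℂ) * D.L (φ ζ) (u ζ) ∂μ =
      dualH D φ μ a (deriv u a) := by
  have hg := (diffContOnCl_div_one_sub (c := (1 - ‖a‖ ^ 2 : ℝ)) ha).smul (diffContOnCl_dslope hu ha)
  have h1 := integral_mul_pk hφ hμ ha hg
  have h2 : 1 - conj a * a ≠ 0 :=
    one_sub_conj_mul_ne_zero (norm_lt_one_of_mem_ball ha) (norm_lt_one_of_mem_ball ha).le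
  have h4 : ((1 - ‖a‖ ^ 2 : ℝ) : ℂ) = 1 - conj a * a := by
    rw [mul_comm, mul_conj, normSq_eq_norm_sq]; push_cast; ring
  simp only [dslope_same, map_smul] at h1
  rw [h4, div_self h2, one_smul] at h1
  rw [← h1]
  congr 1
  ext ζ
  have hζ : ‖(ζ:ℂ)‖ = 1 := mem_sphere_zero_iff_norm.mp ζ.2
  have hne := sphere_sub_ne_zero ha hζ
  have h5 := mul_pk_eq ha hζ
  rw [h4] at h5
  have h6 := one_sub_conj_mul_ne_zero (norm_lt_one_of_mem_ball ha) hζ.le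
  rw [dslope_of_ne _ (sub_ne_zero.mp hne), slope_def_module, hua, sub_zero]
  simp only [map_smul, smul_eq_mul]
  have h7 : (pk a ζ : ℂ) = (1 - conj a * a) * ζ /
      ((ζ - a) * (1 - conj a * ζ)) := by
    rw [eq_div_iff (mul_ne_zero hne h6), h5]
  push_cast
  rw [sq, mul_assoc]
  congr 1
  rw [h7]
  field_simp

theorem integral_pk_of_zero (hφ : D.Reg φ) (hμ : D.Dual φ μ) {a : ℂ} (ha : a ∈ 𝔻)
    (ha0 : a ≠ 0) {u : ℂ → E N} (hu : DiffContOnCl ℂ u 𝔻) (hu0 : u 0 = 0) :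
    ∫ ζ : sphere (0:ℂ) 1, (pk a ζ : ℂ) * D.L (φ ζ) (u ζ) ∂μ = a⁻¹ * dualH D φ μ a (u a) := by
  have h1 := integral_mul_pk hφ hμ ha (diffContOnCl_dslope hu (mem_ball_self one_pos))
  rw [dslope_of_ne _ ha0, slope_def_module, hu0, sub_zero, sub_zero, map_smul, smul_eq_mul] at h1
  rw [← h1]
  congr 1
  ext ζ
  have hζ : ‖(ζ:ℂ)‖ = 1 := mem_sphere_zero_iff_norm.mp ζ.2
  have hne : (ζ:ℂ) ≠ 0 := by rw [← norm_pos_iff, hζ]; exact one_pos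
  rw [dslope_of_ne _ hne, slope_def_module, hu0, sub_zero, sub_zero, map_smul, smul_eq_mul,
    mul_inv_cancel_left₀ hne]

theorem integral_pk_of_zero_at (hφ : D.Reg φ) (hμ : D.Dual φ μ) {a : ℂ} (ha : a ∈ 𝔻)
    (ha0 : a ≠ 0) {u : ℂ → E N} (hu : DiffContOnCl ℂ u 𝔻) (hua : u a = 0) :
    ∫ ζ : sphere (0:ℂ) 1, (pk a ζ : ℂ) * D.L (φ ζ) (u ζ) ∂μ =
      ((1 - ‖a‖ ^ 2 : ℝ) : ℂ) * (-a)⁻¹ * dualH D φ μ 0 (u 0) := by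
  have hg := (diffContOnCl_div_one_sub (c := (1 - ‖a‖ ^ 2 : ℝ)) ha).smul (diffContOnCl_dslope hu ha)
  have h1 := integral_mul_pk hφ hμ (mem_ball_self one_pos) hg
  simp only [map_smul, mul_zero, sub_zero, div_one, smul_eq_mul] at h1
  rw [dslope_of_ne _ ha0.symm, slope_def_module, hua, sub_zero, zero_sub, map_smul, smul_eq_mul,
    ← mul_assoc] at h1
  rw [← h1]
  congr 1
  ext ζ
  have hζ : ‖(ζ:ℂ)‖ = 1 := mem_sphere_zero_iff_norm.mp ζ.2
  have hne := sphere_sub_ne_zero ha hζ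
  have h5 := mul_pk_eq ha hζ
  have h6 := one_sub_conj_mul_ne_zero (norm_lt_one_of_mem_ball ha) hζ.le
  rw [dslope_of_ne _ (sub_ne_zero.mp hne), slope_def_module, hua, sub_zero, pk_zero hζ]
  simp only [map_smul, smul_eq_mul]
  have h7 : (pk a ζ : ℂ) = ((1 - ‖a‖ ^ 2 : ℝ) : ℂ) * ζ /
      ((ζ - a) * (1 - conj a * ζ)) := by
    rw [eq_div_iff (mul_ne_zero hne h6), h5]
  rw [h7]
  push_cast
  field_simp

theorem m_zero (hμ : D.Dual φ μ) : dualM μ 0 = 1 := by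
  have := hμ.prob
  have : ∀ ζ : sphere (0:ℂ) 1, pk 0 ζ = 1 := fun ζ => pk_zero (mem_sphere_zero_iff_norm.mp ζ.2)
  simp [dualM, this]

theorem m_nonneg {a : ℂ} (ha : a ∈ 𝔻) : 0 ≤ dualM μ a :=
  integral_nonneg fun ζ => (pk_pos ha (mem_sphere_zero_iff_norm.mp ζ.2)).le

theorem exists_m_eq_re (hμ : D.Dual φ μ) :
    ∃ f : ℂ → ℂ, DifferentiableOn ℂ f 𝔻 ∧ ∀ a ∈ 𝔻, dualM μ a = (f a).re := by
  have := hμ.prob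
  refine ⟨fun a => ∫ ζ : sphere (0:ℂ) 1, ((ζ:ℂ) - a)⁻¹ • (ζ:ℂ) ∂μ +
    a * ∫ ζ : sphere (0:ℂ) 1, ((ζ:ℂ) - a)⁻¹ • (1:ℂ) ∂μ, ?_, fun a ha => ?_⟩
  · exact (differentiableOn_cauchy (by fun_prop)).add
      (differentiableOn_id.mul (differentiableOn_cauchy continuous_const))
  · have hic : Continuous fun ζ : sphere (0:ℂ) 1 => ((ζ:ℂ) - a)⁻¹ :=
      Continuous.inv₀ (by fun_prop)
        fun ζ => sphere_sub_ne_zero ha (mem_sphere_zero_iff_norm.mp ζ.2)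
    simp only [smul_eq_mul, mul_one]
    rw [← integral_const_mul, ← integral_add (integrable_sphere (by fun_prop))
      (integrable_sphere (by fun_prop))]
    have hi : Integrable (fun ζ : sphere (0:ℂ) 1 => ((ζ:ℂ) - a)⁻¹ * ζ + a * ((ζ:ℂ) - a)⁻¹) μ :=
      integrable_sphere (by fun_prop)
    have h1 := integral_re hi
    simp only [RCLike.re_to_complex] at h1
    rw [← h1, dualM]
    congr 1
    ext ζ
    rw [pk_eq_re ha (mem_sphere_zero_iff_norm.mp ζ.2)]
    congr 1
    ring

end Dual

end Dom

namespace Dom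

variable {Ω : Set (E N)} {α : ℝ} (D : Dom Ω α)

/-- A family of holomorphic coordinate changes which make the domain convex near
boundary points, to first order. -/
structure PeakMap (U : E N → E N → E N) (C ε : ℝ) : Prop where
  diff : ∀ q ∈ frontier Ω, Differentiable ℂ (U q)
  close : ∀ q ∈ frontier Ω, ∀ x, ‖U q x - x‖ ≤ C * ‖x‖ ^ 2
  near : ∀ p ∈ frontier Ω, ∀ q ∈ frontier Ω, ∀ w ∈ closure Ω, ‖p - q‖ ≤ ε → ‖p - w‖ ≤ ε →
    D.r w / 2 ≤ (D.L p (U q (p - w))).re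
  far : ∀ p ∈ frontier Ω, ∀ q ∈ frontier Ω, ∀ w ∈ closure Ω,
    D.r w / 2 - C * ‖p - w‖ ^ 2 ≤ (D.L p (U q (p - w))).re

theorem exists_peakMap : ∃ U C ε, 0 < C ∧ 0 < ε ∧ D.PeakMap U C ε := by
  obtain ⟨Q, C, c, ε, hC, hc, hε, hQd, hQ, hQQ, hlp⟩ := D.exists_levi_poly
  obtain ⟨C', ε', hC', hε', hn⟩ := D.exists_normal
  have hM := D.M_pos
  have hα := D.α_pos
  choose! e he1 he2 using hn
  have hfr : ∀ q ∈ frontier Ω, q ∈ closure Ω := fun q hq => frontier_subset_closure hq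
  have he : ∀ q ∈ frontier Ω, D.L q (e q) = 1 ∧ ‖e q‖ ≤ C' := fun q hq =>
    ⟨he1 q (hfr q hq) (by rw [D.r_frontier hq]; exact hε'.le),
      he2 q (hfr q hq) (by rw [D.r_frontier hq]; exact hε'.le)⟩
  obtain ⟨ε₁, hε₁, h1, h2, h3⟩ : ∃ ε₁ > 0, ε₁ ≤ ε ∧ C * ε₁ ^ α ≤ c ∧ C * (D.M * ε₁ * C') ≤ c := by
    have hcont : Tendsto (fun t : ℝ => C * t ^ α) (𝓝 0) (𝓝 (C * 0 ^ α)) :=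
      ((Real.continuous_rpow_const hα.le).const_mul C).tendsto 0
    rw [zero_rpow hα.ne', mul_zero] at hcont
    have hcont2 : Tendsto (fun t : ℝ => C * (D.M * t * C')) (𝓝 0) (𝓝 (C * (D.M * 0 * C'))) :=
      Continuous.tendsto (by fun_prop) 0
    rw [mul_zero, zero_mul, mul_zero] at hcont2
    have hev := ((hcont.eventually_le_const hc).and (hcont2.eventually_le_const hc)).and
      (eventually_le_nhds hε)
    obtain ⟨t, ⟨⟨h1, h2⟩, h3⟩, h4⟩ := ((hev.filter_mono nhdsWithin_le_nhds).and
      (self_mem_nhdsWithin (s := Ioi (0:ℝ)))).exists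
    exact ⟨t, h4, h3, h1, h2⟩
  set U : E N → E N → E N := fun q x => x - (Q q (-x) / 2) • e q with hU
  have hLU : ∀ p q x, (D.L p (U q x)) = D.L p x - Q q (-x) / 2 * D.L p (e q) := by
    intro p q x
    rw [hU, map_sub, map_smul, smul_eq_mul]
  refine ⟨U, D.M + C * C' + C * D.M * C', ε₁, by positivity, hε₁, ⟨?_, ?_, ?_, ?_⟩⟩
  · intro q hq
    have h1 : Differentiable ℂ fun x => Q q (-x) := (hQd q).comp differentiable_id.neg
    have h2 : Differentiable ℂ fun x => Q q (-x) / 2 := by fun_prop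
    exact differentiable_id.sub (h2.smul_const (e q))
  · intro q hq x
    rw [hU]
    have h4 := hQ q (hfr q hq) (-x)
    rw [norm_neg] at h4
    rw [sub_sub_cancel_left, norm_neg, norm_smul, norm_div, Complex.norm_ofNat]
    have h5 : ‖Q q (-x)‖ / 2 * ‖e q‖ ≤ (C * ‖x‖ ^ 2) * C' :=
      mul_le_mul (by linarith [norm_nonneg (Q q (-x))]) (he q hq).2 (norm_nonneg _) (by positivity)
    have h6 : 0 ≤ D.M * ‖x‖ ^ 2 := by positivity
    have h7 : 0 ≤ C * D.M * C' * ‖x‖ ^ 2 := by positivity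
    linarith
  · intro p hp q hq w hw hpq hpw
    have h4 := hlp p (hfr p hp) (w - p) (by rw [D.r_frontier hp]; exact hε.le)
      (by rw [norm_sub_rev]; exact hpw.trans h1) (by rwa [add_sub_cancel])
    rw [D.r_frontier hp, add_sub_cancel, ← neg_sub p w, map_neg, norm_neg] at h4
    rw [hLU]
    have h5 := hQQ p (hfr p hp) q (hfr q hq) (-(p - w))
    have h6 := hQ q (hfr q hq) (-(p - w))
    rw [norm_neg] at h5 h6
    have h7 : ‖D.L p (e q) - 1‖ ≤ D.M * ‖p - q‖ * C' := by
      rw [← (he q hq).1, ← sub_apply]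
      exact (le_opNorm _ _).trans
        (mul_le_mul (D.d2 q (hfr q hq) p (hfr p hp)) (he q hq).2 (norm_nonneg _) (by positivity))
    have h8 : ‖Q p (-(p - w)) - Q q (-(p - w))‖ ≤ c * ‖p - w‖ ^ 2 :=
      h5.trans (mul_le_mul_of_nonneg_right (le_trans (by gcongr) h2) (by positivity))
    have h9 : ‖Q q (-(p - w)) * (D.L p (e q) - 1)‖ ≤ c * ‖p - w‖ ^ 2 := by
      rw [norm_mul]
      calc _ ≤ (C * ‖p - w‖ ^ 2) * (D.M * ε₁ * C') := by
            refine mul_le_mul h6 (h7.trans ?_) (norm_nonneg _) (by positivity)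
            gcongr
        _ = C * (D.M * ε₁ * C') * ‖p - w‖ ^ 2 := by ring
        _ ≤ _ := mul_le_mul_of_nonneg_right h3 (by positivity)
    have h10 := (abs_re_le_norm _).trans h8
    have h11 := (abs_re_le_norm _).trans h9
    rw [_root_.abs_le] at h10 h11
    have h12 : Q q (-(p - w)) / 2 * D.L p (e q) = Q p (-(p - w)) / 2 -
        (Q p (-(p - w)) - Q q (-(p - w))) / 2 + Q q (-(p - w)) * (D.L p (e q) - 1) / 2 := by ring
    rw [h12]
    simp only [sub_re, add_re, neg_re, Complex.div_ofNat_re] at *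
    linarith [h10.1, h11.2]
  · intro p hp q hq w hw
    rw [hLU]
    have h4 := (_root_.abs_le.mp (D.d1 p (hfr p hp) w hw)).1
    rw [← neg_sub p w, map_neg, norm_neg, neg_re] at h4
    have h5 : D.r p = 0 := D.r_frontier hp
    have h6 : D.r p = -D.ρ p := rfl
    have h7 : D.r w = -D.ρ w := rfl
    have h8 := D.r_nonneg hw
    have h9 := hQ q (hfr q hq) (-(p - w))
    rw [norm_neg] at h9
    have h10 : ‖Q q (-(p - w)) / 2 * D.L p (e q)‖ ≤ (C * ‖p - w‖ ^ 2) * (D.M * C') := by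
      rw [norm_mul, norm_div, Complex.norm_ofNat]
      refine mul_le_mul (by linarith [norm_nonneg (Q q (-(p - w)))]) ?_ (norm_nonneg _)
        (by positivity)
      exact (le_opNorm _ _).trans
        (mul_le_mul (D.norm_L p (hfr p hp)) (he q hq).2 (norm_nonneg _) hM.le)
    have h11 := (re_le_norm _).trans h10
    rw [sub_re]
    have h12 : 0 ≤ C * C' * ‖p - w‖ ^ 2 := by positivity
    linarith

variable {D}

theorem PeakMap.zero {U : E N → E N → E N} {C ε : ℝ} (h : D.PeakMap U C ε) {q : E N}
    (hq : q ∈ frontier Ω) : U q 0 = 0 := by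
  have := h.close q hq 0
  simpa using this

theorem PeakMap.hasFDerivAt {U : E N → E N → E N} {C ε : ℝ} (h : D.PeakMap U C ε) {q : E N}
    (hq : q ∈ frontier Ω) : HasFDerivAt (𝕜 := ℂ) (U q) (ContinuousLinearMap.id ℂ (E N)) 0 := by
  rw [hasFDerivAt_iff_isLittleO_nhds_zero]
  have h1 : (fun x => U q (0 + x) - U q 0 - (ContinuousLinearMap.id ℂ (E N)) x) =O[𝓝 0]
      fun x => ‖x‖ ^ 2 := by
    refine Asymptotics.IsBigO.of_bound C (Eventually.of_forall fun x => ?_)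
    simp only [zero_add, h.zero hq, sub_zero, ContinuousLinearMap.id_apply, norm_pow, norm_norm]
    exact h.close q hq x
  exact h1.trans_isLittleO (Asymptotics.isLittleO_norm_pow_id one_lt_two)

theorem PeakMap.hasDerivAt_comp {U : E N → E N → E N} {C ε : ℝ} (h : D.PeakMap U C ε) {q : E N}
    (hq : q ∈ frontier Ω) {f : ℂ → E N} {f' : E N} {a : ℂ} (hf : HasDerivAt f f' a)
    (hfa : f a = 0) : HasDerivAt (fun ζ => U q (f ζ)) f' a := by
  have h1 := h.hasFDerivAt hq
  rw [← hfa] at h1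
  exact h1.comp_hasDerivAt a hf

theorem PeakMap.norm_le {U : E N → E N → E N} {C ε : ℝ} (h : D.PeakMap U C ε) {q : E N}
    (hq : q ∈ frontier Ω) (f : E N →L[ℂ] ℂ) (x : E N) :
    ‖f (U q x)‖ ≤ ‖f x‖ + ‖f‖ * (C * ‖x‖ ^ 2) := by
  have h1 : f (U q x) = f x + f (U q x - x) := by rw [map_sub]; ring
  rw [h1]
  refine (norm_add_le _ _).trans (add_le_add_right ?_ _)
  exact (f.le_opNorm _).trans (mul_le_mul_of_nonneg_left (h.close q hq x) (norm_nonneg _))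

theorem PeakMap.diffContOnCl_comp {U : E N → E N → E N} {C ε : ℝ} (h : D.PeakMap U C ε) {q : E N}
    (hq : q ∈ frontier Ω) {f : ℂ → E N} (hf : DiffContOnCl ℂ f 𝔻) :
    DiffContOnCl ℂ (fun ζ => U q (f ζ)) 𝔻 :=
  (h.diff q hq).comp_diffContOnCl hf

theorem PeakMap.exists_re_ge {U : E N → E N → E N} {C ε : ℝ} (hC : 0 < C) (hε : 0 < ε)
    (h : D.PeakMap U C ε) : ∃ K > 0, ∀ φ, D.Reg φ →
      ∀ a ∈ closedBall (0:ℂ) 1, ∀ ω ζ : ℂ, ‖ω‖ = 1 → ‖ζ‖ = 1 → ‖ζ - ω‖ ≤ 2 * ‖ζ - a‖ →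
      D.r (φ a) / 2 - K * D.sz φ ^ 2 * ‖ζ - a‖ ^ 4 ≤ (D.L (φ ζ) (U (φ ω) (φ ζ - φ a))).re := by
  obtain ⟨C1, hC1, h1⟩ := D.exists_reg_holder
  obtain ⟨C2, hC2, h2⟩ := D.exists_norm_sub_le
  have hM := D.M_pos
  have hs : ∀ φ, D.Reg φ → D.sz φ ≤ D.M := fun φ hφ => hφ.cen.sz_le
  obtain ⟨η, hη, hηb⟩ : ∃ η > 0, C1 * D.M * (2 * η) ^ (1 / 2 : ℝ) ≤ ε := by
    refine ⟨(ε / (C1 * D.M)) ^ 2 / 2, by positivity, ?_⟩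
    rw [mul_div_cancel₀ _ (two_ne_zero), ← sqrt_eq_rpow, sqrt_sq (by positivity),
      mul_div_cancel₀ _ (by positivity)]
  refine ⟨C * C2 ^ 2 / η ^ 4, by positivity, fun φ hφ a ha ω ζ hω hζ hωζ => ?_⟩
  have hsz := hφ.cen.sz_pos
  have hζc := mem_closedBall_of_norm_eq hζ
  have hωc := mem_closedBall_of_norm_eq hω
  have hac := hφ.memc ha
  by_cases hn : ‖ζ - a‖ ≤ η
  · have h3 : ∀ b ∈ closedBall (0:ℂ) 1, ‖ζ - b‖ ≤ 2 * η → ‖φ ζ - φ b‖ ≤ ε := by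
      intro b hb hbη
      refine (h1 φ hφ ζ hζc b hb).trans (le_trans ?_ hηb)
      have := hs φ hφ
      gcongr
    have h4 := h.near (φ ζ) (hφ.mem_frontier hζ) (φ ω) (hφ.mem_frontier hω) (φ a) hac
      (h3 ω hωc (by linarith)) (h3 a ha (by linarith))
    have h5 : 0 ≤ C * C2 ^ 2 / η ^ 4 * D.sz φ ^ 2 * ‖ζ - a‖ ^ 4 := by positivity
    linarith
  · push Not at hn
    refine le_trans ?_ (h.far (φ ζ) (hφ.mem_frontier hζ) (φ ω) (hφ.mem_frontier hω) (φ a) hac)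
    have h3 := h2 φ hφ ζ hζc a ha
    have h4 : η ^ 4 ≤ ‖ζ - a‖ ^ 4 := pow_le_pow_left₀ hη.le hn.le 4
    have h5 : ‖φ ζ - φ a‖ ^ 2 ≤ (C2 * D.sz φ) ^ 2 := pow_le_pow_left₀ (norm_nonneg _) h3 2
    have h6 : C * (C2 * D.sz φ) ^ 2 ≤ C * C2 ^ 2 / η ^ 4 * D.sz φ ^ 2 * ‖ζ - a‖ ^ 4 := by
      calc C * (C2 * D.sz φ) ^ 2 = C * C2 ^ 2 / η ^ 4 * D.sz φ ^ 2 * η ^ 4 := by field_simp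
        _ ≤ _ := by gcongr
    have h7 := mul_le_mul_of_nonneg_left h5 hC.le
    linarith

end Dom

theorem abs_deriv_le_of_ge {G : ℝ → ℝ} {g K δ : ℝ} (hG : HasDerivAt G g 0) (h0 : G 0 = 0)
    (hδ : 0 < δ) (h : ∀ s, |s| ≤ δ → -(K * |s|) ≤ G s) : |g| ≤ K := by
  rw [hasDerivAt_iff_tendsto_slope] at hG
  have hev : ∀ᶠ s : ℝ in 𝓝 0, |s| ≤ δ := by
    filter_upwards [closedBall_mem_nhds (0:ℝ) hδ] with s hs
    simpa using hs
  refine _root_.abs_le.mpr ⟨?_, ?_⟩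
  · have h1 : Tendsto (slope G 0) (𝓝[>] 0) (𝓝 g) :=
      hG.mono_left (nhdsWithin_mono _ fun x hx => ne_of_gt hx)
    refine ge_of_tendsto h1 ?_
    filter_upwards [hev.filter_mono nhdsWithin_le_nhds, self_mem_nhdsWithin] with s hs hs0
    have hs0 : 0 < s := hs0
    have := h s hs
    rw [slope_def_field, h0, sub_zero, sub_zero, le_div_iff₀ hs0]
    rw [abs_of_pos hs0] at this
    linarith
  · have h1 : Tendsto (slope G 0) (𝓝[<] 0) (𝓝 g) :=
      hG.mono_left (nhdsWithin_mono _ fun x hx => ne_of_lt hx)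
    refine le_of_tendsto h1 ?_
    filter_upwards [hev.filter_mono nhdsWithin_le_nhds, self_mem_nhdsWithin] with s hs hs0
    have hs0 : s < 0 := hs0
    have := h s hs
    rw [slope_def_field, h0, sub_zero, sub_zero, div_le_iff_of_neg hs0]
    rw [abs_of_neg hs0] at this
    linarith

theorem norm_sub_radial_le {a ζ : ℂ} (ha : ‖a‖ ≤ 1) (ha0 : a ≠ 0) (hζ : ‖ζ‖ = 1) :
    ‖(a / (‖a‖ : ℂ))‖ = 1 ∧ ‖ζ - a / (‖a‖ : ℂ)‖ ≤ 2 * ‖ζ - a‖ := by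
  have hn := norm_pos_iff.mpr ha0
  have hnc : (‖a‖ : ℂ) ≠ 0 := by exact_mod_cast hn.ne'
  have h1 : ‖a - a / (‖a‖ : ℂ)‖ = 1 - ‖a‖ := by
    have : a - a / (‖a‖ : ℂ) = (a / (‖a‖ : ℂ)) * ((‖a‖ - 1 : ℝ) : ℂ) := by
      push_cast; field_simp
    rw [this, norm_mul, norm_div, norm_real, norm_real, norm_norm,
      div_self hn.ne', one_mul, norm_eq_abs, abs_sub_comm, abs_of_nonneg (by linarith)]
  refine ⟨by rw [norm_div, norm_real, norm_norm, div_self hn.ne'], ?_⟩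
  have h2 : 1 - ‖a‖ ≤ ‖ζ - a‖ := by rw [← hζ]; exact norm_sub_norm_le _ _
  have h3 := norm_sub_le_norm_sub_add_norm_sub ζ a (a / (‖a‖ : ℂ))
  linarith

namespace Dom

variable {Ω : Set (E N)} {α : ℝ} {D : Dom Ω α}

namespace Dual

variable {φ : ℂ → E N} {μ : Measure (sphere (0:ℂ) 1)}

theorem exists_abs_im_le (hφ : D.Reg φ) (hμ : D.Dual φ μ) : ∃ K > 0, ∀ a ∈ 𝔻, a ≠ 0 →
    |(dualH D φ μ a (deriv φ a)).im| ≤ K * (1 - ‖a‖ ^ 2) := by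
  obtain ⟨U, C, ε, hC, hε, hU⟩ := D.exists_peakMap
  obtain ⟨C1, hC1, h1⟩ := D.exists_reg_holder
  have hsz := hφ.cen.sz_pos
  have := hμ.prob
  set k := C1 * D.sz φ with hk
  have hkp : 0 < k := by positivity
  obtain ⟨δ, hδ, hδε⟩ : ∃ δ > 0, k * δ ^ (1 / 2 : ℝ) ≤ ε := by
    refine ⟨(ε / k) ^ 2, by positivity, ?_⟩
    rw [← sqrt_eq_rpow, sqrt_sq (by positivity), mul_div_cancel₀ _ hkp.ne']
  have hnear : ∀ x ∈ closedBall (0:ℂ) 1, ∀ y ∈ closedBall (0:ℂ) 1, ‖x - y‖ ≤ δ →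
      ‖φ x - φ y‖ ≤ ε := fun x hx y hy hxy =>
    (h1 φ hφ x hx y hy).trans (le_trans (by gcongr) hδε)
  refine ⟨C * k ^ 2 * (4 / δ ^ 2), by positivity, fun a ha ha0 => ?_⟩
  have hκ := one_sub_norm_sq_pos ha
  set ω := a / (‖a‖ : ℂ) with hω
  have hω1 : ‖ω‖ = 1 := by
    rw [hω, norm_div, norm_real, norm_norm, div_self (norm_ne_zero_iff.mpr ha0)]
  have hqf := hφ.mem_frontier hω1
  set rot : ℝ → ℂ := fun s => Complex.exp (I * s) with hrot
  have hrn : ∀ s, ‖rot s‖ = 1 := fun s => by rw [hrot]; exact Complex.norm_exp_I_mul_ofReal s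
  have hrs : ∀ s x, ‖x - rot s * x‖ ≤ |s| * ‖x‖ := by
    intro s x
    have e1 : x - rot s * x = -((rot s - 1) * x) := by ring
    rw [e1, norm_neg, norm_mul]
    exact mul_le_mul_of_nonneg_right (Real.norm_exp_I_mul_ofReal_sub_one_le (x := s))
      (norm_nonneg _)
  refine abs_deriv_le_of_ge (G := fun s => (a⁻¹ * dualH D φ μ a
    (U (φ ω) (φ a - φ (rot s * a)))).re) (δ := δ) ?_ ?_ hδ ?_
  · have hr0 : rot 0 = 1 := by simp [hrot]
    have hd0 : HasDerivAt (fun z : ℂ => Complex.exp (I * z) * a) (I * a) 0 := by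
      have h2 : HasDerivAt (fun z : ℂ => I * z) I 0 := by
        simpa using (hasDerivAt_id (0:ℂ)).const_mul I
      refine ((h2.cexp).mul_const a).congr_deriv ?_
      simp
    have hpa : HasDerivAt φ (deriv φ a) (Complex.exp (I * 0) * a) := by
      rw [mul_zero, Complex.exp_zero, one_mul]
      exact (hφ.cen.diff.differentiableAt (isOpen_ball.mem_nhds ha)).hasDerivAt
    have hd1 : HasDerivAt (fun z : ℂ => φ a - φ (Complex.exp (I * z) * a))
        (-((I * a) • deriv φ a)) 0 := (hpa.scomp (0:ℂ) hd0).const_sub (φ a)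
    have hd2 := hU.hasDerivAt_comp hqf hd1 (by simp)
    have hd3 : HasDerivAt (fun z : ℂ => a⁻¹ * dualH D φ μ a
        (U (φ ω) (φ a - φ (Complex.exp (I * z) * a))))
        (a⁻¹ * dualH D φ μ a (-((I * a) • deriv φ a))) 0 :=
      ((dualH D φ μ a).hasFDerivAt.comp_hasDerivAt (0:ℂ) hd2).const_mul a⁻¹
    have hd4 := HasDerivAt.real_of_complex (z := 0) (by simpa using hd3)
    refine hd4.congr_deriv ?_
    have : -(a⁻¹ * (I * a * dualH D φ μ a (deriv φ a))) =
        -(I * dualH D φ μ a (deriv φ a)) := by field_simp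
    rw [this]
    simp
  · simp [hrot, hU.zero hqf]
  · intro s hs
    have hmaps : ∀ x ∈ closedBall (0:ℂ) 1, rot s * x ∈ closedBall (0:ℂ) 1 := fun x hx => by
      rw [mem_closedBall_zero_iff, norm_mul, hrn, one_mul]; exact mem_closedBall_zero_iff.mp hx
    have hdr : DiffContOnCl ℂ (fun x => φ (rot s * x)) 𝔻 := by
      refine ⟨hφ.cen.diff.comp (by fun_prop) fun x hx => ?_, ?_⟩
      · rw [mem_ball_zero_iff, norm_mul, hrn, one_mul]; exact mem_ball_zero_iff.mp hx
      · rw [closure_unitBall]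
        exact hφ.cont.comp (by fun_prop) hmaps
    have hu : DiffContOnCl ℂ (fun x => U (φ ω) (φ x - φ (rot s * x))) 𝔻 :=
      hU.diffContOnCl_comp hqf (hφ.dcc.sub hdr)
    have hi := integral_pk_of_zero hφ hμ ha ha0 hu (by simp [hU.zero hqf])
    rw [← hi, re_dual_integral (integrable_sphere ((continuous_ofReal.comp
      (continuous_pk ha)).mul (continuous_apply hφ hu)))]
    have hpt : ∀ ζ : sphere (0:ℂ) 1, -(C * k ^ 2 * (4 / δ ^ 2) * (1 - ‖a‖ ^ 2) * |s|) ≤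
        pk a ζ * (D.L (φ ζ) (U (φ ω) (φ ζ - φ (rot s * ζ)))).re := by
      intro ζ
      have hζ : ‖(ζ:ℂ)‖ = 1 := mem_sphere_zero_iff_norm.mp ζ.2
      have hp := pk_pos ha hζ
      have hζc := mem_closedBall_of_norm_eq hζ
      have hrζ : ‖rot s * (ζ:ℂ)‖ = 1 := by rw [norm_mul, hrn, hζ, one_mul]
      have hrf := hφ.mem_frontier hrζ
      have hd : ‖(ζ:ℂ) - rot s * ζ‖ ≤ |s| := by simpa [hζ] using hrs s ζ
      by_cases hn : ‖(ζ:ℂ) - ω‖ ≤ δ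
      · have h2 := hU.near _ (hφ.mem_frontier hζ) _ hqf _ (frontier_subset_closure hrf)
          (hnear _ hζc _ (mem_closedBall_of_norm_eq hω1) hn)
          (hnear _ hζc _ (mem_closedBall_of_norm_eq hrζ) (hd.trans hs))
        rw [D.r_frontier hrf, zero_div] at h2
        have h3 : 0 ≤ C * k ^ 2 * (4 / δ ^ 2) * (1 - ‖a‖ ^ 2) * |s| := by positivity
        linarith [mul_nonneg hp.le h2]
      · push Not at hn
        have h2 := hU.far _ (hφ.mem_frontier hζ) _ hqf _ (frontier_subset_closure hrf)
        rw [D.r_frontier hrf, zero_div, zero_sub] at h2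
        have h3 := (norm_sub_radial_le (norm_lt_one_of_mem_ball ha).le ha0 hζ).2
        have h4 : (δ / 2) ^ 2 ≤ ‖(ζ:ℂ) - a‖ ^ 2 := pow_le_pow_left₀ (by positivity) (by linarith) 2
        have h5 : pk a ζ ≤ 4 / δ ^ 2 * (1 - ‖a‖ ^ 2) := by
          have e1 := pk_mul_norm_sq ha hζ
          have e2 : pk a ζ * (δ / 2) ^ 2 ≤ 1 - ‖a‖ ^ 2 := by
            rw [← e1]; exact mul_le_mul_of_nonneg_left h4 hp.le
          rw [div_mul_eq_mul_div, le_div_iff₀ (by positivity)]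
          linarith
        have h6 : ‖φ ζ - φ (rot s * ζ)‖ ^ 2 ≤ k ^ 2 * |s| := by
          have e1 := h1 φ hφ _ hζc _ (mem_closedBall_of_norm_eq hrζ)
          have e2 : ‖φ ζ - φ (rot s * ζ)‖ ≤ k * |s| ^ (1 / 2 : ℝ) :=
            e1.trans (mul_le_mul_of_nonneg_left (rpow_le_rpow (norm_nonneg _) hd
              (by norm_num)) hkp.le)
          refine (pow_le_pow_left₀ (norm_nonneg _) e2 2).trans (le_of_eq ?_)
          rw [mul_pow, ← sqrt_eq_rpow, sq_sqrt (abs_nonneg _)]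
        have h7 : C * ‖φ ζ - φ (rot s * ζ)‖ ^ 2 ≤ C * (k ^ 2 * |s|) :=
          mul_le_mul_of_nonneg_left h6 hC.le
        have h8 : pk a ζ * (C * (k ^ 2 * |s|)) ≤
            4 / δ ^ 2 * (1 - ‖a‖ ^ 2) * (C * (k ^ 2 * |s|)) :=
          mul_le_mul_of_nonneg_right h5 (by positivity)
        have h9 := mul_le_mul_of_nonneg_left (show -(C * (k ^ 2 * |s|)) ≤
          (D.L (φ ζ) (U (φ ω) (φ ζ - φ (rot s * ζ)))).re by linarith) hp.le
        linarith
    have hint := integral_mono (μ := μ) (integrable_const _) (integrable_sphere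
      ((continuous_pk ha).mul (continuous_re.comp (continuous_apply hφ hu)))) hpt
    rw [integral_const, probReal_univ, one_smul] at hint
    exact hint

theorem exists_const (hφ : D.Reg φ) (hμ : D.Dual φ μ) : ∃ c₀ : ℝ, ∀ a ∈ 𝔻,
    dualH D φ μ a (deriv φ a) = c₀ := by
  obtain ⟨K, hK, h⟩ := exists_abs_im_le hφ hμ
  set f : ℂ → ℂ := fun a => dualH D φ μ a (deriv φ a) with hf
  have hfd : DifferentiableOn ℂ f 𝔻 :=
    (differentiableOn_h hφ hμ).clm_apply (hφ.cen.diff.deriv isOpen_ball)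
  have key : ∀ g : ℂ → ℂ, DifferentiableOn ℂ g 𝔻 →
      (∀ a ∈ 𝔻, a ≠ 0 → |(g a).re| ≤ K * (1 - ‖a‖ ^ 2)) →
      ∀ a ∈ 𝔻, 0 ≤ (g a).re := by
    intro g hg hgb a ha
    have ha1 := norm_lt_one_of_mem_ball ha
    have hlim : Tendsto (fun s : ℝ => -(K * (1 - s ^ 2))) (𝓝[<] 1) (𝓝 (-(K * (1 - 1 ^ 2)))) :=
      (Continuous.tendsto (by fun_prop) 1).mono_left nhdsWithin_le_nhds
    have e0 : -(K * (1 - (1:ℝ) ^ 2)) = 0 := by norm_num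
    rw [e0] at hlim
    refine le_of_tendsto hlim ?_
    filter_upwards [self_mem_nhdsWithin, (eventually_gt_nhds ha1).filter_mono nhdsWithin_le_nhds]
      with s hs1 hs
    have hs1 : s < 1 := hs1
    have hs0 : 0 < s := (norm_nonneg a).trans_lt hs
    refine re_ge_of_sphere hs0 (hg.mono (closedBall_subset_ball hs1)) (fun ζ hζ => ?_) hs.le
    have := hgb ζ (by rw [mem_ball_zero_iff]; linarith) (by rw [← norm_pos_iff]; linarith)
    rw [hζ] at this
    exact (_root_.abs_le.mp this).1
  have him : ∀ a ∈ 𝔻, (f a).im = 0 := by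
    intro a ha
    have h1 := key (fun a => -I * f a) (hfd.const_mul _)
      (fun a ha ha0 => by simpa using h a ha ha0) a ha
    have h2 := key (fun a => I * f a) (hfd.const_mul _)
      (fun a ha ha0 => by simpa using h a ha ha0) a ha
    simp at h1 h2
    linarith
  have hder : EqOn (deriv fun a => I * f a) 0 𝔻 := by
    intro a ha
    have hR : 0 < 1 - ‖a‖ := by linarith [norm_lt_one_of_mem_ball ha]
    have hsub : ball a (1 - ‖a‖) ⊆ 𝔻 := ball_subset_ball' (by simp)
    have h1 := norm_deriv_le_of_abs_re_le (G := fun a => I * f a) (m := 0) hR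
      ((hfd.const_mul _).mono hsub) fun x hx => by simp [him x (hsub hx)]
    simpa using h1
  refine ⟨(f 0).re, fun a ha => ?_⟩
  have h0 : (0:ℂ) ∈ 𝔻 := mem_ball_self one_pos
  have h1 := isOpen_ball.is_const_of_deriv_eq_zero (convex_ball (0:ℂ) 1).isPreconnected
    (hfd.const_mul I) hder ha h0
  have h2 : f a = f 0 := mul_left_cancel₀ Complex.I_ne_zero h1
  change f a = _
  rw [h2]
  exact Complex.ext (by simp) (by simp [him 0 h0])

theorem norm_h_apply_le (hφ : D.Reg φ) (hμ : D.Dual φ μ) {a : ℂ} (ha : a ∈ 𝔻) {y : E N}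
    {B : ℝ} (hB : ∀ ζ : ℂ, ‖ζ‖ = 1 → ‖D.L (φ ζ) y‖ ≤ B) :
    ‖dualH D φ μ a y‖ ≤ B * dualM μ a := by
  have := hμ.prob
  have h1 := integral_mul_pk hφ hμ ha (g := fun _ => y) diffContOnCl_const
  rw [← h1, dualM, ← integral_const_mul]
  refine norm_integral_le_of_norm_le ((integrable_sphere (continuous_pk ha)).const_mul B)
    (Eventually.of_forall fun ζ => ?_)
  have hζ : ‖(ζ:ℂ)‖ = 1 := mem_sphere_zero_iff_norm.mp ζ.2
  have hp := pk_pos ha hζ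
  rw [norm_mul, norm_mul, hζ, one_mul, norm_real, norm_of_nonneg hp.le, mul_comm]
  exact mul_le_mul_of_nonneg_right (hB ζ hζ) hp.le

end Dual

end Dom

theorem rpow_half_mul_le {d p κ : ℝ} (hd : 0 ≤ d) (hp : 0 ≤ p) (hκ : 0 ≤ κ) (h : p * d ^ 2 = κ) :
    d ^ (1 / 2 : ℝ) * p ≤ κ ^ (1 / 4 : ℝ) * (1 + p) := by
  have hx0 : 0 ≤ d ^ (1 / 2 : ℝ) := by positivity
  have hk0 : 0 ≤ κ ^ (1 / 4 : ℝ) := by positivity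
  have hx : (d ^ (1 / 2 : ℝ)) ^ 4 = d ^ 2 := by
    rw [← rpow_natCast, ← rpow_mul hd, ← rpow_natCast]; norm_num
  have hk : (κ ^ (1 / 4 : ℝ)) ^ 4 = κ := by
    rw [← rpow_natCast, ← rpow_mul hκ]; norm_num
  set x := d ^ (1 / 2 : ℝ)
  set k := κ ^ (1 / 4 : ℝ)
  rcases le_total 1 p with h1 | h1
  · have h2 : x ^ 4 ≤ k ^ 4 := by
      rw [hx, hk, ← h]
      exact le_mul_of_one_le_left (sq_nonneg d) h1
    have h3 : x ≤ k := le_of_pow_le_pow_left₀ (by norm_num) hk0 h2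
    have h4 := mul_le_mul_of_nonneg_right h3 hp
    linarith
  · have h2 : (x * p) ^ 4 ≤ k ^ 4 := by
      rw [mul_pow, hx, hk, ← h, mul_comm]
      refine mul_le_mul_of_nonneg_right ?_ (sq_nonneg d)
      exact pow_le_of_le_one hp h1 (by norm_num)
    have h3 : x * p ≤ k := le_of_pow_le_pow_left₀ (by norm_num) hk0 h2
    have h4 := mul_nonneg hk0 hp
    linarith

theorem one_sub_sq_le {a : ℂ} (ha : a ∈ 𝔻) : 1 - ‖a‖ ^ 2 ≤ 2 * (1 - ‖a‖) := by
  have h1 := norm_lt_one_of_mem_ball ha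
  have h2 : (1 - ‖a‖) * (1 + ‖a‖) ≤ (1 - ‖a‖) * 2 :=
    mul_le_mul_of_nonneg_left (by linarith) (by linarith)
  linarith

namespace Dom

variable {Ω : Set (E N)} {α : ℝ} (D : Dom Ω α)

theorem exists_m_le : ∃ C > 0, ∀ φ, D.Reg φ → ∀ μ, D.Dual φ μ →
    ∀ a ∈ 𝔻, dualM μ a ≤ C := by
  obtain ⟨U, C, ε, hC, hε, hU⟩ := D.exists_peakMap
  obtain ⟨K, hK, hre⟩ := hU.exists_re_ge hC hε
  obtain ⟨C1, hC1, h1⟩ := D.exists_norm_sub_le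
  obtain ⟨C2, hC2, h2⟩ := D.exists_norm_L_sub_le
  obtain ⟨c, hc, hh⟩ := D.exists_hopf
  have hM := D.M_pos
  set B := C2 + D.M * (C * C1 ^ 2) with hB
  have hBp : 0 < B := by positivity
  refine ⟨4 + 4 * (2 * B + 4 * K) / c, by positivity, fun φ hφ μ hμ a ha => ?_⟩
  have hsz := hφ.cen.sz_pos
  have := hμ.prob
  have ha1 := norm_lt_one_of_mem_ball ha
  have hκ := one_sub_norm_sq_pos ha
  have hac := ball_subset_closedBall ha
  have h0 : (0:ℂ) ∈ 𝔻 := mem_ball_self one_pos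
  by_cases hs : ‖a‖ ≤ 1 / 2
  · have hp : ∀ ζ : sphere (0:ℂ) 1, pk a ζ ≤ 4 := by
      intro ζ
      have hζ : ‖(ζ:ℂ)‖ = 1 := mem_sphere_zero_iff_norm.mp ζ.2
      have e1 := pk_mul_norm_sq ha hζ
      have e2 : (1 / 2) ^ 2 ≤ ‖(ζ:ℂ) - a‖ ^ 2 := by
        refine pow_le_pow_left₀ (by norm_num) ?_ 2
        have := norm_sub_norm_le (ζ:ℂ) a
        linarith
      have e3 := mul_le_mul_of_nonneg_left e2 (pk_pos ha hζ).le
      have e4 := sq_nonneg ‖a‖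
      linarith
    have hi := integral_mono (μ := μ) (integrable_sphere (continuous_pk ha)) (integrable_const 4) hp
    rw [integral_const, probReal_univ, one_smul] at hi
    have : 0 ≤ 4 * (2 * B + 4 * K) / c := by positivity
    exact le_trans hi (by linarith)
  · push Not at hs
    have ha0 : a ≠ 0 := by rw [← norm_pos_iff]; linarith
    have hω1 : ‖a / (‖a‖ : ℂ)‖ = 1 := (norm_sub_radial_le ha1.le ha0 norm_one).1
    set ω := a / (‖a‖ : ℂ) with hω
    have hqf := hφ.mem_frontier hω1
    have hu : DiffContOnCl ℂ (fun x => U (φ ω) (φ x - φ a)) 𝔻 :=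
      hU.diffContOnCl_comp hqf (hφ.dcc.sub diffContOnCl_const)
    have hi := Dual.integral_pk_of_zero_at hφ hμ ha ha0 hu (by simp [hU.zero hqf])
    have hcont := (continuous_ofReal.comp (continuous_pk ha)).mul
      (Dual.continuous_apply hφ hu)
    have hre1 := re_dual_integral (integrable_sphere (μ := μ) hcont)
    have hlow : D.r (φ a) / 2 * dualM μ a - 4 * K * D.sz φ ^ 2 * (1 - ‖a‖ ^ 2) ≤
        ∫ ζ : sphere (0:ℂ) 1, pk a ζ * (D.L (φ ζ) (U (φ ω) (φ ζ - φ a))).re ∂μ := by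
      have hpt : ∀ ζ : sphere (0:ℂ) 1, D.r (φ a) / 2 * pk a ζ -
          4 * K * D.sz φ ^ 2 * (1 - ‖a‖ ^ 2) ≤
          pk a ζ * (D.L (φ ζ) (U (φ ω) (φ ζ - φ a))).re := by
        intro ζ
        have hζ : ‖(ζ:ℂ)‖ = 1 := mem_sphere_zero_iff_norm.mp ζ.2
        have hp := pk_pos ha hζ
        have e1 := hre φ hφ a hac ω ζ hω1 hζ (norm_sub_radial_le ha1.le ha0 hζ).2
        have e2 := mul_le_mul_of_nonneg_left e1 hp.le
        have e3 : pk a ζ * ‖(ζ:ℂ) - a‖ ^ 4 ≤ 4 * (1 - ‖a‖ ^ 2) := by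
          have e4 : pk a ζ * ‖(ζ:ℂ) - a‖ ^ 4 = (1 - ‖a‖ ^ 2) * ‖(ζ:ℂ) - a‖ ^ 2 := by
            rw [← pk_mul_norm_sq ha hζ]; ring
          have e5 : ‖(ζ:ℂ) - a‖ ^ 2 ≤ 2 ^ 2 :=
            pow_le_pow_left₀ (norm_nonneg _) (by linarith [norm_sub_le (ζ:ℂ) a]) 2
          have e6 := mul_le_mul_of_nonneg_left e5 hκ.le
          linarith
        have e7 := mul_le_mul_of_nonneg_left e3 (show 0 ≤ K * D.sz φ ^ 2 by positivity)
        linarith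
      have hint := integral_mono (μ := μ) (((integrable_sphere (continuous_pk ha)).const_mul
        (D.r (φ a) / 2)).sub (integrable_const _)) (integrable_sphere
        ((continuous_pk ha).mul (continuous_re.comp (Dual.continuous_apply hφ hu)))) hpt
      have e8 : ∫ ζ : sphere (0:ℂ) 1, (D.r (φ a) / 2 * pk a ζ -
          4 * K * D.sz φ ^ 2 * (1 - ‖a‖ ^ 2)) ∂μ = D.r (φ a) / 2 * dualM μ a -
          4 * K * D.sz φ ^ 2 * (1 - ‖a‖ ^ 2) := by
        rw [integral_sub ((integrable_sphere (continuous_pk ha)).const_mul _) (integrable_const _),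
          integral_const_mul, integral_const, probReal_univ, one_smul]
        rfl
      exact e8.symm.le.trans hint
    have hup : ‖dualH D φ μ 0 (U (φ ω) (φ 0 - φ a))‖ ≤ B * D.sz φ ^ 2 := by
      have e1 := Dual.norm_h_apply_le hφ hμ h0 (y := U (φ ω) (φ 0 - φ a)) (B := B * D.sz φ ^ 2) ?_
      · rwa [Dual.m_zero hμ, mul_one] at e1
      · intro ζ hζ
        have hζc := mem_closedBall_of_norm_eq hζ
        refine (hU.norm_le hqf (D.L (φ ζ)) (φ 0 - φ a)).trans ?_
        have e2 := h2 φ hφ ζ hζc 0 (ball_subset_closedBall h0) a hac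
        have e3 := pow_le_pow_left₀ (norm_nonneg _)
          (h1 φ hφ 0 (ball_subset_closedBall h0) a hac) 2
        have e4 := mul_le_mul (D.norm_L _ (hφ.memc hζc)) (mul_le_mul_of_nonneg_left e3 hC.le)
          (by positivity) hM.le
        rw [hB]
        linarith
    rw [← hre1, hi] at hlow
    have hup2 := (re_le_norm (((1 - ‖a‖ ^ 2 : ℝ) : ℂ) * (-a)⁻¹ *
      dualH D φ μ 0 (U (φ ω) (φ 0 - φ a))))
    rw [norm_mul, norm_mul, norm_real, norm_of_nonneg hκ.le, norm_inv, norm_neg] at hup2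
    have hinv : ‖a‖⁻¹ ≤ 2 := by rw [inv_le_comm₀ (by linarith) two_pos]; linarith
    have h5 : (1 - ‖a‖ ^ 2) * ‖a‖⁻¹ * ‖dualH D φ μ 0 (U (φ ω) (φ 0 - φ a))‖ ≤
        (1 - ‖a‖ ^ 2) * 2 * (B * D.sz φ ^ 2) := by gcongr
    have h6 : D.r (φ a) / 2 * dualM μ a ≤ (2 * B + 4 * K) * D.sz φ ^ 2 * (1 - ‖a‖ ^ 2) := by
      linarith
    have h7 := one_sub_sq_le ha
    have h8 := mul_le_mul_of_nonneg_right (hh φ hφ.cen a ha) (Dual.m_nonneg (μ := μ) ha)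
    have h9 := mul_le_mul_of_nonneg_left h7
      (show 0 ≤ (2 * B + 4 * K) * D.sz φ ^ 2 by positivity)
    have h10 : (D.sz φ ^ 2 * (1 - ‖a‖)) * (c * dualM μ a) ≤
        (D.sz φ ^ 2 * (1 - ‖a‖)) * (4 * (2 * B + 4 * K)) := by linarith
    have h11 := le_of_mul_le_mul_left h10 (mul_pos (by positivity) (by linarith))
    have h12 : dualM μ a ≤ 4 * (2 * B + 4 * K) / c := by rw [le_div_iff₀ hc]; linarith
    linarith

theorem exists_const_ge : ∃ c > 0, ∀ φ, D.Reg φ → ∀ μ, D.Dual φ μ → ∀ c₀ : ℝ,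
    (∀ a ∈ 𝔻, dualH D φ μ a (deriv φ a) = c₀) → c * D.sz φ ^ 2 ≤ c₀ := by
  obtain ⟨U, C, ε, hC, hε, hU⟩ := D.exists_peakMap
  obtain ⟨K, hK, hre⟩ := hU.exists_re_ge hC hε
  obtain ⟨c, hc, hh⟩ := D.exists_hopf
  set t := min (1 / 2) (c / (16 * K)) with ht
  have ht0 : 0 < t := by positivity
  have ht1 : t ≤ 1 / 2 := min_le_left _ _
  have ht2 : 16 * K * t ≤ c := by
    have : t ≤ c / (16 * K) := min_le_right _ _
    rw [le_div_iff₀ (by positivity)] at this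
    linarith
  refine ⟨t * c / 4, by positivity, fun φ hφ μ hμ c₀ hc₀ => ?_⟩
  have hsz := hφ.cen.sz_pos
  have := hμ.prob
  obtain ⟨a, has, ham⟩ : ∃ a : ℂ, ‖a‖ = 1 - t ∧ 1 ≤ dualM μ a := by
    by_contra hcon
    push Not at hcon
    obtain ⟨f, hf, hfm⟩ := Dual.exists_m_eq_re hμ
    have hsb : closedBall (0:ℂ) (1 - t) ⊆ 𝔻 := closedBall_subset_ball (by linarith)
    have hcp : IsCompact (sphere (0:ℂ) (1 - t)) := isCompact_sphere _ _
    have hne : (sphere (0:ℂ) (1 - t)).Nonempty := NormedSpace.sphere_nonempty.mpr (by linarith)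
    obtain ⟨b, hb, hbmax⟩ := hcp.exists_isMaxOn hne (f := fun a => (f a).re)
      (continuous_re.comp_continuousOn ((hf.mono hsb).continuousOn.mono
        sphere_subset_closedBall))
    have h1 := re_ge_of_sphere (f := fun a => -f a) (m := -(f b).re) (a := 0) (s := 1 - t)
      (by linarith) (hf.mono hsb).neg (fun ζ hζ => by
        rw [neg_re, neg_le_neg_iff]
        exact hbmax (mem_sphere_zero_iff_norm.mpr hζ)) (by rw [norm_zero]; linarith)
    have h2 := hcon b (mem_sphere_zero_iff_norm.mp hb)
    rw [hfm b (hsb (sphere_subset_closedBall hb))] at h2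
    have h3 := Dual.m_zero hμ
    rw [hfm 0 (mem_ball_self one_pos)] at h3
    rw [neg_re] at h1
    linarith
  have ha : a ∈ 𝔻 := by rw [mem_ball_zero_iff]; linarith
  have ha1 := norm_lt_one_of_mem_ball ha
  have ha0 : a ≠ 0 := by rw [← norm_pos_iff]; linarith
  have hκ := one_sub_norm_sq_pos ha
  have hω1 : ‖a / (‖a‖ : ℂ)‖ = 1 := (norm_sub_radial_le ha1.le ha0 norm_one).1
  set ω := a / (‖a‖ : ℂ) with hω
  have hqf := hφ.mem_frontier hω1
  have hu : DiffContOnCl ℂ (fun x => U (φ ω) (φ x - φ a)) 𝔻 :=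
    hU.diffContOnCl_comp hqf (hφ.dcc.sub diffContOnCl_const)
  have hi := Dual.integral_pk_sq hφ hμ ha hu (by simp [hU.zero hqf])
  have hder : deriv (fun x => U (φ ω) (φ x - φ a)) a = deriv φ a :=
    (hU.hasDerivAt_comp hqf ((hφ.cen.diff.differentiableAt
      (isOpen_ball.mem_nhds ha)).hasDerivAt.sub_const (φ a)) (sub_self _)).deriv
  rw [hder, hc₀ a ha] at hi
  have hpc : Continuous fun ζ : sphere (0:ℂ) 1 => pk a ζ ^ 2 := (continuous_pk ha).pow 2
  have hre1 := re_dual_integral (integrable_sphere (μ := μ) ((continuous_ofReal.comp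
    hpc).mul (Dual.continuous_apply hφ hu)))
  rw [hi, ofReal_re] at hre1
  have hrp : 0 < D.r (φ a) := D.r_pos (hφ.cen.mem ha)
  have hpt : ∀ ζ : sphere (0:ℂ) 1, D.r (φ a) / 2 * (2 * pk a ζ - 1) -
      K * D.sz φ ^ 2 * (1 - ‖a‖ ^ 2) ^ 2 ≤
      pk a ζ ^ 2 * (D.L (φ ζ) (U (φ ω) (φ ζ - φ a))).re := by
    intro ζ
    have hζ : ‖(ζ:ℂ)‖ = 1 := mem_sphere_zero_iff_norm.mp ζ.2
    have e1 := hre φ hφ a (ball_subset_closedBall ha) ω ζ hω1 hζ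
      (norm_sub_radial_le ha1.le ha0 hζ).2
    have e2 := mul_le_mul_of_nonneg_left e1 (sq_nonneg (pk a ζ))
    have e3 : pk a ζ ^ 2 * ‖(ζ:ℂ) - a‖ ^ 4 = (1 - ‖a‖ ^ 2) ^ 2 := by
      rw [← pk_mul_norm_sq ha hζ]; ring
    have e4 : D.r (φ a) / 2 * (2 * pk a ζ - 1) ≤ D.r (φ a) / 2 * pk a ζ ^ 2 :=
      mul_le_mul_of_nonneg_left (by linarith [sq_nonneg (pk a ζ - 1)]) (by positivity)
    have e5 : pk a ζ ^ 2 * (D.r (φ a) / 2 - K * D.sz φ ^ 2 * ‖(ζ:ℂ) - a‖ ^ 4) =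
        D.r (φ a) / 2 * pk a ζ ^ 2 - K * D.sz φ ^ 2 * (pk a ζ ^ 2 * ‖(ζ:ℂ) - a‖ ^ 4) := by ring
    rw [e5, e3] at e2
    linarith
  have hip : Integrable (fun ζ : sphere (0:ℂ) 1 => pk a ζ) μ := integrable_sphere (continuous_pk ha)
  have hip2 : Integrable (fun ζ : sphere (0:ℂ) 1 => 2 * pk a ζ - 1) μ :=
    (hip.const_mul 2).sub (integrable_const 1)
  have hint := integral_mono (μ := μ) ((hip2.const_mul
    (D.r (φ a) / 2)).sub (integrable_const _)) (integrable_sphere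
    (hpc.mul (continuous_re.comp (Dual.continuous_apply hφ hu)))) hpt
  have e6 : ∫ ζ : sphere (0:ℂ) 1, (D.r (φ a) / 2 * (2 * pk a ζ - 1) -
      K * D.sz φ ^ 2 * (1 - ‖a‖ ^ 2) ^ 2) ∂μ = D.r (φ a) / 2 * (2 * dualM μ a - 1) -
      K * D.sz φ ^ 2 * (1 - ‖a‖ ^ 2) ^ 2 := by
    rw [integral_sub (hip2.const_mul _)
      (integrable_const _), integral_const_mul, integral_sub (hip.const_mul 2) (integrable_const 1),
      integral_const_mul, integral_const, integral_const, probReal_univ, one_smul, one_smul]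
    rfl
  have hint2 := (e6.symm.le.trans hint).trans hre1.ge
  have e7 := hh φ hφ.cen a ha
  rw [has] at e7
  have e8 : D.r (φ a) / 2 * 1 ≤ D.r (φ a) / 2 * (2 * dualM μ a - 1) :=
    mul_le_mul_of_nonneg_left (by linarith) (by positivity)
  have e9 : (1 - ‖a‖ ^ 2) ^ 2 ≤ (2 * t) ^ 2 := by
    refine pow_le_pow_left₀ hκ.le ?_ 2
    have := one_sub_sq_le ha
    rw [has] at this ⊢
    linarith
  have e10 := mul_le_mul_of_nonneg_left e9 (show 0 ≤ K * D.sz φ ^ 2 by positivity)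
  have e11 := mul_le_mul_of_nonneg_left ht2 (show 0 ≤ D.sz φ ^ 2 * t / 4 by positivity)
  linarith

theorem exists_m_ge : ∃ c > 0, ∀ φ, D.Reg φ → ∀ μ, D.Dual φ μ →
    ∀ a ∈ 𝔻, c ≤ dualM μ a := by
  obtain ⟨c, hc, hcc⟩ := D.exists_const_ge
  obtain ⟨C1, hC1, h1⟩ := D.exists_reg_holder
  obtain ⟨C2, hC2, h2⟩ := D.exists_basic
  have hM := D.M_pos
  set B := C2 + D.M * C1 ^ 2 with hB
  have hBp : 0 < B := by positivity
  refine ⟨c / (2 * B), by positivity, fun φ hφ μ hμ a ha => ?_⟩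
  have hsz := hφ.cen.sz_pos
  have := hμ.prob
  have hac := ball_subset_closedBall ha
  obtain ⟨c₀, hc₀⟩ := Dual.exists_const hφ hμ
  have hc₁ := hcc φ hφ μ hμ c₀ hc₀
  have hu : DiffContOnCl ℂ (fun x => φ x - φ a) 𝔻 := hφ.dcc.sub diffContOnCl_const
  have hi := Dual.integral_pk_sq hφ hμ ha hu (sub_self _)
  have hder : deriv (fun x => φ x - φ a) a = deriv φ a := deriv_sub_const _
  rw [hder, hc₀ a ha] at hi
  have hpc : Continuous fun ζ : sphere (0:ℂ) 1 => pk a ζ ^ 2 := (continuous_pk ha).pow 2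
  have hre1 := re_dual_integral (integrable_sphere (μ := μ) ((continuous_ofReal.comp
    hpc).mul (Dual.continuous_apply hφ hu)))
  rw [hi, ofReal_re] at hre1
  have hpt : ∀ ζ : sphere (0:ℂ) 1, pk a ζ ^ 2 * (D.L (φ ζ) (φ ζ - φ a)).re ≤
      2 * B * D.sz φ ^ 2 * pk a ζ := by
    intro ζ
    have hζ : ‖(ζ:ℂ)‖ = 1 := mem_sphere_zero_iff_norm.mp ζ.2
    have hζc := mem_closedBall_of_norm_eq hζ
    have hp := pk_pos ha hζ
    have e1 := (_root_.abs_le.mp (D.d1 _ (hφ.memc hζc) _ (hφ.memc hac))).2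
    rw [← neg_sub (φ ζ) (φ a), map_neg, norm_neg, neg_re] at e1
    have e2 : D.r (φ ζ) = 0 := D.r_frontier (hφ.mem_frontier hζ)
    have e3 : D.r (φ ζ) = -D.ρ (φ ζ) := rfl
    have e4 : D.r (φ a) = -D.ρ (φ a) := rfl
    have e5 : ‖φ ζ - φ a‖ ^ 2 ≤ C1 ^ 2 * D.sz φ ^ 2 * ‖(ζ:ℂ) - a‖ := by
      refine (pow_le_pow_left₀ (norm_nonneg _) (h1 φ hφ ζ hζc a hac) 2).trans (le_of_eq ?_)
      rw [mul_pow, ← sqrt_eq_rpow, sq_sqrt (norm_nonneg _), mul_pow]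
    have e6 : D.r (φ a) ≤ C2 * D.sz φ ^ 2 * ‖(ζ:ℂ) - a‖ := by
      refine (h2 φ hφ.cen a ha).1.trans (mul_le_mul_of_nonneg_left ?_ (by positivity))
      have := norm_sub_norm_le (ζ:ℂ) a
      rwa [hζ] at this
    have e7 := mul_le_mul_of_nonneg_left e5 hM.le
    have e8 : (D.L (φ ζ) (φ ζ - φ a)).re ≤ B * D.sz φ ^ 2 * ‖(ζ:ℂ) - a‖ := by
      rw [hB]; linarith
    have e9 := mul_le_mul_of_nonneg_left e8 (sq_nonneg (pk a ζ))
    have e10 := mul_le_mul_of_nonneg_left (norm_sub_mul_pk_le ha hζ)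
      (show 0 ≤ pk a ζ * (B * D.sz φ ^ 2) by positivity)
    linarith
  have hint := integral_mono (μ := μ) (integrable_sphere
    (hpc.mul (continuous_re.comp (Dual.continuous_apply hφ hu))))
    ((integrable_sphere (continuous_pk ha)).const_mul _) hpt
  rw [integral_const_mul] at hint
  have e1 : D.sz φ ^ 2 * c ≤ D.sz φ ^ 2 * (dualM μ a * (2 * B)) := by
    have := hc₁.trans (hre1.le.trans hint)
    rw [← dualM] at this
    linarith
  rw [div_le_iff₀ (by positivity)]
  exact le_of_mul_le_mul_left e1 (by positivity)

/-- Bounds for the dual map of a centered geodesic. -/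
theorem exists_dual_bounds : ∃ C > 0, ∃ c > 0, ∀ φ, D.Reg φ → ∀ μ, D.Dual φ μ →
    ∀ a ∈ 𝔻, dualM μ a ≤ C ∧ c ≤ dualM μ a ∧ ‖dualH D φ μ a‖ ≤ C ∧
      ‖dualH D φ μ a - (a * (dualM μ a : ℂ)) • D.L (φ a)‖ ≤ C * (1 - ‖a‖) ^ (1 / 4 : ℝ) ∧
      ∀ ω : ℂ, ‖ω‖ = 1 → ∀ y, D.L (φ ω) y = 0 → ‖dualH D φ μ a y‖ ≤ C * D.sz φ * ‖y‖ := by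
  obtain ⟨C0, hC0, hm⟩ := D.exists_m_le
  obtain ⟨c, hc, hmc⟩ := D.exists_m_ge
  obtain ⟨C1, hC1, h1⟩ := D.exists_reg_holder
  obtain ⟨C2, hC2, h2⟩ := D.exists_norm_sub_le
  have hM := D.M_pos
  set B := 2 * D.M + D.M * (C1 * D.M) with hB
  refine ⟨C0 + D.M * C0 + B * 2 * (1 + C0) + D.M * C2 * C0, by positivity, c, hc,
    fun φ hφ μ hμ a ha => ?_⟩
  have hsz := hφ.cen.sz_pos
  have := hμ.prob
  have hac := ball_subset_closedBall ha
  have ha1 := norm_lt_one_of_mem_ball ha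
  have hma := hm φ hφ μ hμ a ha
  have hκ := one_sub_norm_sq_pos ha
  have t1 : 0 ≤ D.M * C0 := by positivity
  have t2 : 0 ≤ B * 2 * (1 + C0) := by positivity
  have t3 : 0 ≤ D.M * C2 * C0 := by positivity
  refine ⟨by linarith, hmc φ hφ μ hμ a ha, ?_, ?_, ?_⟩
  · refine opNorm_le_bound _ (by positivity) fun y => ?_
    refine (Dual.norm_h_apply_le hφ hμ ha (B := D.M * ‖y‖) fun ζ hζ => ?_).trans ?_
    · exact (le_opNorm _ _).trans (mul_le_mul_of_nonneg_right
        (D.norm_L _ (hφ.memc (mem_closedBall_of_norm_eq hζ))) (norm_nonneg _))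
    · calc D.M * ‖y‖ * dualM μ a ≤ D.M * ‖y‖ * C0 := by gcongr
        _ = (D.M * C0) * ‖y‖ := by ring
        _ ≤ _ := mul_le_mul_of_nonneg_right (by linarith) (norm_nonneg _)
  · have hup : 0 ≤ (1 - ‖a‖) ^ (1 / 4 : ℝ) := Real.rpow_nonneg (by linarith) _
    refine opNorm_le_bound _ (by positivity) fun y => ?_
    have hi := Dual.integral_mul_pk hφ hμ ha (g := fun _ => y) diffContOnCl_const
    have hcy : Continuous fun ζ : sphere (0:ℂ) 1 => (pk a ζ : ℂ) * ((ζ:ℂ) * D.L (φ ζ) y) :=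
      (continuous_ofReal.comp (continuous_pk ha)).mul
        (continuous_subtype_val.mul (Dual.continuous_apply hφ (u := fun _ => y) diffContOnCl_const))
    have hcp : Continuous fun ζ : sphere (0:ℂ) 1 => (pk a ζ : ℂ) :=
      continuous_ofReal.comp (continuous_pk ha)
    have e1 : (dualH D φ μ a - (a * (dualM μ a : ℂ)) • D.L (φ a)) y =
        ∫ ζ : sphere (0:ℂ) 1, ((pk a ζ : ℂ) * ((ζ:ℂ) * D.L (φ ζ) y) -
          (pk a ζ : ℂ) * (a * D.L (φ a) y)) ∂μ := by
      have e0 : ∫ ζ : sphere (0:ℂ) 1, (pk a ζ : ℂ) ∂μ = (dualM μ a : ℂ) := integral_ofReal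
      rw [integral_sub (integrable_sphere hcy) ((integrable_sphere hcp).mul_const _), hi,
        integral_mul_const, e0, sub_apply, smul_apply, smul_eq_mul]
      ring
    rw [e1]
    have hpt : ∀ ζ : sphere (0:ℂ) 1, ‖(pk a ζ : ℂ) * ((ζ:ℂ) * D.L (φ ζ) y) -
        (pk a ζ : ℂ) * (a * D.L (φ a) y)‖ ≤
        B * ‖y‖ * (2 * (1 - ‖a‖) ^ (1 / 4 : ℝ)) * (1 + pk a ζ) := by
      intro ζ
      have hζ : ‖(ζ:ℂ)‖ = 1 := mem_sphere_zero_iff_norm.mp ζ.2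
      have hζc := mem_closedBall_of_norm_eq hζ
      have hp := pk_pos ha hζ
      have e2 : (pk a ζ : ℂ) * ((ζ:ℂ) * D.L (φ ζ) y) - (pk a ζ : ℂ) * (a * D.L (φ a) y) =
          (pk a ζ : ℂ) * (((ζ:ℂ) - a) * D.L (φ ζ) y + a * ((D.L (φ ζ) - D.L (φ a)) y)) := by
        rw [sub_apply]; ring
      rw [e2, norm_mul, norm_real, norm_of_nonneg hp.le]
      set d := ‖(ζ:ℂ) - a‖ with hd
      have hd2 : d ≤ 2 := by linarith [norm_sub_le (ζ:ℂ) a]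
      have hd0 : 0 ≤ d := norm_nonneg _
      have e3 : d ≤ 2 * d ^ (1 / 2 : ℝ) := by
        rw [← sqrt_eq_rpow]
        have h4 : √d ≤ 2 := by rw [Real.sqrt_le_left two_pos.le]; linarith
        have h5 := mul_le_mul_of_nonneg_right h4 (sqrt_nonneg d)
        rwa [Real.mul_self_sqrt hd0] at h5
      have e4 : ‖((ζ:ℂ) - a) * D.L (φ ζ) y + a * ((D.L (φ ζ) - D.L (φ a)) y)‖ ≤
          B * ‖y‖ * d ^ (1 / 2 : ℝ) := by
        have h6 : ‖((ζ:ℂ) - a) * D.L (φ ζ) y‖ ≤ (2 * d ^ (1 / 2 : ℝ)) * (D.M * ‖y‖) := by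
          rw [norm_mul]
          refine mul_le_mul e3 ?_ (norm_nonneg _) (by positivity)
          exact (le_opNorm _ _).trans (mul_le_mul_of_nonneg_right
            (D.norm_L _ (hφ.memc hζc)) (norm_nonneg _))
        have h7 : ‖a * ((D.L (φ ζ) - D.L (φ a)) y)‖ ≤
            1 * (D.M * (C1 * D.M * d ^ (1 / 2 : ℝ)) * ‖y‖) := by
          rw [norm_mul]
          refine mul_le_mul ha1.le ?_ (norm_nonneg _) zero_le_one
          refine (le_opNorm _ _).trans (mul_le_mul_of_nonneg_right ?_
            (norm_nonneg _))
          refine (D.d2 _ (hφ.memc hac) _ (hφ.memc hζc)).trans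
            (mul_le_mul_of_nonneg_left ?_ hM.le)
          refine (h1 φ hφ ζ hζc a hac).trans ?_
          have := hφ.cen.sz_le
          gcongr
        refine (norm_add_le _ _).trans ((add_le_add h6 h7).trans (le_of_eq ?_))
        rw [hB]; ring
      have e5 := mul_le_mul_of_nonneg_left e4 hp.le
      have e6 := rpow_half_mul_le hd0 hp.le hκ.le (pk_mul_norm_sq ha hζ)
      have e7 : (1 - ‖a‖ ^ 2) ^ (1 / 4 : ℝ) ≤ 2 * (1 - ‖a‖) ^ (1 / 4 : ℝ) := by
        refine (rpow_le_rpow hκ.le (one_sub_sq_le ha) (by norm_num)).trans ?_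
        rw [mul_rpow two_pos.le (by linarith)]
        refine mul_le_mul_of_nonneg_right ?_ hup
        calc (2:ℝ) ^ (1 / 4 : ℝ) ≤ 2 ^ (1:ℝ) :=
              rpow_le_rpow_of_exponent_le one_le_two (by norm_num)
          _ = 2 := rpow_one 2
      have e8 := mul_le_mul_of_nonneg_right e7 (show 0 ≤ 1 + pk a ζ by positivity)
      have e9 := mul_le_mul_of_nonneg_left (e6.trans e8) (show 0 ≤ B * ‖y‖ by positivity)
      linarith
    refine (norm_integral_le_of_norm_le (((integrable_const 1).add
      (integrable_sphere (continuous_pk ha))).const_mul _) (Eventually.of_forall hpt)).trans ?_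
    simp only [Pi.add_apply]
    rw [integral_const_mul, integral_add (integrable_const _)
      (integrable_sphere (continuous_pk ha)), integral_const, probReal_univ, one_smul, ← dualM]
    have e3 : B * ‖y‖ * (2 * (1 - ‖a‖) ^ (1 / 4 : ℝ)) * (1 + dualM μ a) ≤
        B * ‖y‖ * (2 * (1 - ‖a‖) ^ (1 / 4 : ℝ)) * (1 + C0) := by gcongr
    have e4 : 0 ≤ (C0 + D.M * C0 + D.M * C2 * C0) * ((1 - ‖a‖) ^ (1 / 4 : ℝ) * ‖y‖) := by positivity
    linarith
  · intro ω hω y hy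
    have hωc := mem_closedBall_of_norm_eq hω
    refine (Dual.norm_h_apply_le hφ hμ ha (B := D.M * (C2 * D.sz φ) * ‖y‖) fun ζ hζ => ?_).trans ?_
    · have hζc := mem_closedBall_of_norm_eq hζ
      have e1 : D.L (φ ζ) y = (D.L (φ ζ) - D.L (φ ω)) y := by rw [sub_apply, hy, sub_zero]
      rw [e1]
      refine (le_opNorm _ _).trans (mul_le_mul_of_nonneg_right ?_
        (norm_nonneg _))
      exact (D.d2 _ (hφ.memc hωc) _ (hφ.memc hζc)).trans
        (mul_le_mul_of_nonneg_left (h2 φ hφ ζ hζc ω hωc) hM.le)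
    · have e2 : D.M * (C2 * D.sz φ) * ‖y‖ * dualM μ a ≤ D.M * (C2 * D.sz φ) * ‖y‖ * C0 := by gcongr
      have e3 : 0 ≤ (C0 + D.M * C0 + B * 2 * (1 + C0)) * (D.sz φ * ‖y‖) := by positivity
      linarith

/-- The conjugate of the second derivative, with its second argument frozen. -/
def conjEll (z y : E N) : E N →L[ℝ] ℂ :=
  LinearMap.mkContinuous
    { toFun := fun x => conj (D.ell z x y)
      map_add' := fun x x' => by simp [map_add]
      map_smul' := fun c x => by simp [map_smul] }
    (‖D.ell z‖ * ‖y‖) (fun x => by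
      simp only [LinearMap.coe_mk, AddHom.coe_mk, RCLike.norm_conj]
      refine ((D.ell z x).le_opNorm y).trans ?_
      have := mul_le_mul_of_nonneg_right ((D.ell z).le_opNorm x) (norm_nonneg y)
      linarith)

theorem conjEll_apply (z y x : E N) : D.conjEll z y x = conj (D.ell z x y) := rfl

/-- The conjugate of the antilinear part of the second derivative. -/
def anti (z y : E N) : E N →L[ℂ] ℂ := lin (D.conjEll z y)

theorem ell_eq (z y x : E N) :
    D.ell z x y = lin (D.ell z) x y + conj (D.anti z y x) := by
  have h : lin (D.ell z) x y = (2:ℂ)⁻¹ * (D.ell z x y - I * D.ell z (I • x) y) := by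
    rw [lin_apply]; rfl
  rw [h, anti, lin_apply, conjEll_apply, conjEll_apply]
  simp only [smul_eq_mul, map_mul, map_sub, conj_conj, Complex.conj_I, map_inv₀,
    Complex.conj_ofNat]
  ring

theorem re_anti_self (z x : E N) : (D.anti z x x).re = D.herml z x := by
  have h1 := D.re_lin_ell z x
  rw [D.ell_eq z x x, add_re, Complex.conj_re] at h1
  linarith

theorem norm_anti_le {z : E N} (hz : z ∈ closure Ω) (y : E N) : ‖D.anti z y‖ ≤ D.M * ‖y‖ :=
  (norm_lin_le _).trans ((LinearMap.mkContinuous_norm_le _ (by positivity) _).trans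
    (mul_le_mul_of_nonneg_right (D.norm_ell z hz) (norm_nonneg _)))

theorem norm_anti_apply_le {z : E N} (hz : z ∈ closure Ω) (y x : E N) :
    ‖D.anti z y x‖ ≤ D.M * ‖y‖ * ‖x‖ :=
  ((D.anti z y).le_opNorm x).trans
    (mul_le_mul_of_nonneg_right (D.norm_anti_le hz y) (norm_nonneg _))

theorem norm_lin_ell_apply_le {z : E N} (hz : z ∈ closure Ω) (y x : E N) :
    ‖lin (D.ell z) x y‖ ≤ D.M * ‖x‖ * ‖y‖ := by
  refine (le_opNorm _ y).trans (mul_le_mul_of_nonneg_right ?_ (norm_nonneg _))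
  exact ((lin (D.ell z)).le_opNorm x).trans (mul_le_mul_of_nonneg_right
    ((norm_lin_le _).trans (D.norm_ell z hz)) (norm_nonneg _))

theorem norm_anti_sub_apply_le {z w : E N} (hz : z ∈ closure Ω) (hw : w ∈ closure Ω) (y x : E N) :
    ‖D.anti w y x - D.anti z y x‖ ≤ D.M * ‖w - z‖ ^ α * ‖y‖ * ‖x‖ := by
  have h0 : ∀ x, ‖(D.conjEll w y - D.conjEll z y) x‖ ≤ D.M * ‖w - z‖ ^ α * ‖y‖ * ‖x‖ := by
    intro x
    have h1 : (D.conjEll w y - D.conjEll z y) x = conj ((D.ell w - D.ell z) x y) := by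
      simp [conjEll_apply, sub_apply]
    rw [h1, RCLike.norm_conj]
    refine (((D.ell w - D.ell z) x).le_opNorm y).trans ?_
    have h2 := ((D.ell w - D.ell z).le_opNorm x).trans
      (mul_le_mul_of_nonneg_right (D.d4 z hz w hw) (norm_nonneg x))
    calc _ ≤ D.M * ‖w - z‖ ^ α * ‖x‖ * ‖y‖ := mul_le_mul_of_nonneg_right h2 (norm_nonneg y)
      _ = _ := by ring
  have hM := D.M_pos
  have h3 : D.anti w y x - D.anti z y x = lin (D.conjEll w y - D.conjEll z y) x := by
    rw [← lin_sub, sub_apply]; rfl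
  rw [h3]
  refine ((lin _).le_opNorm x).trans (mul_le_mul_of_nonneg_right ?_ (norm_nonneg _))
  refine (norm_lin_le _).trans (opNorm_le_bound _ (by positivity) h0)

theorem exists_quotient_expansion {B : ℝ} (hB : 0 < B) : ∃ C > 0, ∃ ε > 0, ∀ q ∈ closure Ω,
    ∀ e : E N, D.L q e = 1 → ‖e‖ ≤ B → ∀ w ∈ closure Ω, ‖w - q‖ ≤ ε →
      1 / 2 ≤ ‖D.L w e‖ ∧ ∀ y, D.L q y = 0 →
        ‖D.L w y / D.L w e - D.ell q (w - q) y‖ ≤ C * ‖w - q‖ ^ (1 + α) * ‖y‖ := by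
  have hM := D.M_pos
  have hα := D.α_pos
  refine ⟨2 * (D.M + D.M * (D.M * B)), by positivity, min 1 (1 / (2 * (D.M * B))),
    by positivity, fun q hq e he heB w hw hx => ?_⟩
  have hx1 : ‖w - q‖ ≤ 1 := hx.trans (min_le_left _ _)
  have hx2 : D.M * B * ‖w - q‖ ≤ 1 / 2 := by
    have := hx.trans (min_le_right _ _)
    rw [le_div_iff₀ (by positivity)] at this
    linarith
  have h1 : ‖1 - D.L w e‖ ≤ D.M * B * ‖w - q‖ := by
    have : 1 - D.L w e = -((D.L w - D.L q) e) := by rw [sub_apply, he]; ring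
    rw [this, norm_neg]
    refine (le_opNorm _ _).trans ?_
    calc _ ≤ (D.M * ‖w - q‖) * B :=
          mul_le_mul (D.d2 q hq w hw) heB (norm_nonneg _) (by positivity)
      _ = _ := by ring
  have h2 : 1 / 2 ≤ ‖D.L w e‖ := by
    have := norm_sub_norm_le (1:ℂ) (D.L w e)
    rw [norm_one] at this
    linarith
  refine ⟨h2, fun y hy => ?_⟩
  have h3 : D.L w e ≠ 0 := norm_pos_iff.mp (by linarith)
  have h4 : D.L w y / D.L w e - D.ell q (w - q) y =
      ((D.L w - D.L q - D.ell q (w - q)) y + D.ell q (w - q) y * (1 - D.L w e)) / D.L w e := by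
    rw [sub_apply, sub_apply, hy]
    field_simp
    ring
  rw [h4, norm_div, div_le_iff₀ (by linarith)]
  have h5 : ‖w - q‖ ^ 2 ≤ ‖w - q‖ ^ (1 + α) := by
    rcases (norm_nonneg (w - q)).eq_or_lt with h0 | h0
    · rw [← h0, zero_rpow (by linarith)]; norm_num
    · rw [← rpow_natCast]
      exact rpow_le_of_le_one h0 hx1 (by have := D.α_le; norm_num; linarith)
  have h6 : ‖(D.L w - D.L q - D.ell q (w - q)) y‖ ≤ D.M * ‖w - q‖ ^ (1 + α) * ‖y‖ :=
    (le_opNorm _ _).trans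
      (mul_le_mul_of_nonneg_right (D.d3 q hq w hw) (norm_nonneg _))
  have h7 : ‖D.ell q (w - q) y‖ ≤ D.M * ‖w - q‖ * ‖y‖ :=
    (le_opNorm _ _).trans (mul_le_mul_of_nonneg_right
      (((D.ell q).le_opNorm _).trans (mul_le_mul_of_nonneg_right (D.norm_ell q hq) (norm_nonneg _)))
      (norm_nonneg _))
  have h8 : ‖D.ell q (w - q) y * (1 - D.L w e)‖ ≤
      D.M * (D.M * B) * ‖y‖ * ‖w - q‖ ^ 2 := by
    rw [norm_mul]
    calc _ ≤ (D.M * ‖w - q‖ * ‖y‖) * (D.M * B * ‖w - q‖) :=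
          mul_le_mul h7 h1 (norm_nonneg _) (by positivity)
      _ = _ := by ring
  have h9 := mul_le_mul_of_nonneg_left h5 (show 0 ≤ D.M * (D.M * B) * ‖y‖ by positivity)
  have h10 := mul_le_mul_of_nonneg_left h2 (show 0 ≤ 2 * (D.M + D.M * (D.M * B)) *
    ‖w - q‖ ^ (1 + α) * ‖y‖ by positivity)
  refine (norm_add_le _ _).trans ?_
  linarith

end Dom

theorem exists_mul_rpow_quarter_le {A ε : ℝ} (hA : 0 ≤ A) (hε : 0 < ε) :
    ∃ s < (1:ℝ), ∀ u, s ≤ u → u ≤ 1 → A * (1 - u) ^ (1 / 4 : ℝ) ≤ ε := by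
  refine ⟨1 - (ε / (A + 1)) ^ 4, by have : 0 < (ε / (A + 1)) ^ 4 := by positivity
                                    linarith, fun u hu hu1 => ?_⟩
  have h0 : 0 ≤ ε / (A + 1) := by positivity
  have h1 : (1 - u) ^ (1 / 4 : ℝ) ≤ ε / (A + 1) := by
    calc (1 - u) ^ (1 / 4 : ℝ) ≤ ((ε / (A + 1)) ^ 4) ^ (1 / 4 : ℝ) :=
          rpow_le_rpow (by linarith) (by linarith) (by norm_num)
      _ = _ := by
          rw [← rpow_natCast, ← rpow_mul h0]; norm_num
  calc A * (1 - u) ^ (1 / 4 : ℝ) ≤ A * (ε / (A + 1)) := by gcongr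
    _ = ε * (A / (A + 1)) := by ring
    _ ≤ ε * 1 := by
        refine mul_le_mul_of_nonneg_left ?_ hε.le
        rw [div_le_one (by positivity)]; linarith
    _ = ε := mul_one _

theorem norm_quotient_sub_quotient_le {h l : E N →L[ℂ] ℂ} {t : ℂ} {e : E N} {δ c B M : ℝ}
    (hδ : ‖h - t • l‖ ≤ δ) (hc : 0 < c) (hce : c ≤ ‖h e‖) (hle : 1 / 2 ≤ ‖l e‖) (he : ‖e‖ ≤ B)
    (hl : ‖l‖ ≤ M) (y : E N) :
    ‖h y / h e - l y / l e‖ ≤ (1 + 2 * M * B) / c * δ * ‖y‖ := by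
  have hδ0 := (norm_nonneg _).trans hδ
  have hB := (norm_nonneg _).trans he
  have hM := (norm_nonneg _).trans hl
  have h1 : h e ≠ 0 := norm_pos_iff.mp (by linarith)
  have h2 : l e ≠ 0 := norm_pos_iff.mp (by linarith)
  have h3 : h y / h e - l y / l e =
      ((h - t • l) y - (l y / l e) * (h - t • l) e) / h e := by
    simp only [sub_apply, smul_apply, smul_eq_mul]
    field_simp
    ring
  have h4 : ‖(h - t • l) y‖ ≤ δ * ‖y‖ :=
    (le_opNorm _ _).trans (mul_le_mul_of_nonneg_right hδ (norm_nonneg _))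
  have h5 : ‖(h - t • l) e‖ ≤ δ * B :=
    (le_opNorm _ _).trans (mul_le_mul hδ he (norm_nonneg _) hδ0)
  have h6 : ‖l y / l e‖ ≤ 2 * M * ‖y‖ := by
    rw [norm_div, div_le_iff₀ (by linarith)]
    have h7 : ‖l y‖ ≤ M * ‖y‖ :=
      (le_opNorm _ _).trans (mul_le_mul_of_nonneg_right hl (norm_nonneg _))
    have h8 := mul_le_mul_of_nonneg_left hle (show 0 ≤ 2 * M * ‖y‖ by positivity)
    linarith
  rw [h3, norm_div, div_le_iff₀ (by linarith)]
  have h7 : ‖l y / l e * (h - t • l) e‖ ≤ (2 * M * ‖y‖) * (δ * B) := by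
    rw [norm_mul]
    exact mul_le_mul h6 h5 (norm_nonneg _) (by positivity)
  have h8 : (1 + 2 * M * B) * δ * ‖y‖ ≤ (1 + 2 * M * B) / c * δ * ‖y‖ * ‖h e‖ := by
    have h9 := mul_le_mul_of_nonneg_left hce
      (show 0 ≤ (1 + 2 * M * B) / c * δ * ‖y‖ by positivity)
    have h10 : (1 + 2 * M * B) / c * δ * ‖y‖ * c = (1 + 2 * M * B) * δ * ‖y‖ := by field_simp
    linarith
  refine (norm_sub_le _ _).trans ?_
  linarith

namespace Dom

variable {Ω : Set (E N)} {α : ℝ} (D : Dom Ω α)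

/-- Regular centered geodesics are uniformly Hölder continuous of order `β`. -/
def DerivBound (β : ℝ) : Prop :=
  ∃ C > 0, ∀ φ, D.Reg φ → ∀ a ∈ 𝔻,
    ‖deriv φ a‖ ≤ C * D.sz φ * (1 - ‖a‖) ^ (β - 1)

variable {D}

theorem DerivBound.exists_norm_sub_le {β : ℝ} (h : D.DerivBound β) (hβ : 0 < β) (hβ1 : β ≤ 1) :
    ∃ C > 0, ∀ φ, D.Reg φ → ∀ a ∈ closedBall (0:ℂ) 1,
      ∀ b ∈ closedBall (0:ℂ) 1, ‖φ a - φ b‖ ≤ C * D.sz φ * ‖a - b‖ ^ β := by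
  obtain ⟨C, hC, h⟩ := h
  refine ⟨4 / β * C, by positivity, fun φ hφ => ?_⟩
  have hsz := hφ.cen.sz_pos
  have h0 : ∀ a ∈ 𝔻, ∀ b ∈ 𝔻,
      ‖φ a - φ b‖ ≤ 4 / β * C * D.sz φ * ‖a - b‖ ^ β := by
    intro a ha b hb
    have := norm_sub_le_of_hardy_littlewood hφ.cen.diff hβ hβ1 (K := C * D.sz φ) (by positivity)
      (h φ hφ) ha hb
    calc _ ≤ _ := this
      _ = _ := by ring
  have h1 : ∀ a ∈ closedBall (0:ℂ) 1, ∀ b ∈ 𝔻,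
      ‖φ a - φ b‖ ≤ 4 / β * C * D.sz φ * ‖a - b‖ ^ β := by
    intro a ha b hb
    refine le_on_closedBall (f := fun a => ‖φ a - φ b‖)
      (g := fun a => 4 / β * C * D.sz φ * ‖a - b‖ ^ β) (fun a ha => h0 a ha b hb)
      (hφ.cont.sub continuousOn_const).norm ?_ ha
    exact (continuous_const.mul ((continuous_id.sub continuous_const).norm.rpow_const
      fun _ => Or.inr hβ.le)).continuousOn
  intro a ha b hb
  refine le_on_closedBall (f := fun b => ‖φ a - φ b‖)
    (g := fun b => 4 / β * C * D.sz φ * ‖a - b‖ ^ β) (fun b hb => h1 a ha b hb)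
    (continuousOn_const.sub hφ.cont).norm ?_ hb
  exact (continuous_const.mul ((continuous_const.sub continuous_id).norm.rpow_const
    fun _ => Or.inr hβ.le)).continuousOn

variable (D)

theorem derivBound_half : D.DerivBound (1 / 2) := by
  obtain ⟨C, hC, h⟩ := D.exists_basic
  exact ⟨C, hC, fun φ hφ a ha => (h φ hφ.cen a ha).2.1⟩

theorem exists_h_normal_ge {B ε : ℝ} (hB : 0 < B) (hε : 0 < ε) : ∃ c > 0, ∃ η > 0, η ≤ 1 ∧
    ∀ φ, D.Reg φ → ∀ μ, D.Dual φ μ → ∀ ω : ℂ, ‖ω‖ = 1 → ∀ e : E N,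
    D.L (φ ω) e = 1 → ‖e‖ ≤ B → ∀ a ∈ 𝔻 ∩ ball ω η,
      c ≤ ‖dualH D φ μ a e‖ ∧ ‖φ a - φ ω‖ ≤ ε := by
  obtain ⟨C0, hC0, c, hc, hd⟩ := D.exists_dual_bounds
  obtain ⟨C1, hC1, h1⟩ := D.exists_reg_holder
  obtain ⟨C2, hC2, ε2, hε2, h2⟩ := D.exists_quotient_expansion hB
  have hM := D.M_pos
  set δ := min ε ε2 with hδ
  have hδ0 : 0 < δ := lt_min hε hε2
  set η := min (1 / 2) (min ((c / (8 * (C0 * B))) ^ 4) ((δ / (C1 * D.M)) ^ 2)) with hη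
  have hη0 : 0 < η := by positivity
  have hη1 : η ≤ 1 / 2 := min_le_left _ _
  have hη2 : η ≤ (c / (8 * (C0 * B))) ^ 4 := (min_le_right _ _).trans (min_le_left _ _)
  have hη3 : η ≤ (δ / (C1 * D.M)) ^ 2 := (min_le_right _ _).trans (min_le_right _ _)
  refine ⟨c / 8, by positivity, η, hη0, by linarith, fun φ hφ μ hμ ω hω e he heB a ha => ?_⟩
  obtain ⟨haB, haω⟩ := ha
  have ha1 := norm_lt_one_of_mem_ball haB
  have hac := ball_subset_closedBall haB
  have hωc := mem_closedBall_of_norm_eq hω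
  rw [mem_ball, dist_eq_norm] at haω
  have h3 : 1 - ‖a‖ < η := by
    have := norm_sub_norm_le ω a
    rw [hω, norm_sub_rev] at this
    linarith
  have hsz := hφ.cen.sz_pos
  have h4 : ‖φ a - φ ω‖ ≤ δ := by
    refine (h1 φ hφ a hac ω hωc).trans ?_
    have h5 : ‖a - ω‖ ^ (1 / 2 : ℝ) ≤ δ / (C1 * D.M) := by
      calc ‖a - ω‖ ^ (1 / 2 : ℝ) ≤ ((δ / (C1 * D.M)) ^ 2) ^ (1 / 2 : ℝ) :=
            rpow_le_rpow (norm_nonneg _) (by linarith) (by norm_num)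
        _ = _ := by rw [← sqrt_eq_rpow, sqrt_sq (by positivity)]
    calc C1 * D.sz φ * ‖a - ω‖ ^ (1 / 2 : ℝ) ≤ C1 * D.M * (δ / (C1 * D.M)) := by
          have := hφ.cen.sz_le
          gcongr
      _ = δ := by field_simp
  refine ⟨?_, h4.trans (min_le_left _ _)⟩
  obtain ⟨-, hm, -, hh, -⟩ := hd φ hφ μ hμ a haB
  obtain ⟨hLe, -⟩ := h2 (φ ω) (hφ.memc hωc) e he heB (φ a) (hφ.memc hac) (h4.trans (min_le_right _ _))
  have h5 : (1 - ‖a‖) ^ (1 / 4 : ℝ) ≤ c / (8 * (C0 * B)) := by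
    calc (1 - ‖a‖) ^ (1 / 4 : ℝ) ≤ ((c / (8 * (C0 * B))) ^ 4) ^ (1 / 4 : ℝ) :=
          rpow_le_rpow (by linarith) (by linarith) (by norm_num)
      _ = _ := by
          rw [← rpow_natCast, ← rpow_mul (by positivity)]; norm_num
  have h6 : ‖(dualH D φ μ a - (a * (dualM μ a : ℂ)) • D.L (φ a)) e‖ ≤ c / 8 := by
    refine (le_opNorm _ _).trans ?_
    calc _ ≤ (C0 * (c / (8 * (C0 * B)))) * B := by
          refine mul_le_mul (hh.trans ?_) heB (norm_nonneg _) (by positivity)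
          gcongr
      _ = c / 8 := by field_simp
  rw [sub_apply, smul_apply, smul_eq_mul] at h6
  have h7 : c / 4 ≤ ‖a * (dualM μ a : ℂ) * D.L (φ a) e‖ := by
    rw [norm_mul, norm_mul, norm_real, norm_of_nonneg (by linarith)]
    calc c / 4 = 1 / 2 * c * (1 / 2) := by ring
      _ ≤ _ := mul_le_mul (mul_le_mul (by linarith) hm hc.le (norm_nonneg _)) hLe (by norm_num)
          (mul_nonneg (norm_nonneg _) (hc.le.trans hm))
  have h8 := norm_sub_norm_le (a * (dualM μ a : ℂ) * D.L (φ a) e) (dualH D φ μ a e)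
  rw [norm_sub_rev] at h8
  linarith

theorem exists_normal_frontier : ∃ B > 0, ∀ q ∈ frontier Ω, ∃ e : E N, D.L q e = 1 ∧ ‖e‖ ≤ B := by
  obtain ⟨C, ε, hC, hε, h⟩ := D.exists_normal
  exact ⟨C, hC, fun q hq => h q (frontier_subset_closure hq) (by rw [D.r_frontier hq]; exact hε.le)⟩

theorem exists_norm_anti_deriv_le {β γ : ℝ} (hβ : 0 < β) (hβ1 : β ≤ 1) (hγ : 0 < γ)
    (hγβ : γ ≤ β * (1 + α)) (hγ1 : γ ≠ 1) (hγ2 : γ < 2) (hP : D.DerivBound β) :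
    ∃ C > 0, ∃ η > 0, ∀ φ, D.Reg φ → ∀ ω : ℂ, ‖ω‖ = 1 → ∀ y, D.L (φ ω) y = 0 →
      ∀ t : ℝ, 0 ≤ t → t < 1 → 1 - t < η →
        ‖D.anti (φ ω) y (deriv φ (t * ω))‖ ≤ C * D.sz φ * ‖y‖ * (1 - t) ^ (min γ 1 - 1) := by
  obtain ⟨B, hB, hnor⟩ := D.exists_normal_frontier
  obtain ⟨C2, hC2, ε, hε, hq⟩ := D.exists_quotient_expansion hB
  obtain ⟨c, hc, η, hη, hη1, hge⟩ := D.exists_h_normal_ge hB hε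
  obtain ⟨C0, hC0, c0, hc0, hd⟩ := D.exists_dual_bounds
  obtain ⟨C1, hC1, h1⟩ := hP.exists_norm_sub_le hβ hβ1
  obtain ⟨C3, hC3, h3⟩ := D.exists_norm_sub_le
  obtain ⟨C4, hC4, hreg⟩ := exists_reg hγ hγ2 hγ1 hη
  have hM := D.M_pos
  have hα := D.α_pos
  set K0 := C0 / c + D.M * C3 + C2 * (C1 ^ (1 + α) * D.M ^ α) with hK0
  have hK0p : 0 < K0 := by positivity
  refine ⟨C4 * K0, by positivity, η / 4, by positivity, fun φ hφ ω hω y hy t ht0 ht1 htη => ?_⟩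
  obtain ⟨μ, hμ⟩ := hφ.exists_dual
  have hωc := mem_closedBall_of_norm_eq hω
  have hqm := hφ.memc hωc
  obtain ⟨e, he, heB⟩ := hnor (φ ω) (hφ.mem_frontier hω)
  have hsz := hφ.cen.sz_pos
  have hszM := hφ.cen.sz_le
  have hSne : ∀ a ∈ 𝔻 ∩ ball ω η, dualH D φ μ a e ≠ 0 := fun a ha =>
    norm_pos_iff.mp (hc.trans_le (hge φ hφ μ hμ ω hω e he heB a ha).1)
  have hh := (Dual.differentiableOn_h hφ hμ).mono
    (inter_subset_left : 𝔻 ∩ ball ω η ⊆ 𝔻)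
  have hφd := (hφ.cen.diff).mono (inter_subset_left : 𝔻 ∩ ball ω η ⊆ 𝔻)
  have hhy : ∀ v : E N, DifferentiableOn ℂ (fun a => dualH D φ μ a v) (𝔻 ∩ ball ω η) :=
    fun v => hh.clm_apply (differentiableOn_const v)
  have hsub : DifferentiableOn ℂ (fun a => φ a - φ ω) (𝔻 ∩ ball ω η) :=
    hφd.sub (differentiableOn_const _)
  set b : ℂ → ℂ := fun a => D.anti (φ ω) y (φ a - φ ω) with hb
  set k : ℂ → ℂ := fun a => dualH D φ μ a y / dualH D φ μ a e -
    lin (D.ell (φ ω)) (φ a - φ ω) y with hk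
  have hbd : DifferentiableOn ℂ b (𝔻 ∩ ball ω η) :=
    (D.anti (φ ω) y).differentiable.comp_differentiableOn hsub
  have hkd : DifferentiableOn ℂ k (𝔻 ∩ ball ω η) := by
    refine ((hhy y).div (hhy e) hSne).sub ?_
    exact ((lin (D.ell (φ ω))).differentiable.comp_differentiableOn hsub).clm_apply
      (differentiableOn_const y)
  set K := K0 * D.sz φ * ‖y‖ with hK
  have hKp : 0 ≤ K := by positivity
  have t1 : 0 ≤ C0 / c * (D.sz φ * ‖y‖) := by positivity
  have t2 : 0 ≤ D.M * C3 * (D.sz φ * ‖y‖) := by positivity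
  have t3 : 0 ≤ C2 * (C1 ^ (1 + α) * D.M ^ α) * (D.sz φ * ‖y‖) := by positivity
  have hmain := hreg ω k b K hω hKp hkd hbd ?_ ?_ t ht0 ht1 htη
  · have hmem : (t:ℂ) * ω ∈ 𝔻 := by
      rw [mem_ball_zero_iff, norm_mul, hω, norm_real, norm_of_nonneg ht0]
      linarith
    have hder : deriv b (t * ω) = D.anti (φ ω) y (deriv φ (t * ω)) :=
      ((D.anti (φ ω) y).hasFDerivAt.comp_hasDerivAt _
        ((hφ.cen.hasDerivAt hmem).sub_const (φ ω))).deriv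
    rw [← hder]
    calc _ ≤ _ := hmain
      _ = _ := by rw [hK]; ring
  · intro a ha _
    obtain ⟨-, -, -, -, hy0⟩ := hd φ hφ μ hμ a ha.1
    have e1 := hy0 ω hω y hy
    have e2 := (hge φ hφ μ hμ ω hω e he heB a ha).1
    have e3 := h3 φ hφ a (ball_subset_closedBall ha.1) ω hωc
    have e4 : D.M * ‖φ a - φ ω‖ * ‖y‖ ≤ D.M * (C3 * D.sz φ) * ‖y‖ := by gcongr
    constructor
    · have e5 : ‖dualH D φ μ a y / dualH D φ μ a e‖ ≤ C0 / c * (D.sz φ * ‖y‖) := by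
        rw [norm_div]
        calc _ ≤ (C0 * D.sz φ * ‖y‖) / c := div_le_div₀ (by positivity) e1 hc e2
          _ = _ := by ring
      have e6 := D.norm_lin_ell_apply_le hqm y (φ a - φ ω)
      refine (norm_sub_le _ _).trans ?_
      rw [hK, hK0]
      linarith
    · refine (D.norm_anti_apply_le hqm y _).trans ?_
      rw [hK, hK0]
      linarith
  · intro ε' hε'
    obtain ⟨s, hs1, hs⟩ := exists_mul_rpow_quarter_le
      (A := (1 + 2 * D.M * B) / c * C0 * ‖y‖) (by positivity) hε'
    refine ⟨s, hs1, fun a ha hsa => ?_⟩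
    have hac := ball_subset_closedBall ha.1
    obtain ⟨-, -, -, hha, -⟩ := hd φ hφ μ hμ a ha.1
    obtain ⟨hge1, hge2⟩ := hge φ hφ μ hμ ω hω e he heB a ha
    obtain ⟨hL1, hL2⟩ := hq (φ ω) hqm e he heB (φ a) (hφ.memc hac) hge2
    have e1 := norm_quotient_sub_quotient_le hha hc hge1 hL1 heB (D.norm_L _ (hφ.memc hac)) y
    have e2 := hs ‖a‖ hsa (norm_lt_one_of_mem_ball ha.1).le
    have e3 := hL2 y hy
    have e4 : ‖φ a - φ ω‖ ^ (1 + α) ≤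
        C1 ^ (1 + α) * D.M ^ α * D.sz φ * ‖a - ω‖ ^ γ := by
      have haω : ‖a - ω‖ ≤ 1 := by
        have := ha.2
        rw [mem_ball, dist_eq_norm] at this
        linarith
      have f1 : (‖a - ω‖ ^ β) ^ (1 + α) ≤ ‖a - ω‖ ^ γ := by
        rw [← rpow_mul (norm_nonneg _)]
        rcases (norm_nonneg (a - ω)).eq_or_lt with h0 | h0
        · rw [← h0, zero_rpow (by positivity), zero_rpow hγ.ne']
        · exact rpow_le_of_le_one h0 haω hγβ
      have f2 : D.sz φ ^ (1 + α) ≤ D.M ^ α * D.sz φ := by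
        rw [add_comm, rpow_add_one hsz.ne']
        gcongr
      calc ‖φ a - φ ω‖ ^ (1 + α) ≤ (C1 * D.sz φ * ‖a - ω‖ ^ β) ^ (1 + α) :=
            rpow_le_rpow (norm_nonneg _) (h1 φ hφ a hac ω hωc) (by linarith)
        _ = C1 ^ (1 + α) * D.sz φ ^ (1 + α) * (‖a - ω‖ ^ β) ^ (1 + α) := by
            rw [mul_rpow (by positivity) (by positivity), mul_rpow hC1.le hsz.le]
        _ ≤ C1 ^ (1 + α) * (D.M ^ α * D.sz φ) * ‖a - ω‖ ^ γ := by gcongr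
        _ = _ := by ring
    have e5 : k a - conj (b a) =
        (dualH D φ μ a y / dualH D φ μ a e - D.L (φ a) y / D.L (φ a) e) +
        (D.L (φ a) y / D.L (φ a) e - D.ell (φ ω) (φ a - φ ω) y) := by
      rw [D.ell_eq, hk, hb]
      ring
    rw [e5]
    refine (norm_add_le _ _).trans ?_
    have e6 : C2 * ‖φ a - φ ω‖ ^ (1 + α) * ‖y‖ ≤
        C2 * (C1 ^ (1 + α) * D.M ^ α * D.sz φ * ‖a - ω‖ ^ γ) * ‖y‖ := by gcongr
    have e7 : 0 ≤ (C0 / c * (D.sz φ * ‖y‖) + D.M * C3 * (D.sz φ * ‖y‖)) * ‖a - ω‖ ^ γ := by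
      positivity
    rw [hK, hK0]
    linarith

end Dom

theorem exists_radial {a : ℂ} (ha : a ≠ 0) :
    ∃ ω : ℂ, ‖ω‖ = 1 ∧ a = (‖a‖ : ℂ) * ω ∧ ‖a - ω‖ = |1 - ‖a‖| := by
  have hn : (‖a‖ : ℂ) ≠ 0 := by exact_mod_cast (norm_pos_iff.mpr ha).ne'
  have h1 : ‖a / (‖a‖ : ℂ)‖ = 1 := by
    rw [norm_div, norm_real, norm_norm, div_self (norm_pos_iff.mpr ha).ne']
  refine ⟨a / (‖a‖ : ℂ), h1, by field_simp, ?_⟩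
  have h2 : a - a / (‖a‖ : ℂ) = ((‖a‖ - 1 : ℝ) : ℂ) * (a / (‖a‖ : ℂ)) := by
    push_cast; field_simp
  rw [h2, norm_mul, h1, mul_one, norm_real, norm_eq_abs, abs_sub_comm]

namespace Dom

variable {Ω : Set (E N)} {α : ℝ} (D : Dom Ω α)

theorem exists_norm_L_boundary_deriv_le : ∃ C > 0, ∀ φ, D.Reg φ → ∀ a ∈ 𝔻,
    ∀ ω : ℂ, ‖ω‖ = 1 → ‖a - ω‖ = 1 - ‖a‖ → ‖D.L (φ ω) (deriv φ a)‖ ≤ C * D.sz φ ^ 2 := by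
  obtain ⟨C1, hC1, h1⟩ := D.exists_basic
  obtain ⟨C2, hC2, h2⟩ := D.exists_reg_holder
  have hM := D.M_pos
  refine ⟨C1 + D.M * C2 * C1, by positivity, fun φ hφ a ha ω hω haω => ?_⟩
  obtain ⟨-, hd, hL⟩ := h1 φ hφ.cen a ha
  have hac := ball_subset_closedBall ha
  have hωc := mem_closedBall_of_norm_eq hω
  have hsz := hφ.cen.sz_pos
  have hu : 0 < 1 - ‖a‖ := by linarith [norm_lt_one_of_mem_ball ha]
  have e1 : D.L (φ ω) (deriv φ a) =
      D.L (φ a) (deriv φ a) + (D.L (φ ω) - D.L (φ a)) (deriv φ a) := by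
    rw [sub_apply]; ring
  have e2 : ‖(D.L (φ ω) - D.L (φ a)) (deriv φ a)‖ ≤ D.M * C2 * C1 * D.sz φ ^ 2 := by
    have e3 := h2 φ hφ ω hωc a hac
    rw [norm_sub_rev ω a, haω] at e3
    have e4 : (1 - ‖a‖) ^ (1 / 2 : ℝ) * (1 - ‖a‖) ^ (1 / 2 - 1 : ℝ) = 1 := by
      rw [← rpow_add hu]; norm_num
    calc _ ≤ ‖D.L (φ ω) - D.L (φ a)‖ * ‖deriv φ a‖ := le_opNorm _ _
      _ ≤ (D.M * (C2 * D.sz φ * (1 - ‖a‖) ^ (1 / 2 : ℝ))) *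
          (C1 * D.sz φ * (1 - ‖a‖) ^ (1 / 2 - 1 : ℝ)) := by
          refine mul_le_mul ?_ hd (norm_nonneg _) (by positivity)
          exact (D.d2 _ (hφ.memc hac) _ (hφ.memc hωc)).trans (mul_le_mul_of_nonneg_left e3 hM.le)
      _ = D.M * C2 * C1 * D.sz φ ^ 2 *
          ((1 - ‖a‖) ^ (1 / 2 : ℝ) * (1 - ‖a‖) ^ (1 / 2 - 1 : ℝ)) := by ring
      _ = _ := by rw [e4, mul_one]
  rw [e1]
  refine (norm_add_le _ _).trans ?_
  linarith

theorem derivBound_step {β γ : ℝ} (hβ : 0 < β) (hβ1 : β ≤ 1) (hγ : 0 < γ)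
    (hγβ : γ ≤ β * (1 + α)) (hγ1 : γ ≠ 1) (hγ2 : γ < 2) (hP : D.DerivBound β) :
    D.DerivBound (min γ 1) := by
  obtain ⟨C0, hC0, η0, hη0, hanti⟩ := D.exists_norm_anti_deriv_le hβ hβ1 hγ hγβ hγ1 hγ2 hP
  obtain ⟨κ, c, hκ, hc, hherm⟩ := D.exists_herml_ge
  obtain ⟨B, hB, hnor⟩ := D.exists_normal_frontier
  obtain ⟨C1, hC1, h1⟩ := D.exists_basic
  obtain ⟨C5, hC5, h5⟩ := D.exists_norm_L_boundary_deriv_le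
  have hM := D.M_pos
  set η := min η0 (1 / 2) with hη
  have hηp : 0 < η := by positivity
  set m := min γ 1 with hm
  have hm1 : m ≤ 1 := min_le_right _ _
  set K := (C0 + C5 * D.M * D.M * B) / c with hK
  have hKp : 0 < K := by positivity
  refine ⟨C1 * η ^ (1 / 2 - 1 : ℝ) + K + C5 * D.M * B, by positivity, fun φ hφ a ha => ?_⟩
  have ha1 := norm_lt_one_of_mem_ball ha
  have hu : 0 < 1 - ‖a‖ := by linarith
  have hsz := hφ.cen.sz_pos
  have hszM := hφ.cen.sz_le
  have hU : 1 ≤ (1 - ‖a‖) ^ (m - 1) :=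
    Real.one_le_rpow_of_pos_of_le_one_of_nonpos hu (by linarith [norm_nonneg a]) (by linarith)
  set U := (1 - ‖a‖) ^ (m - 1) with hUd
  obtain ⟨-, hd, -⟩ := h1 φ hφ.cen a ha
  have t1 : 0 ≤ C1 * η ^ (1 / 2 - 1 : ℝ) * D.sz φ * U := by positivity
  have t2 : 0 ≤ K * D.sz φ * U := by positivity
  have t3 : 0 ≤ C5 * D.M * B * D.sz φ * U := by positivity
  rcases le_or_gt η (1 - ‖a‖) with hcase | hcase
  · have e1 : (1 - ‖a‖) ^ (1 / 2 - 1 : ℝ) ≤ η ^ (1 / 2 - 1 : ℝ) :=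
      Real.rpow_le_rpow_of_nonpos hηp hcase (by norm_num)
    have e2 : C1 * D.sz φ * (1 - ‖a‖) ^ (1 / 2 - 1 : ℝ) ≤
        C1 * D.sz φ * η ^ (1 / 2 - 1 : ℝ) * U := by
      calc _ ≤ C1 * D.sz φ * η ^ (1 / 2 - 1 : ℝ) := by gcongr
        _ ≤ _ := le_mul_of_one_le_right (by positivity) hU
    linarith
  · have ha0 : a ≠ 0 := by
      rintro rfl
      have : η ≤ 1 / 2 := min_le_right _ _
      rw [norm_zero] at hcase
      linarith
    obtain ⟨ω, hω, haω, hrad⟩ := exists_radial ha0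
    rw [abs_of_pos hu] at hrad
    have hqf := hφ.mem_frontier hω
    obtain ⟨e, he, heB⟩ := hnor (φ ω) hqf
    set v := deriv φ a with hv
    have hLv := h5 φ hφ a ha ω hω hrad
    rw [← hv] at hLv
    set τ := v - (D.L (φ ω) v) • e with hτ
    have hLτ : D.L (φ ω) τ = 0 := by
      rw [hτ, map_sub, map_smul, he, smul_eq_mul, mul_one, sub_self]
    have hz := hφ.memc (mem_closedBall_of_norm_eq hω)
    have e1 := hherm (φ ω) hz τ
    rw [hLτ, D.r_frontier hqf, norm_zero] at e1
    have e2 := hanti φ hφ ω hω τ hLτ ‖a‖ (norm_nonneg a) ha1 (hcase.trans_le (min_le_left _ _))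
    rw [← haω, ← hv] at e2
    have e3 : D.anti (φ ω) τ τ = D.anti (φ ω) τ v - D.L (φ ω) v * D.anti (φ ω) τ e := by
      conv_lhs => rw [hτ]
      rw [map_sub, map_smul, smul_eq_mul]
    have e4 : D.herml (φ ω) τ ≤ ‖D.anti (φ ω) τ v‖ + ‖D.L (φ ω) v‖ * ‖D.anti (φ ω) τ e‖ := by
      rw [← D.re_anti_self, e3, ← norm_mul]
      exact (re_le_norm _).trans (norm_sub_le _ _)
    have hs2 : D.sz φ ^ 2 ≤ D.M * D.sz φ := by
      rw [sq]; exact mul_le_mul_of_nonneg_right hszM hsz.le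
    have e6 : ‖D.L (φ ω) v‖ ≤ C5 * D.M * D.sz φ * U := by
      refine hLv.trans ?_
      calc C5 * D.sz φ ^ 2 ≤ C5 * (D.M * D.sz φ) := by gcongr
        _ = C5 * D.M * D.sz φ := by ring
        _ ≤ _ := le_mul_of_one_le_right (by positivity) hU
    have e5 : ‖D.L (φ ω) v‖ * ‖D.anti (φ ω) τ e‖ ≤
        (C5 * D.M * D.sz φ * U) * (D.M * ‖τ‖ * B) := by
      refine mul_le_mul e6 ?_ (norm_nonneg _) (by positivity)
      exact (D.norm_anti_apply_le hz τ e).trans (mul_le_mul_of_nonneg_left heB (by positivity))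
    have e7 : ‖τ‖ ≤ K * D.sz φ * U := by
      rcases (norm_nonneg τ).eq_or_lt with h0 | h0
      · rw [← h0]; exact t2
      · have e8 : c * ‖τ‖ * ‖τ‖ ≤ (C0 + C5 * D.M * D.M * B) * D.sz φ * U * ‖τ‖ := by linarith
        have e9 := le_of_mul_le_mul_right e8 h0
        rw [hK, div_mul_eq_mul_div, div_mul_eq_mul_div, le_div_iff₀ hc]
        linarith
    have e8 : ‖v‖ ≤ ‖τ‖ + ‖D.L (φ ω) v‖ * ‖e‖ := by
      have : v = τ + (D.L (φ ω) v) • e := by rw [hτ]; abel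
      conv_lhs => rw [this]
      refine (norm_add_le _ _).trans ?_
      rw [norm_smul]
    have e9 : ‖D.L (φ ω) v‖ * ‖e‖ ≤ (C5 * D.M * D.sz φ * U) * B :=
      mul_le_mul e6 heB (norm_nonneg _) (by positivity)
    linarith

theorem derivBound_pow (n : ℕ) : D.DerivBound (min (1 / 2 * (1 + α) ^ n) (1 - α / 4)) := by
  have hα := D.α_pos
  have hα1 := D.α_le
  induction n with
  | zero =>
    rw [pow_zero, mul_one, min_eq_left (by linarith)]
    exact D.derivBound_half
  | succ n ih =>
    set x := 1 / 2 * (1 + α) ^ n with hx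
    have hx0 : 0 < x := by positivity
    have hx1 : 1 / 2 * (1 + α) ^ (n + 1) = x * (1 + α) := by rw [pow_succ, hx]; ring
    rw [hx1]
    have hxα : 0 < x * (1 + α) := by positivity
    set γ := min (x * (1 + α)) (1 - α / 4) with hγ
    have hγ1 : γ ≤ 1 - α / 4 := min_le_right _ _
    have h := D.derivBound_step (γ := γ) (lt_min hx0 (by linarith))
      ((min_le_right _ _).trans (by linarith)) (lt_min hxα (by linarith)) ?_ (by linarith)
      (by linarith) ih
    · rwa [min_eq_left (by linarith)] at h
    · rcases le_total x (1 - α / 4) with h0 | h0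
      · rw [min_eq_left h0]; exact min_le_left _ _
      · rw [min_eq_right h0]
        have : 0 ≤ (1 - α / 4) * α := mul_nonneg (by linarith) hα.le
        linarith

theorem derivBound_one : D.DerivBound 1 := by
  have hα := D.α_pos
  have hα1 := D.α_le
  obtain ⟨n, hn⟩ := pow_unbounded_of_one_lt 2 (show (1:ℝ) < 1 + α by linarith)
  have h := D.derivBound_pow n
  rw [min_eq_right (by linarith)] at h
  have h1 : α * α ≤ α := mul_le_of_le_one_left hα.le hα1
  have h0 : 0 ≤ α * α := mul_self_nonneg α
  have h2 := D.derivBound_step (γ := (1 - α / 4) * (1 + α)) (by linarith) (by linarith)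
    (mul_pos (by linarith) (by linarith)) le_rfl (by intro h; linarith) (by linarith) h
  rwa [min_eq_right (by linarith)] at h2

theorem exists_lipschitz : ∃ C > 0, ∀ φ, D.Reg φ → ∀ a ∈ closedBall (0:ℂ) 1,
    ∀ b ∈ closedBall (0:ℂ) 1, ‖φ a - φ b‖ ≤ C * D.sz φ * ‖a - b‖ := by
  obtain ⟨C, hC, h⟩ := D.derivBound_one.exists_norm_sub_le one_pos le_rfl
  exact ⟨C, hC, fun φ hφ a ha b hb => by simpa only [rpow_one] using h φ hφ a ha b hb⟩

theorem exists_norm_deriv_le : ∃ C > 0, ∀ φ, D.Reg φ → ∀ a ∈ 𝔻,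
    ‖deriv φ a‖ ≤ C * D.sz φ := by
  obtain ⟨C, hC, h⟩ := D.derivBound_one
  exact ⟨C, hC, fun φ hφ a ha => by
    simpa only [sub_self, rpow_zero, mul_one] using h φ hφ a ha⟩

/-- The size of a geodesic is controlled by the chord between any two of its points. -/
theorem exists_sz_le : ∃ C > 0, ∀ φ, D.Reg φ → ∀ a ∈ 𝔻,
    ∀ b ∈ 𝔻, φ a ≠ φ b →
      D.sz φ ≤ C * (‖D.L (φ a) (φ b - φ a)‖ / ‖φ b - φ a‖ + √(D.r (φ a)) + ‖φ b - φ a‖) := by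
  obtain ⟨C1, hC1, h1⟩ := D.exists_parameter_le
  obtain ⟨C2, hC2, h2⟩ := D.exists_lipschitz
  refine ⟨C1 * C2, by positivity, fun φ hφ a ha b hb hab => ?_⟩
  have hsz := hφ.cen.sz_pos
  have hx : 0 < ‖φ b - φ a‖ := norm_pos_iff.mpr (sub_ne_zero.mpr hab.symm)
  have e1 := h1 φ hφ.cen a ha b hb
  have e2 := h2 φ hφ b (ball_subset_closedBall hb) a (ball_subset_closedBall ha)
  rw [norm_sub_rev b a] at e2
  set x := ‖φ b - φ a‖
  set l := ‖D.L (φ a) (φ b - φ a)‖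
  have e3 : D.sz φ * x ≤ C2 * (D.sz φ ^ 2 * ‖a - b‖) := by
    calc D.sz φ * x ≤ D.sz φ * (C2 * D.sz φ * ‖a - b‖) := by gcongr
      _ = _ := by ring
  have e4 := e3.trans (mul_le_mul_of_nonneg_left e1 hC2.le)
  have e5 : C2 * (C1 * (l + x ^ 2 + x * √(D.r (φ a)))) =
      C1 * C2 * (l / x + √(D.r (φ a)) + x) * x := by field_simp; ring
  rw [e5] at e4
  exact le_of_mul_le_mul_right e4 hx

end Dom

theorem norm_one_sub_conj_mul_ge {a b : ℂ} {s : ℝ} (ha : ‖a‖ ≤ s) (hb : ‖b‖ ≤ 1) :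
    1 - s ≤ ‖1 - conj a * b‖ := by
  have h1 := norm_sub_norm_le (1:ℂ) (conj a * b)
  rw [norm_one, norm_mul, RCLike.norm_conj] at h1
  have h2 : ‖a‖ * ‖b‖ ≤ s * 1 := mul_le_mul ha hb (norm_nonneg _) ((norm_nonneg _).trans ha)
  linarith

/-- A function `h` on the disc for which `h(a)/a` has positive real part near the circle has a
zero, and is the product of a quadratic factor and a zero-free function. -/
theorem exists_factor_of_re_div_ge {h : ℂ → ℂ} (hd : DifferentiableOn ℂ h 𝔻) {c C s : ℝ}
    (hc : 0 < c) (hs : 1 / 2 ≤ s) (hs1 : s < 1) (hC : ∀ a ∈ 𝔻, ‖h a‖ ≤ C)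
    (hre : ∀ a ∈ 𝔻, s ≤ ‖a‖ → c ≤ (h a / a).re) :
    ∃ a₁ : ℂ, ‖a₁‖ < s ∧ ∃ σ : ℂ → ℂ, DifferentiableOn ℂ σ 𝔻 ∧
      (∀ a ∈ 𝔻, c / 8 ≤ ‖σ a‖) ∧
      ∀ a ∈ 𝔻, h a = (a - a₁) * (1 - conj a₁ * a) * σ a := by
  have hs0 : 0 < s := by linarith
  have hsub : closedBall (0:ℂ) s ⊆ 𝔻 := closedBall_subset_ball hs1
  have hdiv : ∀ a ∈ 𝔻, s ≤ ‖a‖ → ‖h a / a‖ ≤ 2 * C := by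
    intro a ha has
    rw [norm_div, div_le_iff₀ (by linarith)]
    have h1 := hC a ha
    have h2 : 2 * C * (1 / 2) ≤ 2 * C * ‖a‖ :=
      mul_le_mul_of_nonneg_left (by linarith) (by linarith [norm_nonneg (h a)])
    linarith
  have hC0 : 0 ≤ C := (norm_nonneg _).trans (hC 0 (mem_ball_self one_pos))
  have hzero : ∃ a₁ : ℂ, ‖a₁‖ < s ∧ h a₁ = 0 := by
    by_contra! hcon
    have hne : ∀ a ∈ closedBall (0:ℂ) s, h a ≠ 0 := by
      intro a ha h0
      rcases (mem_closedBall_zero_iff.mp ha).lt_or_eq with h1 | h1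
      · exact hcon a h1 h0
      · have := hre a (hsub ha) h1.ge
        rw [h0, zero_div, zero_re] at this
        linarith
    have h1 := re_ge_of_sphere (f := fun a => a / h a) (m := c / (2 * C + 1) ^ 2) hs0
      (differentiableOn_id.div (hd.mono hsub) hne) ?_ (a := 0) (by simpa using hs0.le)
    · rw [zero_div, zero_re] at h1
      have : 0 < c / (2 * C + 1) ^ 2 := by positivity
      linarith
    · intro a ha
      have hac : a ∈ 𝔻 := hsub (by simp [ha])
      have e1 := hre a hac ha.ge
      have e2 := hdiv a hac ha.ge
      have e3 : a / h a = (h a / a)⁻¹ := by rw [inv_div]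
      rw [e3, Complex.inv_re]
      have e4 : 0 < Complex.normSq (h a / a) := by
        rw [Complex.normSq_pos]
        intro h0
        rw [h0, zero_re] at e1
        linarith
      refine div_le_div₀ (by linarith) e1 e4 ?_
      rw [normSq_eq_norm_sq]
      exact pow_le_pow_left₀ (norm_nonneg _) (by linarith) 2
  obtain ⟨a₁, ha₁, hz⟩ := hzero
  have ha₁B : a₁ ∈ 𝔻 := by rw [mem_ball_zero_iff]; linarith
  have hcj : ∀ a ∈ 𝔻, 1 - s ≤ ‖1 - conj a₁ * a‖ := fun a ha =>
    norm_one_sub_conj_mul_ge ha₁.le (norm_lt_one_of_mem_ball ha).le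
  have hcjne : ∀ a ∈ 𝔻, 1 - conj a₁ * a ≠ 0 := fun a ha =>
    norm_pos_iff.mp (by linarith [hcj a ha])
  set σ : ℂ → ℂ := fun a => dslope h a₁ a / (1 - conj a₁ * a) with hσ
  have hσd : DifferentiableOn ℂ σ 𝔻 :=
    ((Complex.differentiableOn_dslope (isOpen_ball.mem_nhds ha₁B)).mpr hd).div (by fun_prop) hcjne
  have hfac : ∀ a ∈ 𝔻, h a = (a - a₁) * (1 - conj a₁ * a) * σ a := by
    intro a ha
    have e1 := sub_smul_dslope h a₁ a
    rw [hz, sub_zero, smul_eq_mul] at e1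
    rw [← e1, mul_assoc, mul_div_cancel₀ _ (hcjne a ha)]
  refine ⟨a₁, ha₁, σ, hσd, fun a ha => ?_, hfac⟩
  have ha1 := norm_lt_one_of_mem_ball ha
  have hlim : Tendsto (fun t : ℝ => 2 * C * ((1 - t ^ 2) / ((t - s) * (1 - s) ^ 2))) (𝓝[<] 1)
      (𝓝 (2 * C * ((1 - 1 ^ 2) / ((1 - s) * (1 - s) ^ 2)))) := by
    refine (ContinuousAt.tendsto ?_).mono_left nhdsWithin_le_nhds
    have : (1 - s) * (1 - s) ^ 2 ≠ 0 := by
      have : 0 < 1 - s := by linarith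
      positivity
    exact continuousAt_const.mul (ContinuousAt.div (by fun_prop) (by fun_prop) this)
  have hev := hlim.eventually (gt_mem_nhds (show _ < c / 8 by
    rw [one_pow, sub_self, zero_div, mul_zero]; positivity))
  obtain ⟨t, ⟨ht1, ht2⟩, ht3⟩ := ((hev.and ((Ioo_mem_nhdsLT (max_lt ha1 hs1)))).and
    self_mem_nhdsWithin).exists
  have hat : ‖a‖ ≤ t := (le_max_left _ _).trans ht2.1.le
  have hst : s < t := (le_max_right _ _).trans_lt ht2.1
  have ht4 : t < 1 := ht3
  refine le_trans ?_ (re_le_norm _)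
  refine re_ge_of_sphere (s := t) (by linarith)
    (hσd.mono (closedBall_subset_ball ht4)) (fun ζ hζ => ?_) hat
  have hζB : ζ ∈ 𝔻 := by rw [mem_ball_zero_iff, hζ]; exact ht4
  have e1 := hre ζ hζB (by linarith)
  have e2 := hdiv ζ hζB (by linarith)
  have hζ0 : ζ ≠ 0 := norm_pos_iff.mp (by linarith)
  have e3 : t - s ≤ ‖ζ - a₁‖ := by
    have := norm_sub_norm_le ζ a₁
    linarith
  have hζa : ζ - a₁ ≠ 0 := norm_pos_iff.mp (by linarith)
  have e4 := hcj ζ hζB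
  have e5 := hcjne ζ hζB
  set w := 1 - conj a₁ * ζ with hw
  have hwp : 0 < ‖w‖ := norm_pos_iff.mpr e5
  have hwc : conj w = 1 - a₁ * conj ζ := by
    rw [hw]; simp
  have hww : w * conj w = ((‖w‖ ^ 2 : ℝ) : ℂ) := by
    rw [mul_conj, normSq_eq_norm_sq]
  have hζζ : ζ * conj ζ = ((t ^ 2 : ℝ) : ℂ) := by
    rw [mul_conj, normSq_eq_norm_sq, hζ]
  have hwc0 : conj w ≠ 0 := by rwa [Ne, map_eq_zero]
  have e6 : σ ζ = ((1 / ‖w‖ ^ 2 : ℝ) : ℂ) * (h ζ / ζ) +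
      h ζ / ζ * (a₁ * ((1 - t ^ 2 : ℝ) : ℂ) / ((ζ - a₁) * ((‖w‖ ^ 2 : ℝ) : ℂ))) := by
    have e7 : σ ζ = h ζ / ((ζ - a₁) * w) := by
      rw [hfac ζ hζB, mul_div_cancel_left₀ _ (mul_ne_zero hζa e5)]
    have e8 : ((1 / ‖w‖ ^ 2 : ℝ) : ℂ) = 1 / (w * conj w) := by
      rw [hww]; push_cast; ring
    have e9 : ((1 - t ^ 2 : ℝ) : ℂ) = 1 - ζ * conj ζ := by rw [hζζ]; push_cast; ring
    rw [e7, e8, e9, ← hww]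
    field_simp
    rw [hwc]
    ring
  have hw2 : ‖w‖ ≤ 2 := by
    have := norm_sub_le (1:ℂ) (conj a₁ * ζ)
    rw [norm_one, norm_mul, RCLike.norm_conj] at this
    have h2 : ‖a₁‖ * ‖ζ‖ ≤ 1 * 1 :=
      mul_le_mul (by linarith) (by linarith) (norm_nonneg _) zero_le_one
    linarith
  have e7 : c / 4 ≤ (((1 / ‖w‖ ^ 2 : ℝ) : ℂ) * (h ζ / ζ)).re := by
    rw [re_ofReal_mul]
    have h3 : 1 / 4 ≤ 1 / ‖w‖ ^ 2 := by
      refine one_div_le_one_div_of_le (by positivity) ?_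
      have := pow_le_pow_left₀ hwp.le hw2 2
      linarith
    calc c / 4 = 1 / 4 * c := by ring
      _ ≤ _ := mul_le_mul h3 e1 hc.le (by positivity)
  have e8 : ‖h ζ / ζ * (a₁ * ((1 - t ^ 2 : ℝ) : ℂ) / ((ζ - a₁) * ((‖w‖ ^ 2 : ℝ) : ℂ)))‖ ≤
      2 * C * ((1 - t ^ 2) / ((t - s) * (1 - s) ^ 2)) := by
    rw [norm_mul]
    have ht : 0 ≤ 1 - t ^ 2 := by
      have := pow_le_one₀ (n := 2) (show 0 ≤ t by linarith) ht4.le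
      linarith
    refine mul_le_mul e2 ?_ (norm_nonneg _) (by positivity)
    rw [norm_div, norm_mul, norm_mul, norm_real, norm_real,
      norm_of_nonneg ht, norm_of_nonneg (by positivity : 0 ≤ ‖w‖ ^ 2)]
    refine div_le_div₀ ht (mul_le_of_le_one_left ht (by linarith)) ?_ ?_
    · have h1 : 0 < t - s := by linarith
      have h2 : 0 < 1 - s := by linarith
      positivity
    · exact mul_le_mul e3 (pow_le_pow_left₀ (by linarith) e4 2) (sq_nonneg _) (norm_nonneg _)
  have e9 := (abs_le.mp (abs_re_le_norm
    (h ζ / ζ * (a₁ * ((1 - t ^ 2 : ℝ) : ℂ) / ((ζ - a₁) * ((‖w‖ ^ 2 : ℝ) : ℂ)))))).1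
  rw [e6, add_re]
  linarith

namespace Dom

variable {Ω : Set (E N)} {α : ℝ} (D : Dom Ω α)

theorem norm_one_sub_L_le {q w e : E N} {B : ℝ} (hq : q ∈ closure Ω) (hw : w ∈ closure Ω)
    (he : D.L q e = 1) (heB : ‖e‖ ≤ B) : ‖1 - D.L w e‖ ≤ D.M * B * ‖w - q‖ := by
  have hM := D.M_pos
  have : 1 - D.L w e = -((D.L w - D.L q) e) := by rw [sub_apply, he]; ring
  rw [this, norm_neg]
  refine (le_opNorm _ _).trans ?_
  calc _ ≤ (D.M * ‖w - q‖) * B := mul_le_mul (D.d2 q hq w hw) heB (norm_nonneg _) (by positivity)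
    _ = _ := by ring

theorem exists_h_normal_factor {B : ℝ} (hB : 0 < B) : ∃ δ > 0, ∃ s : ℝ, 0 < s ∧ s < 1 ∧
    ∃ c > 0, ∀ φ, D.Reg φ → D.sz φ ≤ δ → ∀ μ, D.Dual φ μ → ∀ e : E N,
      D.L (φ 1) e = 1 → ‖e‖ ≤ B → ∃ a₁ : ℂ, ‖a₁‖ < s ∧ ∃ σ : ℂ → ℂ,
        DifferentiableOn ℂ σ 𝔻 ∧ (∀ a ∈ 𝔻, c ≤ ‖σ a‖) ∧
        ∀ a ∈ 𝔻,
          dualH D φ μ a e = (a - a₁) * (1 - conj a₁ * a) * σ a := by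
  obtain ⟨C0, hC0, c, hc, hd⟩ := D.exists_dual_bounds
  obtain ⟨C3, hC3, h3⟩ := D.exists_norm_sub_le
  have hM := D.M_pos
  obtain ⟨s, hs, hsq⟩ := exists_mul_rpow_quarter_le (A := 2 * (C0 * B)) (ε := c / 4)
    (by positivity) (by positivity)
  have hs1 : max s (1 / 2) < 1 := max_lt hs (by norm_num)
  refine ⟨1 / (2 * (D.M * B * C3)), by positivity, max s (1 / 2),
    lt_of_lt_of_le (by norm_num) (le_max_right _ _), hs1, c / 4 / 8, by positivity,
    fun φ hφ hδ μ hμ e he heB => ?_⟩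
  have h1c : (1:ℂ) ∈ closedBall (0:ℂ) 1 := by simp
  refine exists_factor_of_re_div_ge (C := C0 * B)
    ((Dual.differentiableOn_h hφ hμ).clm_apply (differentiableOn_const e))
    (by positivity) (le_max_right _ _) hs1 (fun a ha => ?_) fun a ha has => ?_
  · exact (le_opNorm _ _).trans
      (mul_le_mul (hd φ hφ μ hμ a ha).2.2.1 heB (norm_nonneg _) hC0.le)
  · obtain ⟨-, hm, -, hh, -⟩ := hd φ hφ μ hμ a ha
    have hac := ball_subset_closedBall ha
    have has1 : 1 / 2 ≤ ‖a‖ := (le_max_right _ _).trans has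
    have ha0 : a ≠ 0 := norm_pos_iff.mp (by linarith)
    have e1 := D.norm_one_sub_L_le (hφ.memc h1c) (hφ.memc hac) he heB
    have e2 : D.M * B * ‖φ a - φ 1‖ ≤ 1 / 2 := by
      rw [le_div_iff₀ (by positivity)] at hδ
      have := mul_le_mul_of_nonneg_left (h3 φ hφ a hac 1 h1c) (show 0 ≤ D.M * B by positivity)
      linarith
    have e3 : 1 / 2 ≤ (D.L (φ a) e).re := by
      have := (re_le_norm (1 - D.L (φ a) e)).trans (e1.trans e2)
      rw [sub_re, Complex.one_re] at this
      linarith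
    have e4 := hsq ‖a‖ ((le_max_left _ _).trans has) (norm_lt_one_of_mem_ball ha).le
    set δ := (dualH D φ μ a - (a * (dualM μ a : ℂ)) • D.L (φ a)) e with hδd
    have e5 : ‖δ‖ ≤ C0 * (1 - ‖a‖) ^ (1 / 4 : ℝ) * B :=
      (le_opNorm _ _).trans
        (mul_le_mul hh heB (norm_nonneg _) ((norm_nonneg _).trans hh))
    have e6 : dualH D φ μ a e / a = (dualM μ a : ℂ) * D.L (φ a) e + δ / a := by
      rw [hδd, sub_apply, smul_apply, smul_eq_mul]
      field_simp
      ring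
    have e7 : ‖δ / a‖ ≤ 2 * (C0 * B) * (1 - ‖a‖) ^ (1 / 4 : ℝ) := by
      rw [norm_div, div_le_iff₀ (by linarith)]
      have := mul_le_mul_of_nonneg_left has1 (norm_nonneg δ)
      have h8 := mul_le_mul_of_nonneg_left has1 (show 0 ≤ 2 * (C0 * B) * (1 - ‖a‖) ^ (1 / 4 : ℝ) by
        have := (norm_nonneg _).trans hh
        have := mul_nonneg this hB.le
        linarith)
      linarith
    have e8 := (_root_.abs_le.mp (abs_re_le_norm (δ / a))).1
    have e9 : c * (1 / 2) ≤ dualM μ a * (D.L (φ a) e).re :=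
      mul_le_mul hm e3 (by norm_num) (hc.le.trans hm)
    rw [e6, add_re, re_ofReal_mul]
    linarith

theorem anti_sub (z y y' x : E N) : D.anti z (y - y') x = D.anti z y x - D.anti z y' x := by
  simp only [anti, lin_apply, conjEll_apply, map_sub, smul_eq_mul]
  ring

theorem exists_norm_L_chord_le : ∃ C > 0, ∀ φ, D.Reg φ → ∀ a ∈ 𝔻,
    ∀ b ∈ 𝔻, ‖D.L (φ a) (φ b - φ a)‖ ≤ C * D.sz φ ^ 2 * ‖b - a‖ := by
  obtain ⟨C1, hC1, h1⟩ := D.exists_basic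
  obtain ⟨C2, hC2, h2⟩ := D.exists_norm_deriv_le
  obtain ⟨C3, hC3, h3⟩ := D.exists_norm_sub_le
  have hM := D.M_pos
  refine ⟨C1 + D.M * C3 * C2, by positivity, fun φ hφ a ha b hb => ?_⟩
  have hsz := hφ.cen.sz_pos
  have hder : ∀ x ∈ 𝔻, HasDerivWithinAt (fun x => D.L (φ a) (φ x))
      (D.L (φ a) (deriv φ x)) 𝔻 x := fun x hx =>
    ((D.L (φ a)).hasFDerivAt.comp_hasDerivAt x (hφ.cen.hasDerivAt hx)).hasDerivWithinAt
  have hbd : ∀ x ∈ 𝔻, ‖D.L (φ a) (deriv φ x)‖ ≤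
      (C1 + D.M * C3 * C2) * D.sz φ ^ 2 := by
    intro x hx
    have hac := ball_subset_closedBall ha
    have hxc := ball_subset_closedBall hx
    have e1 : D.L (φ a) (deriv φ x) =
        D.L (φ x) (deriv φ x) + (D.L (φ a) - D.L (φ x)) (deriv φ x) := by rw [sub_apply]; ring
    have e2 : ‖(D.L (φ a) - D.L (φ x)) (deriv φ x)‖ ≤ (D.M * (C3 * D.sz φ)) * (C2 * D.sz φ) := by
      refine (le_opNorm _ _).trans
        (mul_le_mul ?_ (h2 φ hφ x hx) (norm_nonneg _) (by positivity))
      exact (D.d2 _ (hφ.memc hxc) _ (hφ.memc hac)).trans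
        (mul_le_mul_of_nonneg_left (h3 φ hφ a hac x hxc) hM.le)
    have e3 := (h1 φ hφ.cen x hx).2.2
    rw [e1]
    refine (norm_add_le _ _).trans ?_
    linarith
  have := (convex_ball (0:ℂ) 1).norm_image_sub_le_of_norm_hasDerivWithin_le hder hbd ha hb
  rwa [← map_sub] at this

end Dom

theorem norm_inv_sub_conj_le {a a₁ : ℂ} {s : ℝ} (ha₁ : ‖a₁‖ < s) (hs : s < 1) (ha : ‖a‖ < 1)
    (has : (1 + s) / 2 ≤ ‖a‖) :
    ‖1 / (a - a₁) - conj (a / (1 - conj a₁ * a))‖ ≤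
      4 / (1 - s) ^ 2 * (1 - ‖a‖) := by
  have hs1 : 0 < 1 - s := by linarith
  have h1 : (1 - s) / 2 ≤ ‖a - a₁‖ := by
    have := norm_sub_norm_le a a₁
    linarith
  have h2 := norm_one_sub_conj_mul_ge ha₁.le ha.le
  set w := 1 - conj a₁ * a with hw
  have hwc : conj w = 1 - a₁ * conj a := by rw [hw]; simp
  have h3 : a - a₁ ≠ 0 := norm_pos_iff.mp (by linarith)
  have h4 : conj w ≠ 0 := by
    rw [Ne, map_eq_zero]; exact norm_pos_iff.mp (by linarith)
  have h5 : a * conj a = ((‖a‖ ^ 2 : ℝ) : ℂ) := by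
    rw [mul_conj, normSq_eq_norm_sq]
  have h6 : 1 / (a - a₁) - conj (a / w) =
      ((1 - ‖a‖ ^ 2 : ℝ) : ℂ) / ((a - a₁) * conj w) := by
    rw [map_div₀, ofReal_sub, ← h5]
    field_simp
    rw [hwc]
    push_cast
    ring
  have ha2 : 0 ≤ 1 - ‖a‖ ^ 2 := by
    have := pow_le_one₀ (n := 2) (norm_nonneg a) ha.le
    linarith
  rw [h6, norm_div, norm_mul, RCLike.norm_conj, norm_real, norm_of_nonneg ha2]
  have h7 : (1 - s) / 2 * (1 - s) ≤ ‖a - a₁‖ * ‖w‖ :=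
    mul_le_mul h1 h2 hs1.le (norm_nonneg _)
  calc _ ≤ (2 * (1 - ‖a‖)) / ((1 - s) / 2 * (1 - s)) :=
        div_le_div₀ (by linarith) (one_sub_sq_le (mem_ball_zero_iff.mpr ha)) (by positivity) h7
    _ = _ := by field_simp; ring

namespace Dom

variable {Ω : Set (E N)} {α : ℝ} (D : Dom Ω α)

/-- Moving a frame from `p` to a nearby point `q`. -/
theorem exists_adjusted_frame {p q e : E N} {B : ℝ} (hp : p ∈ closure Ω) (hq : q ∈ closure Ω)
    (he : D.L p e = 1) (heB : ‖e‖ ≤ B) (hpq : D.M * B * ‖q - p‖ ≤ 1 / 2) {y : E N}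
    (hy : D.L p y = 0) :
    ∃ (e' y' : E N) (R : ℂ), D.L q e' = 1 ∧ ‖e'‖ ≤ 2 * B ∧ D.L q y' = 0 ∧
      ‖y' - y‖ ≤ 6 * D.M * B * ‖q - p‖ * ‖y‖ ∧
      ∀ w, D.L w e ≠ 0 → D.L w e' ≠ 0 ∧ D.L w y' / D.L w e' = D.L w y / D.L w e - R := by
  have hM := D.M_pos
  have hB0 : 0 ≤ B := (norm_nonneg _).trans heB
  have h1 := D.norm_one_sub_L_le hp hq he heB
  have h2 : 1 / 2 ≤ ‖D.L q e‖ := by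
    have := norm_sub_norm_le (1:ℂ) (D.L q e)
    rw [norm_one] at this
    linarith
  have hne : D.L q e ≠ 0 := norm_pos_iff.mp (by linarith)
  have hinv : ‖(D.L q e)⁻¹‖ ≤ 2 := by
    rw [norm_inv, inv_le_comm₀ (by linarith) two_pos]; linarith
  have hyq : ‖D.L q y‖ ≤ D.M * ‖q - p‖ * ‖y‖ := by
    have : D.L q y = (D.L q - D.L p) y := by rw [sub_apply, hy, sub_zero]
    rw [this]
    exact (le_opNorm _ _).trans
      (mul_le_mul_of_nonneg_right (D.d2 p hp q hq) (norm_nonneg _))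
  refine ⟨(D.L q e)⁻¹ • e, (D.L q e)⁻¹ • (y - (D.L q y / D.L q e) • e), D.L q y / D.L q e,
    ?_, ?_, ?_, ?_, fun w hw => ⟨?_, ?_⟩⟩
  · rw [map_smul, smul_eq_mul, inv_mul_cancel₀ hne]
  · rw [norm_smul]
    exact mul_le_mul hinv heB (norm_nonneg _) (by norm_num)
  · rw [map_smul, map_sub, map_smul, smul_eq_mul, smul_eq_mul, div_mul_cancel₀ _ hne, sub_self,
      mul_zero]
  · have e1 : (D.L q e)⁻¹ • (y - (D.L q y / D.L q e) • e) - y =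
        (D.L q e)⁻¹ • ((1 - D.L q e) • y - (D.L q y * (D.L q e)⁻¹) • e) := by
      have : y = (D.L q e)⁻¹ • (D.L q e) • y := by rw [smul_smul, inv_mul_cancel₀ hne, one_smul]
      conv_lhs => rw [sub_eq_add_neg]; arg 2; rw [this]
      rw [div_eq_mul_inv]
      module
    rw [e1, norm_smul]
    have e2 : ‖(1 - D.L q e) • y‖ ≤ D.M * B * ‖q - p‖ * ‖y‖ := by
      rw [norm_smul]; exact mul_le_mul_of_nonneg_right h1 (norm_nonneg _)
    have e3 : ‖(D.L q y * (D.L q e)⁻¹) • e‖ ≤ (D.M * ‖q - p‖ * ‖y‖) * 2 * B := by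
      rw [norm_smul, norm_mul]
      exact mul_le_mul (mul_le_mul hyq hinv (norm_nonneg _) (by positivity)) heB (norm_nonneg _)
        (by positivity)
    calc _ ≤ 2 * (D.M * B * ‖q - p‖ * ‖y‖ + (D.M * ‖q - p‖ * ‖y‖) * 2 * B) :=
          mul_le_mul hinv ((norm_sub_le _ _).trans (add_le_add e2 e3)) (norm_nonneg _) (by norm_num)
      _ = _ := by ring
  · rw [map_smul, smul_eq_mul]
    exact mul_ne_zero (inv_ne_zero hne) hw
  · rw [map_smul, map_smul, map_sub, map_smul]
    simp only [smul_eq_mul]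
    field_simp

theorem exists_norm_twisted_deriv_le {B : ℝ} (hB : 0 < B) : ∃ δ > 0, ∃ s : ℝ, 0 < s ∧ s < 1 ∧
    ∃ C > 0, ∀ φ, D.Reg φ → D.sz φ ≤ δ → ∀ e : E N, D.L (φ 1) e = 1 → ‖e‖ ≤ B →
      ∃ a₁ : ℂ, ‖a₁‖ < s ∧ ∀ y, D.L (φ 1) y = 0 → ∃ β : ℂ, ∀ a ∈ 𝔻,
        ‖D.anti (φ 1) y (deriv φ a) - β * (1 / (1 - conj a₁ * a) ^ 2)‖ ≤
          C * D.sz φ ^ (1 + α) * ‖y‖ := by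
  have hM := D.M_pos
  have hα := D.α_pos
  have hα1 := D.α_le
  obtain ⟨δ0, hδ0, s, hs0, hs1, cσ, hcσ, hfac⟩ := D.exists_h_normal_factor hB
  obtain ⟨C2, hC2, ε, hε, hq⟩ := D.exists_quotient_expansion (show 0 < 2 * B by positivity)
  obtain ⟨C0, hC0, c0, hc0, hd⟩ := D.exists_dual_bounds
  obtain ⟨C1, hC1, h1⟩ := D.exists_lipschitz
  obtain ⟨C3, hC3, h3⟩ := D.exists_norm_sub_le
  obtain ⟨C5, hC5, h5⟩ := D.exists_norm_deriv_le
  obtain ⟨C4, hC4, hreg⟩ := exists_reg (γ := 1 + α / 2) (by positivity) (by linarith)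
    (by linarith) (show (0:ℝ) < 5 by norm_num)
  set K0 := C2 * (C1 ^ (1 + α) * 2) * 4 with hK0
  have hK0p : 0 < K0 := by positivity
  refine ⟨min (min 1 δ0) (min (ε / C3) (1 / (2 * (D.M * B * C3)))), by positivity, s, hs0, hs1,
    C4 * K0 + D.M * C3 ^ α * 4 * C5 + D.M * (6 * D.M * B * C3) * C5, by positivity,
    fun φ hφ hδ e he heB => ?_⟩
  obtain ⟨μ, hμ⟩ := hφ.exists_dual
  have hsz := hφ.cen.sz_pos
  have hδ1 : D.sz φ ≤ 1 := hδ.trans ((min_le_left _ _).trans (min_le_left _ _))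
  have hδ2 : D.sz φ ≤ δ0 := hδ.trans ((min_le_left _ _).trans (min_le_right _ _))
  have hδ3 : C3 * D.sz φ ≤ ε := by
    have := hδ.trans ((min_le_right _ _).trans (min_le_left _ _))
    rw [le_div_iff₀ hC3] at this
    linarith
  have hδ4 : D.M * B * (C3 * D.sz φ) ≤ 1 / 2 := by
    have := hδ.trans ((min_le_right _ _).trans (min_le_right _ _))
    rw [le_div_iff₀ (by positivity)] at this
    linarith
  obtain ⟨a₁, ha₁, σ, hσd, hσc, hσ⟩ := hfac φ hφ hδ2 μ hμ e he heB
  have ha₁B : a₁ ∈ 𝔻 := by rw [mem_ball_zero_iff]; linarith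
  have h1c : (1:ℂ) ∈ closedBall (0:ℂ) 1 := by simp
  refine ⟨a₁, ha₁, fun y hy => ?_⟩
  have hcjne : ∀ a ∈ 𝔻, 1 - conj a₁ * a ≠ 0 := fun a ha =>
    norm_pos_iff.mp (by
      linarith [norm_one_sub_conj_mul_ge ha₁.le (norm_lt_one_of_mem_ball ha).le])
  have hσne : ∀ a ∈ 𝔻, σ a ≠ 0 := fun a ha =>
    norm_pos_iff.mp (hcσ.trans_le (hσc a ha))
  set T : ℂ → ℂ := fun a => dualH D φ μ a y / ((1 - conj a₁ * a) * σ a) with hT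
  have hTd : DifferentiableOn ℂ T 𝔻 :=
    ((Dual.differentiableOn_h hφ hμ).clm_apply (differentiableOn_const y)).div
      ((show DifferentiableOn ℂ (fun a => 1 - conj a₁ * a) 𝔻 by
        fun_prop).mul hσd) fun a ha => mul_ne_zero (hcjne a ha) (hσne a ha)
  set β := T a₁ with hβ
  refine ⟨conj β, fun a ha => ?_⟩
  obtain ⟨ω, t, hω, ht0, ht1, hat⟩ : ∃ (ω : ℂ) (t : ℝ), ‖ω‖ = 1 ∧ 0 ≤ t ∧ t < 1 ∧ a = t * ω := by
    rcases eq_or_ne a 0 with h0 | h0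
    · exact ⟨1, 0, norm_one, le_rfl, one_pos, by simp [h0]⟩
    · obtain ⟨ω, h2, h3, -⟩ := exists_radial h0
      exact ⟨ω, ‖a‖, h2, norm_nonneg _, norm_lt_one_of_mem_ball ha, h3⟩
  have hωc := mem_closedBall_of_norm_eq hω
  have hqm := hφ.memc hωc
  have hpm := hφ.memc h1c
  have hpq : D.M * B * ‖φ ω - φ 1‖ ≤ 1 / 2 :=
    (mul_le_mul_of_nonneg_left (h3 φ hφ ω hωc 1 h1c) (by positivity)).trans hδ4
  obtain ⟨e', y', R, he', heB', hy', hyy, hR⟩ := D.exists_adjusted_frame hpm hqm he heB hpq hy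
  have hy4 : ‖y'‖ ≤ 4 * ‖y‖ := by
    have h6 := mul_le_mul_of_nonneg_right hpq (norm_nonneg y)
    have h7 := norm_add_le (y' - y) y
    rw [sub_add_cancel] at h7
    linarith
  have hsub : DifferentiableOn ℂ (fun a => φ a - φ ω) 𝔻 :=
    hφ.cen.diff.sub (differentiableOn_const _)
  set b : ℂ → ℂ := fun a => D.anti (φ ω) y' (φ a - φ ω) -
    conj β * (a / (1 - conj a₁ * a)) with hb
  set k : ℂ → ℂ := fun a => dslope T a₁ a - lin (D.ell (φ ω)) (φ a - φ ω) y' - R with hk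
  have hbd : DifferentiableOn ℂ b 𝔻 := by
    refine ((D.anti (φ ω) y').differentiable.comp_differentiableOn hsub).sub ?_
    exact (differentiableOn_const _).mul (differentiableOn_id.div (by fun_prop) hcjne)
  have hkd : DifferentiableOn ℂ k 𝔻 := by
    refine (((Complex.differentiableOn_dslope (isOpen_ball.mem_nhds ha₁B)).mpr hTd).sub ?_).sub
      (differentiableOn_const _)
    exact ((lin (D.ell (φ ω))).differentiable.comp_differentiableOn hsub).clm_apply
      (differentiableOn_const y')
  set K := K0 * D.sz φ ^ (1 + α) * ‖y‖ with hK
  have hKp : 0 ≤ K := by positivity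
  have hmain := hreg ω k b K hω hKp (hkd.mono inter_subset_left) (hbd.mono inter_subset_left)
    ?_ ?_ t ht0 ht1 (by linarith)
  · have hder : deriv b a = D.anti (φ ω) y' (deriv φ a) -
        conj β * (1 / (1 - conj a₁ * a) ^ 2) := by
      have f1 : HasDerivAt (fun a => D.anti (φ ω) y' (φ a - φ ω))
          (D.anti (φ ω) y' (deriv φ a)) a :=
        (D.anti (φ ω) y').hasFDerivAt.comp_hasDerivAt _
          ((hφ.cen.hasDerivAt ha).sub_const (φ ω))
      have f2 : HasDerivAt (fun a : ℂ => 1 - conj a₁ * a) (-(conj a₁)) a :=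
        (((hasDerivAt_id a).const_mul (conj a₁)).const_sub 1).congr_deriv (by ring)
      have f3 : HasDerivAt (fun a : ℂ => a / (1 - conj a₁ * a))
          (1 / (1 - conj a₁ * a) ^ 2) a :=
        ((hasDerivAt_id a).div f2 (hcjne a ha)).congr_deriv (by simp only [id]; ring)
      exact (f1.sub (f3.const_mul _)).deriv
    rw [← hat, hder, min_eq_right (by linarith), sub_self, rpow_zero, mul_one] at hmain
    have hv := h5 φ hφ a ha
    set v := deriv φ a with hvd
    have g1 : D.anti (φ 1) y v - conj β * (1 / (1 - conj a₁ * a) ^ 2) =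
        (D.anti (φ ω) y' v - conj β * (1 / (1 - conj a₁ * a) ^ 2)) -
        (D.anti (φ ω) y' v - D.anti (φ 1) y' v) - D.anti (φ 1) (y' - y) v := by
      rw [D.anti_sub]; ring
    have hd3 := h3 φ hφ ω hωc 1 h1c
    have hszα : D.sz φ ^ (1 + α) = D.sz φ ^ α * D.sz φ := by
      rw [add_comm, rpow_add_one hsz.ne']
    have g2 : ‖D.anti (φ ω) y' v - D.anti (φ 1) y' v‖ ≤
        D.M * C3 ^ α * 4 * C5 * D.sz φ ^ (1 + α) * ‖y‖ := by
      refine (D.norm_anti_sub_apply_le hpm hqm y' v).trans ?_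
      have : ‖φ ω - φ 1‖ ^ α ≤ C3 ^ α * D.sz φ ^ α := by
        rw [← mul_rpow hC3.le hsz.le]
        exact rpow_le_rpow (norm_nonneg _) hd3 hα.le
      calc _ ≤ D.M * (C3 ^ α * D.sz φ ^ α) * (4 * ‖y‖) * (C5 * D.sz φ) := by gcongr
        _ = _ := by rw [hszα]; ring
    have g3 : ‖D.anti (φ 1) (y' - y) v‖ ≤
        D.M * (6 * D.M * B * C3) * C5 * D.sz φ ^ (1 + α) * ‖y‖ := by
      refine (D.norm_anti_apply_le hpm _ v).trans ?_
      have e1 : D.sz φ * D.sz φ ≤ D.sz φ ^ (1 + α) := by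
        rw [← sq, ← rpow_natCast]
        exact rpow_le_of_le_one hsz hδ1 (by norm_num; linarith)
      calc _ ≤ D.M * (6 * D.M * B * (C3 * D.sz φ) * ‖y‖) * (C5 * D.sz φ) := by
            have := hyy.trans (show _ ≤ 6 * D.M * B * (C3 * D.sz φ) * ‖y‖ by gcongr)
            gcongr
        _ = D.M * (6 * D.M * B * C3) * C5 * ‖y‖ * (D.sz φ * D.sz φ) := by ring
        _ ≤ D.M * (6 * D.M * B * C3) * C5 * ‖y‖ * D.sz φ ^ (1 + α) := by gcongr
        _ = _ := by ring
    rw [g1]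
    refine (norm_sub_le _ _).trans ?_
    have g4 := norm_sub_le (D.anti (φ ω) y' v - conj β *
      (1 / (1 - conj a₁ * a) ^ 2)) (D.anti (φ ω) y' v - D.anti (φ 1) y' v)
    rw [hK] at hmain
    linarith
  · intro a ha hfar
    have := norm_sub_le a ω
    rw [hω] at this
    linarith [norm_lt_one_of_mem_ball ha.1]
  · intro ε' hε'
    have hs2 : 0 < 1 - s := by linarith
    set ch := (1 - s) / 2 * (1 - s) * cσ with hch
    have hchp : 0 < ch := by positivity
    obtain ⟨s', hs'1, hs'⟩ := exists_mul_rpow_quarter_le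
      (A := (1 + 2 * D.M * B) / ch * C0 * ‖y‖ + ‖β‖ * (4 / (1 - s) ^ 2)) (by positivity) hε'
    refine ⟨max s' ((1 + s) / 2), max_lt hs'1 (by linarith), fun a ha hsa => ?_⟩
    have haB := ha.1
    have ha1 := norm_lt_one_of_mem_ball haB
    have has := (le_max_right _ _).trans hsa
    have hac := ball_subset_closedBall haB
    obtain ⟨-, -, -, hha, -⟩ := hd φ hφ μ hμ a haB
    have hge1 : ch ≤ ‖dualH D φ μ a e‖ := by
      rw [hσ a haB, norm_mul, norm_mul]
      have f1 : (1 - s) / 2 ≤ ‖a - a₁‖ := by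
        have := norm_sub_norm_le a a₁
        linarith
      exact mul_le_mul (mul_le_mul f1 (norm_one_sub_conj_mul_ge ha₁.le ha1.le) hs2.le
        (norm_nonneg _)) (hσc a haB) hcσ.le (by positivity)
    have hL1 : 1 / 2 ≤ ‖D.L (φ a) e‖ := by
      have f1 := D.norm_one_sub_L_le hpm (hφ.memc hac) he heB
      have f2 : D.M * B * ‖φ a - φ 1‖ ≤ 1 / 2 :=
        (mul_le_mul_of_nonneg_left (h3 φ hφ a hac 1 h1c) (by positivity)).trans hδ4
      have f3 := norm_sub_norm_le (1:ℂ) (D.L (φ a) e)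
      rw [norm_one] at f3
      linarith
    have hLne : D.L (φ a) e ≠ 0 := norm_pos_iff.mp (by linarith)
    obtain ⟨-, hRa⟩ := hR (φ a) hLne
    obtain ⟨-, hL2⟩ := hq (φ ω) hqm e' he' heB' (φ a) (hφ.memc hac)
      ((h3 φ hφ a hac ω hωc).trans hδ3)
    have e1 := norm_quotient_sub_quotient_le hha hchp hge1 hL1 heB (D.norm_L _ (hφ.memc hac)) y
    have e2 := hs' ‖a‖ ((le_max_left _ _).trans hsa) ha1.le
    have e3 := hL2 y' hy'
    have e4 : ‖φ a - φ ω‖ ^ (1 + α) ≤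
        C1 ^ (1 + α) * 2 * D.sz φ ^ (1 + α) * ‖a - ω‖ ^ (1 + α / 2) := by
      have haω : ‖a - ω‖ ≤ 2 := by
        have := norm_sub_le a ω
        linarith
      have f1 : ‖a - ω‖ ^ (1 + α) ≤ 2 * ‖a - ω‖ ^ (1 + α / 2) := by
        rcases (norm_nonneg (a - ω)).eq_or_lt with h0 | h0
        · rw [← h0, zero_rpow (by positivity), zero_rpow (by positivity), mul_zero]
        · rw [show 1 + α = α / 2 + (1 + α / 2) by ring, rpow_add h0]
          refine mul_le_mul_of_nonneg_right ?_ (by positivity)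
          calc ‖a - ω‖ ^ (α / 2) ≤ 2 ^ (α / 2) :=
                rpow_le_rpow (norm_nonneg _) haω (by positivity)
            _ ≤ 2 ^ (1:ℝ) := rpow_le_rpow_of_exponent_le one_le_two (by linarith)
            _ = 2 := rpow_one 2
      calc ‖φ a - φ ω‖ ^ (1 + α) ≤ (C1 * D.sz φ * ‖a - ω‖) ^ (1 + α) :=
            rpow_le_rpow (norm_nonneg _) (h1 φ hφ a hac ω hωc) (by linarith)
        _ = C1 ^ (1 + α) * D.sz φ ^ (1 + α) * ‖a - ω‖ ^ (1 + α) := by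
            rw [mul_rpow (by positivity) (by positivity), mul_rpow hC1.le hsz.le]
        _ ≤ C1 ^ (1 + α) * D.sz φ ^ (1 + α) * (2 * ‖a - ω‖ ^ (1 + α / 2)) := by gcongr
        _ = _ := by ring
    have haa : a - a₁ ≠ 0 := norm_pos_iff.mp (by
      have := norm_sub_norm_le a a₁
      linarith)
    have e5 : k a - conj (b a) =
        (dualH D φ μ a y / dualH D φ μ a e - D.L (φ a) y / D.L (φ a) e) +
        (D.L (φ a) y' / D.L (φ a) e' - D.ell (φ ω) (φ a - φ ω) y') -
        β * (1 / (a - a₁) - conj (a / (1 - conj a₁ * a))) := by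
      have f1 : dslope T a₁ a = dualH D φ μ a y / dualH D φ μ a e - β / (a - a₁) := by
        rw [dslope_of_ne _ (sub_ne_zero.mp haa), slope_def_field, sub_div, hσ a haB, ← hβ, hT]
        simp only
        rw [div_div, mul_comm _ (a - a₁), mul_assoc]
      rw [hRa, D.ell_eq, hk, hb]
      simp only [map_sub, map_mul, conj_conj]
      rw [← map_sub, f1]
      simp only [map_sub, sub_apply]
      ring
    rw [e5]
    have e6 : ‖β * (1 / (a - a₁) - conj (a / (1 - conj a₁ * a)))‖ ≤
        ‖β‖ * (4 / (1 - s) ^ 2) * (1 - ‖a‖) ^ (1 / 4 : ℝ) := by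
      rw [norm_mul, mul_assoc]
      refine mul_le_mul_of_nonneg_left ?_ (norm_nonneg _)
      refine (norm_inv_sub_conj_le ha₁ hs1 ha1 has).trans ?_
      refine mul_le_mul_of_nonneg_left ?_ (by positivity)
      have := rpow_le_of_le_one (show 0 < 1 - ‖a‖ by linarith) (by linarith [norm_nonneg a])
        (show (1 / 4 : ℝ) ≤ 1 by norm_num)
      rwa [rpow_one] at this
    have e7 : C2 * ‖φ a - φ ω‖ ^ (1 + α) * ‖y'‖ ≤
        C2 * (C1 ^ (1 + α) * 2 * D.sz φ ^ (1 + α) * ‖a - ω‖ ^ (1 + α / 2)) * (4 * ‖y‖) := by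
      gcongr
    have e8 := norm_add_le (dualH D φ μ a y / dualH D φ μ a e - D.L (φ a) y / D.L (φ a) e)
      (D.L (φ a) y' / D.L (φ a) e' - D.ell (φ ω) (φ a - φ ω) y')
    refine (norm_sub_le _ _).trans ?_
    rw [hK, hK0]
    linarith

theorem exists_norm_anti_chord_bounds {B : ℝ} (hB : 0 < B) : ∃ δ > 0, ∃ A > 0, ∃ C > 0,
    ∀ φ, D.Reg φ → D.sz φ ≤ δ → ∀ e : E N, D.L (φ 1) e = 1 → ‖e‖ ≤ B →
      ∀ y, D.L (φ 1) y = 0 → ∃ β : ℝ, ∀ a ∈ 𝔻, ∀ b ∈ 𝔻,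
        ‖D.anti (φ 1) y (φ b - φ a)‖ ≤ (β * A + C * D.sz φ ^ (1 + α) * ‖y‖) * ‖b - a‖ ∧
        β / 4 * ‖b - a‖ ≤ ‖D.anti (φ 1) y (φ b - φ a)‖ +
          C * D.sz φ ^ (1 + α) * ‖y‖ * ‖b - a‖ := by
  obtain ⟨δ, hδ, s, hs0, hs1, C, hC, h⟩ := D.exists_norm_twisted_deriv_le hB
  have hs2 : 0 < 1 - s := by linarith
  refine ⟨δ, hδ, 1 / (1 - s) ^ 2, by positivity, C, hC, fun φ hφ hsz e he heB y hy => ?_⟩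
  obtain ⟨a₁, ha₁, hy'⟩ := h φ hφ hsz e he heB
  obtain ⟨β, hβ⟩ := hy' y hy
  refine ⟨‖β‖, fun a ha b hb => ?_⟩
  set w : ℂ → ℂ := fun a => 1 - conj a₁ * a with hw
  have hwge : ∀ a ∈ 𝔻, 1 - s ≤ ‖w a‖ := fun a ha =>
    norm_one_sub_conj_mul_ge ha₁.le (norm_lt_one_of_mem_ball ha).le
  have hwle : ∀ a ∈ 𝔻, ‖w a‖ ≤ 2 := fun a ha => by
    have h1 := norm_sub_le (1:ℂ) (conj a₁ * a)
    rw [norm_one, norm_mul, RCLike.norm_conj] at h1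
    have h2 := mul_le_mul (ha₁.le.trans hs1.le) (norm_lt_one_of_mem_ball ha).le (norm_nonneg _)
      zero_le_one
    exact h1.trans (by linarith)
  have hwne : ∀ a ∈ 𝔻, w a ≠ 0 := fun a ha =>
    norm_pos_iff.mp (by linarith [hwge a ha])
  have hder : ∀ x ∈ 𝔻, HasDerivWithinAt
      (fun x => D.anti (φ 1) y (φ x) - β * (x / w x))
      (D.anti (φ 1) y (deriv φ x) - β * (1 / w x ^ 2)) 𝔻 x := by
    intro x hx
    have f2 : HasDerivAt w (-(conj a₁)) x :=
      (((hasDerivAt_id x).const_mul (conj a₁)).const_sub 1).congr_deriv (by ring)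
    have f3 : HasDerivAt (fun x : ℂ => x / w x) (1 / w x ^ 2) x :=
      ((hasDerivAt_id x).div f2 (hwne x hx)).congr_deriv (by simp only [id, hw]; ring)
    exact (((D.anti (φ 1) y).hasFDerivAt.comp_hasDerivAt x (hφ.cen.hasDerivAt hx)).sub
      (f3.const_mul β)).hasDerivWithinAt
  have hmain := (convex_ball (0:ℂ) 1).norm_image_sub_le_of_norm_hasDerivWithin_le hder hβ ha hb
  have hwa := hwne a ha
  have hwb := hwne b hb
  have e1 : D.anti (φ 1) y (φ b) - β * (b / w b) - (D.anti (φ 1) y (φ a) - β * (a / w a)) =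
      D.anti (φ 1) y (φ b - φ a) - β * ((b - a) / (w a * w b)) := by
    have : b / w b - a / w a = (b - a) / (w a * w b) := by
      field_simp
      simp only [hw]
      ring
    rw [map_sub, ← this]
    ring
  rw [e1] at hmain
  have e2 : ‖β * ((b - a) / (w a * w b))‖ ≤ ‖β‖ * (1 / (1 - s) ^ 2) * ‖b - a‖ := by
    rw [norm_mul, norm_div, norm_mul, mul_assoc, one_div_mul_eq_div, sq]
    exact mul_le_mul_of_nonneg_left (div_le_div_of_nonneg_left (norm_nonneg _) (by positivity)
      (mul_le_mul (hwge a ha) (hwge b hb) hs2.le (norm_nonneg _))) (norm_nonneg _)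
  have e3 : ‖β‖ / 4 * ‖b - a‖ ≤ ‖β * ((b - a) / (w a * w b))‖ := by
    rw [norm_mul, norm_div, norm_mul, div_mul_eq_mul_div, mul_div_assoc]
    refine mul_le_mul_of_nonneg_left (div_le_div_of_nonneg_left (norm_nonneg _)
      (mul_pos (norm_pos_iff.mpr hwa) (norm_pos_iff.mpr hwb)) ?_) (norm_nonneg _)
    have := mul_le_mul (hwle a ha) (hwle b hb) (norm_nonneg _) zero_le_two
    linarith
  set p := D.anti (φ 1) y (φ b - φ a)
  set q := β * ((b - a) / (w a * w b))
  have e4 := norm_sub_norm_le p q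
  have e5 := norm_sub_norm_le q p
  rw [norm_sub_rev] at e5
  constructor <;> linarith

theorem exists_chord_ge : ∃ δ > 0, ∃ c > 0, ∀ φ, D.Reg φ → D.sz φ ≤ δ →
    ∀ a ∈ 𝔻, ∀ b ∈ 𝔻, c * D.sz φ * ‖b - a‖ ≤ ‖φ b - φ a‖ := by
  have hM := D.M_pos
  have hM1 := D.one_le_M
  have hα := D.α_pos
  have hα1 := D.α_le
  obtain ⟨B, hB, hn⟩ := D.exists_normal_frontier
  obtain ⟨δ0, hδ0, A, hA, C, hC, h⟩ := D.exists_norm_anti_chord_bounds hB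
  obtain ⟨C3, hC3, h3⟩ := D.exists_norm_L_sub_le
  obtain ⟨κ, c, hκ, hc, hherm⟩ := D.exists_herml_ge
  set c' := c / (4 * D.M * A) with hc'
  have hc'p : 0 < c' := by positivity
  set A2 := (C + D.M * C3 * B) / c + C3 * B with hA2
  have hA2p : 0 < A2 := by positivity
  set η := min (1 / (4 * D.M * A2)) (c' / (8 * C)) with hη
  have hηp : 0 < η := by positivity
  refine ⟨min (min 1 δ0) (η ^ (1 / α)), by positivity, c' / (8 * D.M), by positivity,
    fun φ hφ hδ a ha b hb => ?_⟩
  have hsz := hφ.cen.sz_pos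
  have hδ1 : D.sz φ ≤ 1 := hδ.trans ((min_le_left _ _).trans (min_le_left _ _))
  have hδ2 : D.sz φ ≤ δ0 := hδ.trans ((min_le_left _ _).trans (min_le_right _ _))
  have hszη : D.sz φ ^ α ≤ η := by
    have := rpow_le_rpow hsz.le (hδ.trans (min_le_right _ _)) hα.le
    rwa [← rpow_mul hηp.le, one_div_mul_cancel hα.ne', rpow_one] at this
  have hszA : A2 * D.sz φ ^ α ≤ 1 / (4 * D.M) := by
    calc A2 * D.sz φ ^ α ≤ A2 * (1 / (4 * D.M * A2)) :=
          mul_le_mul_of_nonneg_left (hszη.trans (min_le_left _ _)) hA2p.le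
      _ = _ := by field_simp
  have hszC : C * D.sz φ ^ α ≤ c' / 8 := by
    calc C * D.sz φ ^ α ≤ C * (c' / (8 * C)) :=
          mul_le_mul_of_nonneg_left (hszη.trans (min_le_right _ _)) hC.le
      _ = _ := by field_simp
  have hszα : D.sz φ ^ (1 + α) = D.sz φ ^ α * D.sz φ := by
    rw [add_comm, rpow_add_one hsz.ne']
  have hsq : D.sz φ ^ 2 ≤ D.sz φ ^ α * D.sz φ := by
    have := rpow_le_of_le_one hsz hδ1 hα1
    rw [rpow_one] at this
    rw [sq]
    exact mul_le_mul_of_nonneg_right this hsz.le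
  have h1c : (1:ℂ) ∈ closedBall (0:ℂ) 1 := by simp
  have hfr := hφ.mem_frontier (norm_one (α := ℂ))
  have hpm := hφ.memc h1c
  obtain ⟨e, he, heB⟩ := hn _ hfr
  choose! β hβ using h φ hφ hδ2 e he heB
  by_cases hex : ∃ y, D.L (φ 1) y = 0 ∧ y ≠ 0 ∧ c' * D.sz φ * ‖y‖ ≤ β y
  · obtain ⟨y, hy, hy0, hyβ⟩ := hex
    have hyp := norm_pos_iff.mpr hy0
    have h4 := (hβ y hy a ha b hb).2
    have h5 := D.norm_anti_apply_le hpm y (φ b - φ a)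
    have h6 := mul_le_mul_of_nonneg_right hyβ (norm_nonneg (b - a))
    have h7 := mul_le_mul_of_nonneg_right hszC
      (show 0 ≤ D.sz φ * ‖y‖ * ‖b - a‖ by positivity)
    rw [hszα] at h4
    have h8 : ‖y‖ * (c' / 8 * D.sz φ * ‖b - a‖) ≤ ‖y‖ * (D.M * ‖φ b - φ a‖) := by linarith
    have h9 := le_of_mul_le_mul_left h8 hyp
    calc c' / (8 * D.M) * D.sz φ * ‖b - a‖ = (c' / 8 * D.sz φ * ‖b - a‖) / D.M := by
          field_simp
      _ ≤ _ := by rw [div_le_iff₀ hM]; linarith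
  · exfalso
    push Not at hex
    have key : ∀ x ∈ 𝔻, ‖φ x - φ 0‖ ≤ 1 / (2 * D.M) * D.sz φ := by
      intro x hx
      have h0 : (0:ℂ) ∈ 𝔻 := mem_ball_self one_pos
      set v := φ x - φ 0 with hv
      have hL := h3 φ hφ 1 h1c x (ball_subset_closedBall hx) 0 (ball_subset_closedBall h0)
      rw [← hv] at hL
      set τ := v - D.L (φ 1) v • e with hτ
      have hτ0 : D.L (φ 1) τ = 0 := by
        rw [hτ, map_sub, map_smul, he, smul_eq_mul, mul_one, sub_self]
      have hLe : ‖D.L (φ 1) v • e‖ ≤ C3 * B * (D.sz φ ^ α * D.sz φ) := by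
        rw [norm_smul]
        calc _ ≤ (C3 * D.sz φ ^ 2) * B := mul_le_mul hL heB (norm_nonneg _) (by positivity)
          _ = C3 * B * D.sz φ ^ 2 := by ring
          _ ≤ _ := mul_le_mul_of_nonneg_left hsq (by positivity)
      have hτn : ‖τ‖ ≤ (c' * A / c + (C + D.M * C3 * B) / c * D.sz φ ^ α) * D.sz φ := by
        rcases eq_or_ne τ 0 with hz | hz
        · rw [hz, norm_zero]; positivity
        have hp := norm_pos_iff.mpr hz
        have g1 := hherm _ hpm τ
        rw [hτ0, D.r_frontier hfr, norm_zero, ← D.re_anti_self] at g1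
        have g2 : D.anti (φ 1) τ τ = D.anti (φ 1) τ v - D.anti (φ 1) τ (D.L (φ 1) v • e) := by
          rw [← map_sub]
        have g3 := (re_le_norm (D.anti (φ 1) τ τ)).trans (g2 ▸ norm_sub_le _ _)
        have g4 := (hβ τ hτ0 0 h0 x hx).1
        have g5 := (D.norm_anti_apply_le hpm τ (D.L (φ 1) v • e)).trans
          (mul_le_mul_of_nonneg_left hLe (by positivity))
        have g6 := mul_le_mul_of_nonneg_right (hex τ hτ0 hz).le hA.le
        have g7 : (β τ * A + C * D.sz φ ^ (1 + α) * ‖τ‖) * ‖x - 0‖ ≤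
            c' * D.sz φ * ‖τ‖ * A + C * (D.sz φ ^ α * D.sz φ) * ‖τ‖ := by
          rw [hszα, sub_zero]
          refine (mul_le_mul_of_nonneg_right (add_le_add_left g6 _) (norm_nonneg _)).trans ?_
          exact mul_le_of_le_one_right (by positivity) (norm_lt_one_of_mem_ball hx).le
        have g8 : ‖τ‖ * (c * ‖τ‖) ≤
            ‖τ‖ * ((c' * A + (C + D.M * C3 * B) * D.sz φ ^ α) * D.sz φ) := by
          linarith
        have g9 := le_of_mul_le_mul_left g8 hp
        calc ‖τ‖ ≤ ((c' * A + (C + D.M * C3 * B) * D.sz φ ^ α) * D.sz φ) / c := by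
              rw [le_div_iff₀ hc]; linarith
          _ = _ := by ring
      have hvn : ‖v‖ ≤ ‖τ‖ + ‖D.L (φ 1) v • e‖ := by
        have := norm_add_le τ (D.L (φ 1) v • e)
        rwa [hτ, sub_add_cancel] at this
      have hcA : c' * A / c = 1 / (4 * D.M) := by rw [hc']; field_simp
      have hfin := mul_le_mul_of_nonneg_right hszA hsz.le
      rw [hcA] at hτn
      have : 1 / (2 * D.M) * D.sz φ = 1 / (4 * D.M) * D.sz φ + 1 / (4 * D.M) * D.sz φ := by
        field_simp; ring
      rw [this]
      rw [hA2] at hfin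
      linarith
    have h4 := D.r_le_diam_sq hφ.cen.geod key
    rw [← hφ.cen.sz_sq] at h4
    have h5 : D.M * (1 / (2 * D.M) * D.sz φ) ^ 2 = 1 / (4 * D.M) * D.sz φ ^ 2 := by
      field_simp; ring
    have h6 : 1 / (4 * D.M) < 1 := by
      rw [div_lt_one (by positivity)]; linarith
    have h7 := mul_lt_mul_of_pos_right h6 (pow_pos hsz 2)
    linarith

/-- The complex normal part of a chord is small compared with the chord. -/
theorem exists_norm_L_le_sz_mul : ∃ C > 0, ∀ φ, D.Reg φ → ∀ a ∈ 𝔻,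
    ∀ b ∈ 𝔻, ‖D.L (φ a) (φ b - φ a)‖ ≤ C * D.sz φ * ‖φ b - φ a‖ := by
  have hM := D.M_pos
  obtain ⟨δ, hδ, c, hc, h⟩ := D.exists_chord_ge
  obtain ⟨C, hC, h'⟩ := D.exists_norm_L_chord_le
  refine ⟨C / c + D.M / δ, by positivity, fun φ hφ a ha b hb => ?_⟩
  have hsz := hφ.cen.sz_pos
  rcases le_total (D.sz φ) δ with hle | hle
  · calc _ ≤ C * D.sz φ ^ 2 * ‖b - a‖ := h' φ hφ a ha b hb
      _ = C / c * D.sz φ * (c * D.sz φ * ‖b - a‖) := by field_simp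
      _ ≤ C / c * D.sz φ * ‖φ b - φ a‖ :=
        mul_le_mul_of_nonneg_left (h φ hφ hle a ha b hb) (by positivity)
      _ ≤ _ := by
        refine mul_le_mul_of_nonneg_right (mul_le_mul_of_nonneg_right ?_ hsz.le) (norm_nonneg _)
        exact le_add_of_nonneg_right (by positivity)
  · calc _ ≤ D.M * ‖φ b - φ a‖ := (le_opNorm _ _).trans
          (mul_le_mul_of_nonneg_right (D.norm_L _ (hφ.cen.memc ha)) (norm_nonneg _))
      _ = D.M / δ * δ * ‖φ b - φ a‖ := by field_simp
      _ ≤ (C / c + D.M / δ) * D.sz φ * ‖φ b - φ a‖ := by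
        refine mul_le_mul_of_nonneg_right (mul_le_mul ?_ hle hδ.le (by positivity)) (norm_nonneg _)
        exact le_add_of_nonneg_left (by positivity)

/-- Every complex geodesic is, up to reparametrization and boundary values, regular. -/
theorem exists_reg_image_eq {φ : ℂ → E N} (hφ : IsComplexGeodesic Ω φ) :
    ∃ Φ, D.Reg Φ ∧ Φ '' 𝔻 = φ '' 𝔻 := by
  obtain ⟨c, hc, hcen⟩ := D.exists_centered hφ
  obtain ⟨Φ, hΦ, heq⟩ := hcen.exists_reg
  exact ⟨Φ, hΦ, heq.image_eq.trans (image_comp_mob φ hc)⟩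

theorem exists_diam_comparison : ∃ C > 0, ∀ φ, D.Reg φ →
    D.sz φ ≤ C * Metric.diam (φ '' 𝔻) ∧
    Metric.diam (φ '' 𝔻) ≤ C * D.sz φ := by
  have hM1 := D.one_le_M
  obtain ⟨C, hC, h⟩ := D.exists_norm_sub_le
  refine ⟨max D.M C, lt_max_of_lt_right hC, fun φ hφ => ?_⟩
  have hsz := hφ.cen.sz_pos
  have hdist : ∀ x ∈ φ '' 𝔻, ∀ y ∈ φ '' 𝔻, dist x y ≤ C * D.sz φ := by
    rintro _ ⟨a, ha, rfl⟩ _ ⟨b, hb, rfl⟩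
    rw [dist_eq_norm]
    exact h φ hφ a (ball_subset_closedBall ha) b (ball_subset_closedBall hb)
  have hbdd : Bornology.IsBounded (φ '' 𝔻) :=
    Metric.isBounded_iff.mpr ⟨_, fun x hx y hy => hdist x hx y hy⟩
  have hd := Metric.diam_nonneg (s := φ '' 𝔻)
  constructor
  · have h1 := D.r_le_diam_sq hφ.cen.geod (d := Metric.diam (φ '' 𝔻)) fun a ha => by
      rw [← dist_eq_norm]
      exact dist_le_diam_of_mem hbdd (mem_image_of_mem φ ha)
        (mem_image_of_mem φ (mem_ball_self one_pos))
    rw [← hφ.cen.sz_sq] at h1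
    have h2 : D.sz φ ^ 2 ≤ (D.M * Metric.diam (φ '' 𝔻)) ^ 2 := by
      rw [mul_pow]
      exact h1.trans (mul_le_mul_of_nonneg_right (by nlinarith) (by positivity))
    exact (le_of_sq_le_sq h2 (by positivity)).trans
      (mul_le_mul_of_nonneg_right (le_max_left _ _) hd)
  · exact (Metric.diam_le_of_forall_dist_le (by positivity) hdist).trans
      (mul_le_mul_of_nonneg_right (le_max_right _ _) hsz.le)

theorem exists_sz_comparison {π : E N → E N} (hπ : IsClosestPointSelection Ω π) :
    ∃ C > 0, ∀ φ, D.Reg φ →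
      ∀ z ∈ φ '' 𝔻, ∀ w ∈ φ '' 𝔻, z ≠ w →
        D.sz φ ≤ C * (ncomp Ω π z (z - w) / ‖z - w‖ + √(bdist Ω z) + ‖z - w‖) ∧
        ncomp Ω π z (z - w) / ‖z - w‖ + √(bdist Ω z) + ‖z - w‖ ≤ C * D.sz φ := by
  have hM := D.M_pos
  obtain ⟨C0, hC0, h0⟩ := D.exists_bdist_le
  obtain ⟨C1, hC1, h1⟩ := D.exists_ncomp_comparison hπ
  obtain ⟨C2, hC2, h2⟩ := D.exists_sz_le
  obtain ⟨C3, hC3, h3⟩ := D.exists_norm_sub_le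
  obtain ⟨C4, hC4, h4⟩ := D.exists_norm_L_le_sz_mul
  have hK := sqrt_pos.mpr hC0
  have hK' := sqrt_nonneg (2 * D.M ^ 2)
  refine ⟨C2 * (C1 + C1 * (√C0 * D.M) + √(2 * D.M ^ 2) + 1) +
    (C1 * (C4 + C0 * D.M) + √C0 + C3), by positivity, fun φ hφ => ?_⟩
  have hsz := hφ.cen.sz_pos
  rintro _ ⟨a, ha, rfl⟩ _ ⟨b, hb, rfl⟩ hne
  have hz := hφ.cen.mem ha
  have hx := norm_pos_iff.mpr (sub_ne_zero.mpr hne)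
  have hL : ‖D.L (φ a) (φ b - φ a)‖ = ‖D.L (φ a) (φ a - φ b)‖ := by
    rw [← neg_sub, map_neg, norm_neg]
  have k2 := h2 φ hφ a ha b hb hne
  have k4 := h4 φ hφ a ha b hb
  rw [hL, norm_sub_rev (φ b)] at k2 k4
  have k3 := h3 φ hφ a (ball_subset_closedBall ha) b (ball_subset_closedBall hb)
  obtain ⟨k1, k1'⟩ := h1 _ hz (φ a - φ b)
  have hbd : 0 ≤ bdist Ω (φ a) := Metric.infDist_nonneg
  have hr : D.r (φ a) ≤ D.sz φ ^ 2 := by rw [hφ.cen.sz_sq]; exact hφ.cen.max a ha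
  have hb1 : bdist Ω (φ a) ≤ C0 * D.sz φ ^ 2 :=
    (h0 _ hz).trans (mul_le_mul_of_nonneg_left hr hC0.le)
  have hb2 : bdist Ω (φ a) ≤ C0 * D.M * D.sz φ := by
    refine hb1.trans ?_
    rw [sq, mul_assoc]
    exact mul_le_mul_of_nonneg_left (mul_le_mul_of_nonneg_right hφ.cen.sz_le hsz.le) hC0.le
  have hb3 : √(bdist Ω (φ a)) ≤ √C0 * D.sz φ := by
    have := sqrt_le_sqrt hb1
    rwa [sqrt_mul hC0.le, sqrt_sq hsz.le] at this
  have hb4 : bdist Ω (φ a) ≤ √C0 * D.M * √(bdist Ω (φ a)) := by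
    conv_lhs => rw [← Real.mul_self_sqrt hbd]
    exact mul_le_mul_of_nonneg_right
      (hb3.trans (mul_le_mul_of_nonneg_left hφ.cen.sz_le hK.le)) (sqrt_nonneg _)
  have hb5 : √(D.r (φ a)) ≤ √(2 * D.M ^ 2) * √(bdist Ω (φ a)) := by
    rw [← sqrt_mul (by positivity)]
    exact sqrt_le_sqrt (D.r_le_bdist hπ hz)
  set x := ‖φ a - φ b‖
  set l := ‖D.L (φ a) (φ a - φ b)‖
  set n := ncomp Ω π (φ a) (φ a - φ b)
  set t := bdist Ω (φ a)
  have hn : 0 ≤ n := div_nonneg (norm_nonneg _) hbd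
  have e1 : n / x ≤ C1 * (l / x + t) := by
    rw [div_le_iff₀ hx, mul_assoc, add_mul, div_mul_cancel₀ _ hx.ne']
    exact k1
  have e2 : l / x ≤ C1 * (n / x + t) := by
    rw [div_le_iff₀ hx, mul_assoc, add_mul, div_mul_cancel₀ _ hx.ne']
    exact k1'
  have e3 : l / x ≤ C4 * D.sz φ := by rwa [div_le_iff₀ hx]
  have hn' : 0 ≤ n / x := div_nonneg hn hx.le
  have ht := sqrt_nonneg t
  set S := n / x + √t + x
  have hS : 0 ≤ S := by positivity
  constructor
  · have e4 : l / x + √(D.r (φ a)) + x ≤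
        (C1 + C1 * (√C0 * D.M) + √(2 * D.M ^ 2) + 1) * S := by
      have f1 : C1 * (n / x) ≤ C1 * S := mul_le_mul_of_nonneg_left (by linarith) hC1.le
      have f2 : C1 * t ≤ C1 * (√C0 * D.M) * S := by
        rw [mul_assoc]
        refine mul_le_mul_of_nonneg_left (hb4.trans ?_) hC1.le
        exact mul_le_mul_of_nonneg_left (by linarith) (by positivity)
      have f3 : √(2 * D.M ^ 2) * √t ≤ √(2 * D.M ^ 2) * S :=
        mul_le_mul_of_nonneg_left (by linarith) hK'
      linarith
    calc D.sz φ ≤ C2 * ((C1 + C1 * (√C0 * D.M) + √(2 * D.M ^ 2) + 1) * S) :=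
          k2.trans (mul_le_mul_of_nonneg_left e4 hC2.le)
      _ ≤ _ := by
        rw [← mul_assoc]
        exact mul_le_mul_of_nonneg_right (le_add_of_nonneg_right (by positivity)) hS
  · have e5 : S ≤ (C1 * (C4 + C0 * D.M) + √C0 + C3) * D.sz φ := by
      have := e1.trans (mul_le_mul_of_nonneg_left (add_le_add e3 hb2) hC1.le)
      linarith
    refine e5.trans (mul_le_mul_of_nonneg_right ?_ hsz.le)
    exact le_add_of_nonneg_left (by positivity)

end Dom

/-- For complex geodesics and points `z ≠ w` on them:
`‖(z−w)_z‖/‖z−w‖ + δ_Ω(z)^{1/2} + ‖z−w‖ ∼ d_e(φ(Δ))`. -/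
theorem stmt5 {N : ℕ} {α : ℝ} (hα : α ∈ Set.Ioc (0:ℝ) 1)
    (Ω : Set (E N)) (hΩ : IsStronglyPseudoconvexDomain 2 α Ω)
    (π : E N → E N) (hπ : IsClosestPointSelection Ω π) :
    ∃ c C : ℝ, 0 < c ∧ c < C ∧ ∀ φ : ℂ → E N, IsComplexGeodesic Ω φ →
      ∀ z ∈ φ '' ball (0:ℂ) 1, ∀ w ∈ φ '' ball (0:ℂ) 1, z ≠ w →
        c * Metric.diam (φ '' ball (0:ℂ) 1) ≤
          ncomp Ω π z (z - w) / ‖z - w‖ + Real.sqrt (bdist Ω z) + ‖z - w‖ ∧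
        ncomp Ω π z (z - w) / ‖z - w‖ + Real.sqrt (bdist Ω z) + ‖z - w‖ ≤
          C * Metric.diam (φ '' ball (0:ℂ) 1) := by
  obtain ⟨D⟩ := exists_dom hα hΩ
  obtain ⟨A, hA, h1⟩ := D.exists_diam_comparison
  obtain ⟨B, hB, h2⟩ := D.exists_sz_comparison hπ
  refine ⟨1 / (A * B), B * A + 1 / (A * B), by positivity, lt_add_of_pos_left _ (by positivity),
    fun φ hφ z hz w hw hne => ?_⟩
  obtain ⟨Φ, hΦ, him⟩ := D.exists_reg_image_eq hφ
  rw [← him] at hz hw ⊢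
  obtain ⟨g1, g2⟩ := h1 Φ hΦ
  obtain ⟨k1, k2⟩ := h2 Φ hΦ z hz w hw hne
  have hd := Metric.diam_nonneg (s := Φ '' 𝔻)
  constructor
  · rw [one_div_mul_eq_div, div_le_iff₀ (by positivity)]
    have := g2.trans (mul_le_mul_of_nonneg_left k1 hA.le)
    linarith
  · rw [add_mul]
    have := k2.trans (mul_le_mul_of_nonneg_left g1 hB.le)
    have h3 : 0 ≤ 1 / (A * B) * Metric.diam (Φ '' 𝔻) := by positivity
    linarith

end InvDist
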